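/- In the level two walled Brauer-Clifford superalgebra BC_{2,k,k} over ℂ: (1) e_k BC_{2,k,k} e_k = e_k BC_{2,k−1,k−1}, where BC_{2,k−1,k−1} is the subalgebra of BC_{2,k,k} generated by e_1, c_1, c̄_1, x_1, x̄_1, s_1, …, s_{k−2}, s̄_1, …, s̄_{k−2}; (2) there exist unique elements ξ_{a,k} and ξ̄_{a,k} of BC_{2,k−1,k−1} such that e_k z_k^a e_k = ξ_{a,k} e_k and e_k z̄_k^a e_k = ξ̄_{a,k} e_k for every a ∈ ℕ; moreover ξ_{2n,k} = ξ̄_{2n,k} = 0 for all n ≥ 1, and ξ_{1,k} = ω_1. -/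

import Mathlib

open Polynomial

noncomputable section

/-- Transposition `(a b)` (0-based indices) in the symmetric group on `Fin n`;
it is `1` if an index is out of range. -/
def sw (n a b : ℕ) : Equiv.Perm (Fin n) :=
  if h : a < n ∧ b < n then Equiv.swap ⟨a, h.1⟩ ⟨b, h.2⟩ else 1

/-- The permutation word `s_{i,j}` of the paper (1-based indices):
`s_{i,j} = s_i s_{i+1,j}` for `i < j`, `s_{i,i} = 1`, `s_{i,j} = s_{i,j+1} s_j` for `i > j`. -/
def sIJ (n i j : ℕ) : Equiv.Perm (Fin n) :=
  if i < j then ((List.range' i (j - i)).map (fun k => sw n (k - 1) k)).prod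
  else ((List.range' j (i - j)).reverse.map (fun k => sw n (k - 1) k)).prod

/-- The coefficients `a_{2n+1,j}` of the paper: `acoef ω n j = a_{2n+1,j}`, defined by the
recursion `a_{1,0} = -1`, `a_{2n+1,j+1} = a_{2n-1,j}` and
`a_{2n+1,0} = ∑_{j=0}^{n-1} a_{2n-1,j} ω_{2j+1}`. -/
def acoef {A : Type} [Ring A] (ω : ℕ → A) : ℕ → ℕ → A
  | 0, _ => -1
  | n + 1, 0 => ∑ j ∈ Finset.range (n + 1), acoef ω n j * ω (2 * j + 1)
  | n + 1, j + 1 => acoef ω n j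

/-- The parameters `ω̄_k` determined by the parameters `ω` as in Corollary 3.5:
`ω̄_{2n} = 0` and `ω̄_{2n+1} = ∑_{j=0}^{n} a_{2n+1,j} ω_{2j+1}`. -/
def obar {R : Type} [CommRing R] (ω : ℕ → R) (k : ℕ) : R :=
  if k % 2 = 0 then 0
  else ∑ j ∈ Finset.range (k / 2 + 1), acoef ω (k / 2) j * ω (2 * j + 1)

/-- Data for the presentation of the walled Brauer–Clifford superalgebra `BC_{r,t}`
(Definition 2.1 together with relations (2.1)–(2.3)) on an `R`-algebra `A`.
The images of the two symmetric groups are recorded as monoid homomorphisms, so the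
symmetric group relations among the `s_i` (resp. `s̄_j`) hold automatically. -/
structure WBC (R A : Type) [CommRing R] [Ring A] [Algebra R A] (r t : ℕ) : Type where
  σ : Equiv.Perm (Fin r) →* A
  σb : Equiv.Perm (Fin t) →* A
  c : Fin r → A
  cb : Fin t → A
  e : A
  c_sq : ∀ i, c i * c i = -1
  c_anti : ∀ i j, i ≠ j → c i * c j = -(c j * c i)
  c_conj : ∀ w i, σ w * c i * σ (w⁻¹) = c (w i)
  cb_sq : ∀ i, cb i * cb i = 1
  cb_anti : ∀ i j, i ≠ j → cb i * cb j = -(cb j * cb i)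
  cb_conj : ∀ w i, σb w * cb i * σb (w⁻¹) = cb (w i)
  comm_σσb : ∀ w v, σ w * σb v = σb v * σ w
  comm_σcb : ∀ w j, σ w * cb j = cb j * σ w
  comm_σbc : ∀ v i, σb v * c i = c i * σb v
  anti_ccb : ∀ i j, c i * cb j = -(cb j * c i)
  e_c1 : ∀ (h1 : 0 < r) (h2 : 0 < t), e * c ⟨0, h1⟩ = e * cb ⟨0, h2⟩
  c1_e : ∀ (h1 : 0 < r) (h2 : 0 < t), c ⟨0, h1⟩ * e = cb ⟨0, h2⟩ * e
  e_sq : e * e = 0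
  e_s_e : 1 < r → e * σ (sw r 0 1) * e = e
  e_sb_e : 1 < t → e * σb (sw t 0 1) * e = e
  s_e_comm : ∀ i : ℕ, 0 < i → i + 1 < r → σ (sw r i (i + 1)) * e = e * σ (sw r i (i + 1))
  sb_e_comm : ∀ j : ℕ, 0 < j → j + 1 < t → σb (sw t j (j + 1)) * e = e * σb (sw t j (j + 1))
  braid1 : 1 < r → 1 < t →
    e * σ (sw r 0 1) * σb (sw t 0 1) * e * σ (sw r 0 1)
      = e * σ (sw r 0 1) * σb (sw t 0 1) * e * σb (sw t 0 1)
  braid2 : 1 < r → 1 < t →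
    σ (sw r 0 1) * e * σ (sw r 0 1) * σb (sw t 0 1) * e
      = σb (sw t 0 1) * e * σ (sw r 0 1) * σb (sw t 0 1) * e
  c_e_comm : ∀ i : Fin r, (i : ℕ) ≠ 0 → c i * e = e * c i
  cb_e_comm : ∀ j : Fin t, (j : ℕ) ≠ 0 → cb j * e = e * cb j
  e_c_e : ∀ h : 0 < r, e * c ⟨0, h⟩ * e = 0
  e_cb_e : ∀ h : 0 < t, e * cb ⟨0, h⟩ * e = 0

namespace WBC

variable {R A : Type} [CommRing R] [Ring A] [Algebra R A] {r t : ℕ}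

/-- The transposition `(i,j) ∈ Σ_r` (1-based indices). -/
def tr (d : WBC R A r t) (i j : ℕ) : A := d.σ (sw r (i - 1) (j - 1))

/-- The transposition `(ī,j̄) ∈ Σ_t` (1-based indices). -/
def trb (d : WBC R A r t) (i j : ℕ) : A := d.σb (sw t (i - 1) (j - 1))

/-- The generator `s_j = (j, j+1)` (1-based). -/
def s (d : WBC R A r t) (j : ℕ) : A := d.σ (sw r (j - 1) j)

/-- The generator `s̄_j` (1-based). -/
def sb (d : WBC R A r t) (j : ℕ) : A := d.σb (sw t (j - 1) j)

/-- The generator `c_i` (1-based). -/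
def cn (d : WBC R A r t) (i : ℕ) : A := if h : i - 1 < r then d.c ⟨i - 1, h⟩ else 0

/-- The generator `c̄_i` (1-based). -/
def cbn (d : WBC R A r t) (i : ℕ) : A := if h : i - 1 < t then d.cb ⟨i - 1, h⟩ else 0

/-- `e_{i,j} = (1̄,j̄)(1,i) e_1 (1,i)(1̄,j̄)` (1-based). -/
def E (d : WBC R A r t) (i j : ℕ) : A := d.trb 1 j * d.tr 1 i * d.e * d.tr 1 i * d.trb 1 j

/-- `ē_{i,j} = c_i e_{i,j} c_i`. -/
def Eb (d : WBC R A r t) (i j : ℕ) : A := d.cn i * d.E i j * d.cn i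

/-- `L'_i = ∑_{j=1}^{i-1} (j,i)`. -/
def LL (d : WBC R A r t) (i : ℕ) : A := ∑ j ∈ Finset.Ico 1 i, d.tr j i

/-- The Jucys–Murphy element `L_i = L'_i + c_i L'_i c_i`. -/
def L (d : WBC R A r t) (i : ℕ) : A := d.LL i + d.cn i * d.LL i * d.cn i

/-- `L̄'_i = ∑_{j=1}^{i-1} (j̄,ī)`. -/
def LLb (d : WBC R A r t) (i : ℕ) : A := ∑ j ∈ Finset.Ico 1 i, d.trb j i

/-- The Jucys–Murphy element `L̄_i = L̄'_i - c̄_i L̄'_i c̄_i`. -/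
def Lb (d : WBC R A r t) (i : ℕ) : A := d.LLb i - d.cbn i * d.LLb i * d.cbn i

/-- `y_i = ∑_{j=1}^{i-1} (e_{i,j} + ē_{i,j}) - L_i`. -/
def y (d : WBC R A r t) (i : ℕ) : A := (∑ j ∈ Finset.Ico 1 i, (d.E i j + d.Eb i j)) - d.L i

/-- `ȳ_i = ∑_{j=1}^{i-1} (e_{j,i} - ē_{j,i}) - L̄_i`. -/
def yb (d : WBC R A r t) (i : ℕ) : A := (∑ j ∈ Finset.Ico 1 i, (d.E j i - d.Eb j i)) - d.Lb i

/-- `c^α = c_1^{α_1} ⋯ c_r^{α_r}`. -/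
def cpow (d : WBC R A r t) (α : Fin r → Fin 2) : A :=
  ((List.finRange r).map (fun i => d.c i ^ (α i : ℕ))).prod

/-- `c̄^β = c̄_1^{β_1} ⋯ c̄_t^{β_t}`. -/
def cbpow (d : WBC R A r t) (β : Fin t → Fin 2) : A :=
  ((List.finRange t).map (fun j => d.cb j ^ (β j : ℕ))).prod

/-- `e^f = e_1 e_2 ⋯ e_f`. -/
def epow (d : WBC R A r t) (f : ℕ) : A :=
  ((List.range f).map (fun i => d.E (i + 1) (i + 1))).prod

/-- Generators of the subalgebra `BC_{m,m}`: the elements `e_1`, `s_1, …, s_{m-1}`,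
`s̄_1, …, s̄_{m-1}`, `c_1` and `c̄_1` (interpreted as `∅` when `m = 0`). -/
def lowerGens (d : WBC R A r t) (m : ℕ) : Set A :=
  {x | (1 ≤ m ∧ x = d.e) ∨ (∃ j : ℕ, 1 ≤ j ∧ j + 1 ≤ m ∧ x = d.s j)
    ∨ (∃ j : ℕ, 1 ≤ j ∧ j + 1 ≤ m ∧ x = d.sb j)
    ∨ (1 ≤ m ∧ x = d.cn 1) ∨ (1 ≤ m ∧ x = d.cbn 1)}

end WBC

/-- `φ` intertwines two sets of walled Brauer–Clifford data. -/
structure WBCHom {R A B : Type} [CommRing R] [Ring A] [Algebra R A] [Ring B] [Algebra R B]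
    {r t : ℕ} (d : WBC R A r t) (d' : WBC R B r t) (φ : A →ₐ[R] B) : Prop where
  map_σ : ∀ w, φ (d.σ w) = d'.σ w
  map_σb : ∀ w, φ (d.σb w) = d'.σb w
  map_c : ∀ i, φ (d.c i) = d'.c i
  map_cb : ∀ j, φ (d.cb j) = d'.cb j
  map_e : φ d.e = d'.e

/-- `A` (with the data `d`) *is* the walled Brauer–Clifford superalgebra `BC_{r,t}`:
it is initial among all algebras with such data. -/
def WBC.IsUniversal {R A : Type} [CommRing R] [Ring A] [Algebra R A] {r t : ℕ}
    (d : WBC R A r t) : Prop :=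
  ∀ (B : Type) [Ring B] [Algebra R B], ∀ d' : WBC R B r t, ∃! φ : A →ₐ[R] B, WBCHom d d' φ

/-- An element of `D^f_{r,t}`: data `1 ≤ i_1 < ⋯ < i_f ≤ r` and `k ≤ j_k ≤ t`
(all 1-based) describing `s_{f,i_f} s̄_{f,j_f} ⋯ s_{1,i_1} s̄_{1,j_1}`. -/
structure DElt (r t f : ℕ) : Type where
  a : Fin f → ℕ
  b : Fin f → ℕ
  ha_mono : StrictMono a
  ha_lb : ∀ k, 1 ≤ a k
  ha_ub : ∀ k, a k ≤ r
  hb_lb : ∀ k : Fin f, (k : ℕ) + 1 ≤ b k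
  hb_ub : ∀ k, b k ≤ t

/-- The `Σ_r`-component `s_{f,i_f} ⋯ s_{1,i_1}` of the element of `D^f_{r,t}`. -/
def DElt.pr {r t f : ℕ} (x : DElt r t f) : Equiv.Perm (Fin r) :=
  ((List.finRange f).reverse.map (fun (k : Fin f) => sIJ r ((k : ℕ) + 1) (x.a k))).prod

/-- The `Σ_t`-component `s̄_{f,j_f} ⋯ s̄_{1,j_1}` of the element of `D^f_{r,t}`. -/
def DElt.pt {r t f : ℕ} (x : DElt r t f) : Equiv.Perm (Fin t) :=
  ((List.finRange f).reverse.map (fun (k : Fin f) => sIJ t ((k : ℕ) + 1) (x.b k))).prod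

/-- Index for the basis `{c^α d_1⁻¹ e^f w d_2 c̄^β}` of `BC_{r,t}`; the component
`w ∈ Σ_{r-f} × Σ_{t-f}` is a pair of permutations fixing `1, …, f` pointwise. -/
structure BCIndex (r t : ℕ) : Type where
  α : Fin r → Fin 2
  β : Fin t → Fin 2
  f : ℕ
  hf : f ≤ min r t
  d1 : DElt r t f
  d2 : DElt r t f
  w : Equiv.Perm (Fin r)
  wb : Equiv.Perm (Fin t)
  hw : ∀ i : Fin r, (i : ℕ) < f → w i = i
  hwb : ∀ j : Fin t, (j : ℕ) < f → wb j = j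

/-- The basis element `c^α d_1⁻¹ e^f w d_2 c̄^β` of Theorem 2.4. -/
def WBC.basElt {R A : Type} [CommRing R] [Ring A] [Algebra R A] {r t : ℕ}
    (d : WBC R A r t) (x : BCIndex r t) : A :=
  d.cpow x.α * d.σ (x.d1.pr⁻¹) * d.σb (x.d1.pt⁻¹) * d.epow x.f *
    d.σ x.w * d.σb x.wb * d.σ x.d2.pr * d.σb x.d2.pt * d.cbpow x.β

/-- Data for the presentation of the affine walled Brauer–Clifford superalgebra
`BC^aff_{r,t}` (Definition 3.1) with distinguished parameter `ω_1 ∈ R`.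
`om k` is `ω_k` (with `ω_1` the scalar `ω1` and `ω_{2k} = 0`), `omb k` is `ω̄_k`. -/
structure AWBC (R A : Type) [CommRing R] [Ring A] [Algebra R A] (r t : ℕ) (ω1 : R)
    extends WBC R A r t : Type where
  x1 : A
  xb1 : A
  om : ℕ → A
  omb : ℕ → A
  om_one : om 1 = algebraMap R A ω1
  om_even : ∀ k, om (2 * k) = 0
  omb_zero : omb 0 = 0
  om_comm : ∀ k, (∀ w, om k * σ w = σ w * om k) ∧ (∀ w, om k * σb w = σb w * om k) ∧
    (∀ i, om k * c i = c i * om k) ∧ (∀ j, om k * cb j = cb j * om k) ∧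
    om k * e = e * om k ∧ om k * x1 = x1 * om k ∧ om k * xb1 = xb1 * om k ∧
    (∀ l, om k * om l = om l * om k) ∧ (∀ l, om k * omb l = omb l * om k)
  omb_comm : ∀ k, (∀ w, omb k * σ w = σ w * omb k) ∧ (∀ w, omb k * σb w = σb w * omb k) ∧
    (∀ i, omb k * c i = c i * omb k) ∧ (∀ j, omb k * cb j = cb j * omb k) ∧
    omb k * e = e * omb k ∧ omb k * x1 = x1 * omb k ∧ omb k * xb1 = xb1 * omb k ∧
    (∀ l, omb k * omb l = omb l * omb k)
  x_comm : ∀ h : 1 < r, x1 * (σ (sw r 0 1) * x1 * σ (sw r 0 1)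
      - (1 - c ⟨0, by omega⟩ * c ⟨1, h⟩) * σ (sw r 0 1))
    = (σ (sw r 0 1) * x1 * σ (sw r 0 1)
      - (1 - c ⟨0, by omega⟩ * c ⟨1, h⟩) * σ (sw r 0 1)) * x1
  x1_c1 : ∀ h : 0 < r, x1 * c ⟨0, h⟩ = -(c ⟨0, h⟩ * x1)
  x1_c : ∀ i : Fin r, (i : ℕ) ≠ 0 → x1 * c i = c i * x1
  s_x1 : ∀ i : ℕ, 0 < i → i + 1 < r → σ (sw r i (i + 1)) * x1 = x1 * σ (sw r i (i + 1))
  xb_comm : ∀ h : 1 < t, xb1 * (σb (sw t 0 1) * xb1 * σb (sw t 0 1)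
      - (1 + cb ⟨0, by omega⟩ * cb ⟨1, h⟩) * σb (sw t 0 1))
    = (σb (sw t 0 1) * xb1 * σb (sw t 0 1)
      - (1 + cb ⟨0, by omega⟩ * cb ⟨1, h⟩) * σb (sw t 0 1)) * xb1
  xb1_cb1 : ∀ h : 0 < t, xb1 * cb ⟨0, h⟩ = -(cb ⟨0, h⟩ * xb1)
  xb1_cb : ∀ j : Fin t, (j : ℕ) ≠ 0 → xb1 * cb j = cb j * xb1
  sb_xb1 : ∀ j : ℕ, 0 < j → j + 1 < t → σb (sw t j (j + 1)) * xb1 = xb1 * σb (sw t j (j + 1))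
  e_xsum : e * (x1 + xb1) = 0
  xsum_e : (x1 + xb1) * e = 0
  e_sxs : 1 < r → e * (σ (sw r 0 1) * x1 * σ (sw r 0 1)) = (σ (sw r 0 1) * x1 * σ (sw r 0 1)) * e
  x_mixed : ∀ h : 0 < r, x1 * (e + xb1 - c ⟨0, h⟩ * e * c ⟨0, h⟩)
      = (e - c ⟨0, h⟩ * e * c ⟨0, h⟩ + xb1) * x1
  e_sbxbsb : 1 < t →
    e * (σb (sw t 0 1) * xb1 * σb (sw t 0 1)) = (σb (sw t 0 1) * xb1 * σb (sw t 0 1)) * e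
  e_xodd : ∀ k : ℕ, e * x1 ^ (2 * k + 1) * e = om (2 * k + 1) * e
  e_xeven : ∀ k : ℕ, 1 ≤ k → e * x1 ^ (2 * k) * e = 0
  e_xb : ∀ k : ℕ, 1 ≤ k → e * xb1 ^ k * e = omb k * e
  x1_cb_comm : ∀ j, x1 * cb j = cb j * x1
  xb1_c_comm : ∀ i, xb1 * c i = c i * xb1
  x1_σb : ∀ w, σb w * x1 = x1 * σb w
  xb1_σ : ∀ w, σ w * xb1 = xb1 * σ w

namespace AWBC

variable {R A : Type} [CommRing R] [Ring A] [Algebra R A] {r t : ℕ} {ω1 : R}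

/-- `x'_i = s_{i-1} ⋯ s_1 x_1 s_1 ⋯ s_{i-1}` (1-based). -/
def xp (d : AWBC R A r t ω1) (i : ℕ) : A :=
  ((List.range (i - 1)).reverse.map (fun k => d.toWBC.s (k + 1))).prod * d.x1 *
    ((List.range (i - 1)).map (fun k => d.toWBC.s (k + 1))).prod

/-- `x̄'_j = s̄_{j-1} ⋯ s̄_1 x̄_1 s̄_1 ⋯ s̄_{j-1}` (1-based). -/
def xbp (d : AWBC R A r t ω1) (j : ℕ) : A :=
  ((List.range (j - 1)).reverse.map (fun k => d.toWBC.sb (k + 1))).prod * d.xb1 *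
    ((List.range (j - 1)).map (fun k => d.toWBC.sb (k + 1))).prod

/-- `x_i = x'_i - L_i`. -/
def xv (d : AWBC R A r t ω1) (i : ℕ) : A := d.xp i - d.toWBC.L i

/-- `x̄_j = x̄'_j - L̄_j`. -/
def xbv (d : AWBC R A r t ω1) (j : ℕ) : A := d.xbp j - d.toWBC.Lb j

/-- `x^α = x_1^{α_1} ⋯ x_r^{α_r}`. -/
def xpow (d : AWBC R A r t ω1) (α : Fin r → ℕ) : A :=
  ((List.finRange r).map (fun (i : Fin r) => d.xv ((i : ℕ) + 1) ^ α i)).prod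

/-- `x̄^β = x̄_1^{β_1} ⋯ x̄_t^{β_t}`. -/
def xbpow (d : AWBC R A r t ω1) (β : Fin t → ℕ) : A :=
  ((List.finRange t).map (fun (j : Fin t) => d.xbv ((j : ℕ) + 1) ^ β j)).prod

/-- `∏_{n ∈ ℤ^{>0}} ω_{2n+1}^{a_{2n+1}}`, where `g i` is the exponent of `ω_{2(i+1)+1}`. -/
def ompow (d : AWBC R A r t ω1) (g : ℕ →₀ ℕ) : A :=
  ((g.support.sort (· ≤ ·)).map (fun n => d.om (2 * n + 3) ^ g n)).prod

/-- `z_i = x'_i + y_i`. -/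
def z (d : AWBC R A r t ω1) (i : ℕ) : A := d.xp i + d.toWBC.y i

/-- `z̄_j = x̄'_j + ȳ_j`. -/
def zb (d : AWBC R A r t ω1) (j : ℕ) : A := d.xbp j + d.toWBC.yb j

/-- Generators of the subalgebra `BC_{2,m,m}`-type subalgebra:
`e_1, s_1, …, s_{m-1}, s̄_1, …, s̄_{m-1}, c_1, c̄_1, x_1, x̄_1`. -/
def lowerGensA (d : AWBC R A r t ω1) (m : ℕ) : Set A :=
  d.toWBC.lowerGens m ∪ {x | 1 ≤ m ∧ (x = d.x1 ∨ x = d.xb1)}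

end AWBC

/-- `φ` intertwines two sets of affine walled Brauer–Clifford data. -/
structure AWBCHom {R A B : Type} [CommRing R] [Ring A] [Algebra R A] [Ring B] [Algebra R B]
    {r t : ℕ} {ω1 : R} (d : AWBC R A r t ω1) (d' : AWBC R B r t ω1) (φ : A →ₐ[R] B) : Prop where
  map_σ : ∀ w, φ (d.σ w) = d'.σ w
  map_σb : ∀ w, φ (d.σb w) = d'.σb w
  map_c : ∀ i, φ (d.c i) = d'.c i
  map_cb : ∀ j, φ (d.cb j) = d'.cb j
  map_e : φ d.e = d'.e
  map_x1 : φ d.x1 = d'.x1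
  map_xb1 : φ d.xb1 = d'.xb1
  map_om : ∀ k, φ (d.om k) = d'.om k
  map_omb : ∀ k, φ (d.omb k) = d'.omb k

/-- `A` (with the data `d`) is the affine walled Brauer–Clifford superalgebra
`BC^aff_{r,t}` of Definition 3.1. -/
def AWBC.IsUniversal {R A : Type} [CommRing R] [Ring A] [Algebra R A] {r t : ℕ} {ω1 : R}
    (d : AWBC R A r t ω1) : Prop :=
  ∀ (B : Type) [Ring B] [Algebra R B], ∀ d' : AWBC R B r t ω1,
    ∃! φ : A →ₐ[R] B, AWBCHom d d' φ

/-- Assumption 3.6: the parameters `ω̄` are determined by the `ω`'s as in Corollary 3.5. -/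
def AWBC.Ass36 {R A : Type} [CommRing R] [Ring A] [Algebra R A] {r t : ℕ} {ω1 : R}
    (d : AWBC R A r t ω1) : Prop :=
  (∀ n, d.omb (2 * n) = 0) ∧
  (∀ n, d.omb (2 * n + 1) = ∑ j ∈ Finset.range (n + 1), acoef d.om n j * d.om (2 * j + 1))

/-- `A` (with the data `d`) is the affine walled Brauer–Clifford superalgebra
`BC^aff_{r,t}` subject to Assumption 3.6. -/
def AWBC.IsUniversal36 {R A : Type} [CommRing R] [Ring A] [Algebra R A] {r t : ℕ} {ω1 : R}
    (d : AWBC R A r t ω1) : Prop :=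
  d.Ass36 ∧ ∀ (B : Type) [Ring B] [Algebra R B], ∀ d' : AWBC R B r t ω1,
    d'.Ass36 → ∃! φ : A →ₐ[R] B, AWBCHom d d' φ

/-- The parameters `ω_k`, `ω̄_k` are the scalars `ω k`, `obar ω k` (specialization defining
the algebra `B̃C_{r,t}` of Definition 3.13). -/
def AWBC.IsSpec {R A : Type} [CommRing R] [Ring A] [Algebra R A] {r t : ℕ} {ω1 : R}
    (d : AWBC R A r t ω1) (ω : ℕ → R) : Prop :=
  (∀ k, d.om k = algebraMap R A (ω k)) ∧ (∀ k, 1 ≤ k → d.omb k = algebraMap R A (obar ω k))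

/-- `A` (with the data `d`) is the algebra `B̃C_{r,t}` of Definition 3.13 with parameters
`ω_{2n+1} ∈ R`. -/
def AWBC.IsSpecUniversal {R A : Type} [CommRing R] [Ring A] [Algebra R A] {r t : ℕ} {ω1 : R}
    (d : AWBC R A r t ω1) (ω : ℕ → R) : Prop :=
  d.IsSpec ω ∧ ∀ (B : Type) [Ring B] [Algebra R B], ∀ d' : AWBC R B r t ω1,
    d'.IsSpec ω → ∃! φ : A →ₐ[R] B, AWBCHom d d' φ

/-- The cyclotomic relations `f(x_1) = 0` and `g(x̄_1) = 0`. -/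
def AWBC.IsCyc {R A : Type} [CommRing R] [Ring A] [Algebra R A] {r t : ℕ} {ω1 : R}
    (d : AWBC R A r t ω1) (f g : Polynomial R) : Prop :=
  Polynomial.aeval d.x1 f = 0 ∧ Polynomial.aeval d.xb1 g = 0

/-- `A` (with the data `d`) is the cyclotomic walled Brauer–Clifford superalgebra
`BC_{ℓ,r,t}` of Definition 3.14 attached to `f`, `g` and the scalar parameters `ω`. -/
def AWBC.IsCycUniversal {R A : Type} [CommRing R] [Ring A] [Algebra R A] {r t : ℕ} {ω1 : R}
    (d : AWBC R A r t ω1) (ω : ℕ → R) (f g : Polynomial R) : Prop :=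
  d.IsSpec ω ∧ d.IsCyc f g ∧ ∀ (B : Type) [Ring B] [Algebra R B], ∀ d' : AWBC R B r t ω1,
    d'.IsSpec ω → d'.IsCyc f g → ∃! φ : A →ₐ[R] B, AWBCHom d d' φ

/-- Index of a regular monomial `x^α d x̄^β ∏_{n≥1} ω_{2n+1}^{a_{2n+1}}` of `BC^aff_{r,t}`. -/
structure ARIndex (r t : ℕ) : Type where
  α : Fin r → ℕ
  β : Fin t → ℕ
  dIdx : BCIndex r t
  g : ℕ →₀ ℕ

/-- The regular monomial `x^α d x̄^β ∏_{n≥1} ω_{2n+1}^{a_{2n+1}}` of Definition 3.11. -/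
def AWBC.regElt {R A : Type} [CommRing R] [Ring A] [Algebra R A] {r t : ℕ} {ω1 : R}
    (d : AWBC R A r t ω1) (x : ARIndex r t) : A :=
  d.xpow x.α * d.toWBC.basElt x.dIdx * d.xbpow x.β * d.ompow x.g

/-- Index of a regular monomial `x^α d x̄^β` of `B̃C_{r,t}`. -/
structure SIndex (r t : ℕ) : Type where
  α : Fin r → ℕ
  β : Fin t → ℕ
  dIdx : BCIndex r t

/-- The regular monomial `x^α d x̄^β` of `B̃C_{r,t}`. -/
def AWBC.sregElt {R A : Type} [CommRing R] [Ring A] [Algebra R A] {r t : ℕ} {ω1 : R}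
    (d : AWBC R A r t ω1) (x : SIndex r t) : A :=
  d.xpow x.α * d.toWBC.basElt x.dIdx * d.xbpow x.β

/-- Index of a regular monomial `x^α d x̄^β` of the level `ℓ` algebra `BC_{ℓ,r,t}`,
with exponents in `{0, 1, …, ℓ-1}`. -/
structure CIndex (r t ℓ : ℕ) : Type where
  α : Fin r → Fin ℓ
  β : Fin t → Fin ℓ
  dIdx : BCIndex r t

/-- The regular monomial `x^α d x̄^β` of `BC_{ℓ,r,t}`. -/
def AWBC.cregElt {R A : Type} [CommRing R] [Ring A] [Algebra R A] {r t ℓ : ℕ} {ω1 : R}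
    (d : AWBC R A r t ω1) (x : CIndex r t ℓ) : A :=
  d.xpow (fun i => (x.α i : ℕ)) * d.toWBC.basElt x.dIdx * d.xbpow (fun j => (x.β j : ℕ))

/-- Admissibility (Definition 6.4): writing `f(x) = x^{k+2m} + ∑_{i=1}^{2m} a_i x^{k+2m-i}`,
one has `ω_L = -(a_1 ω_{L-1} + ⋯ + a_{2m} ω_{L-2m})` for all `L ≥ k + 2m`. -/
def AdmissibleParam {R : Type} [CommRing R] (ω : ℕ → R) (f : Polynomial R) (k m : ℕ) : Prop :=
  ∀ L, k + 2 * m ≤ L →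
    ω L = -∑ i ∈ Finset.Icc 1 (2 * m), f.coeff (k + 2 * m - i) * ω (L - i)

/-- The parameters `ω_0 = 0`, `ω_1 = -2m(2p-2m+1)`, `ω_i = p(p+1) ω_{i-2}` of (4.16). -/
def omSeq (m : ℕ) (p : ℂ) : ℕ → ℂ
  | 0 => 0
  | 1 => -2 * (m : ℂ) * (2 * p - 2 * (m : ℂ) + 1)
  | n + 2 => p * (p + 1) * omSeq m p n

/-- Index of a monomial `d_1^{-1} c^α x'^β e^f x̄'^{β̄} c̄^{ᾱ} w d_2` of (4.20). -/
structure L2Index (r t : ℕ) : Type where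
  α : Fin r → Fin 2
  βx : Fin r → Fin 2
  αb : Fin t → Fin 2
  βxb : Fin t → Fin 2
  f : ℕ
  hf : f ≤ min r t
  d1 : DElt r t f
  d2 : DElt r t f
  w : Equiv.Perm (Fin r)
  wb : Equiv.Perm (Fin t)
  hw : ∀ i : Fin r, (i : ℕ) < f → w i = i
  hwb : ∀ j : Fin t, (j : ℕ) < f → wb j = j

/-- The monomial `d_1^{-1} c^α x'^β e^f x̄'^{β̄} c̄^{ᾱ} w d_2` of (4.20), where
`x'^β = x'_r{}^{β_r} ⋯ x'_1{}^{β_1}` and `x̄'^{β̄} = x̄'_t{}^{β̄_t} ⋯ x̄'_1{}^{β̄_1}`. -/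
def AWBC.l2Elt {R A : Type} [CommRing R] [Ring A] [Algebra R A] {r t : ℕ} {ω1 : R}
    (d : AWBC R A r t ω1) (x : L2Index r t) : A :=
  d.toWBC.σ (x.d1.pr⁻¹) * d.toWBC.σb (x.d1.pt⁻¹) * d.toWBC.cpow x.α *
    ((List.finRange r).reverse.map (fun (i : Fin r) => d.xp ((i : ℕ) + 1) ^ (x.βx i : ℕ))).prod *
    d.toWBC.epow x.f *
    ((List.finRange t).reverse.map (fun (j : Fin t) => d.xbp ((j : ℕ) + 1) ^ (x.βxb j : ℕ))).prod *
    d.toWBC.cbpow x.αb *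
    d.toWBC.σ x.w * d.toWBC.σb x.wb * d.toWBC.σ x.d2.pr * d.toWBC.σb x.d2.pt

section
set_option linter.unusedSectionVars false
set_option linter.unusedSimpArgs false
set_option linter.unusedVariables false
/-- Sergeev-type data: degenerate affine Hecke-Clifford relations with `x_i ^ 2 = a`. -/
structure SD (ι : Type) [DecidableEq ι] (a : ℂ) (B : Type) [Ring B] [Algebra ℂ B] where
  σ : Equiv.Perm ι →* B
  c : ι → B
  x : ι → B
  c_sq : ∀ i, c i * c i = -1
  c_anti : ∀ i j, i ≠ j → c i * c j = -(c j * c i)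
  σ_c : ∀ w i, σ w * c i = c (w i) * σ w
  σ_x : ∀ w i, σ w * x i = x (w i) * σ w
  x_sq : ∀ i, x i * x i = algebraMap ℂ B a
  x_c : ∀ i, x i * c i = -(c i * x i)
  x_c' : ∀ i j, i ≠ j → x i * c j = c j * x i
  x_x : ∀ i j, i ≠ j → x i * x j = x j * x i
    + ((x i - x j) + c i * c j * (x i + x j)) * σ (Equiv.swap i j)

namespace SDM

variable {ι : Type} [DecidableEq ι] {a : ℂ} {B : Type} [Ring B] [Algebra ℂ B]

abbrev Mod (ι B : Type) [Ring B] : Type := (ι × Bool × Bool) →₀ B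

def br (i : ι) (α β : Bool) : B →ₗ[ℂ] Mod ι B := Finsupp.lsingle (i, α, β)

def lm (b : B) : B →ₗ[ℂ] B := LinearMap.mulLeft ℂ b

@[simp] lemma lm_apply (b y : B) : lm b y = b * y := rfl

def sg (β : Bool) : ℂ := if β then -1 else 1

def lift (f : ι → Bool → Bool → (B →ₗ[ℂ] Mod ι B)) : Module.End ℂ (Mod ι B) :=
  Finsupp.lsum ℂ (fun p => f p.1 p.2.1 p.2.2)

@[simp] lemma lift_br (f : ι → Bool → Bool → (B →ₗ[ℂ] Mod ι B)) (i : ι) (α β : Bool) (y : B) :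
    lift f (br i α β y) = f i α β y := by
  simp [lift, br]

lemma end_ext {N : Type} [AddCommGroup N] [Module ℂ N] {f g : Mod ι B →ₗ[ℂ] N}
    (h : ∀ i α β y, f (br i α β y) = g (br i α β y)) : f = g := by
  apply Finsupp.lhom_ext
  rintro ⟨i, α, β⟩ y
  exact h i α β y

variable (D : SD ι a B) (o : ι)

/-- action of permutations -/
def Sop (w : Equiv.Perm ι) : Module.End ℂ (Mod ι B) :=
  lift fun i α β => br (w i) α β ∘ₗ lm (D.σ (Equiv.swap (w i) o * w * Equiv.swap i o))

lemma Sop_br (w : Equiv.Perm ι) (i : ι) (α β : Bool) (y : B) :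
    Sop D o w (br i α β y)
      = br (w i) α β (D.σ (Equiv.swap (w i) o * w * Equiv.swap i o) * y) := by
  simp [Sop]

def Cop (l : ι) : Module.End ℂ (Mod ι B) :=
  lift fun i α β => if l = i then (sg α * sg β) • br i α (!β)
    else sg β • (br i α β ∘ₗ lm (D.c (Equiv.swap i o l)))

lemma Cop_eq (l : ι) (α β : Bool) (y : B) :
    Cop D o l (br l α β y) = (sg α * sg β) • br l α (!β) y := by
  simp [Cop]

lemma Cop_ne {l i : ι} (h : l ≠ i) (α β : Bool) (y : B) :
    Cop D o l (br i α β y) = sg β • br i α β (D.c (Equiv.swap i o l) * y) := by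
  simp [Cop, h]

def Xop (l : ι) : Module.End ℂ (Mod ι B) :=
  lift fun i α β => if l = i then (if α then a • br i false β else br i true β)
    else (if α then
      (let s := D.σ (Equiv.swap l o * Equiv.swap l i * Equiv.swap i o)
       let g : B →ₗ[ℂ] Mod ι B := br l true β ∘ₗ lm s
       let h : B →ₗ[ℂ] Mod ι B := br l false β ∘ₗ lm (D.x (Equiv.swap l o i) * s)
       br i true β ∘ₗ lm (D.x (Equiv.swap i o l)) + (g - h) + Cop D o l ∘ₗ Cop D o i ∘ₗ (g + h))
      else br i false β ∘ₗ lm (D.x (Equiv.swap i o l)))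

lemma Xop_eq0 (l : ι) (β : Bool) (y : B) :
    Xop D o l (br l false β y) = br l true β y := by
  simp [Xop]

lemma Xop_eq1 (l : ι) (β : Bool) (y : B) :
    Xop D o l (br l true β y) = a • br l false β y := by
  simp [Xop]

lemma Xop_ne0 {l i : ι} (h : l ≠ i) (β : Bool) (y : B) :
    Xop D o l (br i false β y) = br i false β (D.x (Equiv.swap i o l) * y) := by
  simp [Xop, h]

lemma Xop_ne1 {l i : ι} (h : l ≠ i) (β : Bool) (y : B) :
    Xop D o l (br i true β y) = Xop D o i (Xop D o l (br i false β y))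
      + (Xop D o l (Sop D o (Equiv.swap l i) (br i false β y))
        - Xop D o i (Sop D o (Equiv.swap l i) (br i false β y)))
      + Cop D o l (Cop D o i (Xop D o l (Sop D o (Equiv.swap l i) (br i false β y))
        + Xop D o i (Sop D o (Equiv.swap l i) (br i false β y)))) := by
  rw [Sop_br, Equiv.swap_apply_right, Xop_eq0, Xop_ne0 D o h, Xop_ne0 D o h.symm, Xop_eq0]
  simp [Xop, h, mul_assoc]

lemma Sop_mul (w w' : Equiv.Perm ι) : Sop D o (w * w') = Sop D o w * Sop D o w' := by
  apply end_ext
  intro i α β y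
  simp only [Module.End.mul_apply, Sop_br, ← mul_assoc, ← map_mul, Equiv.Perm.mul_apply]
  congr 4
  simp [mul_assoc]

lemma Sop_one : Sop D o 1 = 1 := by
  apply end_ext
  intro i α β y
  simp [Sop_br]

lemma Sop_Cop (w : Equiv.Perm ι) (l : ι) (v : Mod ι B) :
    Sop D o w (Cop D o l v) = Cop D o (w l) (Sop D o w v) := by
  suffices Sop D o w ∘ₗ Cop D o l = Cop D o (w l) ∘ₗ Sop D o w from
    congrArg (fun f => f v) this
  apply end_ext
  intro i α β y
  simp only [LinearMap.comp_apply]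
  by_cases h : l = i
  · subst h
    simp [Cop_eq, Sop_br]
  · have h' : w l ≠ w i := fun e => h (w.injective e)
    rw [Cop_ne D o h, Sop_br, Cop_ne D o h', map_smul, Sop_br, ← mul_assoc, ← mul_assoc, D.σ_c]
    simp

lemma br_eq (i : ι) (α β : Bool) (y : B) :
    br i α β y = Sop D o (Equiv.swap i o) (br o α β y) := by
  simp [Sop_br, ← Equiv.Perm.one_def]

lemma Sop_Xop0 (w : Equiv.Perm ι) (l : ι) (i : ι) (β : Bool) (y : B) :
    Sop D o w (Xop D o l (br i false β y)) = Xop D o (w l) (Sop D o w (br i false β y)) := by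
  by_cases h : l = i
  · subst h
    simp [Xop_eq0, Sop_br]
  · have h' : w l ≠ w i := fun e => h (w.injective e)
    rw [Xop_ne0 D o h, Sop_br, Sop_br, Xop_ne0 D o h', ← mul_assoc, ← mul_assoc, D.σ_x]
    simp

lemma Sop_Sop (w w' : Equiv.Perm ι) (v) : Sop D o w (Sop D o w' v) = Sop D o (w * w') v := by
  rw [Sop_mul]; rfl

lemma Sop_Xop (w : Equiv.Perm ι) (l : ι) (v : Mod ι B) :
    Sop D o w (Xop D o l v) = Xop D o (w l) (Sop D o w v) := by
  suffices Sop D o w ∘ₗ Xop D o l = Xop D o (w l) ∘ₗ Sop D o w from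
    congrArg (fun f => f v) this
  apply end_ext
  intro i α β y
  simp only [LinearMap.comp_apply]
  by_cases h : l = i
  · subst h
    cases α <;>
    simp [Xop_eq0, Xop_eq1, Sop_br]
  · have h' : w l ≠ w i := fun e => h (w.injective e)
    cases α
    · exact Sop_Xop0 D o w l i β y
    · have e0 : Sop D o w (br i true β y) = br (w i) true β
          (D.σ (Equiv.swap (w i) o * w * Equiv.swap i o) * y) := Sop_br ..
      have e1 : Sop D o w (br i false β y) = br (w i) false β
          (D.σ (Equiv.swap (w i) o * w * Equiv.swap i o) * y) := Sop_br ..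
      have e2 : w * Equiv.swap l i = Equiv.swap (w l) (w i) * w := by
        rw [Equiv.swap_apply_apply]; simp
      have e3 : ∀ m, Sop D o w (Xop D o m (Sop D o (Equiv.swap l i) (br i false β y)))
          = Xop D o (w m) (Sop D o (Equiv.swap (w l) (w i)) (Sop D o w (br i false β y))) := by
        intro m
        rw [Sop_br D o (Equiv.swap l i), Sop_Xop0, ← Sop_br, Sop_Sop, Sop_Sop, e2]
      rw [e0, Xop_ne1 D o h', Xop_ne1 D o h, ← e1]
      simp only [map_add, map_sub, Sop_Cop, e3, Xop_ne0 D o h]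
      rw [Sop_Xop0, ← Xop_ne0 D o h, Sop_Xop0]

end SDM
end

section
set_option linter.unusedSectionVars false
set_option linter.unusedSimpArgs false
set_option linter.unusedVariables false
namespace SDM
variable {ι : Type} [DecidableEq ι] {a : ℂ} {B : Type} [Ring B] [Algebra ℂ B]
variable (D : SD ι a B) (o : ι)

/-- To prove an equivariant family identity it is enough to test on `br o`. -/
lemma red {κ : Type} (act : Equiv.Perm ι → κ → κ) (P : κ → Mod ι B → Prop)
    (hP : ∀ w k v, P k v → P (act w k) (Sop D o w v))
    (hact : ∀ w k, act w (act w⁻¹ k) = k)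
    (h : ∀ k α β y, P k (br o α β y)) (k : κ) (i : ι) (α β : Bool) (y : B) :
    P k (br i α β y) := by
  rw [br_eq D o, ← hact (Equiv.swap i o) k]
  exact hP _ _ _ (h _ _ _ _)

lemma Co_eq (α β : Bool) (y : B) :
    Cop D o o (br o α β y) = (sg α * sg β) • br o α (!β) y := Cop_eq ..

lemma Co_ne {l : ι} (h : l ≠ o) (α β : Bool) (y : B) :
    Cop D o l (br o α β y) = sg β • br o α β (D.c l * y) := by
  rw [Cop_ne D o h]; simp

lemma Xo_ne {l : ι} (h : l ≠ o) (β : Bool) (y : B) :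
    Xop D o l (br o false β y) = br o false β (D.x l * y) := by
  rw [Xop_ne0 D o h]; simp

lemma Cop_sq (l : ι) (v : Mod ι B) : Cop D o l (Cop D o l v) = - v := by
  suffices Cop D o l ∘ₗ Cop D o l = -LinearMap.id from congrArg (fun f => f v) this
  apply end_ext
  intro i α β y
  refine red D o (fun w l => w l) (fun l v => (Cop D o l ∘ₗ Cop D o l) v = -v) ?_ ?_ ?_ l i α β y
  · intro w l v h
    simp only [LinearMap.comp_apply] at h ⊢
    rw [← Sop_Cop, ← Sop_Cop, h, map_neg]
  · simp
  · intro l α β y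
    simp only [LinearMap.comp_apply]
    by_cases h : l = o
    · subst h
      cases α <;> cases β <;> simp [Co_eq, sg]
    · cases β <;> simp [Co_ne D o h, sg, ← mul_assoc, D.c_sq]

lemma Cop_anti {l m : ι} (hlm : l ≠ m) (v : Mod ι B) :
    Cop D o l (Cop D o m v) = - Cop D o m (Cop D o l v) := by
  suffices Cop D o l ∘ₗ Cop D o m = -(Cop D o m ∘ₗ Cop D o l) from congrArg (fun f => f v) this
  apply end_ext
  intro i α β y
  refine red D o (fun w p => (w p.1, w p.2)) (fun (p : ι × ι) v => p.1 ≠ p.2 →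
    (Cop D o p.1 ∘ₗ Cop D o p.2) v = -(Cop D o p.2 ∘ₗ Cop D o p.1) v) ?_ ?_ ?_ (l, m) i α β y hlm
  · intro w p v h hp
    simp only [LinearMap.comp_apply] at h hp ⊢
    rw [← Sop_Cop, ← Sop_Cop, ← Sop_Cop, ← Sop_Cop, h, map_neg]
    rintro e; rw [e] at hp; exact hp rfl
  · simp
  · rintro ⟨l, m⟩ α β y hlm
    simp only [LinearMap.comp_apply] at hlm ⊢
    by_cases h : l = o
    · subst h
      cases α <;> cases β <;> simp [Co_eq, Co_ne D l hlm.symm, sg]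
    · by_cases h' : m = o
      · subst h'
        cases α <;> cases β <;> simp [Co_eq, Co_ne D m hlm, sg]
      · cases β <;> simp [Co_ne D o h, Co_ne D o h', sg, ← mul_assoc, D.c_anti _ _ hlm]

/-- `α = 0` part of the `X C` relations. -/
lemma XC0 (l : ι) (i : ι) (β : Bool) (y : B) :
    Xop D o l (Cop D o l (br i false β y)) = - Cop D o l (Xop D o l (br i false β y)) := by
  by_cases h : l = i
  · subst h
    cases β <;> simp [Cop_eq, Xop_eq0, sg]
  · cases β <;> simp [Cop_ne D o h, Xop_ne0 D o h, sg, ← mul_assoc, D.x_c]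

lemma XC0' {l m : ι} (hlm : l ≠ m) (i : ι) (β : Bool) (y : B) :
    Xop D o l (Cop D o m (br i false β y)) = Cop D o m (Xop D o l (br i false β y)) := by
  by_cases h : l = i
  · subst h
    cases β <;> simp [Cop_ne D o hlm.symm, Xop_eq0, sg]
  · by_cases h' : m = i
    · subst h'
      cases β <;> simp [Cop_eq, Xop_ne0 D o hlm, sg]
    · have e : Equiv.swap i o l ≠ Equiv.swap i o m := fun e => hlm ((Equiv.swap i o).injective e)
      cases β <;> simp [Cop_ne D o h', Xop_ne0 D o h, sg, ← mul_assoc, D.x_c' _ _ e]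

/-- vectors with `α = 0`, index `i` -/
def N0 (i : ι) : Submodule ℂ (Mod ι B) := ⨆ β, LinearMap.range (br (B := B) i false β)

lemma br_mem_N0 (i : ι) (β : Bool) (y : B) : br i false β y ∈ N0 (B := B) i :=
  Submodule.mem_iSup_of_mem β ⟨y, rfl⟩

lemma N0_ind {i : ι} {N : Type} [AddCommGroup N] [Module ℂ N] {f g : Mod ι B →ₗ[ℂ] N}
    (h : ∀ β y, f (br i false β y) = g (br i false β y)) {v} (hv : v ∈ N0 (B := B) i) :
    f v = g v := by
  have : N0 (B := B) i ≤ LinearMap.eqLocus f g := by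
    apply iSup_le
    rintro β _ ⟨y, rfl⟩
    exact h β y
  exact this hv

lemma N0_Cop {i : ι} (l : ι) {v} (hv : v ∈ N0 (B := B) i) : Cop D o l v ∈ N0 (B := B) i := by
  have : N0 (B := B) i ≤ (N0 i).comap (Cop D o l) := by
    apply iSup_le
    rintro β _ ⟨y, rfl⟩
    by_cases h : l = i
    · subst h
      simp only [Submodule.mem_comap, Cop_eq]
      exact Submodule.smul_mem _ _ (br_mem_N0 _ _ _)
    · simp only [Submodule.mem_comap, Cop_ne D o h]
      exact Submodule.smul_mem _ _ (br_mem_N0 _ _ _)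
  exact this hv

lemma N0_Sop {i : ι} (w : Equiv.Perm ι) {v} (hv : v ∈ N0 (B := B) i) :
    Sop D o w v ∈ N0 (B := B) (w i) := by
  have : N0 (B := B) i ≤ (N0 (w i)).comap (Sop D o w) := by
    apply iSup_le
    rintro β _ ⟨y, rfl⟩
    simp only [Submodule.mem_comap, Sop_br]
    exact br_mem_N0 _ _ _
  exact this hv

lemma N0_XC {i : ι} (l : ι) {v} (hv : v ∈ N0 (B := B) i) :
    Xop D o l (Cop D o l v) = - Cop D o l (Xop D o l v) :=
  N0_ind (f := Xop D o l ∘ₗ Cop D o l) (g := -(Cop D o l ∘ₗ Xop D o l))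
    (fun β y => XC0 D o l i β y) hv

lemma N0_XC' {i l m : ι} (hlm : l ≠ m) {v} (hv : v ∈ N0 (B := B) i) :
    Xop D o l (Cop D o m v) = Cop D o m (Xop D o l v) :=
  N0_ind (f := Xop D o l ∘ₗ Cop D o m) (g := (Cop D o m ∘ₗ Xop D o l))
    (fun β y => XC0' D o hlm i β y) hv

/-- the right hand side of the commutator -/
def Rop (i j : ι) : Module.End ℂ (Mod ι B) :=
  ((Xop D o i - Xop D o j) + Cop D o i * Cop D o j * (Xop D o i + Xop D o j))
    * Sop D o (Equiv.swap i j)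

lemma N0_XX {i l : ι} (h : l ≠ i) {v} (hv : v ∈ N0 (B := B) i) :
    Xop D o l (Xop D o i v) = Xop D o i (Xop D o l v) + Rop D o l i v := by
  refine N0_ind (f := Xop D o l ∘ₗ Xop D o i) (g := Xop D o i ∘ₗ Xop D o l + Rop D o l i)
    (fun β y => ?_) hv
  simp only [LinearMap.comp_apply, LinearMap.add_apply]
  rw [Xop_eq0, Xop_ne1 D o h, add_assoc]
  simp [Rop]

end SDM
end

section
set_option linter.unusedSectionVars false
set_option linter.unusedSimpArgs false
set_option linter.unusedVariables false
namespace SDM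
variable {ι : Type} [DecidableEq ι] {a : ℂ} {B : Type} [Ring B] [Algebra ℂ B]
variable (D : SD ι a B) (o : ι)

lemma N0_Xop {i l : ι} (h : l ≠ i) {v} (hv : v ∈ N0 (B := B) i) :
    Xop D o l v ∈ N0 (B := B) i := by
  have : N0 (B := B) i ≤ (N0 i).comap (Xop D o l) := by
    apply iSup_le
    rintro β _ ⟨y, rfl⟩
    simp only [Submodule.mem_comap, Xop_ne0 D o h]
    exact br_mem_N0 _ _ _
  exact this hv

lemma N0_Xsq {i : ι} (l : ι) {v} (hv : v ∈ N0 (B := B) i) :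
    Xop D o l (Xop D o l v) = a • v := by
  refine N0_ind (f := Xop D o l ∘ₗ Xop D o l) (g := a • LinearMap.id) (fun β y => ?_) hv
  by_cases h : l = i
  · subst h
    simp [Xop_eq0, Xop_eq1]
  · simp [Xop_ne0 D o h, ← mul_assoc, D.x_sq, ← Algebra.smul_def]

lemma Rop_apply (i j : ι) (v : Mod ι B) : Rop D o i j v =
    (Xop D o i (Sop D o (Equiv.swap i j) v) - Xop D o j (Sop D o (Equiv.swap i j) v))
    + Cop D o i (Cop D o j (Xop D o i (Sop D o (Equiv.swap i j) v)
      + Xop D o j (Sop D o (Equiv.swap i j) v))) := by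
  simp [Rop]

lemma N0_RC {i l j : ι} (h : l ≠ i) {v} (hv : v ∈ N0 (B := B) j) :
    Rop D o l i (Cop D o l v) = - Cop D o l (Rop D o l i v) := by
  have h1 := N0_Sop D o (Equiv.swap l i) hv
  simp only [Rop_apply, Sop_Cop, Equiv.swap_apply_left, map_add, map_sub, N0_XC D o _ h1,
    N0_XC' D o h h1, map_neg, Cop_anti D o h, Cop_sq]
  abel

lemma N0_RC2 {i l j : ι} (h : l ≠ i) {v} (hv : v ∈ N0 (B := B) j) :
    Rop D o l i (Cop D o i v) = - Cop D o i (Rop D o l i v) := by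
  have h1 := N0_Sop D o (Equiv.swap l i) hv
  simp only [Rop_apply, Sop_Cop, Equiv.swap_apply_right, map_add, map_sub, N0_XC D o _ h1,
    N0_XC' D o h.symm h1, map_neg, Cop_anti D o h, Cop_sq]
  abel

lemma N0_RC' {i l j m : ι} (h : m ≠ l) (h' : m ≠ i) {v} (hv : v ∈ N0 (B := B) j) :
    Rop D o l i (Cop D o m v) = Cop D o m (Rop D o l i v) := by
  have h1 := N0_Sop D o (Equiv.swap l i) hv
  simp only [Rop_apply, Sop_Cop, Equiv.swap_apply_of_ne_of_ne h h', map_add, map_sub,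
    N0_XC' D o h.symm h1, N0_XC' D o h'.symm h1, map_neg, Cop_anti D o h, Cop_anti D o h']
  abel

lemma op_ext {f g : Module.End ℂ (Mod ι B)}
    (h0 : ∀ i, ∀ v ∈ N0 (B := B) i, f v = g v)
    (h1 : ∀ i, ∀ v ∈ N0 (B := B) i, f (Xop D o i v) = g (Xop D o i v)) (v) : f v = g v := by
  suffices f = g by rw [this]
  apply end_ext
  intro i α β y
  cases α
  · exact h0 i _ (br_mem_N0 _ _ _)
  · have := h1 i _ (br_mem_N0 i β y)
    rwa [Xop_eq0] at this

lemma XC (l : ι) (v : Mod ι B) : Xop D o l (Cop D o l v) = - Cop D o l (Xop D o l v) := by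
  refine op_ext D o (f := Xop D o l * Cop D o l) (g := -(Cop D o l * Xop D o l)) ?_ ?_ v
  · intro i v hv
    exact N0_XC D o l hv
  · intro i v hv
    simp only [Module.End.mul_apply, LinearMap.neg_apply]
    by_cases h : l = i
    · subst h
      rw [← neg_eq_iff_eq_neg.mpr (N0_XC D o l hv), map_neg, N0_Xsq D o l (N0_Cop D o l hv),
        N0_Xsq D o l hv, map_smul]
    · rw [← N0_XC' D o (Ne.symm h) hv, N0_XX D o h (N0_Cop D o l hv), N0_XX D o h hv,
        N0_RC D o h hv, N0_XC D o l hv, map_neg, N0_XC' D o (Ne.symm h) (N0_Xop D o h hv), map_add]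
      abel

lemma XC' {l m : ι} (hlm : l ≠ m) (v : Mod ι B) :
    Xop D o l (Cop D o m v) = Cop D o m (Xop D o l v) := by
  refine op_ext D o (f := Xop D o l * Cop D o m) (g := (Cop D o m * Xop D o l)) ?_ ?_ v
  · intro i v hv
    exact N0_XC' D o hlm hv
  · intro i v hv
    simp only [Module.End.mul_apply]
    by_cases h : l = i
    · subst h
      rw [← N0_XC' D o hlm hv, N0_Xsq D o l (N0_Cop D o m hv), N0_Xsq D o l hv, map_smul]
    · by_cases h' : m = i
      · subst h'
        rw [← neg_eq_iff_eq_neg.mpr (N0_XC D o m hv), map_neg, N0_XX D o h (N0_Cop D o m hv),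
          N0_XX D o h hv, N0_RC2 D o h hv, N0_XC' D o hlm hv, N0_XC D o m (N0_Xop D o h hv), map_add]
        abel
      · rw [← N0_XC' D o (Ne.symm h') hv, N0_XX D o h (N0_Cop D o m hv), N0_XX D o h hv,
          N0_RC' D o hlm.symm h' hv, N0_XC' D o hlm hv,
          N0_XC' D o (Ne.symm h') (N0_Xop D o h hv), map_add]

lemma Rop_symm {l m : ι} (h : l ≠ m) (v : Mod ι B) : Rop D o l m v = - Rop D o m l v := by
  simp only [Rop_apply, Equiv.swap_comm m l, Cop_anti D o h, map_add]
  abel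

lemma N0_XXg {i l m : ι} (hlm : l ≠ m) {v} (hv : v ∈ N0 (B := B) i) :
    Xop D o l (Xop D o m v) = Xop D o m (Xop D o l v) + Rop D o l m v := by
  by_cases h : m = i
  · subst h; exact N0_XX D o hlm hv
  by_cases h' : l = i
  · subst h'
    rw [N0_XX D o h hv, Rop_symm D o hlm]; abel
  refine N0_ind (f := Xop D o l ∘ₗ Xop D o m) (g := Xop D o m ∘ₗ Xop D o l + Rop D o l m)
    (fun β y => ?_) hv
  have e1 : Equiv.swap l m i = i := Equiv.swap_apply_of_ne_of_ne (Ne.symm h') (Ne.symm h)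
  have e : Equiv.swap i o l ≠ Equiv.swap i o m := fun e => hlm ((Equiv.swap i o).injective e)
  have e2 : Equiv.swap i o * Equiv.swap l m * Equiv.swap i o
      = Equiv.swap (Equiv.swap i o l) (Equiv.swap i o m) := by
    rw [Equiv.swap_apply_apply]; simp
  simp only [LinearMap.comp_apply, LinearMap.add_apply, Rop_apply, Sop_br, e1, e2,
    Xop_ne0 D o h, Xop_ne0 D o h', ← map_add, ← map_sub, Cop_ne D o h, Cop_ne D o h', map_smul]
  rw [smul_smul, show sg β * sg β = 1 by cases β <;> simp [sg], one_smul, ← map_add, ← map_add]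
  congr 1
  simp only [← mul_assoc, D.x_x _ _ e]
  noncomm_ring

lemma N0_RX {i j m : ι} (h : i ≠ m) {v} (hv : v ∈ N0 (B := B) j) :
    Rop D o i m (Xop D o i v) = - Xop D o i (Rop D o i m v) := by
  have h1 := N0_Sop D o (Equiv.swap i m) hv
  simp only [Rop_apply, Sop_Xop, Equiv.swap_apply_left, map_add, map_sub, XC, XC' D o h,
    XC' D o h.symm, N0_Xsq D o _ h1, map_smul, map_neg]
  abel

lemma N0_K {j p q r : ι} (h1 : p ≠ q) (h2 : p ≠ r) {v} (hv : v ∈ N0 (B := B) j) :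
    Xop D o p (Rop D o q r v) - Rop D o q r (Xop D o p v) =
      Rop D o p q (Sop D o (Equiv.swap q r) v) - Rop D o p r (Sop D o (Equiv.swap q r) v)
      + Cop D o q (Cop D o r (Rop D o p q (Sop D o (Equiv.swap q r) v)
        + Rop D o p r (Sop D o (Equiv.swap q r) v))) := by
  have h3 := N0_Sop D o (Equiv.swap q r) hv
  have e1 := N0_XXg D o h1 h3
  have e2 := N0_XXg D o h2 h3
  rw [Rop_apply D o q r v, Rop_apply D o q r (Xop D o p v)]
  simp only [Sop_Xop, Equiv.swap_apply_of_ne_of_ne h1 h2, map_add, map_sub, XC' D o h1, XC' D o h2,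
    e1, e2]
  abel

lemma swap3 {l m i : ι} (h1 : l ≠ m) (h2 : l ≠ i) (h3 : m ≠ i) :
    Equiv.swap m i * Equiv.swap l i = Equiv.swap l m * Equiv.swap m i := by
  ext t
  simp only [Equiv.Perm.mul_apply, Equiv.swap_apply_def]
  split_ifs <;> simp_all

lemma N0_jac {i l m : ι} (h1 : l ≠ m) (h2 : l ≠ i) (h3 : m ≠ i) (v : Mod ι B)
    (hv : v ∈ N0 (B := B) i) :
    Xop D o l (Xop D o m (Xop D o i v)) = Xop D o m (Xop D o l (Xop D o i v))
      + Rop D o l m (Xop D o i v) := by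
  rw [N0_XX D o h3 hv, N0_XX D o h2 hv, map_add, map_add, N0_XX D o h2 (N0_Xop D o h3 hv),
    N0_XX D o h3 (N0_Xop D o h2 hv), N0_XXg D o h1 hv, map_add]
  have k1 := N0_K D o h1.symm h3 hv
  have k2 := N0_K D o h1 h2 hv
  have k3 := N0_K D o h2.symm h3.symm hv
  have s1 := swap3 h1 h2 h3
  have s2 : Equiv.swap l m * Equiv.swap l i = Equiv.swap m i * Equiv.swap l m := by
    have := swap3 h2 h1 h3.symm
    rw [Equiv.swap_comm m i]
    rw [Equiv.swap_comm i m] at this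
    ext t
    simp only [Equiv.Perm.mul_apply, Equiv.swap_apply_def]
    split_ifs <;> simp_all
  have s3 : Equiv.swap l i * Equiv.swap m i = Equiv.swap m i * Equiv.swap l m := by
    ext t
    simp only [Equiv.Perm.mul_apply, Equiv.swap_apply_def]
    split_ifs <;> simp_all
  have s4 : Equiv.swap l i * Equiv.swap l m = Equiv.swap l m * Equiv.swap m i := by
    ext t
    simp only [Equiv.Perm.mul_apply, Equiv.swap_apply_def]
    split_ifs <;> simp_all
  have key : -(Xop D o m (Rop D o l i v) - Rop D o l i (Xop D o m v))
      + (Xop D o l (Rop D o m i v) - Rop D o m i (Xop D o l v))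
      + (Xop D o i (Rop D o l m v) - Rop D o l m (Xop D o i v)) = 0 := by
    rw [k1, k2, k3]
    simp only [Rop_apply, Sop_Sop, Equiv.swap_comm m l, Equiv.swap_comm i l, Equiv.swap_comm i m,
      s1, s2, s3, s4, map_add, map_sub, map_neg, Cop_anti D o h1.symm, Cop_anti D o h2.symm,
      Cop_anti D o h3.symm, Cop_sq]
    abel
  rw [← sub_eq_zero, ← key]
  abel

lemma XX {l m : ι} (h : l ≠ m) (v : Mod ι B) :
    Xop D o l (Xop D o m v) = Xop D o m (Xop D o l v) + Rop D o l m v := by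
  have aux : ∀ l m : ι, l ≠ m → ∀ v ∈ N0 (B := B) l,
      Xop D o l (Xop D o m (Xop D o l v)) = Xop D o m (Xop D o l (Xop D o l v))
        + Rop D o l m (Xop D o l v) := by
    intro l m h v hv
    rw [N0_XX D o h.symm hv, map_add, N0_Xsq D o l hv, N0_Xsq D o l (N0_Xop D o h.symm hv),
      N0_RX D o h hv, Rop_symm D o h.symm, map_neg, map_smul]
  refine op_ext D o (f := Xop D o l * Xop D o m) (g := Xop D o m * Xop D o l + Rop D o l m)
    ?_ ?_ v
  · intro i v hv
    exact N0_XXg D o h hv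
  · intro i v hv
    simp only [Module.End.mul_apply, LinearMap.add_apply]
    by_cases h' : l = i
    · subst h'
      exact aux l m h v hv
    · by_cases h2 : m = i
      · subst h2
        rw [aux m l h.symm v hv, Rop_symm D o h]
        abel
      · exact N0_jac D o h h' h2 v hv

lemma Xsq (l : ι) (v : Mod ι B) : Xop D o l (Xop D o l v) = a • v := by
  refine op_ext D o (f := Xop D o l * Xop D o l) (g := a • 1) ?_ ?_ v
  · intro i v hv
    exact N0_Xsq D o l hv
  · intro i v hv
    simp only [Module.End.mul_apply, LinearMap.smul_apply, Module.End.one_apply]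
    by_cases h' : l = i
    · subst h'
      rw [N0_Xsq D o l hv, map_smul]
    · rw [N0_XX D o h' hv, map_add, N0_XX D o h' (N0_Xop D o h' hv), N0_RX D o h' hv,
        N0_Xsq D o l hv, map_smul]
      abel

/-- The induced module carries Sergeev data. -/
def indSD : SD ι a (Module.End ℂ (Mod ι B)) where
  σ := { toFun := Sop D o, map_one' := Sop_one D o, map_mul' := Sop_mul D o }
  c := Cop D o
  x := Xop D o
  c_sq i := LinearMap.ext fun v => Cop_sq D o i v
  c_anti i j h := LinearMap.ext fun v => Cop_anti D o h v
  σ_c w i := LinearMap.ext fun v => Sop_Cop D o w i v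
  σ_x w i := LinearMap.ext fun v => Sop_Xop D o w i v
  x_sq i := LinearMap.ext fun v => Xsq D o i v
  x_c i := LinearMap.ext fun v => XC D o i v
  x_c' i j h := LinearMap.ext fun v => XC' D o h v
  x_x i j h := LinearMap.ext fun v => XX D o h v

end SDM
end

section
set_option linter.unusedSectionVars false
set_option linter.unusedSimpArgs false
set_option linter.unusedVariables false
section Serg
variable (ι : Type) [DecidableEq ι] (a : ℂ)

abbrev SergFree : Type := FreeAlgebra ℂ (Equiv.Perm ι ⊕ ι ⊕ ι)

variable {ι} in
def fσ (w : Equiv.Perm ι) : SergFree ι := FreeAlgebra.ι ℂ (Sum.inl w)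
variable {ι} in
def fc (i : ι) : SergFree ι := FreeAlgebra.ι ℂ (Sum.inr (Sum.inl i))
variable {ι} in
def fx (i : ι) : SergFree ι := FreeAlgebra.ι ℂ (Sum.inr (Sum.inr i))

inductive SergRel : SergFree ι → SergFree ι → Prop
  | one : SergRel (fσ 1) 1
  | mul (w v) : SergRel (fσ (w * v)) (fσ w * fσ v)
  | c_sq (i) : SergRel (fc i * fc i) (-1)
  | c_anti (i j) (h : i ≠ j) : SergRel (fc i * fc j) (-(fc j * fc i))
  | σ_c (w i) : SergRel (fσ w * fc i) (fc (w i) * fσ w)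
  | σ_x (w i) : SergRel (fσ w * fx i) (fx (w i) * fσ w)
  | x_sq (i) : SergRel (fx i * fx i) (algebraMap ℂ _ a)
  | x_c (i) : SergRel (fx i * fc i) (-(fc i * fx i))
  | x_c' (i j) (h : i ≠ j) : SergRel (fx i * fc j) (fc j * fx i)
  | x_x (i j) (h : i ≠ j) : SergRel (fx i * fx j) (fx j * fx i
    + ((fx i - fx j) + fc i * fc j * (fx i + fx j)) * fσ (Equiv.swap i j))

/-- The universal Sergeev-type algebra. -/
def Serg : Type := RingQuot (SergRel ι a)

instance : Ring (Serg ι a) := inferInstanceAs (Ring (RingQuot (SergRel ι a)))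
instance : Algebra ℂ (Serg ι a) := inferInstanceAs (Algebra ℂ (RingQuot (SergRel ι a)))

def Serg.mk : SergFree ι →ₐ[ℂ] Serg ι a := RingQuot.mkAlgHom ℂ (SergRel ι a)

lemma Serg.mk_rel {u v} (h : SergRel ι a u v) : Serg.mk ι a u = Serg.mk ι a v :=
  RingQuot.mkAlgHom_rel ℂ h

def Serg.can : SD ι a (Serg ι a) where
  σ := { toFun := fun w => Serg.mk ι a (fσ w)
         map_one' := by rw [Serg.mk_rel ι a .one, map_one]
         map_mul' := fun w v => by rw [Serg.mk_rel ι a (.mul w v), map_mul] }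
  c i := Serg.mk ι a (fc i)
  x i := Serg.mk ι a (fx i)
  c_sq i := by simpa using Serg.mk_rel ι a (.c_sq i)
  c_anti i j h := by simpa using Serg.mk_rel ι a (.c_anti i j h)
  σ_c w i := by simpa using Serg.mk_rel ι a (.σ_c w i)
  σ_x w i := by simpa using Serg.mk_rel ι a (.σ_x w i)
  x_sq i := by simpa using Serg.mk_rel ι a (.x_sq i)
  x_c i := by simpa using Serg.mk_rel ι a (.x_c i)
  x_c' i j h := by simpa using Serg.mk_rel ι a (.x_c' i j h)
  x_x i j h := by simpa using Serg.mk_rel ι a (.x_x i j h)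

variable {ι a}

def Serg.liftFree {B : Type} [Ring B] [Algebra ℂ B] (D : SD ι a B) : SergFree ι →ₐ[ℂ] B :=
  FreeAlgebra.lift ℂ (Sum.elim D.σ (Sum.elim D.c D.x))

def Serg.lift {B : Type} [Ring B] [Algebra ℂ B] (D : SD ι a B) : Serg ι a →ₐ[ℂ] B :=
  RingQuot.liftAlgHom ℂ ⟨Serg.liftFree D, by
    have h1 : ∀ w, Serg.liftFree D (fσ w) = D.σ w := fun w => by simp [Serg.liftFree, fσ]
    have h2 : ∀ w, Serg.liftFree D (fc w) = D.c w := fun w => by simp [Serg.liftFree, fc]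
    have h3 : ∀ w, Serg.liftFree D (fx w) = D.x w := fun w => by simp [Serg.liftFree, fx]
    intro u v h
    induction h with
    | one => simp [h1]
    | mul w v => simp [h1]
    | c_sq i => simpa [h1, h2, h3] using D.c_sq i
    | c_anti i j h => simpa [h1, h2, h3] using D.c_anti i j h
    | σ_c w i => simpa [h1, h2, h3] using D.σ_c w i
    | σ_x w i => simpa [h1, h2, h3] using D.σ_x w i
    | x_sq i => simpa [h1, h2, h3] using D.x_sq i
    | x_c i => simpa [h1, h2, h3] using D.x_c i
    | x_c' i j h => simpa [h1, h2, h3] using D.x_c' i j h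
    | x_x i j h => simpa [h1, h2, h3] using D.x_x i j h⟩

lemma Serg.lift_mk {B : Type} [Ring B] [Algebra ℂ B] (D : SD ι a B) (u) :
    Serg.lift D (Serg.mk ι a u) = Serg.liftFree D u :=
  RingQuot.liftAlgHom_mkAlgHom_apply ..

@[simp] lemma Serg.lift_σ {B : Type} [Ring B] [Algebra ℂ B] (D : SD ι a B) (w) :
    Serg.lift D ((Serg.can ι a).σ w) = D.σ w := by
  refine (Serg.lift_mk D _).trans ?_
  simp [Serg.liftFree, fσ]
@[simp] lemma Serg.lift_c {B : Type} [Ring B] [Algebra ℂ B] (D : SD ι a B) (w) :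
    Serg.lift D ((Serg.can ι a).c w) = D.c w := by
  refine (Serg.lift_mk D _).trans ?_
  simp [Serg.liftFree, fc]
@[simp] lemma Serg.lift_x {B : Type} [Ring B] [Algebra ℂ B] (D : SD ι a B) (w) :
    Serg.lift D ((Serg.can ι a).x w) = D.x w := by
  refine (Serg.lift_mk D _).trans ?_
  simp [Serg.liftFree, fx]

lemma Serg.top_of_gens (H : Subalgebra ℂ (Serg ι a)) (h1 : ∀ w, (Serg.can ι a).σ w ∈ H)
    (h2 : ∀ i, (Serg.can ι a).c i ∈ H) (h3 : ∀ i, (Serg.can ι a).x i ∈ H) (u : Serg ι a) :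
    u ∈ H := by
  obtain ⟨v, rfl⟩ : ∃ v, Serg.mk ι a v = u := RingQuot.mkAlgHom_surjective ℂ _ u
  induction v using FreeAlgebra.induction with
  | grade0 r => rw [AlgHom.commutes]; exact H.algebraMap_mem r
  | grade1 g =>
    rcases g with w | i | i
    · exact h1 w
    · exact h2 i
    · exact h3 i
  | mul u v hu hv => rw [map_mul]; exact H.mul_mem hu hv
  | add u v hu hv => rw [map_add]; exact H.add_mem hu hv

lemma Serg.hom_ext {B : Type} [Ring B] [Algebra ℂ B] {f g : Serg ι a →ₐ[ℂ] B}
    (h1 : ∀ w, f ((Serg.can ι a).σ w) = g ((Serg.can ι a).σ w))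
    (h2 : ∀ i, f ((Serg.can ι a).c i) = g ((Serg.can ι a).c i))
    (h3 : ∀ i, f ((Serg.can ι a).x i) = g ((Serg.can ι a).x i)) : f = g := by
  ext u
  exact Serg.top_of_gens (AlgHom.equalizer f g) h1 h2 h3 u

end Serg

/-- A submodule containing `v` closed under left multiplication by generators
contains `u * v` for all `u` in the generated subalgebra. -/
lemma adjoin_left_ind {A : Type} [Ring A] [Algebra ℂ A] {M : Type} [AddCommGroup M] [Module ℂ M]
    (ρ : A →ₐ[ℂ] Module.End ℂ M) (s : Set A)
    (N : Submodule ℂ M) (hs : ∀ g ∈ s, ∀ m ∈ N, ρ g m ∈ N) :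
    ∀ u ∈ Algebra.adjoin ℂ s, ∀ m ∈ N, ρ u m ∈ N := by
  intro u hu
  induction hu using Algebra.adjoin_induction with
  | mem x hx => exact hs x hx
  | algebraMap r => intro m hm; rw [AlgHom.commutes]; exact N.smul_mem r hm
  | add x y _ _ hx hy =>
    intro m hm
    rw [map_add, LinearMap.add_apply]
    exact N.add_mem (hx m hm) (hy m hm)
  | mul x y _ _ hx hy =>
    intro m hm
    rw [map_mul, Module.End.mul_apply]
    exact hx _ (hy m hm)
end

section
set_option linter.unusedSectionVars false
set_option linter.unusedSimpArgs false
set_option linter.unusedVariables false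
namespace Tr
open SDM
variable {ι : Type} [DecidableEq ι] {a : ℂ} (o : ι)

lemma σσ (w v : Equiv.Perm ι) : (Serg.can ι a).σ w * (Serg.can ι a).σ v = (Serg.can ι a).σ (w * v) :=
  (map_mul _ _ _).symm

def Spgens : Set (Serg ι a) :=
  {u | (∃ w : Equiv.Perm ι, w o = o ∧ u = (Serg.can ι a).σ w) ∨ (∃ l, l ≠ o ∧ u = (Serg.can ι a).c l)
    ∨ (∃ l, l ≠ o ∧ u = (Serg.can ι a).x l)}

def Sp : Subalgebra ℂ (Serg ι a) := Algebra.adjoin ℂ (Spgens o)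

variable {o} in
lemma Sp_σ {w : Equiv.Perm ι} (h : w o = o) : (Serg.can ι a).σ w ∈ Sp (a := a) o :=
  Algebra.subset_adjoin (Or.inl ⟨w, h, rfl⟩)
variable {o} in
lemma Sp_c {l : ι} (h : l ≠ o) : (Serg.can ι a).c l ∈ Sp (a := a) o :=
  Algebra.subset_adjoin (Or.inr (Or.inl ⟨l, h, rfl⟩))
variable {o} in
lemma Sp_x {l : ι} (h : l ≠ o) : (Serg.can ι a).x l ∈ Sp (a := a) o :=
  Algebra.subset_adjoin (Or.inr (Or.inr ⟨l, h, rfl⟩))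

def mon (i : ι) (α β : Bool) : Serg ι a :=
  (if α then (Serg.can ι a).x i else 1) * (if β then (Serg.can ι a).c i else 1)

abbrev MM (ι : Type) [DecidableEq ι] (a : ℂ) : Type := Mod ι (Serg ι a)

def ρ : Serg ι a →ₐ[ℂ] Module.End ℂ (MM ι a) := Serg.lift (indSD (Serg.can ι a) o)

@[simp] lemma ρ_σ (w : Equiv.Perm ι) : ρ (a := a) o ((Serg.can ι a).σ w) = Sop (Serg.can ι a) o w := by
  simp [ρ, indSD]
@[simp] lemma ρ_c (l : ι) : ρ (a := a) o ((Serg.can ι a).c l) = Cop (Serg.can ι a) o l := by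
  simp [ρ, indSD]
@[simp] lemma ρ_x (l : ι) : ρ (a := a) o ((Serg.can ι a).x l) = Xop (Serg.can ι a) o l := by
  simp [ρ, indSD]

/-- right multiplication -/
def Rt (y : Serg ι a) : Module.End ℂ (MM ι a) :=
  SDM.lift fun i α β => br i α β ∘ₗ LinearMap.mulRight ℂ y

@[simp] lemma Rt_br (y z : Serg ι a) (i α β) : Rt y (br i α β z) = br (i : ι) α β (z * y) := by
  simp [Rt]

lemma Rt_Sop (y : Serg ι a) (w) (v : MM ι a) :
    Sop (Serg.can ι a) o w (Rt y v) = Rt y (Sop (Serg.can ι a) o w v) := by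
  refine congrArg (fun f => f v) (?_ : Sop (Serg.can ι a) o w ∘ₗ Rt y = Rt y ∘ₗ Sop (Serg.can ι a) o w)
  apply end_ext
  intro i α β z
  simp [Sop_br, mul_assoc]

lemma Rt_Cop (y : Serg ι a) (l) (v : MM ι a) :
    Cop (Serg.can ι a) o l (Rt y v) = Rt y (Cop (Serg.can ι a) o l v) := by
  refine congrArg (fun f => f v) (?_ : Cop (Serg.can ι a) o l ∘ₗ Rt y = Rt y ∘ₗ Cop (Serg.can ι a) o l)
  apply end_ext
  intro i α β z
  by_cases h : l = i
  · subst h; simp [Cop_eq]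
  · simp [Cop_ne _ _ h, mul_assoc]

lemma Rt_N0 (y : Serg ι a) {i} {v : MM ι a} (hv : v ∈ N0 (B := Serg ι a) i) : Rt y v ∈ N0 (B := Serg ι a) i := by
  have : N0 (B := Serg ι a) i ≤ (N0 i).comap (Rt y) := by
    apply iSup_le
    rintro β _ ⟨y, rfl⟩
    simp only [Submodule.mem_comap, Rt_br]
    exact br_mem_N0 _ _ _
  exact this hv

lemma Rt_Xop0 (y : Serg ι a) (l) {i} (v : MM ι a) (hv : v ∈ N0 (B := Serg ι a) i) :
    Xop (Serg.can ι a) o l (Rt y v) = Rt y (Xop (Serg.can ι a) o l v) := by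
  refine N0_ind (f := Xop (Serg.can ι a) o l ∘ₗ Rt y) (g := Rt y ∘ₗ Xop (Serg.can ι a) o l) ?_ hv
  intro β z
  by_cases h : l = i
  · subst h; simp [Xop_eq0]
  · simp [Xop_ne0 _ _ h, mul_assoc]

lemma Rt_Xop (y : Serg ι a) (l) (v : MM ι a) :
    Xop (Serg.can ι a) o l (Rt y v) = Rt y (Xop (Serg.can ι a) o l v) := by
  refine op_ext (Serg.can ι a) o (f := Xop (Serg.can ι a) o l * Rt y) (g := Rt y * Xop (Serg.can ι a) o l) ?_ ?_ v
  · intro i v hv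
    exact Rt_Xop0 o y l v hv
  · intro i v hv
    simp only [Module.End.mul_apply]
    rw [← Rt_Xop0 o y i v hv]
    by_cases h : l = i
    · subst h
      rw [Xsq, Xsq, map_smul]
    · have h1 := N0_Sop (Serg.can ι a) o (Equiv.swap l i) hv
      rw [N0_XX _ o h (Rt_N0 y hv), N0_XX _ o h hv, map_add, Rt_Xop0 o y l v hv,
        Rt_Xop0 o y i _ (N0_Xop _ o h hv)]
      simp only [Rop_apply, Rt_Sop, Rt_Xop0 o y _ _ h1, Rt_Cop, ← map_add, ← map_sub]

lemma Rt_ρ (y u : Serg ι a) (v : MM ι a) : ρ o u (Rt y v) = Rt y (ρ o u v) := by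
  suffices h : ∀ u, u ∈ Subalgebra.comap (ρ (a := a) o) (Subalgebra.centralizer ℂ {Rt y}) by
    have := h u
    rw [Subalgebra.mem_comap, Subalgebra.mem_centralizer_iff] at this
    exact congrArg (fun f => f v) (this _ rfl).symm
  apply Serg.top_of_gens
  · intro w
    simp only [Subalgebra.mem_comap, Subalgebra.mem_centralizer_iff, Set.mem_singleton_iff,
      forall_eq, ρ_σ]
    exact LinearMap.ext fun v => (Rt_Sop o y w v).symm
  · intro w
    simp only [Subalgebra.mem_comap, Subalgebra.mem_centralizer_iff, Set.mem_singleton_iff,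
      forall_eq, ρ_c]
    exact LinearMap.ext fun v => (Rt_Cop o y w v).symm
  · intro w
    simp only [Subalgebra.mem_comap, Subalgebra.mem_centralizer_iff, Set.mem_singleton_iff,
      forall_eq, ρ_x]
    exact LinearMap.ext fun v => (Rt_Xop o y w v).symm

def π : Serg ι a →ₗ[ℂ] MM ι a :=
  (LinearMap.applyₗ (br o false false (1 : Serg ι a))) ∘ₗ (ρ (a := a) o).toLinearMap

lemma π_apply (u : Serg ι a) : π o u = ρ o u (br o false false 1) := rfl

lemma π_Sp {y : Serg ι a} (hy : y ∈ Sp o) : π o y = br o false false y := by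
  suffices h : ∀ z, ρ o y (br o false false z) = br o false false (y * z) by
    rw [π_apply, h, mul_one]
  induction hy using Algebra.adjoin_induction with
  | mem y hy =>
    intro z
    rcases hy with ⟨w, hw, rfl⟩ | ⟨l, hl, rfl⟩ | ⟨l, hl, rfl⟩
    · rw [ρ_σ, Sop_br, hw]; simp [← Equiv.Perm.one_def]
    · rw [ρ_c, Co_ne _ _ hl]; simp [sg]
    · rw [ρ_x, Xo_ne _ _ hl]
  | algebraMap r => intro z; rw [AlgHom.commutes, ← Algebra.smul_def, map_smul]; rfl
  | add x y _ _ hx hy => intro z; simp [map_add, hx, hy, add_mul]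
  | mul x y _ _ hx hy => intro z; simp [map_mul, hx, hy, mul_assoc]

lemma π_mul (u : Serg ι a) {y : Serg ι a} (hy : y ∈ Sp o) : π o (u * y) = Rt y (π o u) := by
  have : π o (u * y) = ρ o u (π o y) := by simp [π_apply]
  rw [this, π_Sp o hy, π_apply, ← Rt_ρ, Rt_br, one_mul]

lemma π_left (u v : Serg ι a) : π o (u * v) = ρ o u (π o v) := by simp [π_apply]

/-- reconstruction map -/
def κ : MM ι a →ₗ[ℂ] Serg ι a :=
  Finsupp.lsum ℂ fun p => LinearMap.mulLeft ℂ (mon p.1 p.2.1 p.2.2 * (Serg.can ι a).σ (Equiv.swap p.1 o))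

lemma κ_br (i α β) (y : Serg ι a) : κ o (br i α β y) = mon i α β * (Serg.can ι a).σ (Equiv.swap i o) * y := by
  simp [κ, br, mul_assoc]

lemma κ_Sop (w) (v : MM ι a) : κ o (Sop (Serg.can ι a) o w v) = (Serg.can ι a).σ w * κ o v := by
  refine congrArg (fun f => f v) (?_ : κ o ∘ₗ Sop (Serg.can ι a) o w
    = LinearMap.mulLeft ℂ ((Serg.can ι a).σ w) ∘ₗ κ o)
  apply end_ext
  intro i α β y
  have e : (Serg.can ι a).σ w * mon i α β = mon (w i) α β * (Serg.can ι a).σ w := by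
    cases α <;> cases β <;> simp [mon, ← mul_assoc, (Serg.can ι a).σ_c, (Serg.can ι a).σ_x]
    simp [mul_assoc, (Serg.can ι a).σ_c]
  simp only [LinearMap.comp_apply, Sop_br, κ_br, LinearMap.mulLeft_apply, ← mul_assoc, e]
  simp only [mul_assoc]
  simp only [← mul_assoc ((Serg.can ι a).σ _) ((Serg.can ι a).σ _), ← map_mul]
  simp [← mul_assoc]

lemma κ_Cop (l) (v : MM ι a) : κ o (Cop (Serg.can ι a) o l v) = (Serg.can ι a).c l * κ o v := by
  refine congrArg (fun f => f v) (?_ : κ o ∘ₗ Cop (Serg.can ι a) o l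
    = LinearMap.mulLeft ℂ ((Serg.can ι a).c l) ∘ₗ κ o)
  apply end_ext
  intro i α β y
  by_cases h : l = i
  · subst h
    cases α <;> cases β <;> simp [Cop_eq, κ_br, mon, sg, ← mul_assoc, (Serg.can ι a).c_sq, (Serg.can ι a).x_c]
  · simp only [LinearMap.comp_apply, Cop_ne _ _ h, κ_br, LinearMap.mulLeft_apply, map_smul]
    have e : (Serg.can ι a).σ (Equiv.swap i o) * (Serg.can ι a).c (Equiv.swap i o l)
       = (Serg.can ι a).c l * (Serg.can ι a).σ (Equiv.swap i o) := by
      rw [(Serg.can ι a).σ_c]; simp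
    have e2 : mon i α β * (Serg.can ι a).c l = sg β • ((Serg.can ι a).c l * mon i α β) := by
      have e3 := (Serg.can ι a).x_c' i l (Ne.symm h)
      have e4 := (Serg.can ι a).c_anti i l (Ne.symm h)
      cases α <;> cases β <;> simp [mon, sg, ← mul_assoc, e3, e4]
      simp [mul_assoc, e4]
      simp [← mul_assoc, e3]
    rw [← mul_assoc (_ * _) _ y, mul_assoc (mon i α β), e, ← mul_assoc, e2]
    simp only [smul_mul_assoc, smul_smul, mul_assoc]
    cases β <;> simp [sg]

lemma κ_Xop0 (l) {i} {v : MM ι a} (hv : v ∈ N0 (B := Serg ι a) i) :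
    κ o (Xop (Serg.can ι a) o l v) = (Serg.can ι a).x l * κ o v := by
  refine N0_ind (f := κ o ∘ₗ Xop (Serg.can ι a) o l)
    (g := LinearMap.mulLeft ℂ ((Serg.can ι a).x l) ∘ₗ κ o) ?_ hv
  intro β y
  by_cases h : l = i
  · subst h
    simp [Xop_eq0, κ_br, mon, ← mul_assoc]
  · simp only [LinearMap.comp_apply, Xop_ne0 _ _ h, κ_br, LinearMap.mulLeft_apply, map_smul]
    have e : (Serg.can ι a).σ (Equiv.swap i o) * (Serg.can ι a).x (Equiv.swap i o l)
       = (Serg.can ι a).x l * (Serg.can ι a).σ (Equiv.swap i o) := by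
      rw [(Serg.can ι a).σ_x]; simp
    rw [← mul_assoc (_ * _) _ y, mul_assoc (mon i _ β), e]
    cases β <;> simp [mon, ← mul_assoc, (Serg.can ι a).x_c' _ _ h]

lemma κ_Xop (l) (v : MM ι a) :
    κ o (Xop (Serg.can ι a) o l v) = (Serg.can ι a).x l * κ o v := by
  suffices h : ∀ i, ∀ v ∈ N0 (B := Serg ι a) i,
      κ o (Xop (Serg.can ι a) o l (Xop (Serg.can ι a) o i v)) = (Serg.can ι a).x l * κ o (Xop (Serg.can ι a) o i v) by
    refine congrArg (fun f => f v) (?_ : κ o ∘ₗ Xop (Serg.can ι a) o l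
      = LinearMap.mulLeft ℂ ((Serg.can ι a).x l) ∘ₗ κ o)
    apply end_ext
    intro i α β y
    cases α
    · exact κ_Xop0 o l (br_mem_N0 _ _ _)
    · have := h i _ (br_mem_N0 i β y)
      rwa [Xop_eq0] at this
  intro i v hv
  rw [κ_Xop0 o i hv]
  by_cases h : l = i
  · subst h
    rw [Xsq, ← mul_assoc, (Serg.can ι a).x_sq, map_smul, Algebra.smul_def]
  · have h1 := N0_Sop (Serg.can ι a) o (Equiv.swap l i) hv
    rw [N0_XX _ o h hv, map_add, κ_Xop0 o i (N0_Xop _ o h hv), κ_Xop0 o l hv, ← mul_assoc,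
      ← mul_assoc, (Serg.can ι a).x_x _ _ h]
    simp only [Rop_apply, map_add, map_sub, κ_Cop, κ_Xop0 o _ h1, κ_Sop]
    noncomm_ring

lemma κ_ρ (u : Serg ι a) (v : MM ι a) : κ o (ρ o u v) = u * κ o v := by
  revert v
  let H : Subalgebra ℂ (Serg ι a) :=
    { carrier := {u | ∀ v : MM ι a, κ o (ρ o u v) = u * κ o v}
      mul_mem' := by
        intro u u' h h' v
        simp only [Set.mem_ofPred_eq] at h h'
        rw [map_mul, Module.End.mul_apply, h, h', mul_assoc]
      add_mem' := by
        intro u u' h h' v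
        simp only [Set.mem_ofPred_eq] at h h'
        rw [map_add, LinearMap.add_apply, map_add, h, h', add_mul]
      algebraMap_mem' := by
        intro r v
        simp [AlgHom.commutes, Algebra.smul_def] }
  refine Serg.top_of_gens H ?_ ?_ ?_ u
  · intro w v; rw [ρ_σ]; exact κ_Sop o w v
  · intro w v; rw [ρ_c]; exact κ_Cop o w v
  · intro w v; rw [ρ_x]; exact κ_Xop o w v

lemma κ_π (u : Serg ι a) : κ o (π o u) = u := by
  rw [π_apply, κ_ρ, κ_br]; simp [mon, ← Equiv.Perm.one_def]

end Tr
end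

section
set_option linter.unusedSectionVars false
set_option linter.unusedSimpArgs false
set_option linter.unusedVariables false
namespace Tr
open SDM
variable {ι : Type} [DecidableEq ι] {a : ℂ} (ω : ℂ) (o : ι)

/-- the partial trace on the induced module -/
def τ₀ : MM ι a →ₗ[ℂ] Serg ι a :=
  Finsupp.lsum ℂ fun p => if p.1 = o then (if p.2.1 && !p.2.2 then ω • LinearMap.id else 0)
    else LinearMap.mulLeft ℂ (mon p.1 p.2.1 p.2.2)

lemma τ₀_ne {i : ι} (h : i ≠ o) (α β) (y : Serg ι a) : τ₀ ω o (br i α β y) = mon i α β * y := by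
  simp [τ₀, br, h]
lemma τ₀_o (α β) (y : Serg ι a) :
    τ₀ ω o (br o α β y) = if α && !β then ω • y else 0 := by
  cases α <;> cases β <;> simp [τ₀, br]

lemma τ₀_Rt (y : Serg ι a) (v : MM ι a) : τ₀ ω o (Rt y v) = τ₀ ω o v * y := by
  refine congrArg (fun f => f v) (?_ : τ₀ ω o ∘ₗ Rt y = LinearMap.mulRight ℂ y ∘ₗ τ₀ ω o)
  apply end_ext
  intro i α β z
  by_cases h : i = o
  · subst h; cases α <;> cases β <;> simp [τ₀_o]
  · simp [τ₀_ne _ _ h, mul_assoc]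

lemma σ_mon (w : Equiv.Perm ι) (i α β) : (Serg.can ι a).σ w * mon i α β = mon (w i) α β * (Serg.can ι a).σ w := by
  cases α <;> cases β <;> simp [mon, ← mul_assoc, (Serg.can ι a).σ_c, (Serg.can ι a).σ_x]
  simp [mul_assoc, (Serg.can ι a).σ_c]

lemma τ₀_Sop {w : Equiv.Perm ι} (hw : w o = o) (v : MM ι a) :
    τ₀ ω o (Sop (Serg.can ι a) o w v) = (Serg.can ι a).σ w * τ₀ ω o v := by
  refine congrArg (fun f => f v) (?_ : τ₀ ω o ∘ₗ Sop (Serg.can ι a) o w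
    = LinearMap.mulLeft ℂ ((Serg.can ι a).σ w) ∘ₗ τ₀ ω o)
  apply end_ext
  intro i α β z
  have e : Equiv.swap (w i) o * w * Equiv.swap i o = w := by
    conv_lhs => rw [← hw, Equiv.swap_apply_apply, hw]
    simp [mul_assoc]
  simp only [LinearMap.comp_apply, Sop_br, e, LinearMap.mulLeft_apply]
  by_cases h : i = o
  · subst h; rw [hw]; cases α <;> cases β <;> simp [τ₀_o]
  · have h' : w i ≠ o := fun e => h (w.injective (e.trans hw.symm))
    rw [τ₀_ne _ _ h, τ₀_ne _ _ h', ← mul_assoc, ← mul_assoc, σ_mon]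

lemma c_mon {l i : ι} (h : l ≠ i) (α β) :
    mon i α β * (Serg.can ι a).c l = sg β • ((Serg.can ι a).c l * mon i α β) := by
  have e3 := (Serg.can ι a).x_c' i l (Ne.symm h)
  have e4 := (Serg.can ι a).c_anti i l (Ne.symm h)
  cases α <;> cases β <;> simp [mon, sg, ← mul_assoc, e3, e4]
  simp [mul_assoc, e4]
  simp [← mul_assoc, e3]

lemma sg_sq (β) : sg β * sg β = 1 := by cases β <;> simp [sg]

lemma τ₀_Cop {l : ι} (hl : l ≠ o) (v : MM ι a) :
    τ₀ ω o (Cop (Serg.can ι a) o l v) = (Serg.can ι a).c l * τ₀ ω o v := by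
  refine congrArg (fun f => f v) (?_ : τ₀ ω o ∘ₗ Cop (Serg.can ι a) o l
    = LinearMap.mulLeft ℂ ((Serg.can ι a).c l) ∘ₗ τ₀ ω o)
  apply end_ext
  intro i α β y
  by_cases h : l = i
  · subst h
    cases α <;> cases β <;> simp [Cop_eq, τ₀_ne _ _ hl, mon, sg, ← mul_assoc, (Serg.can ι a).c_sq, (Serg.can ι a).x_c]
  · simp only [LinearMap.comp_apply, Cop_ne _ _ h, LinearMap.mulLeft_apply, map_smul]
    rw [Equiv.swap_apply_of_ne_of_ne h hl]
    by_cases hi : i = o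
    · subst hi; cases α <;> cases β <;> simp [τ₀_o, sg]
    · rw [τ₀_ne _ _ hi, τ₀_ne _ _ hi, ← mul_assoc, ← mul_assoc, c_mon h, smul_mul_assoc, smul_smul,
        sg_sq, one_smul]

lemma τ₀_Xop0 (l) {i} (hi : i ≠ o) {v : MM ι a} (hv : v ∈ N0 (B := Serg ι a) i) (h : l ≠ o ∨ l = i):
    τ₀ ω o (Xop (Serg.can ι a) o l v) = (Serg.can ι a).x l * τ₀ ω o v := by
  refine N0_ind (f := τ₀ ω o ∘ₗ Xop (Serg.can ι a) o l)
    (g := LinearMap.mulLeft ℂ ((Serg.can ι a).x l) ∘ₗ τ₀ ω o) ?_ hv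
  intro β y
  by_cases h : l = i
  · subst h
    simp [Xop_eq0, τ₀_ne _ _ hi, mon, ← mul_assoc]
  · have hl : l ≠ o := by tauto
    simp only [LinearMap.comp_apply, Xop_ne0 _ _ h, LinearMap.mulLeft_apply, τ₀_ne _ _ hi,
      Equiv.swap_apply_of_ne_of_ne h hl]
    cases β <;> simp [mon, ← mul_assoc, (Serg.can ι a).x_c' _ _ h]

lemma τ₀_Xop {l : ι} (hl : l ≠ o) (v : MM ι a) :
    τ₀ ω o (Xop (Serg.can ι a) o l v) = (Serg.can ι a).x l * τ₀ ω o v := by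
  suffices h : ∀ i ≠ o, ∀ v ∈ N0 (B := Serg ι a) i,
      τ₀ ω o (Xop (Serg.can ι a) o l (Xop (Serg.can ι a) o i v)) = (Serg.can ι a).x l * τ₀ ω o (Xop (Serg.can ι a) o i v) by
    refine congrArg (fun f => f v) (?_ : τ₀ ω o ∘ₗ Xop (Serg.can ι a) o l
      = LinearMap.mulLeft ℂ ((Serg.can ι a).x l) ∘ₗ τ₀ ω o)
    apply end_ext
    intro i α β y
    simp only [LinearMap.comp_apply, LinearMap.mulLeft_apply]
    by_cases hi : i = o
    · subst hi
      cases α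
      · rw [Xop_ne0 _ _ hl, τ₀_o, τ₀_o]; simp
      · rw [Xop_ne1 _ _ hl, Xop_ne0 _ _ hl, Sop_br]
        simp only [Equiv.swap_apply_right, Xop_eq0, Xop_ne0 _ _ hl.symm, map_add, map_sub,
          τ₀_o, τ₀_ne _ _ hl, Equiv.swap_apply_right, Equiv.swap_self, Equiv.swap_apply_of_ne_of_ne,
          Cop_ne _ _ hl.symm, Cop_eq, map_smul]
        have e : (Equiv.swap l i * Equiv.swap l i * Equiv.refl ι) = 1 := by
          rw [Equiv.swap_mul_self]; rfl
        rw [e]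
        cases β
        · simp [mon, sg, ← mul_assoc, mul_assoc _ _ ((Serg.can ι a).c l), (Serg.can ι a).c_sq]
        · simp [mon, sg, ← mul_assoc, mul_assoc _ _ ((Serg.can ι a).c l), (Serg.can ι a).c_sq, (Serg.can ι a).x_c]
    · cases α
      · exact τ₀_Xop0 ω o l hi (br_mem_N0 _ _ _) (Or.inl hl)
      · have := h i hi _ (br_mem_N0 i β y)
        rwa [Xop_eq0] at this
  intro i hi v hv
  rw [τ₀_Xop0 ω o i hi hv (Or.inr rfl)]
  by_cases h : l = i
  · subst h
    rw [Xsq, ← mul_assoc, (Serg.can ι a).x_sq, map_smul, Algebra.smul_def]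
  · have h1 := N0_Sop (Serg.can ι a) o (Equiv.swap l i) hv
    rw [Equiv.swap_apply_right] at h1
    rw [N0_XX _ o h hv, map_add, τ₀_Xop0 ω o i hi (N0_Xop _ o h hv) (Or.inr rfl),
      τ₀_Xop0 ω o l hi hv (Or.inl hl), ← mul_assoc,
      ← mul_assoc, (Serg.can ι a).x_x _ _ h]
    simp only [Rop_apply, map_add, map_sub, τ₀_Cop _ _ hl, τ₀_Cop _ _ hi,
      τ₀_Xop0 ω o l hl h1 (Or.inr rfl), τ₀_Xop0 ω o i hl h1 (Or.inl hi)]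
    rw [τ₀_Sop _ _ (Equiv.swap_apply_of_ne_of_ne hl.symm (Ne.symm hi))]
    noncomm_ring

lemma τ₀_ρ {y : Serg ι a} (hy : y ∈ Sp o) : ∀ v : MM ι a, τ₀ ω o (ρ o y v) = y * τ₀ ω o v := by
  induction hy using Algebra.adjoin_induction with
  | mem y hy =>
    intro z
    rcases hy with ⟨w, hw, rfl⟩ | ⟨l, hl, rfl⟩ | ⟨l, hl, rfl⟩
    · rw [ρ_σ, τ₀_Sop _ _ hw]
    · rw [ρ_c, τ₀_Cop _ _ hl]
    · rw [ρ_x, τ₀_Xop _ _ hl]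
  | algebraMap r => intro z; rw [AlgHom.commutes, ← Algebra.smul_def, ← map_smul]; rfl
  | add x y _ _ hx hy => intro z; simp [map_add, hx, hy, add_mul]
  | mul x y _ _ hx hy => intro z; simp [map_mul, hx, hy, mul_assoc]

def τ : Serg ι a →ₗ[ℂ] Serg ι a := τ₀ ω o ∘ₗ π o

lemma τ_left {y : Serg ι a} (hy : y ∈ Sp o) (u : Serg ι a) : τ ω o (y * u) = y * τ ω o u := by
  simp only [τ, LinearMap.comp_apply, π_left, τ₀_ρ ω o hy]
lemma τ_right {y : Serg ι a} (hy : y ∈ Sp o) (u : Serg ι a) : τ ω o (u * y) = τ ω o u * y := by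
  simp only [τ, LinearMap.comp_apply, π_mul o u hy, τ₀_Rt]

lemma π_mono (α β) : π o (mon o α β : Serg ι a) = br o α β 1 := by
  cases α <;> cases β <;> simp [mon, π_apply, Xop_eq0, Cop_eq, sg]
lemma τ_mono (α β) : τ ω o (mon o α β : Serg ι a) = if α && !β then algebraMap ℂ _ ω else 0 := by
  simp only [τ, LinearMap.comp_apply, π_mono, τ₀_o, Algebra.algebraMap_eq_smul_one]
lemma τ_one : τ ω o (1 : Serg ι a) = 0 := by simpa [mon] using τ_mono (a := a) ω o false false
lemma τ_c : τ ω o ((Serg.can ι a).c o) = 0 := by simpa [mon] using τ_mono (a := a) ω o false true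
lemma τ_x : τ ω o ((Serg.can ι a).x o) = algebraMap ℂ _ ω := by
  simpa [mon] using τ_mono (a := a) ω o true false
lemma τ_xc : τ ω o ((Serg.can ι a).x o * (Serg.can ι a).c o) = 0 := by
  simpa [mon] using τ_mono (a := a) ω o true true
lemma τ_s {i : ι} (h : i ≠ o) : τ ω o ((Serg.can ι a).σ (Equiv.swap i o)) = 1 := by
  simp [τ, π_apply, Sop_br, ← Equiv.Perm.one_def, τ₀_ne _ _ h, mon]

lemma τ_Sp {y : Serg ι a} (hy : y ∈ Sp o) : τ ω o y = 0 := by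
  have := τ_left ω o hy 1
  rwa [τ_one, mul_one, mul_zero] at this

/-- submodule of vectors with components in `Sp` -/
def MS : Submodule ℂ (MM ι a) := Submodule.span ℂ {v | ∃ i α β, ∃ y ∈ Sp o, v = br i α β y}

lemma br_MS (i α β) {y : Serg ι a} (hy : y ∈ Sp o) : br i α β y ∈ MS o :=
  Submodule.subset_span ⟨i, α, β, y, hy, rfl⟩

lemma MS_map {f : Module.End ℂ (MM ι a)} (h : ∀ i α β, ∀ y ∈ Sp o, f (br i α β y) ∈ MS o)
    {v : MM ι a} (hv : v ∈ MS o) : f v ∈ MS o := by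
  have : MS o ≤ (MS o).comap f := by
    apply Submodule.span_le.2
    rintro _ ⟨i, α, β, y, hy, rfl⟩
    exact h i α β y hy
  exact this hv

lemma MS_Sop (w) {v : MM ι a} (hv : v ∈ MS o) : Sop (Serg.can ι a) o w v ∈ MS o := by
  refine MS_map o ?_ hv
  intro i α β y hy
  rw [Sop_br]
  refine br_MS o _ _ _ (mul_mem (Sp_σ ?_) hy)
  simp

lemma swap_ne {i l o : ι} (h : l ≠ i) : Equiv.swap i o l ≠ o := by
  intro e
  exact h ((Equiv.swap i o).injective (e.trans (Equiv.swap_apply_left i o).symm))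

lemma MS_Cop (l) {v : MM ι a} (hv : v ∈ MS o) : Cop (Serg.can ι a) o l v ∈ MS o := by
  refine MS_map o ?_ hv
  intro i α β y hy
  by_cases h : l = i
  · subst h; rw [Cop_eq]; exact Submodule.smul_mem _ _ (br_MS o _ _ _ hy)
  · rw [Cop_ne _ _ h]
    exact Submodule.smul_mem _ _ (br_MS o _ _ _ (mul_mem (Sp_c (swap_ne h)) hy))

lemma MS_Xop (l) {v : MM ι a} (hv : v ∈ MS o) : Xop (Serg.can ι a) o l v ∈ MS o := by
  refine MS_map o ?_ hv
  intro i α β y hy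
  by_cases h : l = i
  · subst h
    cases α
    · rw [Xop_eq0]; exact (br_MS o _ _ _ hy)
    · rw [Xop_eq1]; exact Submodule.smul_mem _ _ (br_MS o _ _ _ hy)
  · have h1 := mul_mem (Sp_x (a := a) (swap_ne (o := o) h)) hy
    cases α
    · rw [Xop_ne0 _ _ h]; exact br_MS o _ _ _ h1
    · rw [Xop_ne1 _ _ h, Xop_ne0 _ _ h, Xop_eq0, Sop_br, Equiv.swap_apply_right, Xop_eq0,
        Xop_ne0 _ _ (Ne.symm h)]
      have h2 : (Serg.can ι a).σ (Equiv.swap l o * Equiv.swap l i * Equiv.swap i o) ∈ Sp o := Sp_σ (by simp)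
      have h3 := br_MS o l true β (mul_mem h2 hy)
      have h4 := br_MS o l false β (mul_mem (Sp_x (a := a) (swap_ne (o := o) (Ne.symm h))) (mul_mem h2 hy))
      exact add_mem (add_mem (br_MS o _ _ _ h1) (sub_mem h3 h4))
        (MS_Cop o _ (MS_Cop o _ (add_mem h3 h4)))

lemma MS_π (u : Serg ι a) : π o u ∈ MS o := by
  rw [π_apply]
  have h0 : br o false false (1 : Serg ι a) ∈ MS o := br_MS o _ _ _ (one_mem _)
  revert h0
  generalize br o false false (1 : Serg ι a) = v
  revert v
  let H : Subalgebra ℂ (Serg ι a) :=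
    { carrier := {u | ∀ v : MM ι a, v ∈ MS o → ρ o u v ∈ MS o}
      mul_mem' := by
        intro u u' h h' v hv
        rw [map_mul]; exact h _ (h' _ hv)
      add_mem' := by
        intro u u' h h' v hv
        rw [map_add]; exact add_mem (h _ hv) (h' _ hv)
      algebraMap_mem' := by
        intro r v hv
        rw [AlgHom.commutes]; exact Submodule.smul_mem _ _ hv }
  refine Serg.top_of_gens H ?_ ?_ ?_ u
  · intro w v; rw [ρ_σ]; exact MS_Sop o w
  · intro w v; rw [ρ_c]; exact MS_Cop o w
  · intro w v; rw [ρ_x]; exact MS_Xop o w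

lemma mon_Sp {i : ι} (h : i ≠ o) (α β) : (mon i α β : Serg ι a) ∈ Sp o := by
  unfold mon
  apply mul_mem <;> split_ifs
  · exact Sp_x h
  · exact one_mem _
  · exact Sp_c h
  · exact one_mem _

lemma Serg_le (N : Submodule ℂ (Serg ι a)) (h1 : ∀ α β, ∀ y ∈ Sp o, mon o α β * y ∈ N)
    (h2 : ∀ i ≠ o, ∀ y ∈ Sp o, ∀ y' ∈ Sp o, y * (Serg.can ι a).σ (Equiv.swap i o) * y' ∈ N) (u) : u ∈ N := by
  have : MS o ≤ N.comap (κ o) := by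
    apply Submodule.span_le.2
    rintro _ ⟨i, α, β, y, hy, rfl⟩
    simp only [Submodule.comap_coe, Set.mem_preimage, SetLike.mem_coe, κ_br]
    by_cases hi : i = o
    · subst hi
      have e : (Serg.can ι a).σ (Equiv.swap i i) = 1 := by rw [Equiv.swap_self]; exact map_one _
      rw [e, mul_one]
      exact h1 _ _ _ hy
    · exact h2 _ hi _ (mon_Sp o hi _ _) _ hy
  have := this (MS_π o u)
  rwa [Submodule.mem_comap, κ_π] at this

lemma Serg_ext {N : Type} [AddCommGroup N] [Module ℂ N] {f g : Serg ι a →ₗ[ℂ] N}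
    (h1 : ∀ α β, ∀ y ∈ Sp o, f (mon o α β * y) = g (mon o α β * y))
    (h2 : ∀ i ≠ o, ∀ y ∈ Sp o, ∀ y' ∈ Sp o, f (y * (Serg.can ι a).σ (Equiv.swap i o) * y')
      = g (y * (Serg.can ι a).σ (Equiv.swap i o) * y')) (u) : f u = g u :=
  Serg_le o (LinearMap.eqLocus f g) h1 h2 u

end Tr
end

section
set_option linter.unusedSectionVars false
set_option linter.unusedSimpArgs false
set_option linter.unusedVariables false
namespace Tr
open SDM
variable {ι : Type} [DecidableEq ι] {a : ℂ} (ω : ℂ) (o : ι)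
local notation "𝐬" => DFunLike.coe (SD.σ (Serg.can _ _))
local notation "𝐜" => SD.c (Serg.can _ _)
local notation "𝐱" => SD.x (Serg.can _ _)

lemma τ_ne {i : ι} (h : i ≠ o) {y y' : Serg ι a} (hy : y ∈ Sp o) (hy' : y' ∈ Sp o) :
    τ ω o (y * 𝐬 (Equiv.swap i o) * y') = y * y' := by
  rw [τ_right _ _ hy', τ_left _ _ hy, τ_s _ _ h, mul_one]

lemma τ_ne1 {i : ι} (h : i ≠ o) {y : Serg ι a} (hy : y ∈ Sp o) :
    τ ω o (y * 𝐬 (Equiv.swap i o)) = y := by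
  rw [τ_left _ _ hy, τ_s _ _ h, mul_one]
lemma τ_ne2 {i : ι} (h : i ≠ o) {y : Serg ι a} (hy : y ∈ Sp o) :
    τ ω o (𝐬 (Equiv.swap i o) * y) = y := by
  rw [τ_right _ _ hy, τ_s _ _ h, one_mul]

lemma τ_mem (u : Serg ι a) : τ ω o u ∈ Sp o := by
  refine Serg_le o ((Subalgebra.toSubmodule (Sp o)).comap (τ ω o)) ?_ ?_ u
  · intro α β y hy
    simp only [Submodule.mem_comap, Subalgebra.mem_toSubmodule, τ_right _ _ hy, τ_mono]
    refine mul_mem ?_ hy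
    split_ifs
    · exact Subalgebra.algebraMap_mem _ _
    · exact zero_mem _
  · intro i hi y hy y' hy'
    simp only [Submodule.mem_comap, Subalgebra.mem_toSubmodule, τ_ne _ _ hi hy hy']
    exact mul_mem hy hy'

lemma s_inv (w : Equiv.Perm ι) : (𝐬 w * 𝐬 w⁻¹ : Serg ι a) = 1 := by rw [σσ]; simp
lemma s_inv' (w : Equiv.Perm ι) : (𝐬 w⁻¹ * 𝐬 w : Serg ι a) = 1 := by rw [σσ]; simp

/-- conjugation by a permutation -/
def cj (w : Equiv.Perm ι) : Serg ι a →ₐ[ℂ] Serg ι a :=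
  { toFun := fun u => 𝐬 w * u * 𝐬 w⁻¹
    map_one' := by rw [mul_one, s_inv]
    map_mul' := by
      intro u v
      calc 𝐬 w * (u * v) * 𝐬 w⁻¹ = 𝐬 w * u * 1 * v * 𝐬 w⁻¹ := by noncomm_ring
        _ = 𝐬 w * u * 𝐬 w⁻¹ * (𝐬 w * v * 𝐬 w⁻¹) := by rw [← s_inv' w]; noncomm_ring
    map_zero' := by simp
    map_add' := by intro u v; noncomm_ring
    commutes' := by
      intro r
      rw [← Algebra.commutes, mul_assoc, s_inv, mul_one] }

lemma cj_apply (w) (u : Serg ι a) : cj w u = 𝐬 w * u * 𝐬 w⁻¹ := rfl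
@[simp] lemma cj_c (w) (i : ι) : cj w (𝐜 i : Serg ι a) = 𝐜 (w i) := by
  rw [cj_apply, (Serg.can ι a).σ_c, mul_assoc, s_inv, mul_one]
@[simp] lemma cj_x (w) (i : ι) : cj w (𝐱 i : Serg ι a) = 𝐱 (w i) := by
  rw [cj_apply, (Serg.can ι a).σ_x, mul_assoc, s_inv, mul_one]
@[simp] lemma cj_s (w v : Equiv.Perm ι) : cj w (𝐬 v : Serg ι a) = 𝐬 (w * v * w⁻¹) := by
  rw [cj_apply, σσ, σσ]
@[simp] lemma cj_mon (w) (i : ι) (α β) : cj w (mon i α β : Serg ι a) = mon (w i) α β := by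
  rw [cj_apply, σ_mon, mul_assoc, s_inv, mul_one]

lemma cj_Sp (w) {y : Serg ι a} (hy : y ∈ Sp o) : cj w y ∈ Sp (w o) := by
  have : Sp o ≤ (Sp (w o)).comap (cj (a := a) w) := by
    apply Algebra.adjoin_le
    rintro y (⟨v, hv, rfl⟩ | ⟨l, hl, rfl⟩ | ⟨l, hl, rfl⟩)
    · change cj (a := a) w _ ∈ Sp (w o)
      rw [cj_s]; exact Sp_σ (by simp [hv])
    · change cj (a := a) w _ ∈ Sp (w o)
      rw [cj_c]; exact Sp_c (fun e => hl (w.injective e))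
    · change cj (a := a) w _ ∈ Sp (w o)
      rw [cj_x]; exact Sp_x (fun e => hl (w.injective e))
  exact this hy

lemma τ_cj (w) (u : Serg ι a) : τ ω (w o) (cj w u) = cj w (τ ω o u) := by
  refine Serg_ext o (f := τ ω (w o) ∘ₗ (cj w).toLinearMap) (g := (cj w).toLinearMap ∘ₗ τ ω o) ?_ ?_ u
  · intro α β y hy
    simp only [LinearMap.comp_apply, AlgHom.toLinearMap_apply, map_mul (cj w), τ_right _ _ hy,
      τ_right _ _ (cj_Sp o w hy), cj_mon, τ_mono]
    split_ifs <;> simp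
  · intro i hi y hy y' hy'
    simp only [LinearMap.comp_apply, AlgHom.toLinearMap_apply, τ_ne _ _ hi hy hy']
    have e : w * Equiv.swap i o * w⁻¹ = Equiv.swap (w i) (w o) := by
      rw [Equiv.swap_apply_apply]
    rw [map_mul (cj w), map_mul (cj w), cj_s, e, τ_ne _ _ (fun e => hi (w.injective e)) (cj_Sp o w hy) (cj_Sp o w hy'),
      map_mul (cj w)]

/-- the subalgebra avoiding two points -/
def Sp2 (o o' : ι) : Subalgebra ℂ (Serg ι a) := Algebra.adjoin ℂ
  {u | (∃ w : Equiv.Perm ι, (w o = o ∧ w o' = o') ∧ u = 𝐬 w) ∨ (∃ l, (l ≠ o ∧ l ≠ o') ∧ u = 𝐜 l)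
    ∨ (∃ l, (l ≠ o ∧ l ≠ o') ∧ u = 𝐱 l)}

variable {o} {o' : ι}
lemma Sp2_σ {w : Equiv.Perm ι} (h : w o = o) (h' : w o' = o') : 𝐬 w ∈ Sp2 (a := a) o o' :=
  Algebra.subset_adjoin (Or.inl ⟨w, ⟨h, h'⟩, rfl⟩)
lemma Sp2_c {l : ι} (h : l ≠ o) (h' : l ≠ o') : 𝐜 l ∈ Sp2 (a := a) o o' :=
  Algebra.subset_adjoin (Or.inr (Or.inl ⟨l, ⟨h, h'⟩, rfl⟩))
lemma Sp2_x {l : ι} (h : l ≠ o) (h' : l ≠ o') : 𝐱 l ∈ Sp2 (a := a) o o' :=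
  Algebra.subset_adjoin (Or.inr (Or.inr ⟨l, ⟨h, h'⟩, rfl⟩))

lemma Sp2_l {y : Serg ι a} (hy : y ∈ Sp2 o o') : y ∈ Sp o := by
  refine Algebra.adjoin_mono ?_ hy
  rintro y (⟨v, hv, rfl⟩ | ⟨l, hl, rfl⟩ | ⟨l, hl, rfl⟩)
  · exact Or.inl ⟨v, hv.1, rfl⟩
  · exact Or.inr (Or.inl ⟨l, hl.1, rfl⟩)
  · exact Or.inr (Or.inr ⟨l, hl.1, rfl⟩)
lemma Sp2_r {y : Serg ι a} (hy : y ∈ Sp2 o o') : y ∈ Sp o' := by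
  refine Algebra.adjoin_mono ?_ hy
  rintro y (⟨v, hv, rfl⟩ | ⟨l, hl, rfl⟩ | ⟨l, hl, rfl⟩)
  · exact Or.inl ⟨v, hv.2, rfl⟩
  · exact Or.inr (Or.inl ⟨l, hl.2, rfl⟩)
  · exact Or.inr (Or.inr ⟨l, hl.2, rfl⟩)

lemma Sp2_t {y : Serg ι a} (hy : y ∈ Sp2 o o') :
    𝐬 (Equiv.swap o o') * y = y * 𝐬 (Equiv.swap o o') := by
  induction hy using Algebra.adjoin_induction with
  | mem y hy =>
    rcases hy with ⟨w, hw, rfl⟩ | ⟨l, hl, rfl⟩ | ⟨l, hl, rfl⟩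
    · rw [σσ, σσ]
      congr 1
      have h := Equiv.swap_apply_apply w o o'
      rw [hw.1, hw.2] at h
      rw [eq_mul_inv_iff_mul_eq] at h
      exact h
    · rw [(Serg.can ι a).σ_c, Equiv.swap_apply_of_ne_of_ne hl.1 hl.2]
    · rw [(Serg.can ι a).σ_x, Equiv.swap_apply_of_ne_of_ne hl.1 hl.2]
  | algebraMap r => rw [Algebra.commutes]
  | add x y _ _ hx hy => rw [mul_add, add_mul, hx, hy]
  | mul x y _ _ hx hy => rw [← mul_assoc, hx, mul_assoc, hy, mul_assoc]

variable (o o')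
def MS2 : Submodule ℂ (MM ι a) := Submodule.span ℂ {v | ∃ i α β, i ≠ o ∧ ∃ y ∈ Sp2 o o', v = br i α β y}

variable {o o'}
lemma br_MS2 {i} (hi : i ≠ o) (α β) {y : Serg ι a} (hy : y ∈ Sp2 o o') : br i α β y ∈ MS2 o o' :=
  Submodule.subset_span ⟨i, α, β, hi, y, hy, rfl⟩

lemma MS2_map {f : Module.End ℂ (MM ι a)} (h : ∀ i α β, i ≠ o → ∀ y ∈ Sp2 o o', f (br i α β y) ∈ MS2 o o')
    {v : MM ι a} (hv : v ∈ MS2 o o') : f v ∈ MS2 o o' := by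
  have : MS2 o o' ≤ (MS2 o o').comap f := by
    apply Submodule.span_le.2
    rintro _ ⟨i, α, β, hi, y, hy, rfl⟩
    exact h i α β hi y hy
  exact this hv

variable (hoo : o ≠ o')
include hoo

lemma MS2_Sop {w : Equiv.Perm ι} (hw : w o = o) {v : MM ι a} (hv : v ∈ MS2 o o') :
    Sop (Serg.can ι a) o' w v ∈ MS2 o o' := by
  refine MS2_map ?_ hv
  intro i α β hi y hy
  rw [Sop_br]
  have hi' : w i ≠ o := fun e => hi (w.injective (e.trans hw.symm))
  refine br_MS2 hi' _ _ (mul_mem (Sp2_σ ?_ ?_) hy)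
  · simp [Equiv.swap_apply_of_ne_of_ne hi.symm hoo, hw, Equiv.swap_apply_of_ne_of_ne hi'.symm hoo]
  · simp

lemma MS2_Cop {l} (hl : l ≠ o) {v : MM ι a} (hv : v ∈ MS2 o o') : Cop (Serg.can ι a) o' l v ∈ MS2 o o' := by
  refine MS2_map ?_ hv
  intro i α β hi y hy
  by_cases h : l = i
  · subst h; rw [Cop_eq]; exact Submodule.smul_mem _ _ (br_MS2 hi _ _ hy)
  · rw [Cop_ne _ _ h]
    refine Submodule.smul_mem _ _ (br_MS2 hi _ _ (mul_mem (Sp2_c ?_ (swap_ne h)) hy))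
    rw [Ne, Equiv.swap_apply_eq_iff, Equiv.swap_apply_of_ne_of_ne hi.symm hoo]; exact hl

lemma MS2_Xop {l} (hl : l ≠ o) {v : MM ι a} (hv : v ∈ MS2 o o') : Xop (Serg.can ι a) o' l v ∈ MS2 o o' := by
  refine MS2_map ?_ hv
  intro i α β hi y hy
  by_cases h : l = i
  · subst h
    cases α
    · rw [Xop_eq0]; exact (br_MS2 hi _ _ hy)
    · rw [Xop_eq1]; exact Submodule.smul_mem _ _ (br_MS2 hi _ _ hy)
  · have q1 : Equiv.swap i o' l ≠ o := by
      rw [Ne, Equiv.swap_apply_eq_iff, Equiv.swap_apply_of_ne_of_ne hi.symm hoo]; exact hl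
    have q2 : Equiv.swap l o' i ≠ o := by
      rw [Ne, Equiv.swap_apply_eq_iff, Equiv.swap_apply_of_ne_of_ne hl.symm hoo]; exact hi
    have h1 := mul_mem (Sp2_x (a := a) q1 (swap_ne (o := o') h)) hy
    cases α
    · rw [Xop_ne0 _ _ h]; exact br_MS2 hi _ _ h1
    · rw [Xop_ne1 _ _ h, Xop_ne0 _ _ h, Xop_eq0, Sop_br, Equiv.swap_apply_right, Xop_eq0,
        Xop_ne0 _ _ (Ne.symm h)]
      have h2 : 𝐬 (Equiv.swap l o' * Equiv.swap l i * Equiv.swap i o') ∈ Sp2 (a := a) o o' := by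
        refine Sp2_σ ?_ (by simp)
        simp [Equiv.swap_apply_of_ne_of_ne hi.symm hoo, Equiv.swap_apply_of_ne_of_ne hl.symm hi.symm,
          Equiv.swap_apply_of_ne_of_ne hl.symm hoo]
      have h3 := br_MS2 hl true β (mul_mem h2 hy)
      have h4 := br_MS2 hl false β (mul_mem (Sp2_x (a := a) q2 (swap_ne (o := o') (Ne.symm h))) (mul_mem h2 hy))
      exact add_mem (add_mem (br_MS2 hi _ _ h1) (sub_mem h3 h4))
        (MS2_Cop hoo hl (MS2_Cop hoo hi (add_mem h3 h4)))

lemma MS2_ρ {y : Serg ι a} (hy : y ∈ Sp o) : ∀ v : MM ι a, v ∈ MS2 o o' → ρ o' y v ∈ MS2 o o' := by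
  induction hy using Algebra.adjoin_induction with
  | mem y hy =>
    intro z hz
    rcases hy with ⟨w, hw, rfl⟩ | ⟨l, hl, rfl⟩ | ⟨l, hl, rfl⟩
    · rw [ρ_σ]; exact MS2_Sop hoo hw hz
    · rw [ρ_c]; exact MS2_Cop hoo hl hz
    · rw [ρ_x]; exact MS2_Xop hoo hl hz
  | algebraMap r => intro z hz; rw [AlgHom.commutes]; exact Submodule.smul_mem _ _ hz
  | add x y _ _ hx hy => intro z hz; rw [map_add]; exact add_mem (hx _ hz) (hy _ hz)
  | mul x y _ _ hx hy => intro z hz; rw [map_mul]; exact hx _ (hy _ hz)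

lemma Sp_le2 (N : Submodule ℂ (Serg ι a)) (h1 : ∀ α β, ∀ y ∈ Sp2 o o', mon o' α β * y ∈ N)
    (h2 : ∀ i, i ≠ o → i ≠ o' → ∀ y ∈ Sp2 o o', ∀ y' ∈ Sp2 o o', y * 𝐬 (Equiv.swap i o') * y' ∈ N)
    {u} (hu : u ∈ Sp o) : u ∈ N := by
  have : MS2 o o' ≤ N.comap (κ o') := by
    apply Submodule.span_le.2
    rintro _ ⟨i, α, β, hio, y, hy, rfl⟩
    simp only [Submodule.comap_coe, Set.mem_preimage, SetLike.mem_coe, κ_br]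
    by_cases hi : i = o'
    · subst hi
      have e : (Serg.can ι a).σ (Equiv.swap i i) = 1 := by rw [Equiv.swap_self]; exact map_one _
      rw [e, mul_one]
      exact h1 _ _ _ hy
    · refine h2 _ hio hi _ ?_ _ hy
      unfold mon
      apply mul_mem <;> split_ifs
      · exact Sp2_x hio hi
      · exact one_mem _
      · exact Sp2_c hio hi
      · exact one_mem _
  have := this (MS2_ρ hoo hu (br o' false false 1) (br_MS2 hoo.symm _ _ (one_mem _)))
  rwa [Submodule.mem_comap, ← π_apply, κ_π] at this

lemma τ_Sp2 {u : Serg ι a} (hu : u ∈ Sp o) : τ ω o' u ∈ Sp2 o o' := by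
  refine Sp_le2 hoo ((Subalgebra.toSubmodule (Sp2 o o')).comap (τ ω o')) ?_ ?_ hu
  · intro α β y hy
    simp only [Submodule.mem_comap, Subalgebra.mem_toSubmodule, τ_right _ _ (Sp2_r hy), τ_mono]
    refine mul_mem ?_ hy
    split_ifs
    · exact Subalgebra.algebraMap_mem _ _
    · exact zero_mem _
  · intro i hi hi' y hy y' hy'
    simp only [Submodule.mem_comap, Subalgebra.mem_toSubmodule, τ_ne _ _ hi' (Sp2_r hy) (Sp2_r hy')]
    exact mul_mem hy hy'

end Tr
end

section
set_option linter.unusedSectionVars false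
set_option linter.unusedSimpArgs false
set_option linter.unusedVariables false
namespace Tr
open SDM
variable {ι : Type} [DecidableEq ι] {a : ℂ} (ω : ℂ) (o : ι)
local notation "𝐬" => DFunLike.coe (SD.σ (Serg.can _ _))
local notation "𝐜" => SD.c (Serg.can _ _)
local notation "𝐱" => SD.x (Serg.can _ _)

lemma Serg_le3 (N : Submodule ℂ (Serg ι a))
    (h : ∀ i α β, ∀ y ∈ Sp o, mon i α β * 𝐬 (Equiv.swap i o) * y ∈ N) (u) : u ∈ N := by
  have : MS o ≤ N.comap (κ o) := by
    apply Submodule.span_le.2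
    rintro _ ⟨i, α, β, y, hy, rfl⟩
    simp only [Submodule.comap_coe, Set.mem_preimage, SetLike.mem_coe, κ_br]
    exact h i α β y hy
  have := this (MS_π o u)
  rwa [Submodule.mem_comap, κ_π] at this

variable {o} {o' : ι} (hoo : o ≠ o')
include hoo

lemma τ_mon2 (α β α' β') : τ ω o (τ ω o' (mon o α β * mon o' α' β' : Serg ι a)) =
    if (α && !β) && (α' && !β') then algebraMap ℂ _ (ω * ω) else 0 := by
  rw [τ_left _ _ (mon_Sp o' hoo _ _), τ_mono]
  cases α <;> cases β <;> cases α' <;> cases β' <;> simp [mon, τ_one, τ_c, τ_x, τ_xc, Algebra.algebraMap_eq_smul_one]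
  rw [smul_smul]

lemma τ_mm_t (α β α' β') : τ ω o (mon o' α β * 𝐬 (Equiv.swap o' o) * mon o' α' β' : Serg ι a)
    = mon o' α β * mon o' α' β' := τ_ne _ _ hoo.symm (mon_Sp o hoo.symm _ _) (mon_Sp o hoo.symm _ _)

lemma τ_comm_aux (α β α' β') : τ ω o (τ ω o' (mon o' α β * 𝐬 (Equiv.swap o' o) * mon o' α' β' : Serg ι a))
    = τ ω o' (mon o' α β * mon o' α' β') := by
  have A := τ_mon2 (a := a) ω hoo
  have B : ∀ α β α' β', τ ω o (τ ω o' (mon o α' β' * (mon o' α β * 𝐬 (Equiv.swap o' o)) : Serg ι a))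
    = τ ω o (mon o α' β' * mon o α β) := by
    intro α β α' β'
    have := σ_mon (a := a) (Equiv.swap o' o) o α β
    rw [Equiv.swap_apply_right] at this
    rw [τ_left _ _ (mon_Sp o' hoo _ _), ← this, Equiv.swap_comm, 
      τ_ne2 _ _ hoo (mon_Sp o' hoo _ _)]
  have r1 := (Serg.can ι a).x_c o
  have r2 := (Serg.can ι a).x_c o'
  have r3 := (Serg.can ι a).x_c' o o' hoo
  have r4 := (Serg.can ι a).x_c' o' o hoo.symm
  have r5 := (Serg.can ι a).c_sq o
  have r6 := (Serg.can ι a).c_sq o'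
  have r7 := (Serg.can ι a).c_anti o o' hoo
  have r8 := (Serg.can ι a).x_sq o
  have r9 := (Serg.can ι a).x_sq o'
  have r10 := (Serg.can ι a).x_x o o' hoo
  have r11 := (Serg.can ι a).x_x o' o hoo.symm
  have r12 := (Serg.can ι a).σ_x (Equiv.swap o' o) o'
  have r13 := (Serg.can ι a).σ_c (Equiv.swap o' o) o'
  have r14 := (Serg.can ι a).σ_x (Equiv.swap o' o) o
  have r15 := (Serg.can ι a).σ_c (Equiv.swap o' o) o
  rw [Equiv.swap_apply_left] at r12 r13
  rw [Equiv.swap_apply_right] at r14 r15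
  have r16 : (𝐬 (Equiv.swap o' o) * 𝐬 (Equiv.swap o' o) : Serg ι a) = 1 := by
    rw [σσ]; simp
  have ass : ∀ {u v w : Serg ι a}, u * v = w → ∀ z, u * (v * z) = w * z := by
    intro u v w h z; rw [← mul_assoc, h]
  have tcx : ∀ o : ι, τ ω o (𝐜 o * 𝐱 o : Serg ι a) = 0 := by
    intro o; have := τ_xc (a := a) ω o; rw [(Serg.can ι a).x_c] at this; simpa using this
  have tal : ∀ (o : ι) (r : ℂ), τ ω o (algebraMap ℂ (Serg ι a) r) = 0 := by
    intro o r; exact τ_Sp _ _ (Subalgebra.algebraMap_mem _ _)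
  have tca : ∀ (o : ι) (r : ℂ), τ ω o (𝐜 o * algebraMap ℂ (Serg ι a) r) = 0 := by
    intro o r; rw [τ_right _ _ (Subalgebra.algebraMap_mem _ _), τ_c, zero_mul]
  have cm : ∀ (u : Serg ι a) r, algebraMap ℂ (Serg ι a) r * u = u * algebraMap ℂ (Serg ι a) r :=
    fun u r => Algebra.commutes r u
  simp only [Bool.forall_bool, mon, if_true, if_false, Bool.false_eq_true, one_mul, mul_one, mul_assoc, mul_add,
    add_mul, mul_sub, sub_mul, mul_neg, neg_mul, neg_neg, r1, r2, r3, r4, r5, r6, r7, r8, r9, r12, r13,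
    r14, r15, r16, ass r1, ass r2, ass r3, ass r4, ass r5, ass r6, ass r7, ass r8, ass r9, ass r12,
    ass r13, ass r14, ass r15, ass r16, map_add, map_sub, map_neg, map_zero, τ_one, τ_x, τ_c, tcx, tal, tca, neg_zero,
    Bool.and_false, Bool.false_and, Bool.not_true, Bool.not_false, Bool.and_true, cm, neg_eq_zero, zero_add, sub_zero] at A B
  simp only [and_assoc] at A B
  obtain ⟨A1, A2, A3, A4, A5, A6, A7, A8, A9, A10, A11, A12, A13, A14, A15, A16⟩ := A
  obtain ⟨B1, B2, B3, B4, B5, B6, B7, B8, B9, B10, B11, B12, B13, B14, B15, B16⟩ := B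
  cases α <;> cases β <;> cases α' <;> cases β' <;>
  (simp only [mon, if_true, if_false, Bool.false_eq_true, one_mul, mul_one, mul_assoc, mul_add,
    add_mul, mul_sub, sub_mul, mul_neg, neg_mul, neg_neg, r1, r2, r3, r4, r5, r6, r7, r8, r9, r11, r12, r13,
    r14, r15, r16, ass r1, ass r2, ass r3, ass r4, ass r5, ass r6, ass r7, ass r8, ass r9, ass r11, ass r12,
    ass r13, ass r14, ass r15, ass r16, map_add, map_sub, map_neg, map_zero, τ_one, τ_x, τ_c, tcx, tal, tca, neg_zero,
    cm, neg_eq_zero, zero_add, sub_zero,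
    A1, A2, A3, A4, A5, A6, A7, A8, A9, A10, A11, A12, A13, A14, A15, A16,
    B1, B2, B3, B4, B5, B6, B7, B8, B9, B10, B11, B12, B13, B14, B15, B16, sub_self, add_zero])
lemma swap3 {l o i : ι} (hl : l ≠ o) (hl' : l ≠ i) (h : o ≠ i) :
    Equiv.swap o i * Equiv.swap l i = Equiv.swap l i * Equiv.swap l o := by
  have := Equiv.swap_apply_apply (Equiv.swap l i) l o
  rw [Equiv.swap_apply_left, Equiv.swap_apply_of_ne_of_ne hl.symm h, Equiv.swap_inv] at this
  rw [Equiv.swap_comm o i, this, mul_assoc, Equiv.swap_mul_self, mul_one]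

lemma τ_comm_aux2 (α β) {y : Serg ι a} (hy : y ∈ Sp o) :
    τ ω o (τ ω o' (mon o' α β * 𝐬 (Equiv.swap o' o) * y)) = τ ω o' (τ ω o (mon o' α β * 𝐬 (Equiv.swap o' o) * y)) := by
  let f : Serg ι a →ₗ[ℂ] Serg ι a := τ ω o ∘ₗ τ ω o' ∘ₗ LinearMap.mulLeft ℂ (mon o' α β * 𝐬 (Equiv.swap o' o))
  let g : Serg ι a →ₗ[ℂ] Serg ι a := τ ω o' ∘ₗ τ ω o ∘ₗ LinearMap.mulLeft ℂ (mon o' α β * 𝐬 (Equiv.swap o' o))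
  suffices h : y ∈ LinearMap.eqLocus f g from h
  have hi := hoo.symm
  refine Sp_le2 hoo _ ?_ ?_ hy
  · intro α' β' y hy
    rw [LinearMap.mem_eqLocus]; simp only [f, g, LinearMap.comp_apply, LinearMap.mulLeft_apply]
    rw [← mul_assoc, τ_right _ _ (Sp2_r hy), τ_right _ _ (Sp2_l hy), τ_right _ _ (Sp2_l hy),
      τ_right _ _ (Sp2_r hy), τ_comm_aux _ hoo, τ_mm_t _ hoo]
  · intro l hl hl' y1 h1 y2 h2
    rw [LinearMap.mem_eqLocus]; simp only [f, g, LinearMap.comp_apply, LinearMap.mulLeft_apply]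
    have e : mon o' α β * 𝐬 (Equiv.swap o' o) * (y1 * 𝐬 (Equiv.swap l o') * y2) =
      (mon o' α β * y1 * 𝐬 (Equiv.swap l o')) * (𝐬 (Equiv.swap l o) * y2) := by
      have e1 := Sp2_t h1
      have e2 : (𝐬 (Equiv.swap o o') * 𝐬 (Equiv.swap l o') : Serg ι a) = 𝐬 (Equiv.swap l o') * 𝐬 (Equiv.swap l o) := by
        rw [σσ, σσ]; congr 1
        exact swap3 hoo hl hl' hoo
      calc _ = mon o' α β * (𝐬 (Equiv.swap o o') * y1) * 𝐬 (Equiv.swap l o') * y2 := by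
            rw [Equiv.swap_comm]; noncomm_ring
        _ = mon o' α β * y1 * (𝐬 (Equiv.swap o o') * 𝐬 (Equiv.swap l o')) * y2 := by
            rw [e1]; noncomm_ring
        _ = _ := by rw [e2]; noncomm_ring
    have hz : mon o' α β * y1 * 𝐬 (Equiv.swap l o') ∈ Sp (a := a) o :=
      mul_mem (mul_mem (mon_Sp o hi _ _) (Sp2_l h1)) (Sp_σ (Equiv.swap_apply_of_ne_of_ne (Ne.symm hl) hoo))
    have hw : 𝐬 (Equiv.swap l o) * y2 ∈ Sp (a := a) o' :=
      mul_mem (Sp_σ (Equiv.swap_apply_of_ne_of_ne (Ne.symm hl') hi)) (Sp2_r h2)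
    rw [e, τ_right _ _ hw, ← mul_assoc, ← mul_assoc, τ_ne _ _ hl (Sp2_l (τ_Sp2 ω hoo hz)) (Sp2_l h2),
      τ_ne _ _ hl hz (Sp2_l h2), τ_right _ _ (Sp2_r h2)]

/-- the two partial traces commute -/
lemma τ_comm (u : Serg ι a) : τ ω o (τ ω o' u) = τ ω o' (τ ω o u) := by
  refine Serg_le3 o (LinearMap.eqLocus (τ ω o ∘ₗ τ ω o') (τ ω o' ∘ₗ τ ω o)) ?_ u
  intro i α β y hy
  simp only [LinearMap.mem_eqLocus, LinearMap.comp_apply]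
  have hy2 := τ_Sp2 ω hoo hy
  by_cases hi : i = o
  · subst hi
    have e : (𝐬 (Equiv.swap i i) : Serg ι a) = 1 := by rw [Equiv.swap_self]; exact map_one _
    rw [e, mul_one, τ_left _ _ (mon_Sp o' hoo _ _), τ_right _ _ hy, τ_right _ _ (Sp2_l hy2), τ_mono]
    split_ifs
    · rw [τ_left _ _ (Subalgebra.algebraMap_mem _ _)]
    · simp
  by_cases hi' : i = o'
  · subst hi'
    exact τ_comm_aux2 ω hoo α β hy
  · have h1 : mon i α β ∈ Sp (a := a) o' := mon_Sp o' hi' _ _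
    have h2 : 𝐬 (Equiv.swap i o) ∈ Sp (a := a) o' := Sp_σ (Equiv.swap_apply_of_ne_of_ne (Ne.symm hi') hoo.symm)
    rw [τ_ne _ _ hi (mon_Sp o hi _ _) hy, τ_left _ _ (mul_mem h1 h2), τ_left _ _ h1,
      τ_ne _ _ hi (mon_Sp o hi _ _) (Sp2_l hy2)]

lemma cj_Sp2 {y : Serg ι a} (hy : y ∈ Sp2 o o') : cj (Equiv.swap o o') y = y := by
  rw [cj_apply, Sp2_t hy, mul_assoc, s_inv, mul_one]

lemma τ_cjt (u : Serg ι a) : τ ω o (cj (Equiv.swap o o') u) = cj (Equiv.swap o o') (τ ω o' u) := by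
  have := τ_cj ω o' (Equiv.swap o o') u
  rwa [Equiv.swap_apply_right] at this
lemma τ_cjt' (u : Serg ι a) : τ ω o' (cj (Equiv.swap o o') u) = cj (Equiv.swap o o') (τ ω o u) := by
  have := τ_cj ω o (Equiv.swap o o') u
  rwa [Equiv.swap_apply_left] at this

lemma ττ_Sp2 (u : Serg ι a) : τ ω o' (τ ω o u) ∈ Sp2 o o' := τ_Sp2 ω hoo (τ_mem ω o u)

lemma ττ_t (u : Serg ι a) : τ ω o' (τ ω o (𝐬 (Equiv.swap o o') * u)) = τ ω o' (τ ω o (u * 𝐬 (Equiv.swap o o'))) := by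
  have h : 𝐬 (Equiv.swap o o') * u = cj (Equiv.swap o o') (u * 𝐬 (Equiv.swap o o')) := by
    rw [cj_apply, ← mul_assoc, mul_assoc, s_inv, mul_one]
  rw [h, τ_cjt _ hoo, τ_cjt' _ hoo, τ_comm _ hoo, cj_Sp2 hoo (ττ_Sp2 ω hoo _)]

/-- `τ((i o) y t) = (i o') τ'((i o') y)` -/
lemma τ_G {i : ι} (hi : i ≠ o) (hi' : i ≠ o') {y : Serg ι a} (hy : y ∈ Sp o) :
    τ ω o (𝐬 (Equiv.swap i o) * y * 𝐬 (Equiv.swap o o')) =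
      𝐬 (Equiv.swap i o') * τ ω o' (𝐬 (Equiv.swap i o') * y) := by
  have hs : 𝐬 (Equiv.swap i o') ∈ Sp (a := a) o := Sp_σ (Equiv.swap_apply_of_ne_of_ne (Ne.symm hi) hoo)
  have e : (𝐬 (Equiv.swap i o) : Serg ι a) = 𝐬 (Equiv.swap i o') * 𝐬 (Equiv.swap o o') * 𝐬 (Equiv.swap i o') := by
    rw [σσ, σσ]; congr 1
    have := Equiv.swap_apply_apply (Equiv.swap i o') o o'
    rw [Equiv.swap_apply_of_ne_of_ne (Ne.symm hi) hoo, Equiv.swap_apply_right, Equiv.swap_inv] at this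
    rw [← this, Equiv.swap_comm]
  have e2 : 𝐬 (Equiv.swap i o) * y * 𝐬 (Equiv.swap o o') =
      𝐬 (Equiv.swap i o') * cj (Equiv.swap o o') (𝐬 (Equiv.swap i o') * y) := by
    rw [cj_apply, e, Equiv.swap_inv]; noncomm_ring
  rw [e2, τ_left _ _ hs, τ_cjt _ hoo, cj_Sp2 hoo (τ_Sp2 ω hoo (mul_mem hs hy))]
end Tr
end

section
set_option linter.unusedSectionVars false
set_option linter.unusedSimpArgs false
set_option linter.unusedVariables false
namespace Tr
open SDM
variable {ι : Type} [DecidableEq ι] {a : ℂ} (ω : ℂ) (o : ι)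
local notation "𝐬" => DFunLike.coe (SD.σ (Serg.can _ _))
local notation "𝐜" => SD.c (Serg.can _ _)
local notation "𝐱" => SD.x (Serg.can _ _)

/-- the sign-changed data defining the parity automorphism -/
def εSD : SD ι a (Serg ι a) where
  σ := (Serg.can ι a).σ
  c := fun i => - 𝐜 i
  x := 𝐱
  c_sq := fun i => by rw [neg_mul_neg, (Serg.can ι a).c_sq]
  c_anti := fun i j h => by rw [neg_mul_neg, neg_mul_neg, (Serg.can ι a).c_anti i j h]
  σ_c := fun w i => by rw [mul_neg, neg_mul, (Serg.can ι a).σ_c]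
  σ_x := (Serg.can ι a).σ_x
  x_sq := (Serg.can ι a).x_sq
  x_c := fun i => by rw [mul_neg, neg_mul, (Serg.can ι a).x_c]
  x_c' := fun i j h => by rw [mul_neg, neg_mul, (Serg.can ι a).x_c' i j h]
  x_x := fun i j h => by rw [neg_mul_neg]; exact (Serg.can ι a).x_x i j h

/-- the parity automorphism -/
def ε : Serg ι a →ₐ[ℂ] Serg ι a := Serg.lift εSD

@[simp] lemma ε_s (w) : ε (𝐬 w : Serg ι a) = 𝐬 w := by simp [ε, εSD]
@[simp] lemma ε_c (i) : ε (𝐜 i : Serg ι a) = - 𝐜 i := by simp [ε, εSD]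
@[simp] lemma ε_x (i) : ε (𝐱 i : Serg ι a) = 𝐱 i := by simp [ε, εSD]
@[simp] lemma ε_ε (u : Serg ι a) : ε (ε u) = u := by
  have : (ε (ι := ι) (a := a)).comp ε = AlgHom.id ℂ _ := by
    apply Serg.hom_ext <;> simp
  exact congrArg (fun f => f u) this

lemma ε_Sp {y : Serg ι a} (hy : y ∈ Sp o) : ε y ∈ Sp o := by
  have : Sp o ≤ (Sp o).comap (ε (ι := ι) (a := a)) := by
    apply Algebra.adjoin_le
    rintro y (⟨v, hv, rfl⟩ | ⟨l, hl, rfl⟩ | ⟨l, hl, rfl⟩)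
    · change ε (a := a) _ ∈ Sp o
      rw [ε_s]; exact Sp_σ hv
    · change ε (a := a) _ ∈ Sp o
      rw [ε_c]; exact neg_mem (Sp_c hl)
    · change ε (a := a) _ ∈ Sp o
      rw [ε_x]; exact Sp_x hl
  exact this hy

lemma c_Sp {y : Serg ι a} (hy : y ∈ Sp o) : 𝐜 o * y = ε y * 𝐜 o := by
  induction hy using Algebra.adjoin_induction with
  | mem y hy =>
    rcases hy with ⟨w, hw, rfl⟩ | ⟨l, hl, rfl⟩ | ⟨l, hl, rfl⟩
    · rw [ε_s, (Serg.can ι a).σ_c, hw]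
    · rw [ε_c, (Serg.can ι a).c_anti _ _ (Ne.symm hl), neg_mul]
    · rw [ε_x, (Serg.can ι a).x_c' _ _ hl]
  | algebraMap r => rw [AlgHom.commutes, Algebra.commutes]
  | add x y _ _ hx hy => rw [mul_add, map_add, add_mul, hx, hy]
  | mul x y _ _ hx hy => rw [← mul_assoc, hx, mul_assoc, hy, map_mul, mul_assoc]

lemma mul_c_Sp {y : Serg ι a} (hy : y ∈ Sp o) : y * 𝐜 o = 𝐜 o * ε y := by
  rw [c_Sp o (ε_Sp o hy), ε_ε]

lemma ε_mon (i : ι) (α β) : ε (mon i α β : Serg ι a) = sg β • mon i α β := by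
  cases α <;> cases β <;> simp [mon, sg]

lemma τ_ε (u : Serg ι a) : τ ω o (ε u) = ε (τ ω o u) := by
  refine Serg_ext o (f := τ ω o ∘ₗ (ε).toLinearMap) (g := (ε).toLinearMap ∘ₗ τ ω o) ?_ ?_ u
  · intro α β y hy
    simp only [LinearMap.comp_apply, AlgHom.toLinearMap_apply, map_mul ε, τ_right _ _ hy,
      τ_right _ _ (ε_Sp o hy), ε_mon, τ_mono, map_smul]
    cases α <;> cases β <;> simp [sg]
  · intro i hi y hy y' hy'
    simp only [LinearMap.comp_apply, AlgHom.toLinearMap_apply, τ_ne _ _ hi hy hy', map_mul ε, ε_s,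
      τ_ne _ _ hi (ε_Sp o hy) (ε_Sp o hy')]

lemma τ_cε (u : Serg ι a) : τ ω o (𝐜 o * u) = τ ω o (ε u * 𝐜 o) := by
  refine Serg_ext o (f := τ ω o ∘ₗ LinearMap.mulLeft ℂ (𝐜 o))
    (g := τ ω o ∘ₗ LinearMap.mulRight ℂ (𝐜 o) ∘ₗ (ε).toLinearMap) ?_ ?_ u
  · intro α β y hy
    simp only [LinearMap.comp_apply, AlgHom.toLinearMap_apply, map_mul ε, ε_mon, LinearMap.mulLeft_apply,
      LinearMap.mulRight_apply]
    rw [mul_assoc _ (ε y), ← c_Sp o hy, ← mul_assoc, ← mul_assoc, τ_right _ _ hy, τ_right _ _ hy]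
    congr 1
    have r1 := (Serg.can ι a).x_c o
    have r5 := (Serg.can ι a).c_sq o
    have t1 := τ_xc (a := a) ω o
    rw [r1, map_neg, neg_eq_zero] at t1
    cases α <;> cases β <;> simp [mon, sg, mul_assoc, r1, r5, τ_one, t1]
  · intro i hi y hy y' hy'
    simp only [LinearMap.comp_apply, AlgHom.toLinearMap_apply, map_mul ε, LinearMap.mulLeft_apply,
      LinearMap.mulRight_apply, ε_s]
    have h1 : 𝐜 o * (y * 𝐬 (Equiv.swap i o) * y') = ε y * 𝐬 (Equiv.swap i o) * (𝐜 i * y') := by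
      have := (Serg.can ι a).σ_c (Equiv.swap i o) i
      rw [Equiv.swap_apply_left] at this
      rw [← mul_assoc, ← mul_assoc, c_Sp o hy, mul_assoc (ε y), ← this]; noncomm_ring
    have h2 : ε y * 𝐬 (Equiv.swap i o) * ε y' * 𝐜 o = (ε y * 𝐜 i) * 𝐬 (Equiv.swap i o) * y' := by
      have := (Serg.can ι a).σ_c (Equiv.swap i o) o
      rw [Equiv.swap_apply_right] at this
      rw [mul_assoc, ← c_Sp o hy', ← mul_assoc, mul_assoc (ε y), this]; noncomm_ring
    rw [h1, h2, τ_ne _ _ hi (ε_Sp o hy) (mul_mem (Sp_c hi) hy'), τ_ne _ _ hi (mul_mem (ε_Sp o hy) (Sp_c hi)) hy',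
      mul_assoc]

/-- the cap-cup operators -/
def En (i : ι) : Serg ι a →ₗ[ℂ] Serg ι a :=
  LinearMap.mulLeft ℂ (𝐬 (Equiv.swap i o)) ∘ₗ τ ω o ∘ₗ LinearMap.mulLeft ℂ (𝐬 (Equiv.swap i o))

lemma En_apply (i : ι) (u : Serg ι a) : En ω o i u = 𝐬 (Equiv.swap i o) * τ ω o (𝐬 (Equiv.swap i o) * u) := rfl

lemma s_En (w : Equiv.Perm ι) (i : ι) (u : Serg ι a) : 𝐬 w * En ω o i u = En ω o (w i) (𝐬 w * u) := by
  have h : 𝐬 (Equiv.swap (w i) o * w * Equiv.swap i o) ∈ Sp (a := a) o := Sp_σ (by simp)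
  have e1 : (𝐬 w * 𝐬 (Equiv.swap i o) : Serg ι a) = 𝐬 (Equiv.swap (w i) o) * 𝐬 (Equiv.swap (w i) o * w * Equiv.swap i o) := by
    rw [σσ, σσ, ← mul_assoc, ← mul_assoc, Equiv.swap_mul_self, one_mul]
  have e2 : (𝐬 (Equiv.swap (w i) o) * 𝐬 w : Serg ι a) = 𝐬 (Equiv.swap (w i) o * w * Equiv.swap i o) * 𝐬 (Equiv.swap i o) := by
    rw [σσ, σσ, mul_assoc, mul_assoc, Equiv.swap_mul_self, mul_one]
  rw [En_apply, En_apply, ← mul_assoc, e1, mul_assoc, ← τ_left _ _ h, ← mul_assoc, ← e2, mul_assoc]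

lemma c_En {l i : ι} (h : l ≠ i) (u : Serg ι a) : 𝐜 l * En ω o i u = En ω o i (𝐜 l * u) := by
  have h1 : 𝐜 (Equiv.swap i o l) ∈ Sp (a := a) o := Sp_c (swap_ne h)
  have e1 := (Serg.can ι a).σ_c (Equiv.swap i o) l
  have e2 := (Serg.can ι a).σ_c (Equiv.swap i o) (Equiv.swap i o l)
  rw [Equiv.swap_apply_self] at e2
  rw [En_apply, En_apply, ← mul_assoc, ← mul_assoc, e1, ← e2, mul_assoc, mul_assoc, τ_left _ _ h1]

lemma x_En {l i : ι} (h : l ≠ i) (u : Serg ι a) : 𝐱 l * En ω o i u = En ω o i (𝐱 l * u) := by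
  have h1 : 𝐱 (Equiv.swap i o l) ∈ Sp (a := a) o := Sp_x (swap_ne h)
  have e1 := (Serg.can ι a).σ_x (Equiv.swap i o) l
  have e2 := (Serg.can ι a).σ_x (Equiv.swap i o) (Equiv.swap i o l)
  rw [Equiv.swap_apply_self] at e2
  rw [En_apply, En_apply, ← mul_assoc, ← mul_assoc, e1, ← e2, mul_assoc, mul_assoc, τ_left _ _ h1]

lemma En_right (i : ι) (u : Serg ι a) {y : Serg ι a} (hy : y ∈ Sp o) : En ω o i (u * y) = En ω o i u * y := by
  rw [En_apply, En_apply, ← mul_assoc, τ_right _ _ hy, mul_assoc]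

lemma En_ε (i : ι) (u : Serg ι a) : En ω o i (ε u) = ε (En ω o i u) := by
  rw [En_apply, En_apply, map_mul ε, ← τ_ε, map_mul ε, ε_s]

lemma En_c (i : ι) (u : Serg ι a) : En ω o i (𝐜 i * u) = En ω o i (ε u * 𝐜 o) := by
  have e1 := (Serg.can ι a).σ_c (Equiv.swap i o) i
  rw [Equiv.swap_apply_left] at e1
  rw [En_apply, En_apply, ← mul_assoc, e1, mul_assoc, τ_cε, map_mul ε, ε_s, mul_assoc]

lemma c_En' (i : ι) (u : Serg ι a) : 𝐜 i * En ω o i u = ε (En ω o i u) * 𝐜 o := by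
  have e1 := (Serg.can ι a).σ_c (Equiv.swap i o) o
  rw [Equiv.swap_apply_right] at e1
  rw [En_apply, ← mul_assoc, ← e1, map_mul ε, ε_s, mul_assoc, mul_assoc, ← c_Sp o (τ_mem _ _ _)]

lemma En_s (i : ι) (u : Serg ι a) : En ω o i (𝐬 (Equiv.swap i o) * u) = 𝐬 (Equiv.swap i o) * τ ω o u := by
  rw [En_apply, ← mul_assoc (𝐬 (Equiv.swap i o)), σσ, Equiv.swap_mul_self, map_one, one_mul]

/-- every image of `En` has the form `σ(i o) y` -/
lemma En_form (i : ι) (u : Serg ι a) : ∃ y ∈ Sp o, En ω o i u = 𝐬 (Equiv.swap i o) * y :=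
  ⟨_, τ_mem ω o _, rfl⟩

lemma sio_c (i : ι) (u : Serg ι a) : 𝐜 i * (𝐬 (Equiv.swap i o) * u) = 𝐬 (Equiv.swap i o) * (𝐜 o * u) := by
  have e1 := (Serg.can ι a).σ_c (Equiv.swap i o) o
  rw [Equiv.swap_apply_right] at e1
  rw [← mul_assoc, ← e1, mul_assoc]
lemma sio_x (i : ι) (u : Serg ι a) : 𝐱 i * (𝐬 (Equiv.swap i o) * u) = 𝐬 (Equiv.swap i o) * (𝐱 o * u) := by
  have e1 := (Serg.can ι a).σ_x (Equiv.swap i o) o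
  rw [Equiv.swap_apply_right] at e1
  rw [← mul_assoc, ← e1, mul_assoc]

lemma En_En (i : ι) (u : Serg ι a) : En ω o i (En ω o i u) = 0 := by
  obtain ⟨y, hy, e⟩ := En_form ω o i u
  rw [e, En_s, τ_Sp _ _ hy, mul_zero]
lemma En_c_En (i : ι) (u : Serg ι a) : En ω o i (𝐜 i * En ω o i u) = 0 := by
  obtain ⟨y, hy, e⟩ := En_form ω o i u
  rw [e, sio_c, En_s, τ_right _ _ hy, τ_c, zero_mul, mul_zero]
lemma En_x_En (i : ι) (u : Serg ι a) : En ω o i (𝐱 i * En ω o i u) = ω • En ω o i u := by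
  obtain ⟨y, hy, e⟩ := En_form ω o i u
  rw [e, sio_x, En_s, τ_right _ _ hy, τ_x, Algebra.algebraMap_eq_smul_one]; simp
end Tr
end

section
set_option linter.unusedSectionVars false
set_option linter.unusedSimpArgs false
set_option linter.unusedVariables false
namespace Tr
open SDM
variable {ι : Type} [DecidableEq ι] {a : ℂ} (ω : ℂ) (o : ι)
local notation "𝐬" => DFunLike.coe (SD.σ (Serg.can _ _))
local notation "𝐜" => SD.c (Serg.can _ _)
local notation "𝐱" => SD.x (Serg.can _ _)

lemma cc (i : ι) (u : Serg ι a) : 𝐜 i * (𝐜 i * u) = -u := by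
  rw [← mul_assoc, (Serg.can ι a).c_sq, neg_one_mul]
lemma cac {i j : ι} (h : i ≠ j) (u : Serg ι a) : 𝐜 i * (𝐜 j * u) = -(𝐜 j * (𝐜 i * u)) := by
  rw [← mul_assoc, (Serg.can ι a).c_anti _ _ h, neg_mul, mul_assoc]

def Ent (i : ι) : Serg ι a →ₗ[ℂ] Serg ι a :=
  En ω o i - LinearMap.mulLeft ℂ (𝐜 i) ∘ₗ En ω o i ∘ₗ LinearMap.mulLeft ℂ (𝐜 i)
lemma Ent_apply (i : ι) (u : Serg ι a) : Ent ω o i u = En ω o i u - 𝐜 i * En ω o i (𝐜 i * u) := rfl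

lemma s_Ent (w : Equiv.Perm ι) (i : ι) (u : Serg ι a) : 𝐬 w * Ent ω o i u = Ent ω o (w i) (𝐬 w * u) := by
  rw [Ent_apply, Ent_apply, mul_sub, s_En, ← mul_assoc, (Serg.can ι a).σ_c, mul_assoc, s_En, ← mul_assoc,
    (Serg.can ι a).σ_c, mul_assoc]

lemma c_Ent (l i : ι) (u : Serg ι a) : 𝐜 l * Ent ω o i u = Ent ω o i (𝐜 l * u) := by
  rw [Ent_apply, Ent_apply, mul_sub]
  by_cases h : l = i
  · subst h
    rw [cc, cc, map_neg]; noncomm_ring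
  · rw [c_En _ _ h, cac h, c_En _ _ h, cac h, map_neg]; noncomm_ring

lemma x_Ent {l i : ι} (h : l ≠ i) (u : Serg ι a) : 𝐱 l * Ent ω o i u = Ent ω o i (𝐱 l * u) := by
  rw [Ent_apply, Ent_apply, mul_sub, x_En _ _ h, ← mul_assoc, (Serg.can ι a).x_c' _ _ h, mul_assoc, x_En _ _ h,
    ← mul_assoc, (Serg.can ι a).x_c' _ _ h, mul_assoc]

lemma Ent_right (i : ι) (u : Serg ι a) {y : Serg ι a} (hy : y ∈ Sp o) : Ent ω o i (u * y) = Ent ω o i u * y := by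
  rw [Ent_apply, Ent_apply, sub_mul, ← mul_assoc (𝐜 i), En_right _ _ _ _ hy, En_right _ _ _ _ hy, mul_assoc]

lemma Ent_ε (i : ι) (u : Serg ι a) : Ent ω o i (ε u) = ε (Ent ω o i u) := by
  rw [Ent_apply, Ent_apply, map_sub ε, map_mul ε, ε_c, En_ε, ← En_ε ω o i (𝐜 i * u), map_mul ε, ε_c]
  simp

lemma Ent_cb (i : ι) (u : Serg ι a) : Ent ω o i (ε u * 𝐜 o) = - (ε (Ent ω o i u) * 𝐜 o) := by
  have e1 : 𝐜 i * (ε u * 𝐜 o) = - (ε (𝐜 i * u) * 𝐜 o) := by rw [map_mul ε, ε_c]; noncomm_ring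
  rw [Ent_apply, Ent_apply, e1, ← En_c, map_neg, ← En_c, cc, map_neg, map_sub ε, map_mul ε, ε_c, sub_mul,
    ← c_En', neg_mul, neg_mul, mul_assoc, ← c_En', cc]
  noncomm_ring

variable [Fintype ι]
def Om : Serg ι a →ₗ[ℂ] Serg ι a := ∑ i, Ent ω o i
lemma Om_apply (u : Serg ι a) : Om ω o u = ∑ i, Ent ω o i u := by simp [Om]

lemma s_Om (w : Equiv.Perm ι) (u : Serg ι a) : 𝐬 w * Om ω o u = Om ω o (𝐬 w * u) := by
  rw [Om_apply, Om_apply, Finset.mul_sum, ← Equiv.sum_comp w (fun i => Ent ω o i (𝐬 w * u))]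
  exact Finset.sum_congr rfl fun i _ => s_Ent _ _ _ _ _
lemma c_Om (l : ι) (u : Serg ι a) : 𝐜 l * Om ω o u = Om ω o (𝐜 l * u) := by
  rw [Om_apply, Om_apply, Finset.mul_sum]
  exact Finset.sum_congr rfl fun i _ => c_Ent _ _ _ _ _
lemma Om_right (u : Serg ι a) {y : Serg ι a} (hy : y ∈ Sp o) : Om ω o (u * y) = Om ω o u * y := by
  rw [Om_apply, Om_apply, Finset.sum_mul]
  exact Finset.sum_congr rfl fun i _ => Ent_right _ _ _ _ hy
lemma Om_ε (u : Serg ι a) : Om ω o (ε u) = ε (Om ω o u) := by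
  rw [Om_apply, Om_apply, map_sum ε]
  exact Finset.sum_congr rfl fun i _ => Ent_ε _ _ _ _
lemma Om_cb (u : Serg ι a) : Om ω o (ε u * 𝐜 o) = - (ε (Om ω o u) * 𝐜 o) := by
  rw [Om_apply, Om_apply, map_sum ε, Finset.sum_mul, ← Finset.sum_neg_distrib]
  exact Finset.sum_congr rfl fun i _ => Ent_cb _ _ _ _
lemma x_Om (l : ι) (u : Serg ι a) : 𝐱 l * (Om ω o u - Ent ω o l u) = Om ω o (𝐱 l * u) - Ent ω o l (𝐱 l * u) := by
  rw [Om_apply, Om_apply, ← Finset.sum_erase_eq_sub (Finset.mem_univ l), ← Finset.sum_erase_eq_sub (Finset.mem_univ l),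
    Finset.mul_sum]
  exact Finset.sum_congr rfl fun i hi => x_Ent _ _ (Finset.ne_of_mem_erase hi).symm _

/-- the odd transposition sum -/
def Tt (l o : ι) : Serg ι a := 𝐬 (Equiv.swap l o) + 𝐜 o * 𝐬 (Equiv.swap l o) * 𝐜 o
def Lo : Serg ι a := ∑ l ∈ Finset.univ.erase o, Tt l o
def Xo : Serg ι a := 𝐱 o - Lo o

lemma Tt_eq (l o : ι) : (Tt l o : Serg ι a) = (1 + 𝐜 o * 𝐜 l) * 𝐬 (Equiv.swap l o) := by
  have := (Serg.can ι a).σ_c (Equiv.swap l o) o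
  rw [Equiv.swap_apply_right] at this
  rw [Tt, mul_assoc, this]; noncomm_ring

lemma cj_Tt (w : Equiv.Perm ι) (l o : ι) : cj w (Tt l o : Serg ι a) = Tt (w l) (w o) := by
  rw [Tt, map_add, map_mul, map_mul, cj_s, cj_c, Tt, Equiv.swap_apply_apply]
lemma cj_Lo (w : Equiv.Perm ι) : cj w (Lo o : Serg ι a) = Lo (w o) := by
  rw [Lo, map_sum, Lo]
  refine Finset.sum_bij (fun i _ => w i) ?_ ?_ ?_ ?_
  · intro i hi; simpa using hi
  · intro i _ j _ h; exact w.injective h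
  · intro j hj; exact ⟨w⁻¹ j, by simpa [Equiv.symm_apply_eq, Equiv.Perm.inv_eq_iff_eq] using hj, by simp⟩
  · intro i hi; rw [cj_Tt]
lemma cj_Xo (w : Equiv.Perm ι) : cj w (Xo o : Serg ι a) = Xo (w o) := by
  rw [Xo, map_sub, cj_x, cj_Lo, Xo]

lemma s_Xo (w : Equiv.Perm ι) : (𝐬 w * Xo o : Serg ι a) = Xo (w o) * 𝐬 w := by
  rw [← cj_Xo, cj_apply, mul_assoc, s_inv', mul_one]

lemma ε_Xo : ε (Xo o : Serg ι a) = Xo o := by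
  simp [Xo, Lo, Tt]

lemma Tt_c {l' l o : ι} (h : l' ≠ l) (h' : l' ≠ o) : (𝐜 l' * Tt l o : Serg ι a) = Tt l o * 𝐜 l' := by
  have h1 := (Serg.can ι a).σ_c (Equiv.swap l o) l'
  rw [Equiv.swap_apply_of_ne_of_ne h h'] at h1
  rw [Tt_eq, mul_assoc, h1, ← mul_assoc, ← mul_assoc]
  congr 1
  rw [mul_add, mul_one, add_mul, one_mul, cac h', (Serg.can ι a).c_anti _ _ h]; noncomm_ring
lemma Tt_x {l' l o : ι} (h : l' ≠ l) (h' : l' ≠ o) : (𝐱 l' * Tt l o : Serg ι a) = Tt l o * 𝐱 l' := by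
  have h1 := (Serg.can ι a).σ_x (Equiv.swap l o) l'
  rw [Equiv.swap_apply_of_ne_of_ne h h'] at h1
  rw [Tt_eq, mul_assoc, h1, ← mul_assoc, ← mul_assoc]
  congr 1
  rw [mul_add, mul_one, add_mul, one_mul, ← mul_assoc, (Serg.can ι a).x_c' _ _ h', mul_assoc,
    (Serg.can ι a).x_c' _ _ h, mul_assoc]
lemma Tt_c2 {l o : ι} (h : l ≠ o) : (𝐜 l * Tt l o : Serg ι a) = Tt l o * 𝐜 l := by
  have h1 := (Serg.can ι a).σ_c (Equiv.swap l o) l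
  rw [Equiv.swap_apply_left] at h1
  have h2 : (𝐜 o * 𝐜 l * 𝐜 o : Serg ι a) = 𝐜 l := by
    rw [mul_assoc, (Serg.can ι a).c_anti _ _ h, mul_neg, cc, neg_neg]
  have h3 : (𝐜 l * (𝐜 o * 𝐜 l) : Serg ι a) = 𝐜 o := by
    rw [(Serg.can ι a).c_anti _ _ h.symm, mul_neg, cc, neg_neg]
  rw [Tt_eq, mul_assoc, h1, ← mul_assoc, ← mul_assoc, mul_add, h3, mul_one]
  rw [add_mul 1, h2, one_mul, add_comm]
lemma Tt_o {l o : ι} : (𝐜 o * Tt l o : Serg ι a) = -(Tt l o * 𝐜 o) := by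
  rw [Tt, mul_add, mul_assoc (𝐜 o), cc, add_mul, mul_assoc, mul_assoc, (Serg.can ι a).c_sq]; noncomm_ring

lemma Xo_c : (𝐜 o * Xo o : Serg ι a) = -(Xo o * 𝐜 o) := by
  rw [Xo, mul_sub, sub_mul, (Serg.can ι a).x_c, Lo, Finset.mul_sum, Finset.sum_mul]
  simp only [Tt_o, Finset.sum_neg_distrib]; noncomm_ring

lemma Xo_cl {l : ι} (h : l ≠ o) : (𝐜 l * Xo o : Serg ι a) = Xo o * 𝐜 l := by
  rw [Xo, mul_sub, sub_mul, (Serg.can ι a).x_c' _ _ h.symm, Lo, Finset.mul_sum, Finset.sum_mul]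
  congr 1
  refine Finset.sum_congr rfl fun i hi => ?_
  by_cases hl : l = i
  · subst hl; exact Tt_c2 h
  · exact Tt_c hl h

lemma Xo_xl {l : ι} (h : l ≠ o) : (𝐱 l * Xo o : Serg ι a) = Xo o * 𝐱 l := by
  have hm : l ∈ Finset.univ.erase o := by simp [h]
  rw [Xo, mul_sub, sub_mul, Lo, Finset.mul_sum, Finset.sum_mul, ← Finset.add_sum_erase _ _ hm,
    ← Finset.add_sum_erase _ (fun i => Tt i o * 𝐱 l) hm, (Serg.can ι a).x_x _ _ h]
  have : ∑ i ∈ (Finset.univ.erase o).erase l, (𝐱 l * Tt i o : Serg ι a) = ∑ i ∈ (Finset.univ.erase o).erase l, Tt i o * 𝐱 l :=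
    Finset.sum_congr rfl fun i hi => Tt_x (Finset.ne_of_mem_erase hi).symm h
  have h1 := (Serg.can ι a).σ_x (Equiv.swap l o) l
  rw [Equiv.swap_apply_left] at h1
  have r := (Serg.can ι a).x_c' _ _ h
  have r1 := (Serg.can ι a).x_c l
  have e : (𝐱 l * Tt l o : Serg ι a) = Tt l o * 𝐱 l + (𝐱 l - 𝐱 o + 𝐜 l * 𝐜 o * (𝐱 l + 𝐱 o)) * 𝐬 (Equiv.swap l o) := by
    rw [Tt_eq, mul_assoc _ _ (𝐱 l), h1, ← mul_assoc, ← mul_assoc, ← add_mul]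
    congr 1
    rw [mul_add, ← mul_assoc (𝐱 l), r, mul_assoc (𝐜 o), r1, (Serg.can ι a).c_anti _ _ h]; noncomm_ring
  rw [this, e]; noncomm_ring

lemma Xo_Sp {y : Serg ι a} (hy : y ∈ Sp o) : y * Xo o = Xo o * y := by
  induction hy using Algebra.adjoin_induction with
  | mem y hy =>
    rcases hy with ⟨w, hw, rfl⟩ | ⟨l, hl, rfl⟩ | ⟨l, hl, rfl⟩
    · rw [s_Xo, hw]
    · exact Xo_cl _ hl
    · exact Xo_xl _ hl
  | algebraMap r => rw [Algebra.commutes]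
  | add x y _ _ hx hy => rw [mul_add, add_mul, hx, hy]
  | mul x y _ _ hx hy => rw [mul_assoc, hy, ← mul_assoc, hx, mul_assoc]

lemma τ_Ent {i : ι} (u : Serg ι a) (h : i ≠ o) : τ ω o (Ent ω o i u) = τ ω o (Tt i o * u) := by
  have h1 := (Serg.can ι a).σ_c (Equiv.swap i o) i
  rw [Equiv.swap_apply_left] at h1
  rw [Ent_apply, En_apply, En_apply, map_sub, τ_ne2 _ _ h (τ_mem _ _ _), ← mul_assoc (𝐜 i),
    τ_ne _ _ h (Sp_c h) (τ_mem _ _ _), ← τ_left _ _ (Sp_c h), ← map_sub]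
  congr 1
  rw [← mul_assoc (𝐬 _), h1, Tt_eq, (Serg.can ι a).c_anti _ _ h.symm]; noncomm_ring

lemma τ_Ent_o (u : Serg ι a) : τ ω o (Ent ω o o u) = 0 := by
  have e : (𝐬 (Equiv.swap o o) : Serg ι a) = 1 := by rw [Equiv.swap_self]; exact map_one _
  rw [Ent_apply, En_apply, En_apply, e]; simp only [one_mul]
  rw [map_sub, τ_Sp _ _ (τ_mem _ _ _), τ_right _ _ (τ_mem _ _ _), τ_c]; simp

/-- KEY1a -/
lemma τ_Om (u : Serg ι a) : τ ω o (Om ω o u) = τ ω o (Lo o * u) := by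
  rw [Om_apply, map_sum, Lo, Finset.sum_mul, map_sum, ← Finset.add_sum_erase _ _ (Finset.mem_univ o), τ_Ent_o, zero_add]
  exact Finset.sum_congr rfl fun i hi => τ_Ent _ _ _ (Finset.ne_of_mem_erase hi)

lemma Ent_Sp {i : ι} (h : i ≠ o) {y : Serg ι a} (hy : y ∈ Sp o) : Ent ω o i y = Tt i o * y := by
  have h1 := (Serg.can ι a).σ_c (Equiv.swap i o) i
  rw [Equiv.swap_apply_left] at h1
  rw [Ent_apply, En_apply, En_apply, τ_ne2 _ _ h hy, τ_ne2 _ _ h (mul_mem (Sp_c h) hy), Tt_eq,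
    ← mul_assoc (𝐬 _), h1, (Serg.can ι a).c_anti _ _ h.symm]
  noncomm_ring
lemma Ent_Sp_o {y : Serg ι a} (hy : y ∈ Sp o) : Ent ω o o y = 0 := by
  have e : (𝐬 (Equiv.swap o o) : Serg ι a) = 1 := by rw [Equiv.swap_self]; exact map_one _
  rw [Ent_apply, En_apply, En_apply, e]; simp only [one_mul]
  rw [τ_Sp _ _ hy, τ_right _ _ hy, τ_c]; simp
/-- KEY2 -/
lemma Om_Sp {y : Serg ι a} (hy : y ∈ Sp o) : Om ω o y = Lo o * y := by
  rw [Om_apply, Lo, Finset.sum_mul, ← Finset.add_sum_erase _ _ (Finset.mem_univ o), Ent_Sp_o _ _ hy, zero_add]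
  exact Finset.sum_congr rfl fun i hi => Ent_Sp _ _ (Finset.ne_of_mem_erase hi) hy
end Tr
end

section
set_option linter.unusedSectionVars false
set_option linter.unusedSimpArgs false
set_option linter.unusedVariables false
namespace Tr
open SDM
variable {ι : Type} [DecidableEq ι] {a : ℂ} (ω : ℂ) (o : ι)
local notation "𝐬" => DFunLike.coe (SD.σ (Serg.can _ _))
local notation "𝐜" => SD.c (Serg.can _ _)
local notation "𝐱" => SD.x (Serg.can _ _)
variable [Fintype ι]

lemma Tt_mem {l i o : ι} (h : l ≠ o) (h' : i ≠ o) : (Tt l i : Serg ι a) ∈ Sp o := by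
  have : 𝐬 (Equiv.swap l i) ∈ Sp (a := a) o := Sp_σ (Equiv.swap_apply_of_ne_of_ne h.symm h'.symm)
  exact add_mem this (mul_mem (mul_mem (Sp_c h') this) (Sp_c h'))

variable {o} in
lemma Xo_split {i : ι} (h : i ≠ o) : ∃ Y ∈ Sp o, (Xo i : Serg ι a) = Y - Tt o i := by
  refine ⟨Xo i + Tt o i, ?_, by abel⟩
  rw [Xo, Lo, ← Finset.add_sum_erase _ _ (show o ∈ Finset.univ.erase i by simp [h.symm])]
  have : ∀ T S x : Serg ι a, x - (T + S) + T = x - S := fun _ _ _ => by abel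
  rw [this]
  refine sub_mem (Sp_x h) (sum_mem fun l hl => Tt_mem (Finset.ne_of_mem_erase hl) h)

lemma Tt_mono {l : ι} (h : l ≠ o) (α β) : τ ω o (Tt l o * mon o α β : Serg ι a) = τ ω o (mon o α β * Tt l o) := by
  have h1 := σ_mon (a := a) (Equiv.swap l o) o α β
  rw [Equiv.swap_apply_right] at h1
  have h1' := σ_mon (a := a) (Equiv.swap l o) l α β
  rw [Equiv.swap_apply_left] at h1'
  have h2 := (Serg.can ι a).σ_c (Equiv.swap l o) o
  rw [Equiv.swap_apply_right] at h2
  have h3 := (Serg.can ι a).σ_c (Equiv.swap l o) l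
  rw [Equiv.swap_apply_left] at h3
  have m := mon_Sp (a := a) o h α β
  have mc := Sp_c (a := a) h
  have e1 : (𝐜 o * 𝐬 (Equiv.swap l o) * 𝐜 o * mon o α β : Serg ι a) = ε (𝐜 l * mon l α β) * 𝐬 (Equiv.swap l o) * 𝐜 l := by
    rw [mul_assoc (𝐜 o), h2, mul_assoc _ _ (mon o α β), mul_assoc _ _ (mon o α β), h1, ← mul_assoc (𝐜 l), ← mul_assoc,
      c_Sp o (mul_mem mc m), mul_assoc, mul_assoc _ _ (𝐜 l), h3]
  have e2 : (mon o α β * (𝐜 o * 𝐬 (Equiv.swap l o) * 𝐜 o) : Serg ι a) = 𝐜 l * 𝐬 (Equiv.swap l o) * ε (mon l α β * 𝐜 l) := by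
    rw [← h3, mul_assoc _ (𝐜 l), ← mul_assoc, ← h1', mul_assoc, ← mul_assoc (mon l α β), mul_c_Sp o (mul_mem m mc),
      ← mul_assoc, h2]
  have e3 : (𝐬 (Equiv.swap l o) * mon o α β : Serg ι a) = mon l α β * 𝐬 (Equiv.swap l o) := h1
  rw [Tt, add_mul, mul_add, map_add, map_add, e1, e2, e3, ← h1', τ_ne1 _ _ h m, τ_ne2 _ _ h m,
    τ_ne _ _ h (ε_Sp o (mul_mem mc m)) mc, τ_ne _ _ h mc (ε_Sp o (mul_mem m mc)), map_mul ε, map_mul ε, ε_c]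
  noncomm_ring

lemma Xo_mono (α β) : τ ω o (Xo o * mon o α β : Serg ι a) = τ ω o (mon o α β * Xo o) := by
  rw [Xo, sub_mul, mul_sub, map_sub, map_sub, Lo, Finset.sum_mul, Finset.mul_sum, map_sum, map_sum]
  congr 1
  · have hx := (Serg.can ι a).x_sq o
    have hc := (Serg.can ι a).x_c o
    cases α <;> cases β <;> simp only [mon, if_true, if_false, one_mul, mul_one, Bool.false_eq_true]
    · rw [τ_xc, ← neg_neg (𝐜 o * 𝐱 o), ← hc, map_neg, τ_xc, neg_zero]
    · have e : (𝐱 o * 𝐜 o * 𝐱 o : Serg ι a) = - (𝐱 o * (𝐱 o * 𝐜 o)) := by rw [mul_assoc, ← mul_neg, hc, neg_neg]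
      rw [e, ← mul_assoc, hx, ← Algebra.smul_def, map_neg, map_smul, τ_c]; simp
  · exact Finset.sum_congr rfl fun l hl => Tt_mono _ _ (Finset.ne_of_mem_erase hl) _ _

/-- KEY1b -/
lemma τ_Xo (u : Serg ι a) : τ ω o (Xo o * u) = τ ω o (u * Xo o) := by
  refine Serg_ext o (f := τ ω o ∘ₗ LinearMap.mulLeft ℂ (Xo o)) (g := τ ω o ∘ₗ LinearMap.mulRight ℂ (Xo o)) ?_ ?_ u
  · intro α β y hy
    simp only [LinearMap.comp_apply, LinearMap.mulLeft_apply, LinearMap.mulRight_apply]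
    rw [mul_assoc _ y, Xo_Sp o hy, ← mul_assoc, ← mul_assoc, τ_right _ _ hy, τ_right _ _ hy, Xo_mono]
  · intro i hi y hy y' hy'
    simp only [LinearMap.comp_apply, LinearMap.mulLeft_apply, LinearMap.mulRight_apply]
    rw [mul_assoc _ y', Xo_Sp o hy', ← mul_assoc, ← mul_assoc, ← mul_assoc, ← Xo_Sp o hy,
      τ_right _ _ hy', τ_right _ _ hy', mul_assoc, mul_assoc, τ_left _ _ hy, τ_left _ _ hy]
    obtain ⟨Y, hY, e⟩ := Xo_split (a := a) hi
    have h1 := s_Xo (a := a) o (Equiv.swap i o)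
    have h2 := s_Xo (a := a) i (Equiv.swap i o)
    rw [Equiv.swap_apply_right] at h1
    rw [Equiv.swap_apply_left] at h2
    congr 2
    have hsq : (𝐬 (Equiv.swap o i) * 𝐬 (Equiv.swap i o) : Serg ι a) = 1 := by
      rw [Equiv.swap_comm o i, σσ, Equiv.swap_mul_self, map_one]
    have hsq' : (𝐬 (Equiv.swap i o) * 𝐬 (Equiv.swap o i) : Serg ι a) = 1 := by
      rw [Equiv.swap_comm o i, σσ, Equiv.swap_mul_self, map_one]
    have hc := (Serg.can ι a).σ_c (Equiv.swap i o) i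
    rw [Equiv.swap_apply_left] at hc
    have e2 : (𝐬 (Equiv.swap i o) * Tt o i : Serg ι a) = 1 + 𝐜 o * 𝐜 i := by
      rw [Tt, mul_add, hsq', ← mul_assoc, ← mul_assoc, hc, mul_assoc (𝐜 o), hsq', mul_one]
    rw [← h2, h1, e, mul_sub, sub_mul, Tt_eq, mul_assoc _ _ (𝐬 (Equiv.swap i o)), hsq, mul_one, ← Tt_eq, e2, map_sub, map_sub,
      τ_ne2 _ _ hi hY, τ_ne1 _ _ hi hY, map_add, map_add, τ_one, τ_left _ _ (Sp_c hi), τ_right _ _ (Sp_c hi), τ_c]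
    simp
end Tr
end

section
set_option linter.unusedSectionVars false
set_option linter.unusedSimpArgs false
set_option linter.unusedVariables false
namespace Tr
open SDM
variable {ι : Type} [DecidableEq ι] {a : ℂ} (ω : ℂ) (o : ι)
local notation "𝐬" => DFunLike.coe (SD.σ (Serg.can _ _))
local notation "𝐜" => SD.c (Serg.can _ _)
local notation "𝐱" => SD.x (Serg.can _ _)
variable [Fintype ι]

lemma En_rs (w : Equiv.Perm ι) (i : ι) (u : Serg ι a) : En ω o i (u * 𝐬 w) = En ω (w o) i u * 𝐬 w := by
  have h : 𝐬 (w * Equiv.swap i o * Equiv.swap i (w o)) ∈ Sp (a := a) (w o) := Sp_σ (by simp)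
  have hw : ∀ x : Serg ι a, τ ω o x = 𝐬 w⁻¹ * τ ω (w o) (𝐬 w * x * 𝐬 w⁻¹) * 𝐬 w := by
    intro x
    rw [← cj_apply, τ_cj, cj_apply, mul_assoc, mul_assoc, mul_assoc, s_inv', mul_one, ← mul_assoc, s_inv', one_mul]
  have e1 : (𝐬 w * (𝐬 (Equiv.swap i o) * (u * 𝐬 w)) * 𝐬 w⁻¹ : Serg ι a)
      = 𝐬 (w * Equiv.swap i o * Equiv.swap i (w o)) * (𝐬 (Equiv.swap i (w o)) * u) := by
    rw [← mul_assoc (𝐬 (w * _ * _)), σσ, mul_assoc (w * _), Equiv.swap_mul_self, mul_one, ← σσ]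
    simp only [mul_assoc, s_inv, mul_one]
  rw [En_apply, hw, e1, τ_left _ _ h, En_apply]
  simp only [← mul_assoc, σσ]
  congr 3
  simp

lemma Ent_form (i : ι) (u : Serg ι a) : Ent ω o i u = En ω o i u + En ω o i (u * 𝐜 o) * 𝐜 o := by
  rw [Ent_apply, c_En', En_c, ← En_ε, map_mul ε, ε_ε, ε_c, mul_neg, map_neg]; noncomm_ring

lemma Ent_rs (w : Equiv.Perm ι) (i : ι) (u : Serg ι a) : Ent ω o i (u * 𝐬 w) = Ent ω (w o) i u * 𝐬 w := by
  rw [Ent_form, Ent_form, En_rs, mul_assoc u, (Serg.can ι a).σ_c, ← mul_assoc, En_rs, mul_assoc _ _ (𝐜 o), 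
    (Serg.can ι a).σ_c, add_mul, mul_assoc]

lemma Om_rs (w : Equiv.Perm ι) (u : Serg ι a) : Om ω o (u * 𝐬 w) = Om ω (w o) u * 𝐬 w := by
  rw [Om_apply, Om_apply, Finset.sum_mul]
  exact Finset.sum_congr rfl fun i _ => Ent_rs _ _ _ _ _

section two
variable {o} {o' : ι} (hoo : o ≠ o')
include hoo

lemma tt : (𝐬 (Equiv.swap o o') * 𝐬 (Equiv.swap o o') : Serg ι a) = 1 := by rw [σσ, Equiv.swap_mul_self, map_one]

lemma τ_En_o (v : Serg ι a) : τ ω o (En ω o' o v) = τ ω o (v * 𝐬 (Equiv.swap o o')) := by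
  have h2 : (cj (Equiv.swap o o') (τ ω o' (𝐬 (Equiv.swap o o') * v)) : Serg ι a) ∈ Sp o := by
    have := cj_Sp o' (Equiv.swap o o') (τ_mem (a := a) ω o' (𝐬 (Equiv.swap o o') * v))
    rwa [Equiv.swap_apply_right] at this
  have e : (𝐬 (Equiv.swap o o') * τ ω o' (𝐬 (Equiv.swap o o') * v) : Serg ι a)
    = cj (Equiv.swap o o') (τ ω o' (𝐬 (Equiv.swap o o') * v)) * 𝐬 (Equiv.swap o o') := by
    rw [cj_apply, mul_assoc, s_inv', mul_one]
  rw [En_apply, e, τ_left _ _ h2, Equiv.swap_comm o o', τ_s _ _ hoo.symm, mul_one, Equiv.swap_comm o' o, ← τ_cjt _ hoo, cj_apply,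
    ← mul_assoc (𝐬 _), tt hoo, one_mul, Equiv.swap_inv]

lemma En_o_Sp {z : Serg ι a} (hz : z ∈ Sp o) : En ω o' o z = z * 𝐬 (Equiv.swap o o') := by
  have h2 : (cj (Equiv.swap o o') z : Serg ι a) ∈ Sp o' := by
    have := cj_Sp o (Equiv.swap o o') hz
    rwa [Equiv.swap_apply_left] at this
  have e : (𝐬 (Equiv.swap o o') * z : Serg ι a) = cj (Equiv.swap o o') z * 𝐬 (Equiv.swap o o') := by
    rw [cj_apply, mul_assoc, s_inv', mul_one]
  rw [En_apply, e, τ_left _ _ h2, τ_s _ _ hoo, mul_one, cj_apply, ← mul_assoc, ← mul_assoc, tt hoo, one_mul, Equiv.swap_inv]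

lemma τ_Ent2 (v : Serg ι a) : τ ω o (Ent ω o' o v) = τ ω o (v * Tt o o') := by
  rw [Ent_form, map_add, τ_right _ _ (Sp_c hoo.symm), τ_En_o _ hoo, τ_En_o _ hoo, ← τ_right _ _ (Sp_c hoo.symm), ← map_add, Tt]
  congr 1
  noncomm_ring
lemma Ent2_Sp {z : Serg ι a} (hz : z ∈ Sp o) : Ent ω o' o z = z * Tt o o' := by
  rw [Ent_form, En_o_Sp _ hoo hz, En_o_Sp _ hoo (mul_mem hz (Sp_c hoo.symm)), Tt]
  noncomm_ring

lemma τ_En3 {l : ι} (hl : l ≠ o) (v : Serg ι a) : τ ω o (En ω o' l v) = En ω o' l (τ ω o v) := by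
  have h : 𝐬 (Equiv.swap l o') ∈ Sp (a := a) o := Sp_σ (Equiv.swap_apply_of_ne_of_ne hl.symm hoo)
  rw [En_apply, τ_left _ _ h, τ_comm _ hoo, τ_left _ _ h, En_apply]
lemma τ_Ent3 {l : ι} (hl : l ≠ o) (v : Serg ι a) : τ ω o (Ent ω o' l v) = Ent ω o' l (τ ω o v) := by
  rw [Ent_form, map_add, τ_right _ _ (Sp_c hoo.symm), τ_En3 _ hoo hl, τ_En3 _ hoo hl, τ_right _ _ (Sp_c hoo.symm), Ent_form]

/-- KEY3 -/
lemma τ_key (v : Serg ι a) : τ ω o (Om ω o' v) - Om ω o' (τ ω o v) = τ ω o (v * Tt o o') - τ ω o v * Tt o o' := by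
  rw [Om_apply, Om_apply, map_sum, ← Finset.add_sum_erase _ _ (Finset.mem_univ o), 
    ← Finset.add_sum_erase _ (fun l => Ent ω o' l (τ ω o v)) (Finset.mem_univ o), τ_Ent2 _ hoo, Ent2_Sp _ hoo (τ_mem _ _ _),
    Finset.sum_congr rfl fun l hl => τ_Ent3 ω hoo (Finset.ne_of_mem_erase hl) v]
  abel

lemma En_key (i : ι) (v : Serg ι a) : En ω o i (Om ω o' v) - Om ω o' (En ω o i v) = En ω o i (v * Tt o o') - En ω o i v * Tt o o' := by
  rw [En_apply, En_apply, En_apply, ← s_Om, ← mul_sub, s_Om, τ_key _ hoo]; noncomm_ring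

lemma Ent_key (i : ι) (v : Serg ι a) : Ent ω o i (Om ω o' v) - Om ω o' (Ent ω o i v) = Ent ω o i (v * Tt o o') - Ent ω o i v * Tt o o' := by
  have h1 := En_key ω hoo i v
  have h2 := En_key ω hoo i (𝐜 i * v)
  rw [Ent_apply, Ent_apply, Ent_apply, map_sub, ← c_Om, ← mul_assoc (𝐜 i) v, c_Om, sub_mul]
  rw [← c_Om] at h2 ⊢
  have h3 : 𝐜 i * (En ω o i (𝐜 i * Om ω o' v) - Om ω o' (En ω o i (𝐜 i * v))) = 𝐜 i * (En ω o i (𝐜 i * v * Tt o o') - En ω o i (𝐜 i * v) * Tt o o') := by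
    rw [h2]
  rw [mul_sub, mul_sub] at h3
  rw [sub_eq_iff_eq_add] at h1 h3
  rw [h1, h3]; noncomm_ring

lemma Om_key (v : Serg ι a) : Om ω o (Om ω o' v) - Om ω o' (Om ω o v) = Om ω o (v * Tt o o') - Om ω o v * Tt o o' := by
  rw [Om_apply ω o, Om_apply ω o, Om_apply ω o, map_sum, Finset.sum_mul, ← Finset.sum_sub_distrib, ← Finset.sum_sub_distrib]
  exact Finset.sum_congr rfl fun i _ => Ent_key _ hoo _ _
end two

/-- the operator of x̄ -/
def Xb : Serg ι a →ₗ[ℂ] Serg ι a := - LinearMap.mulRight ℂ (Xo o) - Om ω o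
lemma Xb_apply (u : Serg ι a) : Xb ω o u = - (u * Xo o) - Om ω o u := rfl

lemma Xb_rs (w : Equiv.Perm ι) (u : Serg ι a) : Xb ω o (u * 𝐬 w) = Xb ω (w o) u * 𝐬 w := by
  rw [Xb_apply, Xb_apply, Om_rs, mul_assoc, s_Xo]; noncomm_ring
lemma s_Xb (w : Equiv.Perm ι) (u : Serg ι a) : 𝐬 w * Xb ω o u = Xb ω o (𝐬 w * u) := by
  rw [Xb_apply, Xb_apply, mul_sub, s_Om]; noncomm_ring
lemma c_Xb (i : ι) (u : Serg ι a) : 𝐜 i * Xb ω o u = Xb ω o (𝐜 i * u) := by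
  rw [Xb_apply, Xb_apply, mul_sub, c_Om]; noncomm_ring
lemma Xb_right (u : Serg ι a) {y : Serg ι a} (hy : y ∈ Sp o) : Xb ω o (u * y) = Xb ω o u * y := by
  rw [Xb_apply, Xb_apply, Om_right _ _ _ hy, mul_assoc, Xo_Sp o hy]; noncomm_ring
lemma Xb_ε (u : Serg ι a) : Xb ω o (ε u) = ε (Xb ω o u) := by
  rw [Xb_apply, Xb_apply, map_sub ε, map_neg ε, map_mul ε, ε_Xo, Om_ε]
lemma Xb_cb (u : Serg ι a) : Xb ω o (ε u * 𝐜 o) = - (ε (Xb ω o u) * 𝐜 o) := by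
  rw [Xb_apply, Xb_apply, map_sub ε, map_neg ε, map_mul ε, ε_Xo, Om_cb, mul_assoc, Xo_c]; noncomm_ring
lemma x_mixed (l : ι) (u : Serg ι a) : 𝐱 l * (Ent ω o l u + Xb ω o u) = Ent ω o l (𝐱 l * u) + Xb ω o (𝐱 l * u) := by
  have := x_Om ω o l u
  rw [Xb_apply, Xb_apply]
  have h2 : 𝐱 l * (Ent ω o l u + (-(u * Xo o) - Om ω o u)) = - (𝐱 l * (u * Xo o)) - 𝐱 l * (Om ω o u - Ent ω o l u) := by noncomm_ring
  rw [h2, this]; noncomm_ring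
lemma e_xsum (i : ι) (u : Serg ι a) : En ω o i (𝐱 i * u + Xb ω o u) = 0 := by
  have h1 := (Serg.can ι a).σ_x (Equiv.swap i o) i
  rw [Equiv.swap_apply_left] at h1
  rw [En_apply, mul_add, ← mul_assoc, h1, s_Xb, Xb_apply, map_add, map_sub, map_neg, τ_Om, ← τ_Xo, mul_assoc, Xo, sub_mul, map_sub]
  simp
lemma Xb_sy (i : ι) {y : Serg ι a} (hy : y ∈ Sp o) : Xb ω o (𝐬 (Equiv.swap i o) * y) = - (𝐱 i * (𝐬 (Equiv.swap i o) * y)) := by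
  rw [← s_Xb, Xb_apply, Xo_Sp o hy, Om_Sp _ _ hy, sio_x, Xo]; noncomm_ring
lemma Xb_y {y : Serg ι a} (hy : y ∈ Sp o) : Xb ω o y = - (𝐱 o * y) := by
  rw [Xb_apply, Xo_Sp o hy, Om_Sp _ _ hy, Xo]; noncomm_ring
lemma xsum_e (i : ι) (u : Serg ι a) : 𝐱 i * En ω o i u + Xb ω o (En ω o i u) = 0 := by
  obtain ⟨y, hy, e⟩ := En_form ω o i u
  rw [e, Xb_sy _ _ _ hy]; simp
lemma Om_x : Om ω o (𝐱 o : Serg ι a) = 𝐱 o * Lo o + algebraMap ℂ _ ω := by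
  have := x_Om (a := a) ω o o 1
  have e : (𝐬 (Equiv.swap o o) : Serg ι a) = 1 := by rw [Equiv.swap_self]; exact map_one _
  rw [Om_Sp ω o (one_mem _), Ent_Sp_o ω o (one_mem _), sub_zero, mul_one, mul_one, Ent_apply, En_apply, En_apply, e, one_mul, one_mul,
    one_mul, one_mul, τ_x] at this
  have h2 : τ ω o (𝐜 o * 𝐱 o : Serg ι a) = 0 := by
    rw [← neg_neg (𝐜 o * 𝐱 o : Serg ι a), ← (Serg.can ι a).x_c, map_neg, τ_xc, neg_zero]
  rw [h2, mul_zero, sub_zero, eq_sub_iff_add_eq] at this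
  exact this.symm
lemma Xb_xy {y : Serg ι a} (hy : y ∈ Sp o) : Xb ω o (𝐱 o * y) = - ((a + ω) • y) := by
  rw [Xb_right _ _ _ hy, Xb_apply, Om_x, Xo, mul_sub, (Serg.can ι a).x_sq, Algebra.smul_def, map_add]; noncomm_ring
lemma Xb_sq (u : Serg ι a) : Xb ω o (Xb ω o u) = (a + ω) • u := by
  have key : ∀ (i : ι) (α : Bool) (y : Serg ι a), y ∈ Sp o → Xb ω o (Xb ω o ((if α then 𝐱 i else 1) * (𝐬 (Equiv.swap i o) * y)))
      = (a + ω) • ((if α then 𝐱 i else 1) * (𝐬 (Equiv.swap i o) * y)) := by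
    intro i α y hy
    cases α
    · simp only [Bool.false_eq_true, if_false, one_mul]
      rw [← s_Xb, ← s_Xb, Xb_y _ _ hy, map_neg, Xb_xy _ _ hy]; simp
    · simp only [if_true]
      rw [sio_x, ← s_Xb, ← s_Xb, Xb_xy _ _ hy, map_neg, map_smul, Xb_y _ _ hy]; simp
  have h : u ∈ LinearMap.ker (Xb ω o ∘ₗ Xb ω o - (a + ω) • LinearMap.id) := by
    refine Serg_le3 o _ ?_ u
    intro i α β y hy
    have h := key i α y hy
    rw [LinearMap.mem_ker, LinearMap.sub_apply, sub_eq_zero]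
    simp only [LinearMap.comp_apply, LinearMap.smul_apply, LinearMap.id_apply, mon]
    have e : ((if α then 𝐱 i else 1) * (if β then 𝐜 i else 1) * 𝐬 (Equiv.swap i o) * y : Serg ι a)
      = (if α && β then (-1 : ℂ) else 1) • ((if β then 𝐜 i else 1) * ((if α then 𝐱 i else 1) * (𝐬 (Equiv.swap i o) * y))) := by
      have hc := (Serg.can ι a).x_c i
      cases α <;> cases β <;> simp [mul_assoc]
      rw [← mul_assoc, hc]; noncomm_ring
    rw [e, map_smul, map_smul]
    have h2 : Xb ω o (Xb ω o ((if β then 𝐜 i else 1) * ((if α then 𝐱 i else 1) * (𝐬 (Equiv.swap i o) * y))))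
      = (a + ω) • ((if β then 𝐜 i else 1) * ((if α then 𝐱 i else 1) * (𝐬 (Equiv.swap i o) * y))) := by
      cases β
      · simpa using h
      · simp only [if_true]
        rw [← c_Xb, ← c_Xb, h]; simp
    rw [h2, smul_comm]
  rw [LinearMap.mem_ker, LinearMap.sub_apply, sub_eq_zero] at h
  exact h

section two
variable {o} {o' : ι} (hoo : o ≠ o')
include hoo
lemma e_Xb' (i : ι) (u : Serg ι a) : En ω o i (Xb ω o' u) = Xb ω o' (En ω o i u) := by
  obtain ⟨Y, hY, e⟩ := Xo_split (a := a) hoo.symm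
  have := En_key ω hoo i u
  rw [sub_eq_iff_eq_add] at this
  rw [Xb_apply, Xb_apply, e, mul_sub, mul_sub, map_sub, map_neg, map_sub, this, En_right _ _ _ _ hY]; abel
lemma Xb_comm (u : Serg ι a) : Xb ω o (Xb ω o' u - u * Tt o o') = Xb ω o' (Xb ω o u) - Xb ω o u * Tt o o' := by
  obtain ⟨Y, hY, e⟩ := Xo_split (a := a) hoo.symm
  obtain ⟨Y2, hY2, e2⟩ := Xo_split (a := a) hoo
  have h1 : ∀ u : Serg ι a, Xb ω o' u - u * Tt o o' = - (u * Y) - Om ω o' u := by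
    intro u; rw [Xb_apply, e]; noncomm_ring
  rw [h1, h1, map_sub, map_neg, Xb_right _ _ _ hY, Xb_apply, Xb_apply]
  have h2 := Om_key ω hoo.symm u
  have h3 : Om ω o' (u * Xo o) = Om ω o' u * Xo o - Om ω o' (u * Tt o' o) + Om ω o' u * Tt o' o := by
    rw [e2, mul_sub, map_sub, Om_right _ _ _ hY2]; noncomm_ring
  rw [sub_eq_iff_eq_add] at h2
  rw [map_sub, map_neg, h2, h3]; noncomm_ring
end two
end Tr
end

section
set_option linter.unusedSectionVars false
set_option linter.unusedSimpArgs false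
set_option linter.unusedVariables false
namespace Tr
open SDM
variable {ι : Type} [DecidableEq ι] {a : ℂ} (ω : ℂ) (o : ι)
local notation "𝐬" => DFunLike.coe (SD.σ (Serg.can _ _))
local notation "𝐜" => SD.c (Serg.can _ _)
local notation "𝐱" => SD.x (Serg.can _ _)
variable [Fintype ι]
lemma e_s_e {i i' : ι} (hi : i ≠ o) (hi' : i' ≠ o) (h : i ≠ i') (u : Serg ι a) :
    En ω o i (𝐬 (Equiv.swap i i') * En ω o i u) = En ω o i u := by
  have e : Equiv.swap i o * Equiv.swap i i' * Equiv.swap i o = Equiv.swap i' o := by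
    have := Equiv.swap_apply_apply (Equiv.swap i o) i i'
    rw [Equiv.swap_apply_left, Equiv.swap_apply_of_ne_of_ne h.symm hi', Equiv.swap_inv] at this
    rw [← this, Equiv.swap_comm]
  rw [En_apply ω o i u, En_apply]
  rw [← mul_assoc (𝐬 _), ← mul_assoc (𝐬 _ * 𝐬 _), σσ, σσ, e, τ_ne2 _ _ hi' (τ_mem _ _ _)]
lemma e_sb_e {i o' : ι} (hoo : o ≠ o') (u : Serg ι a) :
    En ω o i (En ω o i u * 𝐬 (Equiv.swap o o')) = En ω o i u := by
  have e : (𝐬 (Equiv.swap i o) * 𝐬 (Equiv.swap i o) : Serg ι a) = 1 := by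
    rw [σσ, Equiv.swap_mul_self, map_one]
  rw [En_apply ω o i u, En_apply, ← mul_assoc, ← mul_assoc, e, one_mul, Equiv.swap_comm o o',
    τ_ne1 _ _ hoo.symm (τ_mem _ _ _)]
section br
variable {o} {o' i i' : ι} (hoo : o ≠ o') (hi : i ≠ o) (hi' : i' ≠ o) (h2 : i ≠ o') (h2' : i' ≠ o') (h : i ≠ i')
include hoo hi hi' h2 h2' h
lemma F_form (u : Serg ι a) : En ω o i (𝐬 (Equiv.swap i i') * (En ω o i u * 𝐬 (Equiv.swap o o')))
    = 𝐬 (Equiv.swap i o * Equiv.swap i' o') * τ ω o' (τ ω o (𝐬 (Equiv.swap i o * Equiv.swap i' o') * u)) := by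
  have e : Equiv.swap i o * Equiv.swap i i' * Equiv.swap i o = Equiv.swap i' o := by
    have := Equiv.swap_apply_apply (Equiv.swap i o) i i'
    rw [Equiv.swap_apply_left, Equiv.swap_apply_of_ne_of_ne h.symm hi', Equiv.swap_inv] at this
    rw [← this, Equiv.swap_comm]
  have e2 : Equiv.swap i o * Equiv.swap i' o' = Equiv.swap i' o' * Equiv.swap i o := by
    have := Equiv.mul_swap_eq_swap_mul (Equiv.swap i o) i' o'
    rwa [Equiv.swap_apply_of_ne_of_ne h.symm hi', Equiv.swap_apply_of_ne_of_ne h2.symm hoo.symm] at this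
  have h3 : (𝐬 (Equiv.swap i' o') : Serg ι a) ∈ Sp o := Sp_σ (Equiv.swap_apply_of_ne_of_ne hi'.symm hoo)
  rw [En_apply ω o i u, En_apply]
  rw [← mul_assoc (𝐬 (Equiv.swap i o)), ← mul_assoc (𝐬 _ * 𝐬 _), ← mul_assoc (𝐬 _ * 𝐬 _), σσ, σσ, e,
    τ_G ω hoo hi' h2' (τ_mem _ _ _), ← mul_assoc, σσ, ← τ_left ω o h3, ← mul_assoc, σσ, e2]
lemma h_conj : Equiv.swap i o * Equiv.swap i' o' * Equiv.swap i i' = Equiv.swap o o' * (Equiv.swap i o * Equiv.swap i' o') := by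
  have := Equiv.mul_swap_eq_swap_mul (Equiv.swap i o * Equiv.swap i' o') i i'
  rw [Equiv.Perm.mul_apply, Equiv.Perm.mul_apply, Equiv.swap_apply_left, Equiv.swap_apply_of_ne_of_ne h h2,
    Equiv.swap_apply_left, Equiv.swap_apply_of_ne_of_ne h2.symm hoo.symm] at this
  exact this
lemma br1 (u : Serg ι a) : En ω o i (𝐬 (Equiv.swap i i') * (En ω o i (𝐬 (Equiv.swap i i') * u) * 𝐬 (Equiv.swap o o')))
   = En ω o i (𝐬 (Equiv.swap i i') * (En ω o i (u * 𝐬 (Equiv.swap o o')) * 𝐬 (Equiv.swap o o'))) := by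
  rw [F_form ω hoo hi hi' h2 h2' h, F_form ω hoo hi hi' h2 h2' h, ← mul_assoc, σσ, h_conj hoo hi hi' h2 h2' h, ← σσ (Equiv.swap o o'), mul_assoc (𝐬 (Equiv.swap o o')),
    ττ_t ω hoo, mul_assoc (𝐬 _) u]
lemma br2 (u : Serg ι a) : 𝐬 (Equiv.swap i i') * En ω o i (𝐬 (Equiv.swap i i') * (En ω o i u * 𝐬 (Equiv.swap o o')))
   = En ω o i (𝐬 (Equiv.swap i i') * (En ω o i u * 𝐬 (Equiv.swap o o'))) * 𝐬 (Equiv.swap o o') := by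
  have e : Equiv.swap i i' * (Equiv.swap i o * Equiv.swap i' o') = Equiv.swap i o * Equiv.swap i' o' * Equiv.swap o o' := by
    have e2 : Equiv.swap i o * Equiv.swap i' o' = Equiv.swap i' o' * Equiv.swap i o := by
      have := Equiv.mul_swap_eq_swap_mul (Equiv.swap i o) i' o'
      rwa [Equiv.swap_apply_of_ne_of_ne h.symm hi', Equiv.swap_apply_of_ne_of_ne h2.symm hoo.symm] at this
    have := congrArg (fun w => w⁻¹) (h_conj hoo hi hi' h2 h2' h)
    simp only [mul_inv_rev, Equiv.swap_inv, ← e2] at this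
    exact this
  rw [F_form ω hoo hi hi' h2 h2' h, ← mul_assoc, σσ, e, ← σσ _ (Equiv.swap o o'), mul_assoc, Sp2_t (ττ_Sp2 ω hoo _), mul_assoc]
end br
end Tr
end

section
set_option linter.unusedSectionVars false
set_option linter.unusedSimpArgs false
set_option linter.unusedVariables false
namespace CN
variable {ι : Type} [DecidableEq ι] [Fintype ι]
def wt (q : ℂ) : Option ι → ℂ := fun i => i.elim q (fun _ => -1)
def QF (ι : Type) [DecidableEq ι] [Fintype ι] (q : ℂ) : QuadraticForm ℂ (Option ι → ℂ) := QuadraticMap.weightedSumSquares ℂ (wt q)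
abbrev Cl (ι : Type) [DecidableEq ι] [Fintype ι] (q : ℂ) := CliffordAlgebra (QF ι q)
def gen (q : ℂ) (i : Option ι) : Cl ι q := CliffordAlgebra.ι (QF ι q) (Pi.single i 1)
lemma QF_single (q : ℂ) (i : Option ι) : QF ι q (Pi.single i 1) = wt q i := by
  rw [QF, QuadraticMap.weightedSumSquares_apply, Finset.sum_eq_single i]
  · simp
  · intro j _ hj; simp [hj]
  · simp
lemma gen_sq (q : ℂ) (i : Option ι) : gen q i * gen q i = algebraMap ℂ _ (wt q i) := by
  rw [gen, CliffordAlgebra.ι_sq_scalar, QF_single]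
lemma gen_anti (q : ℂ) {i j : Option ι} (h : i ≠ j) : gen q i * gen q j = -(gen q j * gen q i) := by
  rw [eq_neg_iff_add_eq_zero, gen, gen, CliffordAlgebra.ι_mul_ι_add_swap, QuadraticMap.polar]
  have : QF ι q (Pi.single i 1 + Pi.single j 1) = wt q i + wt q j := by
    rw [QF, QuadraticMap.weightedSumSquares_apply]
    rw [← Finset.add_sum_erase _ _ (Finset.mem_univ i), ← Finset.add_sum_erase _ _ (Finset.mem_erase.2 ⟨h.symm, Finset.mem_univ j⟩), Finset.sum_eq_zero]
    · simp [h, h.symm]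
    · intro l hl; simp at hl; simp [hl.1, hl.2]
  rw [this, QF_single, QF_single]; simp
def pm (q : ℂ) (w : Equiv.Perm ι) : Cl ι q →ₐ[ℂ] Cl ι q :=
  CliffordAlgebra.lift (QF ι q) ⟨(CliffordAlgebra.ι (QF ι q)).comp (LinearMap.funLeft ℂ ℂ (Option.map (w⁻¹ : Equiv.Perm ι))), by
    intro m
    rw [LinearMap.comp_apply, CliffordAlgebra.ι_sq_scalar]
    congr 1
    rw [QF, QuadraticMap.weightedSumSquares_apply, QuadraticMap.weightedSumSquares_apply]
    rw [Fintype.sum_option, Fintype.sum_option]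
    congr 1
    rw [← Equiv.sum_comp w]
    simp [LinearMap.funLeft, wt]⟩
lemma cl_ext {q : ℂ} {B : Type} [Ring B] [Algebra ℂ B] {f g : Cl ι q →ₐ[ℂ] B} (h : ∀ i, f (gen q i) = g (gen q i)) : f = g := by
  refine CliffordAlgebra.hom_ext ?_
  refine LinearMap.pi_ext' fun i => ?_
  refine LinearMap.ext_ring ?_
  exact h i
lemma pm_gen (q : ℂ) (w : Equiv.Perm ι) (i : Option ι) : pm q w (gen q i) = gen q (i.map w) := by
  rw [gen, pm, CliffordAlgebra.lift_ι_apply, LinearMap.comp_apply, gen]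
  congr 1
  funext j
  simp only [LinearMap.funLeft_apply, Pi.single_apply]
  congr 1
  cases i <;> cases j <;> simp [Equiv.eq_symm_apply, eq_comm]
def ev (q : ℂ) : Cl ι q →ₐ[ℂ] Cl ι q := CliffordAlgebra.involute
lemma ev_gen (q : ℂ) (i : Option ι) : ev q (gen q i) = - gen q i := CliffordAlgebra.involute_ι _
lemma ev_ev (q : ℂ) (u : Cl ι q) : ev q (ev q u) = u := CliffordAlgebra.involute_involute u
lemma pm_ev (q : ℂ) (w : Equiv.Perm ι) (u : Cl ι q) : pm q w (ev q u) = ev q (pm q w u) := by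
  have : (pm q w).comp (ev q) = (ev q).comp (pm q w) := by
    refine cl_ext fun i => ?_
    simp [pm_gen, ev_gen]
  exact DFunLike.congr_fun this u
lemma gen_ind {q : ℂ} (P : Cl ι q → Prop) (h0 : ∀ r, P (algebraMap ℂ _ r)) (hg : ∀ i, P (gen q i)) (ha : ∀ u v, P u → P v → P (u+v))
    (hm : ∀ u v, P u → P v → P (u*v)) (u) : P u := by
  refine CliffordAlgebra.induction (C := P) h0 ?_ hm ha u
  intro m
  rw [← Finset.univ_sum_single m, map_sum]
  refine Finset.sum_induction _ P ha (by simpa using h0 0) ?_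
  intro i _
  have : (Pi.single i (m i) : Option ι → ℂ) = m i • Pi.single i 1 := by
    rw [← Pi.single_smul]; simp
  rw [this, map_smul, Algebra.smul_def]
  exact hm _ _ (h0 _) (hg i)
lemma pm_swap (q : ℂ) {i j : ι} (h : i ≠ j) (u : Cl ι q) :
    (gen q (some i) - gen q (some j)) * ev q u = pm q (Equiv.swap i j) u * (gen q (some i) - gen q (some j)) := by
  have hij : some i ≠ some j := by simpa using h
  refine gen_ind (fun u => (gen q (some i) - gen q (some j)) * ev q u = pm q (Equiv.swap i j) u * (gen q (some i) - gen q (some j))) ?_ ?_ ?_ ?_ u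
  · intro r; simp [Algebra.commutes]
  · intro l
    simp only [ev_gen, pm_gen]
    have hi := gen_sq q (some i)
    have hj := gen_sq q (some j)
    have ha := gen_anti q hij
    simp only [wt, Option.elim] at hi hj
    by_cases h1 : l = some i
    · subst h1
      simp only [Option.map_some, Equiv.swap_apply_left]
      simp only [sub_mul, mul_sub, mul_neg, hi, hj, ha]; abel
    by_cases h2 : l = some j
    · subst h2
      simp only [Option.map_some, Equiv.swap_apply_right]
      simp only [sub_mul, mul_sub, mul_neg, hi, hj, ha]; abel
    have : l.map (Equiv.swap i j) = l := by
      cases l with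
      | none => rfl
      | some l => simp at h1 h2; simp [Equiv.swap_apply_of_ne_of_ne h1 h2]
    rw [this]
    simp only [sub_mul, mul_sub, mul_neg, gen_anti q h1, gen_anti q h2]; abel
  · intro u v hu hv; simp only [map_add, mul_add, add_mul, hu, hv]
  · intro u v hu hv; simp only [map_mul]; rw [← mul_assoc, hu, mul_assoc, hv, mul_assoc]
def pmH (q : ℂ) : Equiv.Perm ι →* Module.End ℂ (Cl ι q) where
  toFun w := (pm q w).toLinearMap
  map_one' := by
    have : pm q (1 : Equiv.Perm ι) = AlgHom.id ℂ _ := cl_ext fun i => by cases i <;> simp [pm_gen]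
    rw [this]; rfl
  map_mul' w w' := by
    have : pm q (w * w') = (pm q w).comp (pm q w') := cl_ext fun i => by cases i <;> simp [pm_gen]
    rw [this]; rfl
/-- explicit data on the Clifford algebra -/
def xo (al : ℂ) (i : ι) : Module.End ℂ (Cl ι (-al)) :=
  (-al) • (LinearMap.mulLeft ℂ (gen _ (some i)) * LinearMap.mulRight ℂ (gen _ (some i)) * (ev _).toLinearMap)
   + LinearMap.mulLeft ℂ (gen _ (some i) * gen _ none)
lemma xo_a (al : ℂ) (i : ι) (u) : xo al i u = (-al) • (gen _ (some i) * (ev _ u * gen _ (some i))) + gen _ (some i) * gen _ none * u := by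
  simp [xo, mul_assoc]
lemma xc_aux {R : Type} [Ring R] [Algebra ℂ R] (al : ℂ) (c f u : R) (hc : c * c = -1) (hf : f * f = algebraMap ℂ R (-al)) (hcf : f * c = -(c*f)) 
   {c' v} (h1 : c * c' = - (c' * c)) (h2 : f * c' = - (c' * f)) :
   (-al) • (c * (-c' * v * c)) + c * f * (c' * u) = c' * ((-al) • (c * (v * c)) + c * f * u) := by
  have e1 : c * (-c' * v * c) = c' * (c * (v * c)) := by
    simp only [← mul_assoc, mul_neg, neg_mul]; rw [h1]; simp
  have e2 : c * f * (c' * u) = c' * (c * f * u) := by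
    have : c * f * c' = c' * (c * f) := by rw [mul_assoc, h2, mul_neg, ← mul_assoc, h1]; simp [mul_assoc]
    rw [← mul_assoc, this, mul_assoc]
  rw [e1, e2, mul_add, mul_smul_comm]
lemma xx_aux {R : Type} [Ring R] [Algebra ℂ R] (al : ℂ) (c d f u v S T: R) (hc : c * c = -1) (hd : d * d = -1) (hf : f * f = algebraMap ℂ R (-al))
   (hcf : f * c = -(c*f)) (hdf : f * d = -(d*f)) (hdc : d * c = -(c*d)) (hT : T * (c - d) = (c - d) * u) :
   (-al) • (c * (((-al) • (-d * (u * -d)) + -d * -f * v) * c)) + c * f * ((-al) • (d * (v * d)) + d * f * u)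
   = (-al) • (d * (((-al) • (-c * (u * -c)) + -c * -f * v) * d)) + d * f * ((-al) • (c * (v * c)) + c * f * u)
    + ((-al) • (c * (T * c)) + c * f * S - ((-al) • (d * (T * d)) + d * f * S) + c * (d * ((-al) • (c * (T * c)) + c * f * S + ((-al) • (d * (T * d)) + d * f * S)))) := by
  have hTd : T * d = T * c - (c - d) * u := by rw [← hT]; noncomm_ring
  have hf' : ∀ y, f * (f * y) = (-al) • y := fun y => by rw [← mul_assoc, hf, Algebra.smul_def]
  have hcf' : ∀ y, f * (c * y) = - (c * (f * y)) := fun y => by rw [← mul_assoc, hcf, neg_mul, mul_assoc]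
  have hdf' : ∀ y, f * (d * y) = - (d * (f * y)) := fun y => by rw [← mul_assoc, hdf, neg_mul, mul_assoc]
  have hdc' : ∀ y, d * (c * y) = - (c * (d * y)) := fun y => by rw [← mul_assoc, hdc, neg_mul, mul_assoc]
  have hc' : ∀ y, c * (c * y) = - y := fun y => by rw [← mul_assoc, hc]; simp
  have hd' : ∀ y, d * (d * y) = - y := fun y => by rw [← mul_assoc, hd]; simp
  simp only [hTd, mul_add, add_mul, mul_sub, sub_mul, mul_neg, neg_mul, mul_assoc, hf', hcf', hdf', hdc', hc', hd', hdc, smul_neg, smul_add, smul_sub,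
    mul_smul_comm, smul_mul_assoc, neg_neg, neg_smul, neg_sub]
  module
def sd (al : ℂ) : SD ι (al * al - al) (Module.End ℂ (Cl ι (-al))) := by
  have hsq : ∀ i : ι, gen (-al) (some i) * gen (-al) (some i) = -1 := fun i => by rw [gen_sq]; simp [wt]
  have hf : gen (-al) (none : Option ι) * gen (-al) none = algebraMap ℂ _ (-al) := by rw [gen_sq]; rfl
  have hcf : ∀ i : ι, gen (-al) none * gen (-al) (some i) = - (gen (-al) (some i) * gen (-al) none) := fun i => gen_anti _ (by simp)
  have hcc : ∀ i j : ι, i ≠ j → gen (-al) (some i) * gen (-al) (some j) = - (gen (-al) (some j) * gen (-al) (some i)) := fun i j h => gen_anti _ (by simpa using h)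
  refine ⟨pmH (-al), fun i => LinearMap.mulLeft ℂ (gen _ (some i)), xo al, ?_, ?_, ?_, ?_, ?_, ?_, ?_, ?_⟩
  · intro i; ext u; simp [← mul_assoc, hsq]
  · intro i j h; ext u; simp [← mul_assoc, hcc i j h]
  · intro w i; ext u; simp [pmH, pm_gen]
  · intro w i; ext u; simp [pmH, pm_gen, xo_a, pm_ev]
  · intro i
    ext u
    have hc' : ∀ y, gen (-al) (some i) * (gen (-al) (some i) * y) = - y := fun y => by rw [← mul_assoc, hsq]; simp
    have hcf' : ∀ y, gen (-al) none * (gen (-al) (some i) * y) = - (gen (-al) (some i) * (gen (-al) none * y)) := fun y => by rw [← mul_assoc, hcf, neg_mul, mul_assoc]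
    have hf' : ∀ y, gen (-al) (none : Option ι) * (gen (-al) none * y) = (-al) • y := fun y => by rw [← mul_assoc, hf, Algebra.smul_def]
    rw [Module.End.mul_apply, xo_a, xo_a]
    simp only [map_add, map_neg, map_smul, map_mul, ev_gen, ev_ev, mul_add, add_mul, mul_neg, neg_mul, mul_assoc, hf', hcf', hc', hsq, smul_neg, smul_add,
      mul_smul_comm, smul_mul_assoc, neg_neg, neg_smul, Module.algebraMap_end_apply, mul_one]
    module
  · intro i
    ext u
    have hc' : ∀ y, gen (-al) (some i) * (gen (-al) (some i) * y) = - y := fun y => by rw [← mul_assoc, hsq]; simp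
    have hcf' : ∀ y, gen (-al) none * (gen (-al) (some i) * y) = - (gen (-al) (some i) * (gen (-al) none * y)) := fun y => by rw [← mul_assoc, hcf, neg_mul, mul_assoc]
    simp only [LinearMap.neg_apply, Module.End.mul_apply, xo_a, LinearMap.mulLeft_apply]
    simp only [map_add, map_neg, map_smul, map_mul, ev_gen, ev_ev, mul_add, add_mul, mul_neg, neg_mul, mul_assoc, hcf', hc', hsq, smul_neg, smul_add,
      mul_smul_comm, smul_mul_assoc, neg_neg, neg_smul]
    module
  · intro i j h
    ext u
    simp only [Module.End.mul_apply, xo_a, LinearMap.mulLeft_apply, map_mul, ev_gen]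
    exact xc_aux al _ _ _ (hsq i) hf (hcf i) (hcc i j h) (hcf j)
  · intro i j h
    ext u
    simp only [Module.End.mul_apply, LinearMap.add_apply, LinearMap.sub_apply, xo_a, LinearMap.mulLeft_apply]
    simp only [map_add, map_smul, map_mul, ev_gen, ev_ev]
    refine xx_aux al _ _ _ u (ev _ u) _ _ (hsq i) (hsq j) hf (hcf i) (hcf j) (hcc j i h.symm) ?_
    have := congrArg (ev (-al)) (pm_swap (-al) h u)
    simp only [map_mul, map_sub, ev_gen, ev_ev] at this
    change ev _ (pm _ _ u) * _ = _
    have e : -(gen (-al) (some i) : Cl ι (-al)) - -gen (-al) (some j) = -(gen (-al) (some i) - gen (-al) (some j)) := by abel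
    rw [e, neg_mul, mul_neg, neg_inj] at this
    exact this.symm
lemma serg_nontrivial (a : ℂ) : Nontrivial (Serg ι a) := by
  obtain ⟨s, hs⟩ := IsAlgClosed.exists_pow_nat_eq (1 + 4 * a) (n := 2) (by norm_num)
  have ha : a = ((1 + s) / 2) * ((1 + s) / 2) - ((1 + s) / 2) := by linear_combination (-1/4) * hs
  rw [ha]
  have : Nontrivial (Cl ι (-((1+s)/2))) := inferInstance
  exact (Serg.lift (sd (ι := ι) ((1 + s) / 2))).toRingHom.domain_nontrivial
end CN
end

section
set_option linter.unusedSectionVars false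
set_option linter.unusedSimpArgs false
set_option linter.unusedVariables false
namespace Tr
open SDM
variable {ι : Type} [DecidableEq ι] {a : ℂ} (ω : ℂ) (o : ι)
local notation "𝐬" => DFunLike.coe (SD.σ (Serg.can _ _))
local notation "𝐜" => SD.c (Serg.can _ _)
local notation "𝐱" => SD.x (Serg.can _ _)
lemma π_monσ (i : ι) (α β) : π o (mon i α β * 𝐬 (Equiv.swap i o) : Serg ι a) = br i α β 1 := by
  have h : (mon i α β * 𝐬 (Equiv.swap i o) : Serg ι a) = 𝐬 (Equiv.swap i o) * mon o α β := by
    rw [σ_mon, Equiv.swap_apply_right]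
  rw [h, π_left, π_mono, ρ_σ, Sop_br, Equiv.swap_apply_right, Equiv.swap_mul_self, one_mul, Equiv.swap_self]
  show br i α β ((Serg.can ι a).σ 1 * 1) = _
  rw [map_one, mul_one]
/-- the subalgebra supported on `J` -/
def SJ (a : ℂ) (J : Finset ι) : Subalgebra ℂ (Serg ι a) := Algebra.adjoin ℂ
  {u | (∃ w : Equiv.Perm ι, (∀ i ∉ J, w i = i) ∧ u = (Serg.can ι a).σ w) ∨ ∃ i ∈ J, u = (Serg.can ι a).c i ∨ u = (Serg.can ι a).x i}
lemma SJ_Sp {J : Finset ι} (h : o ∉ J) : SJ a J ≤ Sp o := by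
  refine Algebra.adjoin_le ?_
  rintro u (⟨w, hw, rfl⟩ | ⟨i, hi, rfl | rfl⟩)
  · exact Sp_σ (hw o h)
  · exact Sp_c (fun hc => h (hc ▸ hi))
  · exact Sp_x (fun hc => h (hc ▸ hi))
lemma SJ_σ {J : Finset ι} {w : Equiv.Perm ι} (h : ∀ i ∉ J, w i = i) : (Serg.can ι a).σ w ∈ SJ a J :=
  Algebra.subset_adjoin (Or.inl ⟨w, h, rfl⟩)
lemma SJ_mono {J J' : Finset ι} (h : J ⊆ J') : SJ a J ≤ SJ a J' := by
  refine Algebra.adjoin_mono ?_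
  rintro u (⟨w, hw, rfl⟩ | ⟨i, hi, h1⟩)
  · exact Or.inl ⟨w, fun i hi => hw i (fun hc => hi (h hc)), rfl⟩
  · exact Or.inr ⟨i, h hi, h1⟩
lemma SJ_mon {J : Finset ι} {i} (h : i ∈ J) (α β) : (mon i α β : Serg ι a) ∈ SJ a J := by
  have hc : (Serg.can ι a).c i ∈ SJ a J := Algebra.subset_adjoin (Or.inr ⟨i, h, Or.inl rfl⟩)
  have hx : (Serg.can ι a).x i ∈ SJ a J := Algebra.subset_adjoin (Or.inr ⟨i, h, Or.inr rfl⟩)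
  unfold mon
  cases α <;> cases β <;> simp <;> first | exact one_mem _ | exact hc | exact hx | exact mul_mem hx hc
lemma SJ_indep [Fintype ι] (J : Finset ι) : ∃ (K : Type) (_ : Fintype K) (v : K → Serg ι a), Fintype.card K = 4 ^ J.card * J.card.factorial
    ∧ (∀ k, v k ∈ SJ a J) ∧ LinearIndependent ℂ v := by
  induction J using Finset.induction_on with
  | empty =>
    refine ⟨Unit, inferInstance, fun _ => 1, by simp, fun _ => one_mem _, ?_⟩
    refine LinearIndependent.of_subsingleton () ?_
    have := CN.serg_nontrivial (ι := ι) a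
    exact one_ne_zero
  | insert o J ho ih =>
    obtain ⟨K, hK, v, h1, h2, h3⟩ := ih
    refine ⟨(↥(insert o J) × Bool × Bool) × K, inferInstance,
      fun q => mon (q.1.1 : ι) q.1.2.1 q.1.2.2 * (Serg.can ι a).σ (Equiv.swap (q.1.1 : ι) o) * v q.2, ?_, ?_, ?_⟩
    · rw [Fintype.card_prod, Fintype.card_prod, Fintype.card_prod, Fintype.card_coe, Fintype.card_bool, h1, Finset.card_insert_of_notMem ho, Nat.factorial_succ, pow_succ]; ring
    · rintro ⟨⟨⟨i, hi⟩, α, β⟩, q⟩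
      refine mul_mem (mul_mem (SJ_mon hi _ _) (SJ_σ ?_)) (SJ_mono (Finset.subset_insert _ _) (h2 q))
      intro j hj
      refine Equiv.swap_apply_of_ne_of_ne ?_ ?_
      · rintro rfl; exact hj hi
      · rintro rfl; exact hj (Finset.mem_insert_self _ _)
    · refine LinearIndependent.of_comp (π o) ?_
      have e : (π o ∘ fun q : (↥(insert o J) × Bool × Bool) × K => mon (q.1.1 : ι) q.1.2.1 q.1.2.2 * (Serg.can ι a).σ (Equiv.swap (q.1.1 : ι) o) * v q.2)
        = (fun ix : Σ _ : ι × Bool × Bool, K => Finsupp.single ix.1 (v ix.2)) ∘ (fun q => ⟨((q.1.1 : ι), q.1.2.1, q.1.2.2), q.2⟩) := by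
        funext q
        simp only [Function.comp]
        rw [π_mul o _ (SJ_Sp o ho (h2 q.2)), π_monσ, Rt_br, one_mul]; rfl
      rw [e]
      refine LinearIndependent.comp (Finsupp.linearIndependent_single (fun _ => v) (fun _ => h3)) _ ?_
      rintro ⟨⟨⟨i, hi⟩, α, β⟩, q⟩ ⟨⟨⟨i', hi'⟩, α', β'⟩, q'⟩ h
      simp at h
      obtain ⟨⟨rfl, rfl, rfl⟩, rfl⟩ := h
      rfl
lemma serg_dim [Fintype ι] (N : Submodule ℂ (Serg ι a)) [Module.Finite ℂ N] (h : N = ⊤) :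
    4 ^ Fintype.card ι * (Fintype.card ι).factorial ≤ Module.finrank ℂ N := by
  obtain ⟨K, hK, v, h1, h2, h3⟩ := SJ_indep (a := a) (Finset.univ : Finset ι)
  subst h
  have h4 : LinearIndependent ℂ (fun k => (⟨v k, trivial⟩ : (⊤ : Submodule ℂ (Serg ι a)))) :=
    LinearIndependent.of_comp (⊤ : Submodule ℂ (Serg ι a)).subtype h3
  have := h4.fintype_card_le_finrank
  rwa [h1, Finset.card_univ] at this
end Tr
end

section
set_option linter.unusedSectionVars false
set_option linter.unusedSimpArgs false
set_option linter.unusedVariables false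
namespace Tr
open SDM
variable {ι : Type} [DecidableEq ι] {a : ℂ} (ω : ℂ) (o : ι)
local notation "𝐬" => DFunLike.coe (SD.σ (Serg.can _ _))
local notation "𝐜" => SD.c (Serg.can _ _)
local notation "𝐱" => SD.x (Serg.can _ _)
section rep
variable {k : ℕ}
abbrev IK (k : ℕ) : Type := Fin k ⊕ Fin k
abbrev PK (k : ℕ) (a : ℂ) : Type := Serg (IK k) a
def il (w : Equiv.Perm (Fin k)) : Equiv.Perm (IK k) := Equiv.Perm.sumCongrHom _ _ (w, 1)
def ir (w : Equiv.Perm (Fin k)) : Equiv.Perm (IK k) := Equiv.Perm.sumCongrHom _ _ (1, w)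
@[simp] lemma il_l (w : Equiv.Perm (Fin k)) (i) : il w (Sum.inl i) = Sum.inl (w i) := rfl
@[simp] lemma il_r (w : Equiv.Perm (Fin k)) (i) : il w (Sum.inr i) = Sum.inr i := rfl
@[simp] lemma ir_l (w : Equiv.Perm (Fin k)) (i) : ir w (Sum.inl i) = Sum.inl i := rfl
@[simp] lemma ir_r (w : Equiv.Perm (Fin k)) (i) : ir w (Sum.inr i) = Sum.inr (w i) := rfl
lemma il_mul (w v : Equiv.Perm (Fin k)) : il (w * v) = il w * il v := by
  rw [il, il, il, ← map_mul]; simp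
lemma ir_mul (w v : Equiv.Perm (Fin k)) : ir (w * v) = ir w * ir v := by
  rw [ir, ir, ir, ← map_mul]; simp
lemma il_one : il (1 : Equiv.Perm (Fin k)) = 1 := map_one _
lemma ir_one : ir (1 : Equiv.Perm (Fin k)) = 1 := map_one _
lemma il_swap (i j : Fin k) : il (Equiv.swap i j) = Equiv.swap (Sum.inl i) (Sum.inl j) :=
  Equiv.Perm.sumCongr_swap_one i j
lemma ir_swap (i j : Fin k) : ir (Equiv.swap i j) = Equiv.swap (Sum.inr i) (Sum.inr j) :=
  Equiv.Perm.sumCongr_one_swap i j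
lemma ir_inv (w : Equiv.Perm (Fin k)) : ir w⁻¹ = (ir w)⁻¹ := by
  rw [eq_inv_iff_mul_eq_one, ← ir_mul, inv_mul_cancel, ir_one]
lemma il_inv (w : Equiv.Perm (Fin k)) : il w⁻¹ = (il w)⁻¹ := by
  rw [eq_inv_iff_mul_eq_one, ← il_mul, inv_mul_cancel, il_one]

abbrev EP (k : ℕ) (a : ℂ) : Type := Module.End ℂ (PK k a)
def oσ : Equiv.Perm (Fin k) →* EP k a where
  toFun w := LinearMap.mulLeft ℂ (𝐬 (il w))
  map_one' := by rw [il_one, map_one]; ext u; simp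
  map_mul' w v := by rw [il_mul, map_mul]; ext u; simp [mul_assoc]
lemma oσ_a (w : Equiv.Perm (Fin k)) (u : PK k a) : oσ w u = 𝐬 (il w) * u := rfl
def oσb : Equiv.Perm (Fin k) →* EP k a where
  toFun w := LinearMap.mulRight ℂ (𝐬 (ir w⁻¹))
  map_one' := by rw [inv_one, ir_one, map_one]; ext u; simp
  map_mul' w v := by rw [mul_inv_rev, ir_mul, map_mul]; ext u; simp [mul_assoc]
lemma oσb_a (w : Equiv.Perm (Fin k)) (u : PK k a) : oσb w u = u * 𝐬 (ir w⁻¹) := rfl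
def oc (i : Fin k) : EP k a := LinearMap.mulLeft ℂ (𝐜 (Sum.inl i))
lemma oc_a (i : Fin k) (u : PK k a) : oc i u = 𝐜 (Sum.inl i) * u := rfl
def ocb (i : Fin k) : EP k a := LinearMap.mulRight ℂ (𝐜 (Sum.inr i)) ∘ₗ (ε : PK k a →ₐ[ℂ] PK k a).toLinearMap
lemma ocb_a (i : Fin k) (u : PK k a) : ocb i u = ε u * 𝐜 (Sum.inr i) := rfl
def ox (i : Fin k) : EP k a := LinearMap.mulLeft ℂ (𝐱 (Sum.inl i))
lemma ox_a (i : Fin k) (u : PK k a) : ox i u = 𝐱 (Sum.inl i) * u := rfl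

lemma sw_eq {n a b : ℕ} (ha : a < n) (hb : b < n) : sw n a b = Equiv.swap ⟨a, ha⟩ ⟨b, hb⟩ := by
  simp [sw, ha, hb]
lemma s_c (w : Equiv.Perm ι) (i : ι) (u : Serg ι a) : 𝐬 w * (𝐜 i * u) = 𝐜 (w i) * (𝐬 w * u) := by
  rw [← mul_assoc, (Serg.can ι a).σ_c, mul_assoc]
lemma s_x (w : Equiv.Perm ι) (i : ι) (u : Serg ι a) : 𝐬 w * (𝐱 i * u) = 𝐱 (w i) * (𝐬 w * u) := by
  rw [← mul_assoc, (Serg.can ι a).σ_x, mul_assoc]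
lemma swap_fix {k i j l : ℕ} (hi : i < k) (hj : j < k) (hl : l < k) (h1 : l ≠ i) (h2 : l ≠ j) :
    Equiv.swap (⟨i, hi⟩ : Fin k) ⟨j, hj⟩ ⟨l, hl⟩ = ⟨l, hl⟩ :=
  Equiv.swap_apply_of_ne_of_ne (by simpa using h1) (by simpa using h2)

variable (a) in
/-- The representation of the walled Brauer-Clifford relations on `PK k a`. -/
def repW (hk : 2 ≤ k) : WBC ℂ (EP k a) k k where
  σ := oσ
  σb := oσb
  c := oc
  cb := ocb
  e := En ω (Sum.inr ⟨0, by omega⟩) (Sum.inl ⟨0, by omega⟩)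
  c_sq i := by
    refine LinearMap.ext fun u => ?_
    simp only [Module.End.mul_apply, oc_a, cc, LinearMap.neg_apply, Module.End.one_apply]
  c_anti i j h := by
    refine LinearMap.ext fun u => ?_
    simp only [Module.End.mul_apply, oc_a, LinearMap.neg_apply]
    exact cac (by simpa using h) u
  c_conj w i := by
    refine LinearMap.ext fun u => ?_
    simp only [Module.End.mul_apply, oc_a, oσ_a, s_c, il_l, il_inv]
    rw [← mul_assoc (𝐬 _), s_inv, one_mul]
  cb_sq i := by
    refine LinearMap.ext fun u => ?_
    simp only [Module.End.mul_apply, ocb_a, map_mul, ε_c, ε_ε, mul_assoc, Module.End.one_apply]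
    rw [neg_mul, (Serg.can _ _).c_sq]; simp
  cb_anti i j h := by
    refine LinearMap.ext fun u => ?_
    simp only [Module.End.mul_apply, ocb_a, map_mul, ε_c, ε_ε, mul_assoc, LinearMap.neg_apply]
    rw [neg_mul, (Serg.can _ _).c_anti _ _ (by simpa using (Ne.symm h))]; simp
  cb_conj w i := by
    refine LinearMap.ext fun u => ?_
    simp only [Module.End.mul_apply, ocb_a, oσb_a, map_mul, ε_s, mul_assoc, inv_inv, ir_inv]
    rw [← mul_assoc (𝐬 _), (Serg.can _ _).σ_c, mul_assoc, s_inv, mul_one, ir_r]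
  comm_σσb w v := by
    refine LinearMap.ext fun u => ?_
    simp only [Module.End.mul_apply, oσ_a, oσb_a, mul_assoc]
  comm_σcb w v := by
    refine LinearMap.ext fun u => ?_
    simp only [Module.End.mul_apply, oσ_a, ocb_a, mul_assoc, map_mul, ε_s]
  comm_σbc w v := by
    refine LinearMap.ext fun u => ?_
    simp only [Module.End.mul_apply, oc_a, oσb_a, mul_assoc]
  anti_ccb w v := by
    refine LinearMap.ext fun u => ?_
    simp only [Module.End.mul_apply, oc_a, ocb_a, mul_assoc, map_mul, ε_c, LinearMap.neg_apply]
    simp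
  e_c1 h1 h2 := by
    refine LinearMap.ext fun u => ?_
    simp only [Module.End.mul_apply, oc_a, ocb_a]
    exact En_c _ _ _ _
  c1_e h1 h2 := by
    refine LinearMap.ext fun u => ?_
    simp only [Module.End.mul_apply, oc_a, ocb_a]
    exact c_En' _ _ _ _
  e_sq := by
    refine LinearMap.ext fun u => ?_
    simp only [Module.End.mul_apply]
    exact En_En _ _ _ _
  e_s_e h := by
    refine LinearMap.ext fun u => ?_
    rw [sw_eq (by omega) h]
    simp only [Module.End.mul_apply, oσ_a, il_swap]
    exact e_s_e _ _ (by simp) (by simp) (by simp) _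
  e_sb_e h := by
    refine LinearMap.ext fun u => ?_
    rw [sw_eq (by omega) h]
    simp only [Module.End.mul_apply, oσb_a, ir_swap, Equiv.swap_inv]
    exact e_sb_e _ _ (by simp) _
  s_e_comm i h0 h1 := by
    refine LinearMap.ext fun u => ?_
    rw [sw_eq (by omega) h1]
    simp only [Module.End.mul_apply, oσ_a, s_En, il_l]
    rw [swap_fix _ _ _ (by omega) (by omega)]
  sb_e_comm i h0 h1 := by
    refine LinearMap.ext fun u => ?_
    rw [sw_eq (by omega) h1]
    simp only [Module.End.mul_apply, oσb_a]
    rw [En_right]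
    refine Sp_σ ?_
    rw [Equiv.swap_inv, ir_r, swap_fix _ _ _ (by omega) (by omega)]
  braid1 h h' := by
    refine LinearMap.ext fun u => ?_
    rw [sw_eq (by omega) h]
    simp only [Module.End.mul_apply, oσ_a, oσb_a, il_swap, ir_swap, Equiv.swap_inv]
    exact br1 _ (by simp) (by simp) (by simp) (by simp) (by simp) (by simp) _
  braid2 h h' := by
    refine LinearMap.ext fun u => ?_
    rw [sw_eq (by omega) h]
    simp only [Module.End.mul_apply, oσ_a, oσb_a, il_swap, ir_swap, Equiv.swap_inv]
    exact br2 _ (by simp) (by simp) (by simp) (by simp) (by simp) (by simp) _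
  c_e_comm i h := by
    refine LinearMap.ext fun u => ?_
    simp only [Module.End.mul_apply, oc_a]
    refine c_En _ _ ?_ _
    intro h'; apply h; rw [Sum.inl.inj h']
  cb_e_comm i h := by
    refine LinearMap.ext fun u => ?_
    simp only [Module.End.mul_apply, ocb_a]
    rw [En_right, En_ε]
    refine Sp_c ?_
    intro h'; apply h; rw [Sum.inr.inj h']
  e_c_e h := by
    refine LinearMap.ext fun u => ?_
    simp only [Module.End.mul_apply, oc_a]
    exact En_c_En _ _ _ _
  e_cb_e h := by
    refine LinearMap.ext fun u => ?_
    simp only [Module.End.mul_apply, ocb_a]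
    rw [← En_c, En_c_En]; rfl
end rep
end Tr
end

section
set_option linter.unusedSectionVars false
set_option linter.unusedSimpArgs false
set_option linter.unusedVariables false
namespace Tr
open SDM
variable {ι : Type} [DecidableEq ι] {a : ℂ} (ω : ℂ) (o : ι)
local notation "𝐬" => DFunLike.coe (SD.σ (Serg.can _ _))
local notation "𝐜" => SD.c (Serg.can _ _)
local notation "𝐱" => SD.x (Serg.can _ _)
section rep2
variable {k : ℕ}
lemma obar_even (f : ℕ → ℂ) (n : ℕ) : obar f (2 * n) = 0 := by simp [obar]
lemma obar_odd (f : ℕ → ℂ) (a : ℂ) (h : ∀ n, f (n + 2) = a * f n) (n : ℕ) :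
    obar f (2 * n + 1) = - (a + f 1) ^ n * f 1 := by
  have key : ∀ n, ∑ j ∈ Finset.range (n + 1), acoef f n j * f (2 * j + 1) = - (a + f 1) ^ n * f 1 := by
    intro n
    induction n with
    | zero => simp [acoef]
    | succ n ih =>
      rw [Finset.sum_range_succ']
      have e : ∀ j, acoef f (n + 1) (j + 1) * f (2 * (j + 1) + 1) = a * (acoef f n j * f (2 * j + 1)) := by
        intro j
        rw [show 2 * (j + 1) + 1 = 2 * j + 1 + 2 by ring, h, acoef]; ring
      rw [Finset.sum_congr rfl (fun j _ => e j), ← Finset.mul_sum, ih, acoef, ih]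
      simp only [mul_zero, zero_add]; ring
  have h1 : (2 * n + 1) % 2 = 1 := by omega
  have h2 : (2 * n + 1) / 2 = n := by omega
  rw [obar, h1, h2, key]; simp
lemma odd_seq (f : ℕ → ℂ) (a : ℂ) (h : ∀ n, f (n + 2) = a * f n) (n : ℕ) : f (2 * n + 1) = a ^ n * f 1 := by
  induction n with
  | zero => simp
  | succ n ih => rw [show 2 * (n + 1) + 1 = 2 * n + 1 + 2 by ring, h, ih]; ring
lemma even_seq (f : ℕ → ℂ) (a : ℂ) (h0 : f 0 = 0) (h : ∀ n, f (n + 2) = a * f n) (n : ℕ) : f (2 * n) = 0 := by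
  induction n with
  | zero => simpa
  | succ n ih => rw [show 2 * (n + 1) = 2 * n + 2 by ring, h, ih]; ring
lemma pow_even {B : Type} [Ring B] [Algebra ℂ B] {x : B} {b : ℂ} (h : x * x = algebraMap ℂ B b) (n : ℕ) :
    x ^ (2 * n) = algebraMap ℂ B (b ^ n) := by
  rw [pow_mul, pow_two, h, map_pow]
lemma pow_odd {B : Type} [Ring B] [Algebra ℂ B] {x : B} {b : ℂ} (h : x * x = algebraMap ℂ B b) (n : ℕ) :
    x ^ (2 * n + 1) = algebraMap ℂ B (b ^ n) * x := by
  rw [pow_succ, pow_even h]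

set_option maxHeartbeats 400000 in
def repA (hk : 2 ≤ k) (f : ℕ → ℂ) (h0 : f 0 = 0) (h : ∀ n, f (n + 2) = a * f n) : AWBC ℂ (EP k a) k k (f 1) where
  toWBC := repW a (f 1) hk
  x1 := ox ⟨0, by omega⟩
  xb1 := Xb (f 1) (Sum.inr ⟨0, by omega⟩)
  om n := algebraMap ℂ _ (f n)
  omb n := algebraMap ℂ _ (obar f n)
  om_one := rfl
  om_even n := by rw [even_seq f a h0 h, map_zero]
  omb_zero := by rw [show (0 : ℕ) = 2 * 0 from rfl, obar_even, map_zero]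
  om_comm n := ⟨fun _ => Algebra.commutes _ _, fun _ => Algebra.commutes _ _, fun _ => Algebra.commutes _ _,
    fun _ => Algebra.commutes _ _, Algebra.commutes _ _, Algebra.commutes _ _, Algebra.commutes _ _,
    fun _ => Algebra.commutes _ _, fun _ => Algebra.commutes _ _⟩
  omb_comm n := ⟨fun _ => Algebra.commutes _ _, fun _ => Algebra.commutes _ _, fun _ => Algebra.commutes _ _,
    fun _ => Algebra.commutes _ _, Algebra.commutes _ _, Algebra.commutes _ _, Algebra.commutes _ _,
    fun _ => Algebra.commutes _ _⟩
  x_comm hr := by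
    refine LinearMap.ext fun u => ?_
    have hx := (Serg.can (IK k) a).x_x (Sum.inl ⟨0, by omega⟩) (Sum.inl ⟨1, hr⟩) (by simp)
    have hc := (Serg.can (IK k) a).x_c (Sum.inl ⟨0, by omega⟩)
    have hc' := (Serg.can (IK k) a).x_c' (Sum.inl ⟨0, by omega⟩) (Sum.inl ⟨1, hr⟩) (by simp)
    have hs := (Serg.can (IK k) a).σ_x (Equiv.swap (Sum.inl ⟨0, by omega⟩) (Sum.inl ⟨1, hr⟩)) (Sum.inl ⟨0, by omega⟩)
    have hs2 : (𝐬 (Equiv.swap (Sum.inl ⟨0, by omega⟩) (Sum.inl ⟨1, hr⟩)) * 𝐬 (Equiv.swap (Sum.inl ⟨0, by omega⟩) (Sum.inl ⟨1, hr⟩)) : PK k a) = 1 := by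
      rw [σσ, Equiv.swap_mul_self, map_one]
    rw [Equiv.swap_apply_left] at hs
    rw [sw_eq (by omega) hr]
    simp only [repW, Module.End.mul_apply, LinearMap.sub_apply, Module.End.one_apply, oc_a, ox_a, oσ_a, il_swap]
    set X0 : PK k a := 𝐱 (Sum.inl ⟨0, by omega⟩)
    set X1 : PK k a := 𝐱 (Sum.inl ⟨1, hr⟩)
    set C0 : PK k a := 𝐜 (Sum.inl ⟨0, by omega⟩)
    set C1 : PK k a := 𝐜 (Sum.inl ⟨1, hr⟩)
    set S : PK k a := 𝐬 (Equiv.swap (Sum.inl ⟨0, by omega⟩) (Sum.inl ⟨1, hr⟩))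
    have e1 : S * (X0 * (S * u)) = X1 * u := by rw [← mul_assoc, hs, mul_assoc, ← mul_assoc S, hs2, one_mul]
    have e2 : S * (X0 * (S * (X0 * u))) = X1 * (X0 * u) := by rw [← mul_assoc, hs, mul_assoc, ← mul_assoc S, hs2, one_mul]
    have e3 : S * (X0 * u) = X1 * (S * u) := by rw [← mul_assoc, hs, mul_assoc]
    have e4 : X0 * (C0 * (C1 * (S * u))) = - (C0 * (C1 * (X0 * (S * u)))) := by
      rw [← mul_assoc, hc, ← mul_assoc C1 X0, ← hc']; noncomm_ring
    have e5 : X0 * (X1 * u) = X1 * (X0 * u) + ((X0 - X1) + C0 * C1 * (X0 + X1)) * S * u := by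
      rw [← mul_assoc, hx]; noncomm_ring
    rw [e1, e2, e3, mul_sub, mul_sub, e4, e5]; noncomm_ring
  x1_c1 hr := by
    refine LinearMap.ext fun u => ?_
    simp only [repW, Module.End.mul_apply, LinearMap.neg_apply, oc_a, ox_a, ← mul_assoc]
    rw [(Serg.can _ _).x_c, neg_mul]
  x1_c i hi := by
    refine LinearMap.ext fun u => ?_
    simp only [repW, Module.End.mul_apply, oc_a, ox_a, ← mul_assoc]
    rw [(Serg.can _ _).x_c']
    intro h'; apply hi; rw [← Sum.inl.inj h']
  s_x1 i h0 h1 := by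
    refine LinearMap.ext fun u => ?_
    rw [sw_eq (by omega) h1]
    simp only [repW, Module.End.mul_apply, oσ_a, ox_a, s_x, il_l]
    rw [swap_fix _ _ _ (by omega) (by omega)]
  xb_comm ht := by
    refine LinearMap.ext fun u => ?_
    have key : ∀ v : PK k a, (repW a (f 1) hk).σb (Equiv.swap ⟨0, by omega⟩ ⟨1, ht⟩) v = v * 𝐬 (Equiv.swap (Sum.inr ⟨0, by omega⟩) (Sum.inr ⟨1, ht⟩)) := by
      intro v
      simp only [repW, oσb_a, ir_swap, Equiv.swap_inv]
    have kc : ∀ j (v : PK k a), (repW a (f 1) hk).cb j v = ε v * 𝐜 (Sum.inr j) := fun j v => rfl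
    have hs : ∀ v : PK k a, v * 𝐬 (Equiv.swap (Sum.inr ⟨0, by omega⟩) (Sum.inr ⟨1, ht⟩)) * 𝐬 (Equiv.swap (Sum.inr ⟨0, by omega⟩) (Sum.inr ⟨1, ht⟩)) = v := by
      intro v
      rw [mul_assoc, σσ, Equiv.swap_mul_self, map_one, mul_one]
    have h1 : ∀ v : PK k a, Xb (f 1) (Sum.inr ⟨0, by omega⟩) (v * 𝐬 (Equiv.swap (Sum.inr ⟨0, by omega⟩) (Sum.inr ⟨1, ht⟩)))
       * 𝐬 (Equiv.swap (Sum.inr ⟨0, by omega⟩) (Sum.inr ⟨1, ht⟩)) = Xb (f 1) (Sum.inr ⟨1, ht⟩) v := by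
      intro v; rw [Xb_rs, Equiv.swap_apply_left, hs]
    have h2 : ∀ v : PK k a, v * 𝐬 (Equiv.swap (Sum.inr ⟨0, by omega⟩) (Sum.inr ⟨1, ht⟩)) +
        ε (ε (v * 𝐬 (Equiv.swap (Sum.inr ⟨0, by omega⟩) (Sum.inr ⟨1, ht⟩))) * 𝐜 (Sum.inr ⟨1, ht⟩)) * 𝐜 (Sum.inr ⟨0, by omega⟩)
        = v * Tt (Sum.inr ⟨0, by omega⟩) (Sum.inr ⟨1, ht⟩) := by
      intro v
      have e := (Serg.can (IK k) a).σ_c (Equiv.swap (Sum.inr ⟨0, by omega⟩) (Sum.inr ⟨1, ht⟩)) (Sum.inr ⟨0, by omega⟩)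
      rw [Equiv.swap_apply_left] at e
      have e2 := (Serg.can (IK k) a).c_anti (Sum.inr ⟨1, ht⟩) (Sum.inr ⟨0, by omega⟩) (by simp)
      simp only [map_mul, ε_ε, ε_c, ε_s, Tt, mul_add, ← mul_assoc]
      rw [add_right_inj, mul_neg, neg_mul, mul_assoc _ (𝐜 _) (𝐜 _), e2, mul_neg, neg_neg, ← mul_assoc, mul_assoc v, e, ← mul_assoc]
    rw [sw_eq (by omega) ht]
    simp only [Module.End.mul_apply, LinearMap.sub_apply, LinearMap.add_apply, Module.End.one_apply, key, kc, h1, h2]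
    exact Xb_comm _ (by simp) _
  xb1_cb1 ht := by
    refine LinearMap.ext fun u => ?_
    simp only [repW, Module.End.mul_apply, LinearMap.neg_apply, ocb_a]
    exact Xb_cb _ _ _
  xb1_cb j hj := by
    refine LinearMap.ext fun u => ?_
    simp only [repW, Module.End.mul_apply, ocb_a]
    rw [Xb_right, Xb_ε]
    refine Sp_c ?_
    intro h'; apply hj; rw [Sum.inr.inj h']
  sb_xb1 j h0 h1 := by
    refine LinearMap.ext fun u => ?_
    rw [sw_eq (by omega) h1]
    simp only [repW, Module.End.mul_apply, oσb_a]
    rw [Xb_right]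
    refine Sp_σ ?_
    rw [Equiv.swap_inv, ir_r, swap_fix _ _ _ (by omega) (by omega)]
  e_xsum := by
    refine LinearMap.ext fun u => ?_
    simp only [repW, Module.End.mul_apply, LinearMap.add_apply, ox_a]
    rw [e_xsum]; rfl
  xsum_e := by
    refine LinearMap.ext fun u => ?_
    simp only [repW, Module.End.mul_apply, LinearMap.add_apply, ox_a]
    rw [xsum_e]; rfl
  e_sxs hr := by
    refine LinearMap.ext fun u => ?_
    have key : ∀ v : PK k a, 𝐬 (Equiv.swap (Sum.inl ⟨0, by omega⟩) (Sum.inl ⟨1, hr⟩)) * (𝐱 (Sum.inl ⟨0, by omega⟩) *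
      (𝐬 (Equiv.swap (Sum.inl ⟨0, by omega⟩) (Sum.inl ⟨1, hr⟩)) * v)) = 𝐱 (Sum.inl ⟨1, hr⟩) * v := by
      intro v
      rw [s_x, Equiv.swap_apply_left, ← mul_assoc (𝐬 _), σσ, Equiv.swap_mul_self, map_one, one_mul]
    rw [sw_eq (by omega) hr]
    simp only [repW, Module.End.mul_apply, ox_a, oσ_a, il_swap, key]
    exact (x_En _ _ (by simp) _).symm
  x_mixed hr := by
    refine LinearMap.ext fun u => ?_
    have := x_mixed (f 1) (Sum.inr (⟨0, hr⟩ : Fin k)) (Sum.inl ⟨0, hr⟩) u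
    simp only [repW, Module.End.mul_apply, LinearMap.sub_apply, LinearMap.add_apply, ox_a, oc_a]
    rw [Ent_apply, Ent_apply] at this
    rw [← this]; congr 1; abel
  e_sbxbsb ht := by
    refine LinearMap.ext fun u => ?_
    have h1 : ∀ v : PK k a, Xb (f 1) (Sum.inr ⟨0, by omega⟩) (v * 𝐬 (Equiv.swap (Sum.inr ⟨0, by omega⟩) (Sum.inr ⟨1, ht⟩)))
       * 𝐬 (Equiv.swap (Sum.inr ⟨0, by omega⟩) (Sum.inr ⟨1, ht⟩)) = Xb (f 1) (Sum.inr ⟨1, ht⟩) v := by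
      intro v; rw [Xb_rs, Equiv.swap_apply_left, mul_assoc, σσ, Equiv.swap_mul_self, map_one, mul_one]
    rw [sw_eq (by omega) ht]
    simp only [repW, Module.End.mul_apply, oσb_a, ir_swap, Equiv.swap_inv, h1]
    exact e_Xb' _ (by simp) _ _
  e_xodd n := by
    refine LinearMap.ext fun u => ?_
    have hx : (ox ⟨0, by omega⟩ * ox ⟨0, by omega⟩ : EP k a) = algebraMap ℂ _ a := by
      refine LinearMap.ext fun u => ?_
      rw [Module.End.mul_apply, ox_a, ox_a, ← mul_assoc, (Serg.can _ _).x_sq, Module.algebraMap_end_apply, Algebra.smul_def]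
    rw [pow_odd hx, odd_seq f a h]
    simp only [repW, Module.End.mul_apply, Module.algebraMap_end_apply, map_smul, ox_a]
    rw [En_x_En, mul_smul]
  e_xeven n hn := by
    refine LinearMap.ext fun u => ?_
    have hx : (ox ⟨0, by omega⟩ * ox ⟨0, by omega⟩ : EP k a) = algebraMap ℂ _ a := by
      refine LinearMap.ext fun u => ?_
      rw [Module.End.mul_apply, ox_a, ox_a, ← mul_assoc, (Serg.can _ _).x_sq, Module.algebraMap_end_apply, Algebra.smul_def]
    rw [pow_even hx]
    simp only [repW, Module.End.mul_apply, Module.algebraMap_end_apply, map_smul, En_En]; simp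
  e_xb n hn := by
    refine LinearMap.ext fun u => ?_
    have hx : (Xb (f 1) (Sum.inr ⟨0, by omega⟩) * Xb (f 1) (Sum.inr ⟨0, by omega⟩) : EP k a) = algebraMap ℂ _ (a + f 1) := by
      refine LinearMap.ext fun u => ?_
      rw [Module.End.mul_apply, Xb_sq, Module.algebraMap_end_apply]
    have hx2 := xsum_e (a := a) (f 1) (Sum.inr (⟨0, by omega⟩ : Fin k)) (Sum.inl ⟨0, by omega⟩) u
    have hx3 := eq_neg_of_add_eq_zero_right hx2
    obtain ⟨j, rfl | rfl⟩ := Nat.even_or_odd' n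
    · rw [pow_even hx, obar_even]
      simp only [repW, Module.End.mul_apply, Module.algebraMap_end_apply, map_smul, En_En]; simp
    · rw [pow_odd hx, obar_odd f a h]
      simp only [repW, Module.End.mul_apply, Module.algebraMap_end_apply, map_smul, hx3, map_neg, En_x_En]
      rw [← smul_neg, ← neg_smul, smul_smul]; congr 1; ring
  x1_cb_comm j := by
    refine LinearMap.ext fun u => ?_
    simp only [repW, Module.End.mul_apply, ox_a, ocb_a, map_mul, ε_x, mul_assoc]
  xb1_c_comm j := by
    refine LinearMap.ext fun u => ?_
    simp only [repW, Module.End.mul_apply, oc_a, c_Xb]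
  x1_σb w := by
    refine LinearMap.ext fun u => ?_
    simp only [repW, Module.End.mul_apply, ox_a, oσb_a, mul_assoc]
  xb1_σ w := by
    refine LinearMap.ext fun u => ?_
    simp only [repW, Module.End.mul_apply, oσ_a, s_Xb]
end rep2
end Tr
end

section
set_option linter.unusedSectionVars false
set_option linter.unusedSimpArgs false
set_option linter.unusedVariables false
/-- Equivariant form of the level two walled Brauer-Clifford relations. -/
structure WD (k : ℕ) (a b ω : ℂ) (A : Type) [Ring A] [Algebra ℂ A] where
  σ : Equiv.Perm (Fin k) →* A
  σb : Equiv.Perm (Fin k) →* A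
  c : Fin k → A
  cb : Fin k → A
  x : Fin k → A
  xb : Fin k → A
  E : Fin k → Fin k → A
  σσb : ∀ w v, σ w * σb v = σb v * σ w
  σ_c : ∀ w i, σ w * c i = c (w i) * σ w
  σ_x : ∀ w i, σ w * x i = x (w i) * σ w
  σ_E : ∀ w i j, σ w * E i j = E (w i) j * σ w
  σ_cb : ∀ w j, σ w * cb j = cb j * σ w
  σ_xb : ∀ w j, σ w * xb j = xb j * σ w
  σb_cb : ∀ w i, σb w * cb i = cb (w i) * σb w
  σb_xb : ∀ w i, σb w * xb i = xb (w i) * σb w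
  σb_E : ∀ w i j, σb w * E i j = E i (w j) * σb w
  σb_c : ∀ w j, σb w * c j = c j * σb w
  σb_x : ∀ w j, σb w * x j = x j * σb w
  c_sq : ∀ i, c i * c i = -1
  c_anti : ∀ i j, i ≠ j → c i * c j = -(c j * c i)
  x_sq : ∀ i, x i * x i = algebraMap ℂ A a
  x_c : ∀ i, x i * c i = -(c i * x i)
  x_c' : ∀ i j, i ≠ j → x i * c j = c j * x i
  x_x : ∀ i j, i ≠ j → x i * x j = x j * x i
    + ((x i - x j) + c i * c j * (x i + x j)) * σ (Equiv.swap i j)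
  cb_sq : ∀ i, cb i * cb i = 1
  cb_anti : ∀ i j, i ≠ j → cb i * cb j = -(cb j * cb i)
  xb_sq : ∀ i, xb i * xb i = algebraMap ℂ A b
  xb_cb : ∀ i, xb i * cb i = -(cb i * xb i)
  xb_cb' : ∀ i j, i ≠ j → xb i * cb j = cb j * xb i
  xb_xb : ∀ i j, i ≠ j → xb i * xb j = xb j * xb i
    + ((xb i - xb j) - cb i * cb j * (xb i + xb j)) * σb (Equiv.swap i j)
  c_cb : ∀ i j, c i * cb j = -(cb j * c i)
  x_cb : ∀ i j, x i * cb j = cb j * x i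
  xb_c : ∀ i j, xb i * c j = c j * xb i
  x_xb : ∀ i j, x i * xb j = xb j * x i + (E i j - c i * E i j * c i) * x i - x i * (E i j - c i * E i j * c i)
  E_c : ∀ i j, E i j * c i = E i j * cb j
  c_E : ∀ i j, c i * E i j = cb j * E i j
  E_x : ∀ i j, E i j * x i = - (E i j * xb j)
  x_E : ∀ i j, x i * E i j = - (xb j * E i j)
  E_c' : ∀ l i j, l ≠ i → c l * E i j = E i j * c l
  E_x' : ∀ l i j, l ≠ i → x l * E i j = E i j * x l
  E_cb' : ∀ l i j, l ≠ j → cb l * E i j = E i j * cb l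
  E_xb' : ∀ l i j, l ≠ j → xb l * E i j = E i j * xb l
  E_E : ∀ i j, E i j * E i j = 0
  E_cE : ∀ i j, E i j * c i * E i j = 0
  E_xE : ∀ i j, E i j * x i * E i j = ω • E i j
  EE_r : ∀ i j l, j ≠ l → E i j * E i l = E i j * σb (Equiv.swap j l)
  EE_l : ∀ i j l, i ≠ l → E i j * E l j = E i j * σ (Equiv.swap i l)
  EE_comm : ∀ i j l m, i ≠ l → j ≠ m → E i j * E l m = E l m * E i j
  EE_σ : ∀ i j l m, i ≠ l → j ≠ m → E i j * E l m * σ (Equiv.swap i l) * σb (Equiv.swap j m) = E i j * E l m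

lemma perm_gen {k : ℕ} (P : Fin k → Prop) (H : Subgroup (Equiv.Perm (Fin k)))
    (h : ∀ i j, P i → P j → Equiv.swap i j ∈ H) (w : Equiv.Perm (Fin k)) (hw : ∀ i, ¬ P i → w i = i) : w ∈ H := by
  generalize hn : w.support.card = n
  induction n using Nat.strong_induction_on generalizing w with
  | _ n ih =>
    by_cases h1 : w = 1
    · rw [h1]; exact one_mem _
    · obtain ⟨x, hx⟩ : ∃ x, w x ≠ x := by
        by_contra hc; push Not at hc; exact h1 (Equiv.ext hc)
      have px : P x := by by_contra hc; exact hx (hw x hc)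
      have pwx : P (w x) := by by_contra hc; exact hx (w.injective (hw _ hc))
      have h2 := Equiv.Perm.card_support_swap_mul hx
      have h3 := ih _ (hn ▸ h2) (Equiv.swap x (w x) * w) (by
        intro i hi
        rw [Equiv.Perm.mul_apply, hw i hi, Equiv.swap_apply_of_ne_of_ne]
        · rintro rfl; exact hi px
        · rintro rfl; exact hi pwx) rfl
      have := mul_mem (h x (w x) px pwx) h3
      rwa [← mul_assoc, Equiv.swap_mul_self, one_mul] at this

/-- adjacent swaps generate the interval symmetric groups -/
lemma adj_gen {k : ℕ} (p q : ℕ) (H : Subgroup (Equiv.Perm (Fin k)))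
    (h : ∀ i, p ≤ i → i + 1 < q → sw k i (i + 1) ∈ H) (hq : q ≤ k) (w : Equiv.Perm (Fin k))
    (hw : ∀ i : Fin k, ¬ (p ≤ (i : ℕ) ∧ (i : ℕ) < q) → w i = i) : w ∈ H := by
  refine perm_gen (fun i => p ≤ (i : ℕ) ∧ (i : ℕ) < q) H ?_ w hw
  have key : ∀ (n i : ℕ) (hi : p ≤ i) (hn : i + n < q), Equiv.swap (⟨i, by omega⟩ : Fin k) ⟨i + n, by omega⟩ ∈ H := by
    intro n
    induction n with
    | zero => intro i hi hn; simp only [add_zero, Equiv.swap_self]; exact one_mem H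
    | succ n ih =>
      intro i hi hn
      have h1 := ih i hi (by omega)
      have h2 := h (i + n) (by omega) (by omega)
      rw [Tr.sw_eq (by omega) (by omega)] at h2
      rcases Nat.eq_zero_or_pos n with rfl | hpos
      · exact h2
      · have h3 := mul_mem (mul_mem h2 h1) h2
        have := Equiv.swap_apply_apply (Equiv.swap (⟨i + n, by omega⟩ : Fin k) ⟨i + n + 1, by omega⟩) ⟨i, by omega⟩ ⟨i + n, by omega⟩
        rw [Equiv.swap_apply_left, Tr.swap_fix _ _ _ (by omega) (by omega), Equiv.swap_inv] at this
        rw [← this] at h3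
        exact h3
  intro i j hi hj
  rcases le_total (i : ℕ) j with hij | hij
  · have := key (j - i) i hi.1 (by omega)
    convert this using 2
    ext; simp only []; omega
  · have := key (i - j) j hj.1 (by omega)
    rw [Equiv.swap_comm]
    convert this using 2
    ext; simp only []; omega

lemma ex_pair {k : ℕ} {z o i l : Fin k} (h : z ≠ o) (h' : i ≠ l) : ∃ w : Equiv.Perm (Fin k), w z = i ∧ w o = l := by
  refine ⟨Equiv.swap (Equiv.swap z i o) l * Equiv.swap z i, ?_, ?_⟩
  · rw [Equiv.Perm.mul_apply, Equiv.swap_apply_left, Equiv.swap_apply_of_ne_of_ne _ h']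
    intro hc
    apply h
    apply (Equiv.swap z i).injective
    rw [Equiv.swap_apply_left]; exact hc
  · rw [Equiv.Perm.mul_apply, Equiv.swap_apply_left]

section conj
variable {A : Type} [Ring A] [Algebra ℂ A] {G : Type} [Group G]
def cjA (σ : G →* A) (w : G) : A →ₐ[ℂ] A where
  toFun u := σ w * u * σ w⁻¹
  map_one' := by rw [mul_one, ← map_mul, mul_inv_cancel, map_one]
  map_mul' u v := by
    have : σ w⁻¹ * σ w = 1 := by rw [← map_mul, inv_mul_cancel, map_one]
    calc _ = σ w * u * 1 * v * σ w⁻¹ := by noncomm_ring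
      _ = _ := by rw [← this]; noncomm_ring
  map_zero' := by simp
  map_add' u v := by noncomm_ring
  commutes' r := by
    rw [← Algebra.commutes, mul_assoc, ← map_mul, mul_inv_cancel, map_one, mul_one]
lemma cjA_apply (σ : G →* A) (w : G) (u) : cjA σ w u = σ w * u * σ w⁻¹ := rfl
lemma cjA_eq (σ : G →* A) {w : G} {u v : A} (h : σ w * u = v * σ w) : cjA σ w u = v := by
  rw [cjA_apply, h, mul_assoc, ← map_mul, mul_inv_cancel, map_one, mul_one]
lemma cjA_σ (σ : G →* A) (w v : G) : cjA σ w (σ v) = σ (w * v * w⁻¹) := by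
  rw [cjA_apply, map_mul, map_mul]
lemma of_cjA (σ : G →* A) {w : G} {u v : A} (h : cjA σ w u = v) : σ w * u = v * σ w := by
  rw [← h, cjA_apply, mul_assoc, ← map_mul, inv_mul_cancel, map_one, mul_one]
end conj
end

section
set_option linter.unusedSectionVars false
set_option linter.unusedSimpArgs false
set_option linter.unusedVariables false
section half
variable {A : Type} [Ring A] [Algebra ℂ A] {k : ℕ}
def commSub (σ : Equiv.Perm (Fin k) →* A) (g : A) : Subgroup (Equiv.Perm (Fin k)) where
  carrier := {w | σ w * g = g * σ w}
  mul_mem' {u v} hu hv := by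
    simp only [Set.mem_ofPred_eq] at *
    rw [map_mul, mul_assoc, hv, ← mul_assoc, hu, mul_assoc]
  one_mem' := by simp
  inv_mem' {u} hu := by
    simp only [Set.mem_ofPred_eq] at *
    have h1 : σ u⁻¹ * σ u = 1 := by rw [← map_mul, inv_mul_cancel, map_one]
    have h2 : σ u * σ u⁻¹ = 1 := by rw [← map_mul, mul_inv_cancel, map_one]
    calc σ u⁻¹ * g = σ u⁻¹ * g * (σ u * σ u⁻¹) := by rw [h2, mul_one]
      _ = σ u⁻¹ * (g * σ u) * σ u⁻¹ := by noncomm_ring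
      _ = (σ u⁻¹ * σ u) * g * σ u⁻¹ := by rw [← hu]; noncomm_ring
      _ = _ := by rw [h1, one_mul]

lemma comm_adj (σ : Equiv.Perm (Fin k) →* A) (g : A) (hk : 0 < k)
    (h : ∀ i : ℕ, 0 < i → i + 1 < k → σ (sw k i (i + 1)) * g = g * σ (sw k i (i + 1)))
    (w : Equiv.Perm (Fin k)) (hw : w ⟨0, hk⟩ = ⟨0, hk⟩) : σ w * g = g * σ w := by
  have : w ∈ commSub σ g := by
    refine adj_gen 1 k _ (fun i h1 h2 => h i (by omega) h2) le_rfl w ?_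
    intro i hi
    have : i = ⟨0, hk⟩ := by ext; simp only []; have := i.2; omega
    rw [this]; exact hw
  exact this

def cjf (σ : Equiv.Perm (Fin k) →* A) (z : Fin k) (g : A) (i : Fin k) : A :=
  σ (Equiv.swap z i) * g * σ (Equiv.swap z i)
lemma cjf_z (σ : Equiv.Perm (Fin k) →* A) (z : Fin k) (g : A) : cjf σ z g z = g := by
  have : σ (Equiv.swap z z) = 1 := by rw [Equiv.swap_self]; exact map_one σ
  rw [cjf, this, one_mul, mul_one]
lemma cjf_conj (σ : Equiv.Perm (Fin k) →* A) (z : Fin k) (g : A)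
    (hg : ∀ w : Equiv.Perm (Fin k), w z = z → σ w * g = g * σ w) (w i) :
    σ w * cjf σ z g i = cjf σ z g (w i) * σ w := by
  have h1 := hg (Equiv.swap z (w i) * w * Equiv.swap z i) (by simp [Equiv.Perm.mul_apply])
  have h2 : σ w * σ (Equiv.swap z i) = σ (Equiv.swap z (w i)) * σ (Equiv.swap z (w i) * w * Equiv.swap z i) := by
    rw [← map_mul, ← map_mul]; congr 1; simp [← mul_assoc]
  have h3 : σ (Equiv.swap z (w i) * w * Equiv.swap z i) * σ (Equiv.swap z i) = σ (Equiv.swap z (w i)) * σ w := by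
    rw [← map_mul, ← map_mul]; congr 1; simp [mul_assoc]
  unfold cjf
  calc _ = (σ w * σ (Equiv.swap z i)) * g * σ (Equiv.swap z i) := by noncomm_ring
    _ = σ (Equiv.swap z (w i)) * (σ (Equiv.swap z (w i) * w * Equiv.swap z i) * g) * σ (Equiv.swap z i) := by
      rw [h2]; noncomm_ring
    _ = σ (Equiv.swap z (w i)) * g * (σ (Equiv.swap z (w i) * w * Equiv.swap z i) * σ (Equiv.swap z i)) := by
      rw [h1]; noncomm_ring
    _ = _ := by rw [h3]; noncomm_ring
lemma cjf_comm (σ : Equiv.Perm (Fin k) →* A) (z : Fin k) (g u : A) (h : ∀ w, σ w * u = u * σ w)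
    (hg : g * u = u * g) (i) : cjf σ z g i * u = u * cjf σ z g i := by
  unfold cjf
  rw [mul_assoc, h, ← mul_assoc, mul_assoc _ g, hg, ← mul_assoc, h, mul_assoc, mul_assoc, mul_assoc]
end half

namespace AWBC
variable {A : Type} [Ring A] [Algebra ℂ A] {k : ℕ} {ω1 : ℂ}

section
variable (d : AWBC ℂ A k k ω1) (hk : 2 ≤ k)
def zz : Fin k := ⟨0, by omega⟩
def oo : Fin k := ⟨1, by omega⟩
def gx (i : Fin k) : A := cjf d.σ (zz hk) d.x1 i
def gxb (i : Fin k) : A := cjf d.σb (zz hk) d.xb1 i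
def gE (i j : Fin k) : A := cjf d.σb (zz hk) (cjf d.σ (zz hk) d.e i) j

lemma zo : zz hk ≠ oo hk := by simp [zz, oo]
lemma sw01 : sw k 0 1 = Equiv.swap (zz hk) (oo hk) := Tr.sw_eq _ _
lemma gσ_c (w i) : d.σ w * d.c i = d.c (w i) * d.σ w := by
  rw [← d.c_conj, mul_assoc, ← map_mul, inv_mul_cancel, map_one, mul_one]
lemma gσb_cb (w i) : d.σb w * d.cb i = d.cb (w i) * d.σb w := by
  rw [← d.cb_conj, mul_assoc, ← map_mul, inv_mul_cancel, map_one, mul_one]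
lemma gσ_x (w i) : d.σ w * d.gx hk i = d.gx hk (w i) * d.σ w :=
  cjf_conj _ _ _ (comm_adj _ _ (by omega) d.s_x1) w i
lemma gσb_xb (w i) : d.σb w * d.gxb hk i = d.gxb hk (w i) * d.σb w :=
  cjf_conj _ _ _ (comm_adj _ _ (by omega) d.sb_xb1) w i
lemma gσb_x (w i) : d.σb w * d.gx hk i = d.gx hk i * d.σb w :=
  (cjf_comm _ _ _ _ (fun u => d.comm_σσb u w) (d.x1_σb w).symm i).symm
lemma gσ_xb (w i) : d.σ w * d.gxb hk i = d.gxb hk i * d.σ w :=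
  (cjf_comm _ _ _ _ (fun u => (d.comm_σσb w u).symm) (d.xb1_σ w).symm i).symm
lemma σb_e (w : Equiv.Perm (Fin k)) (hw : w (zz hk) = zz hk) : d.σb w * d.e = d.e * d.σb w :=
  comm_adj _ _ (by omega) d.sb_e_comm w hw
lemma σ_e (w : Equiv.Perm (Fin k)) (hw : w (zz hk) = zz hk) : d.σ w * d.e = d.e * d.σ w :=
  comm_adj _ _ (by omega) d.s_e_comm w hw
lemma gσb_E (w i j) : d.σb w * d.gE hk i j = d.gE hk i (w j) * d.σb w := by
  refine cjf_conj _ _ _ (fun v hv => ?_) w j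
  exact (cjf_comm _ _ _ _ (fun u => d.comm_σσb u v) (d.σb_e hk v hv).symm i).symm
lemma gσ_E (w i j) : d.σ w * d.gE hk i j = d.gE hk (w i) j * d.σ w := by
  have h1 := cjf_conj d.σ _ _ (d.σ_e hk) w i
  have h2 := d.comm_σσb w (Equiv.swap (zz hk) j)
  unfold gE
  generalize cjf d.σ (zz hk) d.e i = u at *
  generalize cjf d.σ (zz hk) d.e (w i) = u' at *
  rw [cjf, cjf, ← mul_assoc, ← mul_assoc, h2, mul_assoc (d.σb _) (d.σ w), h1, mul_assoc, mul_assoc, h2]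
  noncomm_ring
lemma gx0 : d.gx hk (zz hk) = d.x1 := cjf_z _ _ _
lemma gxb0 : d.gxb hk (zz hk) = d.xb1 := cjf_z _ _ _
lemma gE0 : d.gE hk (zz hk) (zz hk) = d.e := by rw [gE, cjf_z, cjf_z]

def TT (w v : Equiv.Perm (Fin k)) : A →ₐ[ℂ] A := (cjA d.σ w).comp (cjA d.σb v)
variable (w v : Equiv.Perm (Fin k))
lemma T_c (i) : d.TT w v (d.c i) = d.c (w i) := by
  rw [TT, AlgHom.comp_apply, cjA_eq _ (d.comm_σbc v i), cjA_eq _ (d.gσ_c w i)]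
lemma T_cb (i) : d.TT w v (d.cb i) = d.cb (v i) := by
  rw [TT, AlgHom.comp_apply, cjA_eq _ (d.gσb_cb v i), cjA_eq _ (d.comm_σcb w _)]
lemma T_x (i) : d.TT w v (d.gx hk i) = d.gx hk (w i) := by
  rw [TT, AlgHom.comp_apply, cjA_eq _ (d.gσb_x hk v i), cjA_eq _ (d.gσ_x hk w i)]
lemma T_xb (i) : d.TT w v (d.gxb hk i) = d.gxb hk (v i) := by
  rw [TT, AlgHom.comp_apply, cjA_eq _ (d.gσb_xb hk v i), cjA_eq _ (d.gσ_xb hk w _)]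
lemma T_E (i j) : d.TT w v (d.gE hk i j) = d.gE hk (w i) (v j) := by
  rw [TT, AlgHom.comp_apply, cjA_eq _ (d.gσb_E hk v i j), cjA_eq _ (d.gσ_E hk w _ _)]
lemma T_σ (i j) : d.TT w v (d.σ (Equiv.swap i j)) = d.σ (Equiv.swap (w i) (w j)) := by
  rw [TT, AlgHom.comp_apply, cjA_eq _ (d.comm_σσb _ v).symm, cjA_σ, Equiv.swap_apply_apply]
lemma T_σb (i j) : d.TT w v (d.σb (Equiv.swap i j)) = d.σb (Equiv.swap (v i) (v j)) := by
  rw [TT, AlgHom.comp_apply, cjA_σ, cjA_eq _ (d.comm_σσb w _), Equiv.swap_apply_apply]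

/-- transport of an identity -/
lemma tr1 {P Q : A} (h : P = Q) : d.TT w v P = d.TT w v Q := by rw [h]
end
end AWBC
end

section
set_option linter.unusedSectionVars false
set_option linter.unusedSimpArgs false
set_option linter.unusedVariables false
namespace AWBC
variable {A : Type} [Ring A] [Algebra ℂ A] {k : ℕ} {ω1 : ℂ}
section
variable (d : AWBC ℂ A k k ω1) (hk : 2 ≤ k)
lemma ss (i j : Fin k) : d.σ (Equiv.swap i j) * d.σ (Equiv.swap i j) = 1 := by
  rw [← map_mul, Equiv.swap_mul_self, map_one]
lemma ssb (i j : Fin k) : d.σb (Equiv.swap i j) * d.σb (Equiv.swap i j) = 1 := by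
  rw [← map_mul, Equiv.swap_mul_self, map_one]
lemma gxo : d.σ (sw k 0 1) * d.x1 * d.σ (sw k 0 1) = d.gx hk (oo hk) := by
  rw [gx, cjf, sw01 hk]
lemma gxbo : d.σb (sw k 0 1) * d.xb1 * d.σb (sw k 0 1) = d.gxb hk (oo hk) := by
  rw [gxb, cjf, sw01 hk]
lemma base_xx : d.gx hk (zz hk) * d.gx hk (oo hk) = d.gx hk (oo hk) * d.gx hk (zz hk)
    + ((d.gx hk (zz hk) - d.gx hk (oo hk)) + d.c (zz hk) * d.c (oo hk) * (d.gx hk (zz hk) + d.gx hk (oo hk)))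
      * d.σ (Equiv.swap (zz hk) (oo hk)) := by
  have h := d.x_comm (by omega)
  rw [gxo _ hk, sw01 hk, ← d.gx0 hk] at h
  change d.gx hk (zz hk) * (d.gx hk (oo hk) - (1 - d.c (zz hk) * d.c (oo hk)) * d.σ (Equiv.swap (zz hk) (oo hk))) =
   (d.gx hk (oo hk) - (1 - d.c (zz hk) * d.c (oo hk)) * d.σ (Equiv.swap (zz hk) (oo hk))) * d.gx hk (zz hk) at h
  have h1 := d.gσ_x hk (Equiv.swap (zz hk) (oo hk)) (zz hk)
  rw [Equiv.swap_apply_left] at h1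
  have h2 : d.gx hk (zz hk) * d.c (zz hk) = -(d.c (zz hk) * d.gx hk (zz hk)) := by
    rw [gx0]; exact d.x1_c1 _
  have h3 : d.gx hk (zz hk) * d.c (oo hk) = d.c (oo hk) * d.gx hk (zz hk) := by
    rw [gx0]; exact d.x1_c _ (by simp [oo])
  have h4 : d.gx hk (zz hk) * (d.c (zz hk) * d.c (oo hk)) = -(d.c (zz hk) * d.c (oo hk)) * d.gx hk (zz hk) := by
    rw [← mul_assoc, h2, neg_mul, mul_assoc, h3]; noncomm_ring
  generalize d.c (zz hk) * d.c (oo hk) = C at *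
  generalize d.gx hk (zz hk) = X at *
  generalize d.gx hk (oo hk) = Y at *
  generalize d.σ (Equiv.swap (zz hk) (oo hk)) = S at *
  have h5 : X * (1 - C) * S = (X + C * X) * S := by rw [mul_sub, h4]; noncomm_ring
  have h6 : (1 - C) * S * X = (Y - C * Y) * S := by rw [mul_assoc, h1]; noncomm_ring
  have h7 : X * Y = Y * X + X * (1 - C) * S - (1 - C) * S * X := by
    rw [mul_sub, sub_mul] at h
    rw [← sub_eq_zero] at h ⊢
    rw [← h]; noncomm_ring
  rw [h7, h5, h6]; noncomm_ring
lemma base_xbxb : d.gxb hk (zz hk) * d.gxb hk (oo hk) = d.gxb hk (oo hk) * d.gxb hk (zz hk)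
    + ((d.gxb hk (zz hk) - d.gxb hk (oo hk)) - d.cb (zz hk) * d.cb (oo hk) * (d.gxb hk (zz hk) + d.gxb hk (oo hk)))
      * d.σb (Equiv.swap (zz hk) (oo hk)) := by
  have h := d.xb_comm (by omega)
  rw [gxbo _ hk, sw01 hk, ← d.gxb0 hk] at h
  change d.gxb hk (zz hk) * (d.gxb hk (oo hk) - (1 + d.cb (zz hk) * d.cb (oo hk)) * d.σb (Equiv.swap (zz hk) (oo hk))) =
   (d.gxb hk (oo hk) - (1 + d.cb (zz hk) * d.cb (oo hk)) * d.σb (Equiv.swap (zz hk) (oo hk))) * d.gxb hk (zz hk) at h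
  have h1 := d.gσb_xb hk (Equiv.swap (zz hk) (oo hk)) (zz hk)
  rw [Equiv.swap_apply_left] at h1
  have h2 : d.gxb hk (zz hk) * d.cb (zz hk) = -(d.cb (zz hk) * d.gxb hk (zz hk)) := by
    rw [gxb0]; exact d.xb1_cb1 _
  have h3 : d.gxb hk (zz hk) * d.cb (oo hk) = d.cb (oo hk) * d.gxb hk (zz hk) := by
    rw [gxb0]; exact d.xb1_cb _ (by simp [oo])
  have h4 : d.gxb hk (zz hk) * (d.cb (zz hk) * d.cb (oo hk)) = -(d.cb (zz hk) * d.cb (oo hk)) * d.gxb hk (zz hk) := by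
    rw [← mul_assoc, h2, neg_mul, mul_assoc, h3]; noncomm_ring
  generalize d.cb (zz hk) * d.cb (oo hk) = C at *
  generalize d.gxb hk (zz hk) = X at *
  generalize d.gxb hk (oo hk) = Y at *
  generalize d.σb (Equiv.swap (zz hk) (oo hk)) = S at *
  have h5 : X * (1 + C) * S = (X - C * X) * S := by rw [mul_add, h4]; noncomm_ring
  have h6 : (1 + C) * S * X = (Y + C * Y) * S := by rw [mul_assoc, h1]; noncomm_ring
  have h7 : X * Y = Y * X + X * (1 + C) * S - (1 + C) * S * X := by
    rw [mul_sub, sub_mul] at h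
    rw [← sub_eq_zero] at h ⊢
    rw [← h]; noncomm_ring
  rw [h7, h5, h6]; noncomm_ring
lemma gE_oz : d.gE hk (oo hk) (zz hk) = d.σ (Equiv.swap (zz hk) (oo hk)) * d.e * d.σ (Equiv.swap (zz hk) (oo hk)) := by
  rw [gE, cjf_z, cjf]
lemma gE_zo : d.gE hk (zz hk) (oo hk) = d.σb (Equiv.swap (zz hk) (oo hk)) * d.e * d.σb (Equiv.swap (zz hk) (oo hk)) := by
  rw [gE, cjf_z, cjf]
lemma base_EE_r : d.gE hk (zz hk) (zz hk) * d.gE hk (zz hk) (oo hk)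
    = d.gE hk (zz hk) (zz hk) * d.σb (Equiv.swap (zz hk) (oo hk)) := by
  have h := d.e_sb_e (by omega)
  rw [sw01 hk] at h
  rw [gE0, gE_zo, ← mul_assoc, ← mul_assoc, h]
lemma base_EE_l : d.gE hk (zz hk) (zz hk) * d.gE hk (oo hk) (zz hk)
    = d.gE hk (zz hk) (zz hk) * d.σ (Equiv.swap (zz hk) (oo hk)) := by
  have h := d.e_s_e (by omega)
  rw [sw01 hk] at h
  rw [gE0, gE_oz, ← mul_assoc, ← mul_assoc, h]
lemma gE_oo : d.gE hk (oo hk) (oo hk) = d.σ (Equiv.swap (zz hk) (oo hk)) * d.σb (Equiv.swap (zz hk) (oo hk)) * d.e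
    * (d.σ (Equiv.swap (zz hk) (oo hk)) * d.σb (Equiv.swap (zz hk) (oo hk))) := by
  rw [gE, cjf, cjf, d.comm_σσb]
  have := d.comm_σσb (Equiv.swap (zz hk) (oo hk)) (Equiv.swap (zz hk) (oo hk))
  simp only [mul_assoc]
  rw [this]
lemma base_EE1 : d.gE hk (zz hk) (zz hk) * d.gE hk (oo hk) (oo hk)
    = d.e * (d.σ (Equiv.swap (zz hk) (oo hk)) * d.σb (Equiv.swap (zz hk) (oo hk))) * d.e := by
  have h := d.braid1 (by omega) (by omega)
  rw [sw01 hk] at h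
  have ht := d.ssb (zz hk) (oo hk)
  rw [gE0, gE_oo]
  generalize d.σ (Equiv.swap (zz hk) (oo hk)) = r at *
  generalize d.σb (Equiv.swap (zz hk) (oo hk)) = t at *
  calc _ = (d.e * r * t * d.e * r) * t := by noncomm_ring
    _ = d.e * r * t * d.e * (t * t) := by rw [h]; noncomm_ring
    _ = _ := by rw [ht, mul_one]; noncomm_ring
lemma base_EE2 : d.gE hk (oo hk) (oo hk) * d.gE hk (zz hk) (zz hk)
    = d.e * (d.σ (Equiv.swap (zz hk) (oo hk)) * d.σb (Equiv.swap (zz hk) (oo hk))) * d.e := by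
  have h := d.braid2 (by omega) (by omega)
  rw [sw01 hk] at h
  have ht := d.ssb (zz hk) (oo hk)
  have hc := d.comm_σσb (Equiv.swap (zz hk) (oo hk)) (Equiv.swap (zz hk) (oo hk))
  rw [gE0, gE_oo]
  generalize d.σ (Equiv.swap (zz hk) (oo hk)) = r at *
  generalize d.σb (Equiv.swap (zz hk) (oo hk)) = t at *
  calc _ = (r * t) * d.e * (r * t) * d.e := by noncomm_ring
    _ = t * (r * d.e * r * t * d.e) := by rw [hc]; nth_rewrite 2 [← hc]; noncomm_ring
    _ = (t * t) * d.e * r * t * d.e := by rw [h]; noncomm_ring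
    _ = _ := by rw [ht, one_mul]; noncomm_ring
lemma base_EE3 : d.gE hk (zz hk) (zz hk) * d.gE hk (oo hk) (oo hk) * d.σ (Equiv.swap (zz hk) (oo hk)) * d.σb (Equiv.swap (zz hk) (oo hk))
    = d.gE hk (zz hk) (zz hk) * d.gE hk (oo hk) (oo hk) := by
  have h := d.braid1 (by omega) (by omega)
  rw [sw01 hk] at h
  have ht := d.ssb (zz hk) (oo hk)
  rw [base_EE1]
  generalize d.σ (Equiv.swap (zz hk) (oo hk)) = r at *
  generalize d.σb (Equiv.swap (zz hk) (oo hk)) = t at *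
  calc _ = (d.e * r * t * d.e * r) * t := by noncomm_ring
    _ = d.e * r * t * d.e * (t * t) := by rw [h]; noncomm_ring
    _ = _ := by rw [ht, mul_one]; noncomm_ring
end
end AWBC
end

section
set_option linter.unusedSectionVars false
set_option linter.unusedSimpArgs false
set_option linter.unusedVariables false
namespace AWBC
variable {A : Type} [Ring A] [Algebra ℂ A] {k : ℕ} {ω1 a b : ℂ}
section
variable (d : AWBC ℂ A k k ω1) (hk : 2 ≤ k)
/-- transport of an identity from base indices -/
lemma tr2 {P Q : A} (h : P = Q) (w v : Equiv.Perm (Fin k)) {P' Q' : A} (h1 : d.TT w v P = P') (h2 : d.TT w v Q = Q') :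
    P' = Q' := by rw [← h1, ← h2, h]

def toWD (hx : d.x1 * d.x1 = algebraMap ℂ A a) (hxb : d.xb1 * d.xb1 = algebraMap ℂ A b) : WD k a b ω1 A where
  σ := d.σ
  σb := d.σb
  c := d.c
  cb := d.cb
  x := d.gx hk
  xb := d.gxb hk
  E := d.gE hk
  σσb := d.comm_σσb
  σ_c := d.gσ_c
  σ_x := d.gσ_x hk
  σ_E := d.gσ_E hk
  σ_cb := d.comm_σcb
  σ_xb := d.gσ_xb hk
  σb_cb := d.gσb_cb
  σb_xb := d.gσb_xb hk
  σb_E := d.gσb_E hk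
  σb_c := d.comm_σbc
  σb_x := d.gσb_x hk
  c_sq := d.c_sq
  c_anti := d.c_anti
  cb_sq := d.cb_sq
  cb_anti := d.cb_anti
  c_cb := d.anti_ccb
  x_sq i := by
    rw [← d.gx0 hk] at hx
    refine d.tr2 hx (Equiv.swap (zz hk) i) 1 ?_ ?_ <;> simp [T_x]
  x_c i := by
    have h := d.x1_c1 (by omega)
    rw [← d.gx0 hk] at h
    refine d.tr2 h (Equiv.swap (zz hk) i) 1 ?_ ?_ <;> simp only [map_mul, map_neg, T_x, T_c, gx0]
    · rw [← d.gx0 hk, T_x]; erw [Equiv.swap_apply_left]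
    · rw [← d.gx0 hk, T_x]; erw [Equiv.swap_apply_left]
  x_c' i j hij := by
    obtain ⟨w, hw1, hw2⟩ := ex_pair (zo hk) hij
    have h := d.x1_c (oo hk) (by simp [oo])
    rw [← d.gx0 hk] at h
    refine d.tr2 h w 1 ?_ ?_ <;> simp only [map_mul, map_neg, T_x, T_c, hw1, hw2]
  x_x i j hij := by
    obtain ⟨w, hw1, hw2⟩ := ex_pair (zo hk) hij
    refine d.tr2 (d.base_xx hk) w 1 ?_ ?_ <;> simp only [map_mul, map_neg, map_add, map_sub, T_x, T_c, T_σ, hw1, hw2]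
  xb_sq i := by
    rw [← d.gxb0 hk] at hxb
    refine d.tr2 hxb 1 (Equiv.swap (zz hk) i) ?_ ?_ <;> simp [T_xb]
  xb_cb i := by
    have h : d.xb1 * d.cb (zz hk) = -(d.cb (zz hk) * d.xb1) := d.xb1_cb1 _
    rw [← d.gxb0 hk] at h
    refine d.tr2 h 1 (Equiv.swap (zz hk) i) ?_ ?_ <;> simp only [map_mul, map_neg, T_xb, T_cb, Equiv.swap_apply_left]
  xb_cb' i j hij := by
    obtain ⟨w, hw1, hw2⟩ := ex_pair (zo hk) hij
    have h := d.xb1_cb (oo hk) (by simp [oo])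
    rw [← d.gxb0 hk] at h
    refine d.tr2 h 1 w ?_ ?_ <;> simp only [map_mul, map_neg, T_xb, T_cb, hw1, hw2]
  xb_xb i j hij := by
    obtain ⟨w, hw1, hw2⟩ := ex_pair (zo hk) hij
    refine d.tr2 (d.base_xbxb hk) 1 w ?_ ?_ <;> simp only [map_mul, map_neg, map_add, map_sub, T_xb, T_cb, T_σb, hw1, hw2]
  x_cb i j := by
    have h := d.x1_cb_comm j
    rw [← d.gx0 hk] at h
    refine d.tr2 h (Equiv.swap (zz hk) i) 1 ?_ ?_ <;>
      simp only [map_mul, T_x, T_cb, Equiv.swap_apply_left, Equiv.Perm.one_apply]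
  xb_c i j := by
    have h := d.xb1_c_comm j
    rw [← d.gxb0 hk] at h
    refine d.tr2 h 1 (Equiv.swap (zz hk) i) ?_ ?_ <;>
      simp only [map_mul, T_xb, T_c, Equiv.swap_apply_left, Equiv.Perm.one_apply]
  x_xb i j := by
    have h : d.x1 * (d.e + d.xb1 - d.c (zz hk) * d.e * d.c (zz hk))
      = (d.e - d.c (zz hk) * d.e * d.c (zz hk) + d.xb1) * d.x1 := d.x_mixed _
    rw [← d.gxb0 hk, ← d.gx0 hk, ← d.gE0 hk] at h
    have h' := d.tr1 (Equiv.swap (zz hk) i) (Equiv.swap (zz hk) j) h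
    simp only [map_mul, map_add, map_sub, T_x, T_xb, T_c, T_E, Equiv.swap_apply_left] at h'
    generalize d.c i * d.gE hk i j * d.c i = u at *
    generalize d.gE hk i j = E at *
    rw [← sub_eq_zero] at h' ⊢
    rw [← h']; noncomm_ring
  E_c i j := by
    have h : d.e * d.c (zz hk) = d.e * d.cb (zz hk) := d.e_c1 _ _
    rw [← d.gE0 hk] at h
    refine d.tr2 h (Equiv.swap (zz hk) i) (Equiv.swap (zz hk) j) ?_ ?_ <;>
      simp only [map_mul, T_E, T_c, T_cb, Equiv.swap_apply_left]
  c_E i j := by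
    have h : d.c (zz hk) * d.e = d.cb (zz hk) * d.e := d.c1_e _ _
    rw [← d.gE0 hk] at h
    refine d.tr2 h (Equiv.swap (zz hk) i) (Equiv.swap (zz hk) j) ?_ ?_ <;>
      simp only [map_mul, T_E, T_c, T_cb, Equiv.swap_apply_left]
  E_x i j := by
    have h := d.e_xsum
    rw [mul_add, add_eq_zero_iff_eq_neg, ← d.gE0 hk, ← d.gx0 hk, ← d.gxb0 hk] at h
    refine d.tr2 h (Equiv.swap (zz hk) i) (Equiv.swap (zz hk) j) ?_ ?_ <;>
      simp only [map_mul, map_neg, T_E, T_x, T_xb, Equiv.swap_apply_left]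
  x_E i j := by
    have h := d.xsum_e
    rw [add_mul, add_eq_zero_iff_eq_neg, ← d.gE0 hk, ← d.gx0 hk, ← d.gxb0 hk] at h
    refine d.tr2 h (Equiv.swap (zz hk) i) (Equiv.swap (zz hk) j) ?_ ?_ <;>
      simp only [map_mul, map_neg, T_E, T_x, T_xb, Equiv.swap_apply_left]
  E_c' l i j h := by
    obtain ⟨w, hw1, hw2⟩ := ex_pair (zo hk) h.symm
    have h := d.c_e_comm (oo hk) (by simp [oo])
    rw [← d.gE0 hk] at h
    refine d.tr2 h w (Equiv.swap (zz hk) j) ?_ ?_ <;> simp only [map_mul, T_E, T_c, hw1, hw2, Equiv.swap_apply_left]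
  E_x' l i j h := by
    obtain ⟨w, hw1, hw2⟩ := ex_pair (zo hk) h.symm
    have h := (d.e_sxs (by omega)).symm
    rw [← d.gE0 hk, gxo _ hk] at h
    refine d.tr2 h w (Equiv.swap (zz hk) j) ?_ ?_ <;> simp only [map_mul, T_E, T_x, hw1, hw2, Equiv.swap_apply_left]
  E_cb' l i j h := by
    obtain ⟨w, hw1, hw2⟩ := ex_pair (zo hk) h.symm
    have h := d.cb_e_comm (oo hk) (by simp [oo])
    rw [← d.gE0 hk] at h
    refine d.tr2 h (Equiv.swap (zz hk) i) w ?_ ?_ <;> simp only [map_mul, T_E, T_cb, hw1, hw2, Equiv.swap_apply_left]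
  E_xb' l i j h := by
    obtain ⟨w, hw1, hw2⟩ := ex_pair (zo hk) h.symm
    have h := (d.e_sbxbsb (by omega)).symm
    rw [← d.gE0 hk, gxbo _ hk] at h
    refine d.tr2 h (Equiv.swap (zz hk) i) w ?_ ?_ <;> simp only [map_mul, T_E, T_xb, hw1, hw2, Equiv.swap_apply_left]
  E_E i j := by
    have h := d.e_sq
    rw [← d.gE0 hk] at h
    refine d.tr2 h (Equiv.swap (zz hk) i) (Equiv.swap (zz hk) j) ?_ ?_ <;>
      simp only [map_mul, map_zero, T_E, Equiv.swap_apply_left]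
  E_cE i j := by
    have h : d.e * d.c (zz hk) * d.e = 0 := d.e_c_e _
    rw [← d.gE0 hk] at h
    refine d.tr2 h (Equiv.swap (zz hk) i) (Equiv.swap (zz hk) j) ?_ ?_ <;>
      simp only [map_mul, map_zero, T_E, T_c, Equiv.swap_apply_left]
  E_xE i j := by
    have h := d.e_xodd 0
    rw [show 2 * 0 + 1 = 1 from rfl, pow_one, d.om_one, ← Algebra.smul_def, ← d.gE0 hk, ← d.gx0 hk] at h
    refine d.tr2 h (Equiv.swap (zz hk) i) (Equiv.swap (zz hk) j) ?_ ?_ <;>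
      simp only [map_mul, map_smul, T_E, T_x, Equiv.swap_apply_left]
  EE_r i j l h := by
    obtain ⟨w, hw1, hw2⟩ := ex_pair (zo hk) h
    refine d.tr2 (d.base_EE_r hk) (Equiv.swap (zz hk) i) w ?_ ?_ <;>
      simp only [map_mul, T_E, T_σb, hw1, hw2, Equiv.swap_apply_left]
  EE_l i j l h := by
    obtain ⟨w, hw1, hw2⟩ := ex_pair (zo hk) h
    refine d.tr2 (d.base_EE_l hk) w (Equiv.swap (zz hk) j) ?_ ?_ <;>
      simp only [map_mul, T_E, T_σ, hw1, hw2, Equiv.swap_apply_left]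
  EE_comm i j l m h h' := by
    obtain ⟨w, hw1, hw2⟩ := ex_pair (zo hk) h
    obtain ⟨v, hv1, hv2⟩ := ex_pair (zo hk) h'
    refine d.tr2 ((d.base_EE1 hk).trans (d.base_EE2 hk).symm) w v ?_ ?_ <;>
      simp only [map_mul, T_E, hw1, hw2, hv1, hv2]
  EE_σ i j l m h h' := by
    obtain ⟨w, hw1, hw2⟩ := ex_pair (zo hk) h
    obtain ⟨v, hv1, hv2⟩ := ex_pair (zo hk) h'
    refine d.tr2 (d.base_EE3 hk) w v ?_ ?_ <;>
      simp only [map_mul, T_E, T_σ, T_σb, hw1, hw2, hv1, hv2]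
end
end AWBC
end

section
set_option linter.unusedSectionVars false
set_option linter.unusedSimpArgs false
set_option linter.unusedVariables false
namespace WD
variable {A : Type} [Ring A] [Algebra ℂ A] {k : ℕ} {a b ω : ℂ} (D : WD k a b ω A) (n : Fin k)

lemma ss (i j) : D.σ (Equiv.swap i j) * D.σ (Equiv.swap i j) = 1 := by
  rw [← map_mul, Equiv.swap_mul_self, map_one]
lemma ssb (i j) : D.σb (Equiv.swap i j) * D.σb (Equiv.swap i j) = 1 := by
  rw [← map_mul, Equiv.swap_mul_self, map_one]

lemma e_even {X : A} (i j) (h1 : X * D.c i = D.c i * X) (h2 : X * D.cb j = D.cb j * X) :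
    D.E i j * X * D.E i j = 0 := by
  have e1 : D.E i j * D.c i * X * D.c i * D.E i j = -(D.E i j * X * D.E i j) := by
    calc _ = D.E i j * (D.c i * X) * D.c i * D.E i j := by noncomm_ring
      _ = D.E i j * X * (D.c i * D.c i) * D.E i j := by rw [← h1]; noncomm_ring
      _ = _ := by rw [D.c_sq]; noncomm_ring
  have e2 : D.E i j * D.c i * X * D.c i * D.E i j = D.E i j * X * D.E i j := by
    calc _ = (D.E i j * D.c i) * X * (D.c i * D.E i j) := by noncomm_ring
      _ = D.E i j * (D.cb j * X) * (D.cb j * D.E i j) := by rw [D.E_c, D.c_E]; noncomm_ring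
      _ = D.E i j * X * (D.cb j * D.cb j) * D.E i j := by rw [← h2]; noncomm_ring
      _ = _ := by rw [D.cb_sq]; noncomm_ring
  have h3 := e1.symm.trans e2
  have : (2 : ℂ) • (D.E i j * X * D.E i j) = 0 := by
    rw [two_smul]; nth_rewrite 1 [← h3]; simp
  exact (smul_eq_zero.1 this).resolve_left two_ne_zero
lemma E_xcE (i j) : D.E i j * (D.x i * D.c i) * D.E i j = 0 := by
  have h1 : D.E i j * (D.x i * D.c i) * D.E i j = D.E i j * D.cb j * D.x i * D.E i j := by
    rw [← mul_assoc, mul_assoc _ (D.c i), D.c_E, ← mul_assoc, mul_assoc _ (D.x i), D.x_cb, ← mul_assoc]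
  have h2 : D.E i j * (D.x i * D.c i) * D.E i j = -(D.E i j * D.cb j * D.x i * D.E i j) := by
    rw [D.x_c, ← D.E_c]; noncomm_ring
  have h3 := h1.symm.trans h2
  have : (2 : ℂ) • (D.E i j * (D.x i * D.c i) * D.E i j) = 0 := by
    rw [two_smul]; nth_rewrite 2 [h2]; rw [← h1]; simp
  exact (smul_eq_zero.1 this).resolve_left two_ne_zero

lemma EsbE {j l} (i) (h : j ≠ l) : D.E i j * D.σb (Equiv.swap j l) * D.E i j = D.E i j := by
  rw [mul_assoc, D.σb_E, Equiv.swap_apply_left, ← mul_assoc, D.EE_r _ _ _ h, mul_assoc, D.ssb, mul_one]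
lemma EsE {i l} (j) (h : i ≠ l) : D.E i j * D.σ (Equiv.swap i l) * D.E i j = D.E i j := by
  rw [mul_assoc, D.σ_E, Equiv.swap_apply_left, ← mul_assoc, D.EE_l _ _ _ h, mul_assoc, D.ss, mul_one]

def Z : A := D.x n + (∑ j ∈ Finset.univ.erase n, (D.E n j + D.c n * D.E n j * D.c n)
   - (∑ j ∈ Finset.univ.erase n, D.σ (Equiv.swap n j)
      + D.c n * (∑ j ∈ Finset.univ.erase n, D.σ (Equiv.swap n j)) * D.c n))
def Zb : A := D.xb n + (∑ j ∈ Finset.univ.erase n, (D.E j n - D.c j * D.E j n * D.c j)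
   - (∑ j ∈ Finset.univ.erase n, D.σb (Equiv.swap n j)
      - D.cb n * (∑ j ∈ Finset.univ.erase n, D.σb (Equiv.swap n j)) * D.cb n))

lemma Z_c : D.Z n * D.c n = -(D.c n * D.Z n) := by
  have key : ∀ u : A, (u + D.c n * u * D.c n) * D.c n = -(D.c n * (u + D.c n * u * D.c n)) := by
    intro u
    have := D.c_sq n
    calc _ = u * D.c n + D.c n * u * (D.c n * D.c n) := by noncomm_ring
      _ = -(D.c n * u) - (D.c n * D.c n) * u * D.c n := by rw [this]; noncomm_ring
      _ = _ := by noncomm_ring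
  rw [Z, add_mul, sub_mul, key, D.x_c, Finset.sum_mul, Finset.sum_congr rfl (fun j _ => key (D.E n j)), Finset.sum_neg_distrib, ← Finset.mul_sum]
  noncomm_ring
lemma Z_cb : D.Z n * D.cb n = D.cb n * D.Z n := by
  have key : ∀ u : A, u * D.cb n = D.cb n * u → (u + D.c n * u * D.c n) * D.cb n = D.cb n * (u + D.c n * u * D.c n) := by
    intro u hu
    have := D.c_cb n n
    calc _ = u * D.cb n + D.c n * u * (D.c n * D.cb n) := by noncomm_ring
      _ = u * D.cb n - D.c n * (u * D.cb n) * D.c n := by rw [this]; noncomm_ring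
      _ = D.cb n * u - (D.c n * D.cb n) * u * D.c n := by rw [hu]; noncomm_ring
      _ = _ := by rw [this]; noncomm_ring
  rw [Z, add_mul, sub_mul, D.x_cb, Finset.sum_mul, key, Finset.sum_congr rfl (fun j hj => key (D.E n j) (D.E_cb' _ _ _ (Finset.ne_of_mem_erase hj).symm).symm), ← Finset.mul_sum]
  · noncomm_ring
  · rw [Finset.sum_mul, Finset.mul_sum]
    exact Finset.sum_congr rfl fun j _ => D.σ_cb _ _
lemma Zb_cb : D.Zb n * D.cb n = -(D.cb n * D.Zb n) := by
  have key : ∀ u : A, (u - D.cb n * u * D.cb n) * D.cb n = -(D.cb n * (u - D.cb n * u * D.cb n)) := by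
    intro u
    have := D.cb_sq n
    calc _ = u * D.cb n - D.cb n * u * (D.cb n * D.cb n) := by noncomm_ring
      _ = -(D.cb n * u) + (D.cb n * D.cb n) * u * D.cb n := by rw [this]; noncomm_ring
      _ = _ := by noncomm_ring
  have h2 : ∀ j, D.E j n - D.c j * D.E j n * D.c j = D.E j n - D.cb n * D.E j n * D.cb n := by
    intro j; rw [D.c_E, mul_assoc, D.E_c, ← mul_assoc]
  simp only [Zb, h2]
  rw [add_mul, sub_mul, key, D.xb_cb, Finset.sum_mul, Finset.sum_congr rfl (fun j _ => key (D.E j n)), Finset.sum_neg_distrib, ← Finset.mul_sum]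
  noncomm_ring
lemma Zb_c : D.Zb n * D.c n = D.c n * D.Zb n := by
  have key : ∀ u : A, u * D.c n = D.c n * u → (u - D.cb n * u * D.cb n) * D.c n = D.c n * (u - D.cb n * u * D.cb n) := by
    intro u hu
    have : D.cb n * D.c n = -(D.c n * D.cb n) := by rw [D.c_cb, neg_neg]
    calc _ = u * D.c n - D.cb n * u * (D.cb n * D.c n) := by noncomm_ring
      _ = u * D.c n + D.cb n * (u * D.c n) * D.cb n := by rw [this]; noncomm_ring
      _ = D.c n * u + (D.cb n * D.c n) * u * D.cb n := by rw [hu]; noncomm_ring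
      _ = _ := by rw [this]; noncomm_ring
  have h2 : ∀ j, D.E j n - D.c j * D.E j n * D.c j = D.E j n - D.cb n * D.E j n * D.cb n := by
    intro j; rw [D.c_E, mul_assoc, D.E_c, ← mul_assoc]
  simp only [Zb, h2]
  rw [add_mul, sub_mul, D.xb_c, Finset.sum_mul, key, Finset.sum_congr rfl (fun j hj => key (D.E j n) (D.E_c' _ _ _ (Finset.ne_of_mem_erase hj).symm).symm), ← Finset.mul_sum]
  · noncomm_ring
  · rw [Finset.sum_mul, Finset.mul_sum]
    exact Finset.sum_congr rfl fun j _ => D.σb_c _ _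

lemma ev_comm {u v : A} (h : u * v = -(v * u)) (m : ℕ) : u ^ (2 * m) * v = v * u ^ (2 * m) := by
  have h2 : Commute (u ^ 2) v := by
    change u ^ 2 * v = v * u ^ 2
    rw [pow_two, mul_assoc, h, mul_neg, ← mul_assoc, h]; noncomm_ring
  rw [pow_mul]; exact (h2.pow_left m)
lemma Z_even (m : ℕ) : D.E n n * D.Z n ^ (2 * m) * D.E n n = 0 := by
  refine D.e_even _ _ (ev_comm (D.Z_c n) m) ?_
  have : Commute (D.Z n) (D.cb n) := D.Z_cb n
  exact this.pow_left _
lemma Zb_even (m : ℕ) : D.E n n * D.Zb n ^ (2 * m) * D.E n n = 0 := by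
  refine D.e_even _ _ ?_ (ev_comm (D.Zb_cb n) m)
  have : Commute (D.Zb n) (D.c n) := D.Zb_c n
  exact this.pow_left _

lemma Z_one : D.E n n * D.Z n * D.E n n = ω • D.E n n := by
  have cc : ∀ u : A, u * D.cb n = D.cb n * u → D.E n n * (D.c n * u * D.c n) * D.E n n = D.E n n * u * D.E n n := by
    intro u hu
    calc _ = (D.E n n * D.c n) * u * (D.c n * D.E n n) := by noncomm_ring
      _ = D.E n n * (D.cb n * u) * D.cb n * D.E n n := by rw [D.c_E, D.E_c]; noncomm_ring
      _ = D.E n n * u * (D.cb n * D.cb n) * D.E n n := by rw [← hu]; noncomm_ring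
      _ = _ := by rw [D.cb_sq, mul_one]
  have h1 : ∀ j ∈ Finset.univ.erase n, D.E n n * (D.E n j + D.c n * D.E n j * D.c n) * D.E n n = D.E n n + D.E n n := by
    intro j hj
    have hj := (Finset.ne_of_mem_erase hj).symm
    rw [mul_add, add_mul, cc _ (D.E_cb' _ _ _ hj).symm, D.EE_r _ _ _ hj, D.EsbE _ hj]
  have h2 : D.E n n * (∑ j ∈ Finset.univ.erase n, D.σ (Equiv.swap n j)) * D.E n n = ∑ j ∈ Finset.univ.erase n, D.E n n := by
    rw [Finset.mul_sum, Finset.sum_mul]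
    refine Finset.sum_congr rfl fun j hj => ?_
    rw [D.EsE _ (Finset.ne_of_mem_erase hj).symm]
  have h3 := cc (∑ j ∈ Finset.univ.erase n, D.σ (Equiv.swap n j)) (by
    rw [Finset.sum_mul, Finset.mul_sum]
    exact Finset.sum_congr rfl fun j _ => D.σ_cb _ _)
  rw [Z, mul_add, add_mul, mul_sub, sub_mul, mul_add, add_mul, h3, h2, Finset.mul_sum, Finset.sum_mul,
    Finset.sum_congr rfl h1, Finset.sum_add_distrib, D.E_xE]
  simp
end WD
end

section
set_option linter.unusedSectionVars false
set_option linter.unusedSimpArgs false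
set_option linter.unusedVariables false
namespace WD
variable {A : Type} [Ring A] [Algebra ℂ A] {k : ℕ} {a b ω : ℂ} (D : WD k a b ω A) (n : Fin k)

/-- generators of the lower subalgebra fixing the strand `n` -/
def lgen : Set A := {u | (∃ w : Equiv.Perm (Fin k), w n = n ∧ u = D.σ w) ∨ (∃ w : Equiv.Perm (Fin k), w n = n ∧ u = D.σb w)
  ∨ (∃ i, i ≠ n ∧ (u = D.c i ∨ u = D.cb i ∨ u = D.x i ∨ u = D.xb i)) ∨ ∃ i j, i ≠ n ∧ j ≠ n ∧ u = D.E i j}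
def LA : Subalgebra ℂ A := Algebra.adjoin ℂ (D.lgen n)
variable {n}
lemma LAσ {w : Equiv.Perm (Fin k)} (h : w n = n) : D.σ w ∈ D.LA n := Algebra.subset_adjoin (Or.inl ⟨w, h, rfl⟩)
lemma LAσb {w : Equiv.Perm (Fin k)} (h : w n = n) : D.σb w ∈ D.LA n := Algebra.subset_adjoin (Or.inr (Or.inl ⟨w, h, rfl⟩))
lemma LAc {i} (h : i ≠ n) : D.c i ∈ D.LA n := Algebra.subset_adjoin (Or.inr (Or.inr (Or.inl ⟨i, h, by simp⟩)))
lemma LAcb {i} (h : i ≠ n) : D.cb i ∈ D.LA n := Algebra.subset_adjoin (Or.inr (Or.inr (Or.inl ⟨i, h, by simp⟩)))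
lemma LAx {i} (h : i ≠ n) : D.x i ∈ D.LA n := Algebra.subset_adjoin (Or.inr (Or.inr (Or.inl ⟨i, h, by simp⟩)))
lemma LAxb {i} (h : i ≠ n) : D.xb i ∈ D.LA n := Algebra.subset_adjoin (Or.inr (Or.inr (Or.inl ⟨i, h, by simp⟩)))
lemma LAE {i j} (h : i ≠ n) (h' : j ≠ n) : D.E i j ∈ D.LA n :=
  Algebra.subset_adjoin (Or.inr (Or.inr (Or.inr ⟨i, j, h, h', rfl⟩)))

lemma LA_E {y : A} (hy : y ∈ D.LA n) : y * D.E n n = D.E n n * y := by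
  induction hy using Algebra.adjoin_induction with
  | mem u hu =>
    rcases hu with ⟨w, h, rfl⟩ | ⟨w, h, rfl⟩ | ⟨i, h, rfl | rfl | rfl | rfl⟩ | ⟨i, j, h, h', rfl⟩
    · rw [D.σ_E, h]
    · rw [D.σb_E, h]
    · exact D.E_c' _ _ _ h
    · exact D.E_cb' _ _ _ h
    · exact D.E_x' _ _ _ h
    · exact D.E_xb' _ _ _ h
    · exact D.EE_comm _ _ _ _ h h'
  | algebraMap r => exact Algebra.commutes r _
  | add u v _ _ hu hv => rw [add_mul, mul_add, hu, hv]
  | mul u v _ _ hu hv => rw [mul_assoc, hv, ← mul_assoc, hu, mul_assoc]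

variable (n)
def uu (i j : Fin k) : A := D.σ (Equiv.swap i n) * D.σb (Equiv.swap j n)
def pp (i j : Fin k) : A := D.uu n i j * D.E n n
variable {n}
lemma u_c (l i j) : D.c l * D.uu n i j = D.uu n i j * D.c (Equiv.swap i n l) := by
  symm; rw [uu, mul_assoc, D.σb_c, ← mul_assoc, D.σ_c, Equiv.swap_apply_self, mul_assoc]
lemma u_x (l i j) : D.x l * D.uu n i j = D.uu n i j * D.x (Equiv.swap i n l) := by
  symm; rw [uu, mul_assoc, D.σb_x, ← mul_assoc, D.σ_x, Equiv.swap_apply_self, mul_assoc]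
lemma u_cb (l i j) : D.cb l * D.uu n i j = D.uu n i j * D.cb (Equiv.swap j n l) := by
  symm; rw [uu, mul_assoc, D.σb_cb, ← mul_assoc, D.σ_cb, Equiv.swap_apply_self, mul_assoc]
lemma u_xb (l i j) : D.xb l * D.uu n i j = D.uu n i j * D.xb (Equiv.swap j n l) := by
  symm; rw [uu, mul_assoc, D.σb_xb, ← mul_assoc, D.σ_xb, Equiv.swap_apply_self, mul_assoc]
lemma u_E (l m i j) : D.E l m * D.uu n i j = D.uu n i j * D.E (Equiv.swap i n l) (Equiv.swap j n m) := by
  symm; rw [uu, mul_assoc, D.σb_E, ← mul_assoc, D.σ_E, Equiv.swap_apply_self, Equiv.swap_apply_self, mul_assoc]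
lemma sne {i n l : Fin k} (h : l ≠ i) : Equiv.swap i n l ≠ n := by
  intro hc
  apply h
  apply (Equiv.swap i n).injective
  rw [hc, Equiv.swap_apply_left]
lemma p_eq (i j) : D.pp n i j = D.E i j * D.uu n i j := by
  rw [D.u_E, Equiv.swap_apply_left, Equiv.swap_apply_left, pp]
lemma p_c {l i} (j) (h : l ≠ i) : D.c l * D.pp n i j = D.pp n i j * D.c (Equiv.swap i n l) := by
  rw [pp, ← mul_assoc, D.u_c, mul_assoc, D.E_c' _ _ _ (sne h), mul_assoc]
lemma p_x {l i} (j) (h : l ≠ i) : D.x l * D.pp n i j = D.pp n i j * D.x (Equiv.swap i n l) := by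
  rw [pp, ← mul_assoc, D.u_x, mul_assoc, D.E_x' _ _ _ (sne h), mul_assoc]
lemma p_cb {l j} (i) (h : l ≠ j) : D.cb l * D.pp n i j = D.pp n i j * D.cb (Equiv.swap j n l) := by
  rw [pp, ← mul_assoc, D.u_cb, mul_assoc, D.E_cb' _ _ _ (sne h), mul_assoc]
lemma p_xb {l j} (i) (h : l ≠ j) : D.xb l * D.pp n i j = D.pp n i j * D.xb (Equiv.swap j n l) := by
  rw [pp, ← mul_assoc, D.u_xb, mul_assoc, D.E_xb' _ _ _ (sne h), mul_assoc]
lemma p_E {l m i j} (h : l ≠ i) (h' : m ≠ j) :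
    D.E l m * D.pp n i j = D.pp n i j * D.E (Equiv.swap i n l) (Equiv.swap j n m) := by
  rw [pp, ← mul_assoc, D.u_E, mul_assoc, D.EE_comm _ _ _ _ (sne h) (sne h'), mul_assoc]
lemma p_cb' (i j) : D.cb j * D.pp n i j = D.c i * D.pp n i j := by
  rw [p_eq, ← mul_assoc, ← mul_assoc, D.c_E]
lemma p_xb' (i j) : D.xb j * D.pp n i j = -(D.x i * D.pp n i j) := by
  rw [p_eq, ← mul_assoc, ← mul_assoc, D.x_E, neg_mul, neg_neg]
lemma p_El {l i} (j) (h : l ≠ i) : D.E l j * D.pp n i j = D.σ (Equiv.swap l i) * D.pp n i j := by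
  rw [p_eq, ← mul_assoc, ← mul_assoc, D.EE_l _ _ _ h, D.σ_E, Equiv.swap_apply_right]
lemma p_Er {m j} (i) (h : m ≠ j) : D.E i m * D.pp n i j = D.σb (Equiv.swap m j) * D.pp n i j := by
  rw [p_eq, ← mul_assoc, ← mul_assoc, D.EE_r _ _ _ h, D.σb_E, Equiv.swap_apply_right]
lemma p_E0 (i j) : D.E i j * D.pp n i j = 0 := by rw [p_eq, ← mul_assoc, D.E_E, zero_mul]
lemma p_Ec (i j) : D.E i j * (D.c i * D.pp n i j) = 0 := by
  rw [p_eq, ← mul_assoc, ← mul_assoc, D.E_cE, zero_mul]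
lemma p_Ex (i j) : D.E i j * (D.x i * D.pp n i j) = ω • D.pp n i j := by
  rw [p_eq, ← mul_assoc, ← mul_assoc, D.E_xE, smul_mul_assoc]
lemma p_Exc (i j) : D.E i j * (D.x i * (D.c i * D.pp n i j)) = 0 := by
  rw [p_eq, ← mul_assoc, ← mul_assoc, ← mul_assoc, mul_assoc (D.E i j) (D.x i), D.E_xcE, zero_mul]
lemma p_σ (w : Equiv.Perm (Fin k)) (i j) : ∃ y ∈ D.LA n, D.σ w * D.pp n i j = D.pp n (w i) j * y := by
  have h : (Equiv.swap (w i) n * w * Equiv.swap i n) n = n := by simp [Equiv.Perm.mul_apply]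
  refine ⟨D.σ (Equiv.swap (w i) n * w * Equiv.swap i n), D.LAσ h, ?_⟩
  have h1 : D.uu n (w i) j * D.σ (Equiv.swap (w i) n * w * Equiv.swap i n) = D.σ w * D.uu n i j := by
    rw [uu, uu, mul_assoc, ← D.σσb, ← mul_assoc, ← mul_assoc, ← map_mul, ← map_mul]; congr 2; simp [← mul_assoc]
  rw [pp, pp, ← mul_assoc, ← h1, mul_assoc (D.uu _ _ _), mul_assoc (D.uu _ _ _), ← D.LA_E (D.LAσ h)]
lemma p_σb (w : Equiv.Perm (Fin k)) (i j) : ∃ y ∈ D.LA n, D.σb w * D.pp n i j = D.pp n i (w j) * y := by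
  have h : (Equiv.swap (w j) n * w * Equiv.swap j n) n = n := by simp [Equiv.Perm.mul_apply]
  refine ⟨D.σb (Equiv.swap (w j) n * w * Equiv.swap j n), D.LAσb h, ?_⟩
  have h1 : D.uu n i (w j) * D.σb (Equiv.swap (w j) n * w * Equiv.swap j n) = D.σb w * D.uu n i j := by
    rw [uu, uu, D.σσb, D.σσb, ← mul_assoc, mul_assoc, D.σσb, ← mul_assoc, ← map_mul, ← map_mul]; congr 2; simp [← mul_assoc]
  rw [pp, pp, ← mul_assoc, ← h1, mul_assoc (D.uu _ _ _), mul_assoc (D.uu _ _ _), ← D.LA_E (D.LAσb h)]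

variable (n)
def V (i j : Fin k) (v : A) : Prop := ∃ y ∈ D.LA n, v = D.pp n i j * y ∨ v = D.c i * (D.pp n i j * y)
variable {n} {D}
lemma V0 {i j y} (hy : y ∈ D.LA n) : D.V n i j (D.pp n i j * y) := ⟨y, hy, Or.inl rfl⟩
lemma V1 {i j y} (hy : y ∈ D.LA n) : D.V n i j (D.c i * (D.pp n i j * y)) := ⟨y, hy, Or.inr rfl⟩
lemma Vz (i j) : D.V n i j 0 := ⟨0, zero_mem _, Or.inl (by simp)⟩
lemma Vn {i j v} (h : D.V n i j v) : D.V n i j (-v) := by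
  obtain ⟨y, hy, rfl | rfl⟩ := h
  · rw [← mul_neg]; exact V0 (neg_mem hy)
  · rw [← mul_neg, ← mul_neg]; exact V1 (neg_mem hy)
lemma V_c {i j v} (h : D.V n i j v) (l) : D.V n i j (D.c l * v) := by
  by_cases hl : l = i
  · subst hl
    obtain ⟨y, hy, rfl | rfl⟩ := h
    · exact V1 hy
    · rw [← mul_assoc, D.c_sq, neg_one_mul]; exact Vn (V0 hy)
  · obtain ⟨y, hy, rfl | rfl⟩ := h
    · rw [← mul_assoc, D.p_c j hl, mul_assoc]; exact V0 (mul_mem (D.LAc (sne hl)) hy)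
    · rw [← mul_assoc, D.c_anti _ _ hl, neg_mul, mul_assoc, ← mul_assoc (D.c l), D.p_c j hl, mul_assoc]
      exact Vn (V1 (mul_mem (D.LAc (sne hl)) hy))
lemma V_σ {i j v} (h : D.V n i j v) (w : Equiv.Perm (Fin k)) : D.V n (w i) j (D.σ w * v) := by
  obtain ⟨z, hz, h1⟩ := D.p_σ (n := n) w i j
  obtain ⟨y, hy, rfl | rfl⟩ := h
  · rw [← mul_assoc, h1, mul_assoc]; exact V0 (mul_mem hz hy)
  · rw [← mul_assoc, D.σ_c, mul_assoc, ← mul_assoc (D.σ w), h1, mul_assoc]; exact V1 (mul_mem hz hy)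
lemma V_σb {i j v} (h : D.V n i j v) (w : Equiv.Perm (Fin k)) : D.V n i (w j) (D.σb w * v) := by
  obtain ⟨z, hz, h1⟩ := D.p_σb (n := n) w i j
  obtain ⟨y, hy, rfl | rfl⟩ := h
  · rw [← mul_assoc, h1, mul_assoc]; exact V0 (mul_mem hz hy)
  · rw [← mul_assoc, D.σb_c, mul_assoc, ← mul_assoc (D.σb w), h1, mul_assoc]; exact V1 (mul_mem hz hy)
lemma V_x {i j v} (h : D.V n i j v) {l} (hl : l ≠ i) : D.V n i j (D.x l * v) := by
  obtain ⟨y, hy, rfl | rfl⟩ := h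
  · rw [← mul_assoc, D.p_x j hl, mul_assoc]; exact V0 (mul_mem (D.LAx (sne hl)) hy)
  · rw [← mul_assoc, D.x_c' _ _ hl, mul_assoc, ← mul_assoc (D.x l), D.p_x j hl, mul_assoc]
    exact V1 (mul_mem (D.LAx (sne hl)) hy)
lemma cb_c (i j) : D.cb j * D.c i = -(D.c i * D.cb j) := by rw [D.c_cb, neg_neg]
lemma V_cb {i j v} (h : D.V n i j v) (l) : D.V n i j (D.cb l * v) := by
  by_cases hl : l = j
  · subst hl
    obtain ⟨y, hy, rfl | rfl⟩ := h
    · rw [← mul_assoc, D.p_cb', mul_assoc]; exact V1 hy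
    · rw [← mul_assoc, cb_c, neg_mul, mul_assoc, ← mul_assoc (D.cb l), D.p_cb', mul_assoc]
      exact Vn (V_c (V1 hy) i)
  · obtain ⟨y, hy, rfl | rfl⟩ := h
    · rw [← mul_assoc, D.p_cb i hl, mul_assoc]; exact V0 (mul_mem (D.LAcb (sne hl)) hy)
    · rw [← mul_assoc, cb_c, neg_mul, mul_assoc, ← mul_assoc (D.cb l), D.p_cb i hl, mul_assoc]
      exact Vn (V1 (mul_mem (D.LAcb (sne hl)) hy))
lemma V_xb {i j v} (h : D.V n i j v) {l} (hl : l ≠ j) : D.V n i j (D.xb l * v) := by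
  obtain ⟨y, hy, rfl | rfl⟩ := h
  · rw [← mul_assoc, D.p_xb i hl, mul_assoc]; exact V0 (mul_mem (D.LAxb (sne hl)) hy)
  · rw [← mul_assoc, D.xb_c, mul_assoc, ← mul_assoc (D.xb l), D.p_xb i hl, mul_assoc]
    exact V1 (mul_mem (D.LAxb (sne hl)) hy)
lemma V_xb' {i j v} (h : D.V n i j v) : ∃ v', D.V n i j v' ∧ D.xb j * v = D.x i * v' := by
  obtain ⟨y, hy, rfl | rfl⟩ := h
  · refine ⟨_, Vn (V0 hy), ?_⟩
    rw [← mul_assoc, D.p_xb']; noncomm_ring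
  · refine ⟨_, V1 hy, ?_⟩
    rw [← mul_assoc, D.xb_c, mul_assoc, ← mul_assoc (D.xb j), D.p_xb', ← mul_assoc (D.x i) (D.c i), D.x_c]
    noncomm_ring
lemma V_E {i j v} (h : D.V n i j v) (l m) : ∃ i' j', D.V n i' j' (D.E l m * v) ∧ (l ≠ i → i' = i ∨ i' = l) := by
  by_cases hl : l = i
  · subst hl
    by_cases hm : m = j
    · subst hm
      refine ⟨l, m, ?_, fun hc => absurd rfl hc⟩
      obtain ⟨y, hy, rfl | rfl⟩ := h
      · rw [← mul_assoc, D.p_E0, zero_mul]; exact Vz _ _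
      · rw [← mul_assoc, ← mul_assoc, mul_assoc (D.E l m), D.p_Ec, zero_mul]; exact Vz _ _
    · refine ⟨l, Equiv.swap m j j, ?_, fun hc => absurd rfl hc⟩
      · obtain ⟨y, hy, rfl | rfl⟩ := h
        · rw [← mul_assoc, D.p_Er l hm, mul_assoc]; exact V_σb (V0 hy) (Equiv.swap m j)
        · rw [← mul_assoc, D.E_c, mul_assoc, ← mul_assoc (D.cb m), D.p_cb l hm, mul_assoc, ← mul_assoc (D.E l m), D.p_Er l hm, mul_assoc]
          exact V_σb (V0 (mul_mem (D.LAcb (sne hm)) hy)) (Equiv.swap m j)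
  · by_cases hm : m = j
    · subst hm
      refine ⟨Equiv.swap l i i, m, ?_, ?_⟩
      · obtain ⟨y, hy, rfl | rfl⟩ := h
        · rw [← mul_assoc, D.p_El m hl, mul_assoc]; exact V_σ (V0 hy) (Equiv.swap l i)
        · rw [← mul_assoc, ← D.E_c' _ _ _ (Ne.symm hl), mul_assoc, ← mul_assoc (D.E l m), D.p_El m hl, mul_assoc]
          exact V_c (V_σ (V0 hy) (Equiv.swap l i)) i
      · intro _; right; simp
    · refine ⟨i, j, ?_, fun _ => Or.inl rfl⟩
      obtain ⟨y, hy, rfl | rfl⟩ := h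
      · rw [← mul_assoc, D.p_E hl hm, mul_assoc]; exact V0 (mul_mem (D.LAE (sne hl) (sne hm)) hy)
      · rw [← mul_assoc, ← D.E_c' _ _ _ (Ne.symm hl), mul_assoc, ← mul_assoc (D.E l m), D.p_E hl hm, mul_assoc]
        exact V1 (mul_mem (D.LAE (sne hl) (sne hm)) hy)
end WD
end

section
set_option linter.unusedSectionVars false
set_option linter.unusedSimpArgs false
set_option linter.unusedVariables false
namespace WD
variable {A : Type} [Ring A] [Algebra ℂ A] {k : ℕ} {a b ω : ℂ} (D : WD k a b ω A) (n : Fin k)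

/-- span of the normal forms of `A * E n n` -/
def NN : Submodule ℂ A := Submodule.span ℂ {v | ∃ i j, D.V n i j v ∨ ∃ v', D.V n i j v' ∧ v = D.x i * v'}
variable {n} {D}
lemma N0 {i j v} (h : D.V n i j v) : v ∈ D.NN n := Submodule.subset_span ⟨i, j, Or.inl h⟩
lemma N1 {i j v} (h : D.V n i j v) : D.x i * v ∈ D.NN n := Submodule.subset_span ⟨i, j, Or.inr ⟨v, h, rfl⟩⟩
lemma N_close {g : A} {S : Submodule ℂ A} (h : ∀ i j v, D.V n i j v → g * v ∈ S ∧ g * (D.x i * v) ∈ S) {u} (hu : u ∈ D.NN n) :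
    g * u ∈ S := by
  induction hu using Submodule.span_induction with
  | mem u hu =>
    obtain ⟨i, j, h1 | ⟨v, h1, rfl⟩⟩ := hu
    · exact (h _ _ _ h1).1
    · exact (h _ _ _ h1).2
  | zero => rw [mul_zero]; exact zero_mem _
  | add u v _ _ hu hv => rw [mul_add]; exact add_mem hu hv
  | smul r u _ hu => rw [mul_smul_comm]; exact Submodule.smul_mem _ _ hu
lemma N_σ (w) {u} (hu : u ∈ D.NN n) : D.σ w * u ∈ D.NN n := by
  refine N_close (fun i j v h => ⟨N0 (V_σ h w), ?_⟩) hu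
  rw [← mul_assoc, D.σ_x, mul_assoc]; exact N1 (V_σ h w)
lemma N_σb (w) {u} (hu : u ∈ D.NN n) : D.σb w * u ∈ D.NN n := by
  refine N_close (fun i j v h => ⟨N0 (V_σb h w), ?_⟩) hu
  rw [← mul_assoc, D.σb_x, mul_assoc]; exact N1 (V_σb h w)
lemma N_c (l) {u} (hu : u ∈ D.NN n) : D.c l * u ∈ D.NN n := by
  refine N_close (fun i j v h => ⟨N0 (V_c h l), ?_⟩) hu
  by_cases hl : l = i
  · subst hl
    rw [← mul_assoc, ← neg_neg (D.c l * D.x l), ← D.x_c, neg_mul, mul_assoc]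
    exact neg_mem (N1 (V_c h l))
  · rw [← mul_assoc, ← D.x_c' _ _ (Ne.symm hl), mul_assoc]; exact N1 (V_c h l)
lemma N_cb (l) {u} (hu : u ∈ D.NN n) : D.cb l * u ∈ D.NN n := by
  refine N_close (fun i j v h => ⟨N0 (V_cb h l), ?_⟩) hu
  rw [← mul_assoc, ← D.x_cb, mul_assoc]; exact N1 (V_cb h l)
lemma N_x0 (l) {i j v} (h : D.V n i j v) : D.x l * v ∈ D.NN n := by
  by_cases hl : l = i
  · subst hl; exact N1 h
  · exact N0 (V_x h hl)
lemma N_x (l) {u} (hu : u ∈ D.NN n) : D.x l * u ∈ D.NN n := by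
  refine N_close (fun i j v h => ⟨N_x0 l h, ?_⟩) hu
  by_cases hl : l = i
  · subst hl
    rw [← mul_assoc, D.x_sq, ← Algebra.smul_def]; exact Submodule.smul_mem _ _ (N0 h)
  · rw [← mul_assoc, D.x_x _ _ hl, add_mul, mul_assoc (D.x i), mul_assoc _ (D.σ _)]
    have h2 := V_σ h (Equiv.swap l i)
    refine add_mem (N_x0 i (V_x h hl)) ?_
    rw [add_mul, sub_mul, mul_assoc, mul_assoc, add_mul]
    exact add_mem (sub_mem (N_x0 l h2) (N_x0 i h2)) (N_c _ (N_c _ (add_mem (N_x0 l h2) (N_x0 i h2))))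
lemma N_E0 (l m) {i j v} (h : D.V n i j v) : D.E l m * v ∈ D.NN n := by
  obtain ⟨i', j', h', -⟩ := V_E h l m; exact N0 h'
lemma N_E (l m) {u} (hu : u ∈ D.NN n) : D.E l m * u ∈ D.NN n := by
  refine N_close (fun i j v h => ⟨N_E0 l m h, ?_⟩) hu
  by_cases hl : l = i
  · subst hl
    by_cases hm : m = j
    · subst hm
      obtain ⟨y, hy, rfl | rfl⟩ := h
      · rw [← mul_assoc (D.x l), ← mul_assoc, D.p_Ex, smul_mul_assoc]
        exact Submodule.smul_mem _ _ (N0 (V0 hy))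
      · rw [← mul_assoc (D.c l), ← mul_assoc (D.x l), ← mul_assoc, D.p_Exc, zero_mul]; exact zero_mem _
    · rw [← mul_assoc, D.E_x, neg_mul, mul_assoc]
      exact neg_mem (N_E0 _ _ (V_xb h hm))
  · rw [← mul_assoc, ← D.E_x' _ _ _ (Ne.symm hl), mul_assoc]
    exact N_x _ (N_E0 _ _ h)
lemma N_xb0 (l) {i j v} (h : D.V n i j v) : D.xb l * v ∈ D.NN n := by
  by_cases hl : l = j
  · subst hl
    obtain ⟨v', h1, h2⟩ := V_xb' h
    rw [h2]; exact N1 h1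
  · exact N0 (V_xb h hl)
lemma N_xb (l) {u} (hu : u ∈ D.NN n) : D.xb l * u ∈ D.NN n := by
  refine N_close (fun i j v h => ⟨N_xb0 l h, ?_⟩) hu
  have hx := D.x_xb i l
  have e : D.xb l * (D.x i * v) = D.x i * (D.xb l * v) - (D.E i l * (D.x i * v) - D.c i * (D.E i l * (D.c i * (D.x i * v))))
      + D.x i * (D.E i l * v - D.c i * (D.E i l * (D.c i * v))) := by
    have := congrArg (· * v) hx
    simp only [add_mul, sub_mul, mul_sub, mul_assoc] at this
    simp only [mul_sub]
    rw [this]; abel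
  rw [e]
  have h0 := N0 h
  have h1 := N1 h
  refine add_mem (sub_mem (N_x _ (N_xb0 l h)) ?_) (N_x _ ?_)
  · exact sub_mem (N_E _ _ h1) (N_c _ (N_E _ _ (N_c _ h1)))
  · exact sub_mem (N_E _ _ h0) (N_c _ (N_E _ _ (N_c _ h0)))

variable (D)
/-- all generators -/
def gens : Set A := {u | (∃ w, u = D.σ w) ∨ (∃ w, u = D.σb w)
  ∨ (∃ i, (u = D.c i ∨ u = D.cb i ∨ u = D.x i ∨ u = D.xb i)) ∨ ∃ i j, u = D.E i j}
/-- left ideals are detected on generators -/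
lemma gens_ind (hg : Algebra.adjoin ℂ D.gens = ⊤) (S : Submodule ℂ A) (h : ∀ g ∈ D.gens, ∀ u ∈ S, g * u ∈ S) (g : A) :
    ∀ u ∈ S, g * u ∈ S := by
  have : g ∈ Algebra.adjoin ℂ D.gens := by rw [hg]; trivial
  induction this using Algebra.adjoin_induction with
  | mem g hg => exact h g hg
  | algebraMap r => intro u hu; rw [← Algebra.smul_def]; exact Submodule.smul_mem _ _ hu
  | add g g' _ _ h1 h2 => intro u hu; rw [add_mul]; exact add_mem (h1 u hu) (h2 u hu)
  | mul g g' _ _ h1 h2 => intro u hu; rw [mul_assoc]; exact h1 _ (h2 u hu)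
lemma N_all (hg : Algebra.adjoin ℂ D.gens = ⊤) (g : A) {u} (hu : u ∈ D.NN n) : g * u ∈ D.NN n := by
  refine D.gens_ind hg _ ?_ g u hu
  rintro g (⟨w, rfl⟩ | ⟨w, rfl⟩ | ⟨i, rfl | rfl | rfl | rfl⟩ | ⟨i, j, rfl⟩) u hu
  exacts [N_σ _ hu, N_σb _ hu, N_c _ hu, N_cb _ hu, N_x _ hu, N_xb _ hu, N_E _ _ hu]
lemma pp_nn : D.pp n n n = D.E n n := by
  rw [pp, uu, Equiv.swap_self]; show D.σ 1 * D.σb 1 * _ = _; rw [map_one, map_one, one_mul, one_mul]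
lemma N_En : D.E n n ∈ D.NN n := by
  have : D.V n n n (D.E n n) := ⟨1, one_mem _, Or.inl (by rw [pp_nn, mul_one])⟩
  exact N0 this
variable (n)
def EL : Submodule ℂ A := (Subalgebra.toSubmodule (D.LA n)).map (LinearMap.mulLeft ℂ (D.E n n))
variable {n} {D}
lemma EL_mem {y} (hy : y ∈ D.LA n) : D.E n n * y ∈ D.EL n := ⟨y, hy, rfl⟩
lemma EL_l {y v} (hy : y ∈ D.LA n) (hv : D.E n n * v ∈ D.EL n) : D.E n n * (y * v) ∈ D.EL n := by
  obtain ⟨z, hz, h⟩ := hv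
  rw [← mul_assoc, ← D.LA_E hy, mul_assoc, ← h, LinearMap.mulLeft_apply, ← mul_assoc, D.LA_E hy, mul_assoc]
  exact EL_mem (mul_mem hy hz)
lemma EL_r {y v} (hy : y ∈ D.LA n) (hv : D.E n n * v ∈ D.EL n) : D.E n n * (v * y) ∈ D.EL n := by
  obtain ⟨z, hz, h⟩ := hv
  rw [← mul_assoc, ← h, LinearMap.mulLeft_apply, mul_assoc]
  exact EL_mem (mul_mem hz hy)
lemma EL_pp {i j} (h : ¬ (i = n ∧ j = n)) : D.E n n * D.pp n i j ∈ D.EL n := by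
  by_cases hi : i = n
  · subst hi
    have hj : j ≠ i := fun hc => h ⟨rfl, hc⟩
    rw [pp, uu, Equiv.swap_self]
    show _ * (D.σ 1 * _ * _) ∈ _
    rw [map_one, one_mul, ← mul_assoc, Equiv.swap_comm, D.EsbE _ hj.symm, ← mul_one (D.E i i)]
    exact EL_mem (one_mem _)
  · by_cases hj : j = n
    · subst hj
      rw [pp, uu, Equiv.swap_self]
      show _ * (_ * D.σb 1 * _) ∈ _
      rw [map_one, mul_one, ← mul_assoc, Equiv.swap_comm, D.EsE _ (Ne.symm hi), ← mul_one (D.E j j)]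
      exact EL_mem (one_mem _)
    · rw [p_eq, uu, ← mul_assoc, ← mul_assoc, Equiv.swap_comm i, Equiv.swap_comm j, D.EE_σ _ _ _ _ (Ne.symm hi) (Ne.symm hj)]
      exact EL_mem (D.LAE hi hj)
lemma EL_V {i j v} (hv : D.V n i j v) : D.E n n * v ∈ D.EL n ∧ D.E n n * (D.x i * v) ∈ D.EL n := by
  by_cases h : i = n ∧ j = n
  · obtain ⟨h, h'⟩ := h; subst h; subst h'
    obtain ⟨y, hy, rfl | rfl⟩ := hv
    · constructor
      · rw [← mul_assoc, D.p_E0, zero_mul]; exact zero_mem _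
      · rw [← mul_assoc (D.x _), ← mul_assoc, D.p_Ex, pp_nn, smul_mul_assoc]
        exact Submodule.smul_mem _ _ (EL_mem hy)
    · constructor
      · rw [← mul_assoc (D.c _), ← mul_assoc, D.p_Ec, zero_mul]; exact zero_mem _
      · rw [← mul_assoc (D.c _), ← mul_assoc (D.x _), ← mul_assoc, D.p_Exc, zero_mul]; exact zero_mem _
  · by_cases hi : i = n
    · subst hi
      have hj : i ≠ j := fun hc => h ⟨rfl, hc.symm⟩
      have key : ∀ {v}, D.V i i j v → D.E i i * v ∈ D.EL i := by
        intro v hv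
        obtain ⟨y, hy, rfl | rfl⟩ := hv
        · exact EL_r hy (EL_pp h)
        · rw [← mul_assoc, D.E_c, mul_assoc, ← mul_assoc (D.cb i), D.p_cb _ hj, mul_assoc]
          exact EL_r (mul_mem (D.LAcb (sne hj)) hy) (EL_pp h)
      refine ⟨key hv, ?_⟩
      rw [← mul_assoc, D.E_x, neg_mul, mul_assoc]
      exact neg_mem (key (V_xb hv hj))
    · have key : D.E n n * v ∈ D.EL n := by
        obtain ⟨y, hy, rfl | rfl⟩ := hv
        · exact EL_r hy (EL_pp h)
        · exact EL_l (D.LAc hi) (EL_r hy (EL_pp h))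
      exact ⟨key, EL_l (D.LAx hi) key⟩

variable (D)
theorem part1_le (hg : Algebra.adjoin ℂ D.gens = ⊤) (g : A) : ∃ y ∈ D.LA n, D.E n n * g * D.E n n = D.E n n * y := by
  have h : D.E n n * (g * D.E n n) ∈ D.EL n := N_close (fun i j v => EL_V) (D.N_all hg g D.N_En)
  obtain ⟨y, hy, h⟩ := h
  exact ⟨y, hy, by rw [mul_assoc, ← h]; rfl⟩
theorem part1_ge {l} (hl : n ≠ l) {y} (hy : y ∈ D.LA n) : D.E n n * y = D.E n n * (D.σ (Equiv.swap n l) * y) * D.E n n := by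
  rw [← mul_assoc, mul_assoc, D.LA_E hy, ← mul_assoc, D.EsE _ hl]
end WD
end

section
set_option linter.unusedSectionVars false
set_option linter.unusedSimpArgs false
set_option linter.unusedVariables false
namespace AWBC
variable {A : Type} [Ring A] [Algebra ℂ A] {k : ℕ} {ω1 : ℂ}

/-- the generating elements -/
structure InS (d : AWBC ℂ A k k ω1) (S : Subalgebra ℂ A) : Prop where
  σ : ∀ w, d.σ w ∈ S
  σb : ∀ w, d.σb w ∈ S
  c : ∀ i, d.c i ∈ S
  cb : ∀ i, d.cb i ∈ S
  e : d.e ∈ S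
  x1 : d.x1 ∈ S
  xb1 : d.xb1 ∈ S
  om : ∀ i, d.om i ∈ S
  omb : ∀ i, d.omb i ∈ S

/-- restriction of the data to a subalgebra containing the generators -/
def restr (d : AWBC ℂ A k k ω1) (S : Subalgebra ℂ A) (h : d.InS S) : AWBC ℂ S k k ω1 where
  σ := { toFun := fun w => ⟨d.σ w, h.σ w⟩, map_one' := Subtype.ext (map_one d.σ), map_mul' := fun _ _ => Subtype.ext (map_mul d.σ _ _) }
  σb := { toFun := fun w => ⟨d.σb w, h.σb w⟩, map_one' := Subtype.ext (map_one d.σb), map_mul' := fun _ _ => Subtype.ext (map_mul d.σb _ _) }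
  c i := ⟨d.c i, h.c i⟩
  cb i := ⟨d.cb i, h.cb i⟩
  e := ⟨d.e, h.e⟩
  x1 := ⟨d.x1, h.x1⟩
  xb1 := ⟨d.xb1, h.xb1⟩
  om i := ⟨d.om i, h.om i⟩
  omb i := ⟨d.omb i, h.omb i⟩
  c_sq i := Subtype.ext (d.c_sq i)
  c_anti i j hij := Subtype.ext (d.c_anti i j hij)
  c_conj w i := Subtype.ext (d.c_conj w i)
  cb_sq i := Subtype.ext (d.cb_sq i)
  cb_anti i j hij := Subtype.ext (d.cb_anti i j hij)
  cb_conj w i := Subtype.ext (d.cb_conj w i)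
  comm_σσb w v := Subtype.ext (d.comm_σσb w v)
  comm_σcb w v := Subtype.ext (d.comm_σcb w v)
  comm_σbc w v := Subtype.ext (d.comm_σbc w v)
  anti_ccb w v := Subtype.ext (d.anti_ccb w v)
  e_c1 w v := Subtype.ext (d.e_c1 w v)
  c1_e w v := Subtype.ext (d.c1_e w v)
  e_sq := Subtype.ext d.e_sq
  e_s_e w := Subtype.ext (d.e_s_e w)
  e_sb_e w := Subtype.ext (d.e_sb_e w)
  s_e_comm i h1 h2 := Subtype.ext (d.s_e_comm i h1 h2)
  sb_e_comm i h1 h2 := Subtype.ext (d.sb_e_comm i h1 h2)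
  braid1 h1 h2 := Subtype.ext (d.braid1 h1 h2)
  braid2 h1 h2 := Subtype.ext (d.braid2 h1 h2)
  c_e_comm i h1 := Subtype.ext (d.c_e_comm i h1)
  cb_e_comm i h1 := Subtype.ext (d.cb_e_comm i h1)
  e_c_e h1 := Subtype.ext (d.e_c_e h1)
  e_cb_e h1 := Subtype.ext (d.e_cb_e h1)
  om_one := Subtype.ext d.om_one
  om_even i := Subtype.ext (d.om_even i)
  omb_zero := Subtype.ext d.omb_zero
  om_comm i := by
    obtain ⟨h1, h2, h3, h4, h5, h6, h7, h8, h9⟩ := d.om_comm i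
    exact ⟨fun w => Subtype.ext (h1 w), fun w => Subtype.ext (h2 w), fun w => Subtype.ext (h3 w), fun w => Subtype.ext (h4 w),
      Subtype.ext h5, Subtype.ext h6, Subtype.ext h7, fun w => Subtype.ext (h8 w), fun w => Subtype.ext (h9 w)⟩
  omb_comm i := by
    obtain ⟨h1, h2, h3, h4, h5, h6, h7, h8⟩ := d.omb_comm i
    exact ⟨fun w => Subtype.ext (h1 w), fun w => Subtype.ext (h2 w), fun w => Subtype.ext (h3 w), fun w => Subtype.ext (h4 w),
      Subtype.ext h5, Subtype.ext h6, Subtype.ext h7, fun w => Subtype.ext (h8 w)⟩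
  x_comm i := Subtype.ext (d.x_comm i)
  x1_c1 i := Subtype.ext (d.x1_c1 i)
  x1_c i h1 := Subtype.ext (d.x1_c i h1)
  s_x1 i h1 h2 := Subtype.ext (d.s_x1 i h1 h2)
  xb_comm i := Subtype.ext (d.xb_comm i)
  xb1_cb1 i := Subtype.ext (d.xb1_cb1 i)
  xb1_cb i h1 := Subtype.ext (d.xb1_cb i h1)
  sb_xb1 i h1 h2 := Subtype.ext (d.sb_xb1 i h1 h2)
  e_xsum := Subtype.ext d.e_xsum
  xsum_e := Subtype.ext d.xsum_e
  e_sxs h1 := Subtype.ext (d.e_sxs h1)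
  x_mixed h1 := Subtype.ext (d.x_mixed h1)
  e_sbxbsb h1 := Subtype.ext (d.e_sbxbsb h1)
  e_xodd i := Subtype.ext (d.e_xodd i)
  e_xeven i h1 := Subtype.ext (d.e_xeven i h1)
  e_xb i h1 := Subtype.ext (d.e_xb i h1)
  x1_cb_comm i := Subtype.ext (d.x1_cb_comm i)
  xb1_c_comm i := Subtype.ext (d.xb1_c_comm i)
  x1_σb i := Subtype.ext (d.x1_σb i)
  xb1_σ i := Subtype.ext (d.xb1_σ i)

lemma gen_top (d : AWBC ℂ A k k ω1) {ω f g} (hu : d.IsCycUniversal ω f g) (S : Subalgebra ℂ A) (h : d.InS S) : S = ⊤ := by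
  obtain ⟨h1, h2, h3⟩ := hu
  obtain ⟨φ, hφ, -⟩ := h3 S (d.restr S h) ⟨fun i => Subtype.ext (h1.1 i), fun i hi => Subtype.ext (h1.2 i hi)⟩ (by
    constructor
    · apply Subtype.ext
      have := Polynomial.aeval_algHom_apply S.val (d.restr S h).x1 f
      exact this.symm.trans h2.1
    · apply Subtype.ext
      have := Polynomial.aeval_algHom_apply S.val (d.restr S h).xb1 g
      exact this.symm.trans h2.2)
  obtain ⟨ψ, hψ, h4⟩ := h3 A d h1 h2
  have e1 : S.val.comp φ = ψ := h4 _ ⟨fun w => congrArg Subtype.val (hφ.map_σ w), fun w => congrArg Subtype.val (hφ.map_σb w),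
    fun w => congrArg Subtype.val (hφ.map_c w), fun w => congrArg Subtype.val (hφ.map_cb w), congrArg Subtype.val hφ.map_e,
    congrArg Subtype.val hφ.map_x1, congrArg Subtype.val hφ.map_xb1, fun w => congrArg Subtype.val (hφ.map_om w),
    fun w => congrArg Subtype.val (hφ.map_omb w)⟩
  have e2 : AlgHom.id ℂ A = ψ := h4 _ ⟨fun _ => rfl, fun _ => rfl, fun _ => rfl, fun _ => rfl, rfl, rfl, rfl, fun _ => rfl, fun _ => rfl⟩
  rw [eq_top_iff]
  intro u _
  have := congrArg (fun f => f u) (e1.trans e2.symm)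
  simp only [AlgHom.comp_apply, AlgHom.id_apply] at this
  rw [← this]; exact (φ u).2

section
variable (d : AWBC ℂ A k k ω1) (hk : 2 ≤ k)
lemma xp_eq (m : ℕ) (hm : m < k) : d.xp (m + 1) = d.gx hk ⟨m, hm⟩ := by
  induction m with
  | zero => simp [xp]; exact (d.gx0 hk).symm
  | succ m ih =>
    have h := ih (by omega)
    have h1 : d.xp (m + 1 + 1) = d.toWBC.s (m + 1) * d.xp (m + 1) * d.toWBC.s (m + 1) := by
      simp [xp, List.range_succ, mul_assoc]
    rw [h1, h, WBC.s, Nat.add_sub_cancel, Tr.sw_eq (by omega) hm, d.gσ_x, mul_assoc, d.ss, mul_one, Equiv.swap_apply_left]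
lemma xbp_eq (m : ℕ) (hm : m < k) : d.xbp (m + 1) = d.gxb hk ⟨m, hm⟩ := by
  induction m with
  | zero => simp [xbp]; exact (d.gxb0 hk).symm
  | succ m ih =>
    have h := ih (by omega)
    have h1 : d.xbp (m + 1 + 1) = d.toWBC.sb (m + 1) * d.xbp (m + 1) * d.toWBC.sb (m + 1) := by
      simp [xbp, List.range_succ, mul_assoc]
    rw [h1, h, WBC.sb, Nat.add_sub_cancel, Tr.sw_eq (by omega) hm, d.gσb_xb, mul_assoc, d.ssb, mul_one, Equiv.swap_apply_left]
lemma E_eq (i j : Fin k) : d.toWBC.E (i + 1) (j + 1) = d.gE hk i j := by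
  rw [WBC.E, WBC.tr, WBC.trb, gE, cjf, cjf, Nat.sub_self, Nat.add_sub_cancel, Nat.add_sub_cancel, Tr.sw_eq (by omega) i.2, Tr.sw_eq (by omega) j.2]
  simp only [mul_assoc]; rfl
lemma cn_eq (i : Fin k) : d.toWBC.cn (i + 1) = d.c i := by simp [WBC.cn]
lemma cbn_eq (i : Fin k) : d.toWBC.cbn (i + 1) = d.cb i := by simp [WBC.cbn]
lemma tr_eq (i j : Fin k) : d.toWBC.tr (i + 1) (j + 1) = d.σ (Equiv.swap i j) := by
  rw [WBC.tr, Nat.add_sub_cancel, Nat.add_sub_cancel, Tr.sw_eq i.2 j.2]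
lemma trb_eq (i j : Fin k) : d.toWBC.trb (i + 1) (j + 1) = d.σb (Equiv.swap i j) := by
  rw [WBC.trb, Nat.add_sub_cancel, Nat.add_sub_cancel, Tr.sw_eq i.2 j.2]
/-- last index -/
def nn : Fin k := ⟨k - 1, by omega⟩
lemma nn1 : ((nn hk : Fin k) : ℕ) + 1 = k := by simp [nn]; omega
lemma sum_eq (f : ℕ → A) : ∑ j ∈ Finset.Ico 1 k, f j = ∑ j ∈ Finset.univ.erase (nn hk), f ((j : ℕ) + 1) := by
  symm
  refine Finset.sum_bij (fun j _ => (j : ℕ) + 1) ?_ ?_ ?_ ?_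
  · intro j hj
    have h1 := Finset.ne_of_mem_erase hj
    have h2 : (j : ℕ) ≠ k - 1 := fun hc => h1 (Fin.ext hc)
    rw [Finset.mem_Ico]; omega
  · intro i _ j _ h; exact Fin.ext (by omega)
  · intro j hj
    rw [Finset.mem_Ico] at hj
    refine ⟨⟨j - 1, by omega⟩, ?_, ?_⟩
    · rw [Finset.mem_erase]; refine ⟨fun hc => ?_, Finset.mem_univ _⟩
      have := congrArg Fin.val hc
      simp only [nn] at this; omega
    · simp only; omega
  · intros; rfl
end
section
variable (d : AWBC ℂ A k k ω1) (hk : 2 ≤ k) {a b : ℂ} (hx : d.x1 * d.x1 = algebraMap ℂ A a) (hxb : d.xb1 * d.xb1 = algebraMap ℂ A b)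
lemma z_eq : d.z k = (d.toWD hk hx hxb).Z (nn hk) := by
  have e1 := nn1 hk
  have h0 : d.xp k = d.gx hk (nn hk) := by rw [← d.xp_eq hk (nn hk) (nn hk).2]; exact congrArg _ e1.symm
  have hE : ∀ j : Fin k, d.toWBC.E k (j + 1) = d.gE hk (nn hk) j := by
    intro j; have := d.E_eq hk (nn hk) j; rwa [e1] at this
  have hc : d.toWBC.cn k = d.c (nn hk) := by have := d.cn_eq (nn hk); rwa [e1] at this
  have hs : ∀ j : Fin k, d.toWBC.tr (j + 1) k = d.σ (Equiv.swap (nn hk) j) := by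
    intro j; have := d.tr_eq j (nn hk); rw [e1] at this; rw [this, Equiv.swap_comm]
  rw [z, WBC.y, WBC.L, WBC.LL, h0, sum_eq hk, sum_eq hk]
  simp only [WBC.Eb, hE, hc, hs]
  rfl
lemma zb_eq : d.zb k = (d.toWD hk hx hxb).Zb (nn hk) := by
  have e1 := nn1 hk
  have h0 : d.xbp k = d.gxb hk (nn hk) := by rw [← d.xbp_eq hk (nn hk) (nn hk).2]; exact congrArg _ e1.symm
  have hE : ∀ j : Fin k, d.toWBC.E (j + 1) k = d.gE hk j (nn hk) := by
    intro j; have := d.E_eq hk j (nn hk); rwa [e1] at this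
  have hc : d.toWBC.cbn k = d.cb (nn hk) := by have := d.cbn_eq (nn hk); rwa [e1] at this
  have hs : ∀ j : Fin k, d.toWBC.trb (j + 1) k = d.σb (Equiv.swap (nn hk) j) := by
    intro j; have := d.trb_eq j (nn hk); rw [e1] at this; rw [this, Equiv.swap_comm]
  rw [zb, WBC.yb, WBC.Lb, WBC.LLb, h0, sum_eq hk, sum_eq hk]
  simp only [WBC.Eb, hE, hc, hs, cn_eq]
  rfl
lemma Ek_eq : d.toWBC.E k k = (d.toWD hk hx hxb).E (nn hk) (nn hk) := by
  have := d.E_eq hk (nn hk) (nn hk); rwa [nn1 hk] at this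

/-- subgroup of permutations landing in a subalgebra -/
def inSub (σ : Equiv.Perm (Fin k) →* A) (S : Subalgebra ℂ A) : Subgroup (Equiv.Perm (Fin k)) where
  carrier := {w | σ w ∈ S ∧ σ w⁻¹ ∈ S}
  one_mem' := by simp [one_mem]
  mul_mem' := by
    rintro u v ⟨h1, h2⟩ ⟨h3, h4⟩
    refine ⟨?_, ?_⟩
    · rw [map_mul]; exact mul_mem h1 h3
    · rw [mul_inv_rev, map_mul]; exact mul_mem h4 h2
  inv_mem' := by
    rintro u ⟨h1, h2⟩
    exact ⟨h2, by rwa [inv_inv]⟩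
lemma inSub_adj (σ : Equiv.Perm (Fin k) →* A) (S : Subalgebra ℂ A) (h : ∀ i, i + 1 < k - 1 → σ (sw k i (i + 1)) ∈ S)
    {w : Equiv.Perm (Fin k)} (hw : w (nn hk) = nn hk) : σ w ∈ S := by
  have := adj_gen 0 (k - 1) (inSub σ S) (fun i _ hi => ⟨h i hi, by
    rw [Tr.sw_eq (by omega) (by omega), Equiv.swap_inv, ← Tr.sw_eq (by omega) (by omega)]; exact h i hi⟩) (by omega) w (by
    intro i hi
    have : i = nn hk := Fin.ext (by have := i.2; simp only [nn]; omega)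
    rw [this, hw])
  exact this.1
lemma znn : (zz hk : Fin k) ≠ nn hk := by
  intro h; have := congrArg Fin.val h; simp only [zz, nn] at this; omega
lemma sw_nn {i : Fin k} (h : i ≠ nn hk) : Equiv.swap (zz hk) i (nn hk) = nn hk :=
  Equiv.swap_apply_of_ne_of_ne (znn hk).symm h.symm
lemma LA_eq : Algebra.adjoin ℂ (d.lowerGensA (k - 1)) = (d.toWD hk hx hxb).LA (nn hk) := by
  set D := d.toWD hk hx hxb with hD
  have hk1 : 1 ≤ k - 1 := by omega
  have hc1 : d.toWBC.cn 1 = d.c (zz hk) := d.cn_eq (zz hk)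
  have hcb1 : d.toWBC.cbn 1 = d.cb (zz hk) := d.cbn_eq (zz hk)
  have hs : ∀ j, j + 1 ≤ k - 1 → 1 ≤ j → sw k (j - 1) j (nn hk) = nn hk := by
    intro j h1 h2
    rw [Tr.sw_eq (by omega) (by omega)]
    refine Equiv.swap_apply_of_ne_of_ne ?_ ?_ <;> (intro h; have := congrArg Fin.val h; simp only [nn] at this; omega)
  apply le_antisymm
  · refine Algebra.adjoin_le ?_
    rintro u ((⟨-, rfl⟩ | ⟨j, h1, h2, rfl⟩ | ⟨j, h1, h2, rfl⟩ | ⟨-, rfl⟩ | ⟨-, rfl⟩) | ⟨-, rfl | rfl⟩)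
    · rw [← d.gE0 hk]; exact D.LAE (znn hk) (znn hk)
    · exact D.LAσ (hs j h2 h1)
    · exact D.LAσb (hs j h2 h1)
    · rw [hc1]; exact D.LAc (znn hk)
    · rw [hcb1]; exact D.LAcb (znn hk)
    · rw [← d.gx0 hk]; exact D.LAx (znn hk)
    · rw [← d.gxb0 hk]; exact D.LAxb (znn hk)
  · set S := Algebra.adjoin ℂ (d.lowerGensA (k - 1)) with hS
    have Sσ : ∀ {w : Equiv.Perm (Fin k)}, w (nn hk) = nn hk → d.σ w ∈ S := fun hw => inSub_adj hk d.σ S (fun i hi =>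
      Algebra.subset_adjoin (Or.inl (Or.inr (Or.inl ⟨i + 1, by omega, by omega, rfl⟩)))) hw
    have Sσb : ∀ {w : Equiv.Perm (Fin k)}, w (nn hk) = nn hk → d.σb w ∈ S := fun hw => inSub_adj hk d.σb S (fun i hi =>
      Algebra.subset_adjoin (Or.inl (Or.inr (Or.inr (Or.inl ⟨i + 1, by omega, by omega, rfl⟩))))) hw
    have Sc : d.c (zz hk) ∈ S := Algebra.subset_adjoin (Or.inl (Or.inr (Or.inr (Or.inr (Or.inl ⟨hk1, hc1.symm⟩)))))
    have Scb : d.cb (zz hk) ∈ S := Algebra.subset_adjoin (Or.inl (Or.inr (Or.inr (Or.inr (Or.inr ⟨hk1, hcb1.symm⟩)))))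
    have Se : d.e ∈ S := Algebra.subset_adjoin (Or.inl (Or.inl ⟨hk1, rfl⟩))
    have Sx : d.x1 ∈ S := Algebra.subset_adjoin (Or.inr ⟨hk1, Or.inl rfl⟩)
    have Sxb : d.xb1 ∈ S := Algebra.subset_adjoin (Or.inr ⟨hk1, Or.inr rfl⟩)
    refine Algebra.adjoin_le ?_
    rintro u (⟨w, h, rfl⟩ | ⟨w, h, rfl⟩ | ⟨i, h, rfl | rfl | rfl | rfl⟩ | ⟨i, j, h, h', rfl⟩)
    · exact Sσ h
    · exact Sσb h
    · have := d.c_conj (Equiv.swap (zz hk) i) (zz hk)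
      rw [Equiv.swap_apply_left, Equiv.swap_inv] at this
      show d.c i ∈ S
      rw [← this]
      exact mul_mem (mul_mem (Sσ (sw_nn hk h)) Sc) (Sσ (sw_nn hk h))
    · have := d.cb_conj (Equiv.swap (zz hk) i) (zz hk)
      rw [Equiv.swap_apply_left, Equiv.swap_inv] at this
      show d.cb i ∈ S
      rw [← this]
      exact mul_mem (mul_mem (Sσb (sw_nn hk h)) Scb) (Sσb (sw_nn hk h))
    · exact mul_mem (mul_mem (Sσ (sw_nn hk h)) Sx) (Sσ (sw_nn hk h))
    · exact mul_mem (mul_mem (Sσb (sw_nn hk h)) Sxb) (Sσb (sw_nn hk h))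
    · exact mul_mem (mul_mem (Sσb (sw_nn hk h')) (mul_mem (mul_mem (Sσ (sw_nn hk h)) Se) (Sσ (sw_nn hk h)))) (Sσb (sw_nn hk h'))

lemma gens_top {ω f g} (hu : d.IsCycUniversal ω f g) : Algebra.adjoin ℂ (d.toWD hk hx hxb).gens = ⊤ := by
  apply d.gen_top hu
  have h0 := hu.1
  refine ⟨fun w => Algebra.subset_adjoin (Or.inl ⟨w, rfl⟩), fun w => Algebra.subset_adjoin (Or.inr (Or.inl ⟨w, rfl⟩)),
    fun i => Algebra.subset_adjoin (Or.inr (Or.inr (Or.inl ⟨i, Or.inl rfl⟩))),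
    fun i => Algebra.subset_adjoin (Or.inr (Or.inr (Or.inl ⟨i, Or.inr (Or.inl rfl)⟩))),
    Algebra.subset_adjoin (Or.inr (Or.inr (Or.inr ⟨zz hk, zz hk, (d.gE0 hk).symm⟩))),
    Algebra.subset_adjoin (Or.inr (Or.inr (Or.inl ⟨zz hk, Or.inr (Or.inr (Or.inl (d.gx0 hk).symm))⟩))),
    Algebra.subset_adjoin (Or.inr (Or.inr (Or.inl ⟨zz hk, Or.inr (Or.inr (Or.inr (d.gxb0 hk).symm))⟩))), ?_, ?_⟩
  · intro i; rw [h0.1]; exact Subalgebra.algebraMap_mem _ _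
  · intro i
    rcases Nat.eq_zero_or_pos i with rfl | hi
    · rw [d.omb_zero]; exact zero_mem _
    · rw [h0.2 i hi]; exact Subalgebra.algebraMap_mem _ _
end
end AWBC
end

section
set_option linter.unusedSectionVars false
set_option linter.unusedSimpArgs false
set_option linter.unusedVariables false
namespace Tr
open SDM
variable {ι : Type} [DecidableEq ι] {a : ℂ} (ω : ℂ) (o : ι)
local notation "𝐬" => DFunLike.coe (SD.σ (Serg.can _ _))
local notation "𝐜" => SD.c (Serg.can _ _)
local notation "𝐱" => SD.x (Serg.can _ _)
/-- the representation of the walled data on `PK k a` -/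
structure WRep {k : ℕ} {b ω : ℂ} {A : Type} [Ring A] [Algebra ℂ A] (D : WD k a b ω A) (φ : A →ₐ[ℂ] EP k a) : Prop where
  hσ : ∀ w u, φ (D.σ w) u = 𝐬 (il w) * u
  hσb : ∀ w u, φ (D.σb w) u = u * 𝐬 (ir w⁻¹)
  hc : ∀ i u, φ (D.c i) u = 𝐜 (Sum.inl i) * u
  hcb : ∀ i u, φ (D.cb i) u = ε u * 𝐜 (Sum.inr i)
  hx : ∀ i u, φ (D.x i) u = 𝐱 (Sum.inl i) * u
  hxb : ∀ i u, φ (D.xb i) u = Xb ω (Sum.inr i) u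
  hE : ∀ i j u, φ (D.E i j) u = En ω (Sum.inr j) (Sum.inl i) u
lemma wrep_of {k : ℕ} {A : Type} [Ring A] [Algebra ℂ A] {b : ℂ} (hk : 2 ≤ k) (f : ℕ → ℂ) (h0 : f 0 = 0) (h : ∀ n, f (n + 2) = a * f n)
    (d : AWBC ℂ A k k (f 1)) (hx : d.x1 * d.x1 = algebraMap ℂ A a) (hxb : d.xb1 * d.xb1 = algebraMap ℂ A b) (φ : A →ₐ[ℂ] EP k a)
    (hφ : AWBCHom d (repA hk f h0 h) φ) : WRep (d.toWD hk hx hxb) φ := by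
  have hs : ∀ w u, φ (d.σ w) u = 𝐬 (il w) * u := fun w u => by rw [hφ.map_σ]; rfl
  have hsb : ∀ w u, φ (d.σb w) u = u * 𝐬 (ir w⁻¹) := fun w u => by rw [hφ.map_σb]; rfl
  have he : ∀ u, φ d.e u = En (f 1) (Sum.inr (AWBC.zz hk)) (Sum.inl (AWBC.zz hk)) u := fun u => by rw [hφ.map_e]; rfl
  refine ⟨hs, hsb, fun i u => ?_, fun i u => ?_, fun i u => ?_, fun i u => ?_, fun i j u => ?_⟩
  · show φ (d.c i) u = _; rw [hφ.map_c]; rfl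
  · show φ (d.cb i) u = _; rw [hφ.map_cb]; rfl
  · show φ (d.σ _ * d.x1 * d.σ _) u = _
    have h1 : ∀ u, φ d.x1 u = 𝐱 (Sum.inl (AWBC.zz hk)) * u := fun u => by rw [hφ.map_x1]; rfl
    rw [map_mul, map_mul, Module.End.mul_apply, Module.End.mul_apply, hs, hs, h1, s_x, il_l, Equiv.swap_apply_left, ← mul_assoc (𝐬 _), σσ,
      ← il_mul, Equiv.swap_mul_self, il_one, map_one, one_mul]
  · show φ (d.σb _ * d.xb1 * d.σb _) u = _
    have h1 : ∀ u, φ d.xb1 u = Xb (f 1) (Sum.inr (AWBC.zz hk)) u := fun u => by rw [hφ.map_xb1]; rfl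
    rw [map_mul, map_mul, Module.End.mul_apply, Module.End.mul_apply, hsb, hsb, h1, Xb_rs, Equiv.swap_inv, ir_r, Equiv.swap_apply_left, mul_assoc, σσ,
      ← ir_mul, Equiv.swap_mul_self, ir_one, map_one, mul_one]
  · show φ (d.σb _ * (d.σ _ * d.e * d.σ _) * d.σb _) u = _
    simp only [map_mul, Module.End.mul_apply, hs, hsb, he, s_En, il_l, Equiv.swap_apply_left]
    rw [← mul_assoc (𝐬 _) (𝐬 _), σσ, ← il_mul, Equiv.swap_mul_self, il_one, map_one, one_mul, En_rs, Equiv.swap_inv, ir_r, Equiv.swap_apply_left, mul_assoc, σσ,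
      ← ir_mul, Equiv.swap_mul_self, ir_one, map_one, mul_one]
lemma wrep_exists {k : ℕ} {A : Type} [Ring A] [Algebra ℂ A] {b : ℂ} (hk : 2 ≤ k) (f : ℕ → ℂ) (h0 : f 0 = 0) (h : ∀ n, f (n + 2) = a * f n)
    (hb : b = a + f 1)
    (d : AWBC ℂ A k k (f 1)) (hu : d.IsCycUniversal f (X ^ 2 - C a) (X ^ 2 - C b))
    (hx : d.x1 * d.x1 = algebraMap ℂ A a) (hxb : d.xb1 * d.xb1 = algebraMap ℂ A b) : ∃ φ, WRep (d.toWD hk hx hxb) φ := by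
  have hc : (repA hk f h0 h).IsCyc (X ^ 2 - C a) (X ^ 2 - C b) := by
    constructor
    · simp only [map_sub, map_pow, aeval_X, aeval_C]
      refine LinearMap.ext fun u => ?_
      rw [LinearMap.sub_apply, pow_two]
      show 𝐱 _ * (𝐱 _ * u) - a • u = 0
      rw [← mul_assoc, (Serg.can _ _).x_sq, ← Algebra.smul_def, sub_self]
    · simp only [map_sub, map_pow, aeval_X, aeval_C]
      refine LinearMap.ext fun u => ?_
      rw [LinearMap.sub_apply, pow_two]
      show Xb _ _ (Xb _ _ u) - b • u = 0
      rw [Xb_sq, hb, sub_self]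
  obtain ⟨φ, hφ, -⟩ := hu.2.2 (EP k a) (repA hk f h0 h) ⟨fun _ => rfl, fun _ _ => rfl⟩ hc
  exact ⟨φ, wrep_of hk f h0 h d hx hxb φ hφ⟩
end Tr
end

section
set_option linter.unusedSectionVars false
set_option linter.unusedSimpArgs false
set_option linter.unusedVariables false
namespace SD
variable {ι : Type} [DecidableEq ι] {a : ℂ} {B : Type} [Ring B] [Algebra ℂ B] (D : SD ι a B)

/-- span of the permutations supported on a list -/
def SS (L : List ι) : Submodule ℂ B := Submodule.span ℂ {u | ∃ w : Equiv.Perm ι, (∀ i, i ∉ L → w i = i) ∧ u = D.σ w}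
/-- span of the local monomials at one letter -/
def M1 (l : ι) : Submodule ℂ B := Submodule.span ℂ {1, D.c l} * Submodule.span ℂ {1, D.x l}
/-- ordered products of local monomials -/
def KK (L : List ι) : Submodule ℂ B := (L.map D.M1).prod
variable {D}
lemma KK_cons (l L) : D.KK (l :: L) = Submodule.span ℂ {1, D.c l} * (Submodule.span ℂ {1, D.x l} * D.KK L) := by
  rw [KK, List.map_cons, List.prod_cons, M1, mul_assoc]; rfl
lemma KK_append (L L') : D.KK (L ++ L') = D.KK L * D.KK L' := by
  rw [KK, List.map_append, List.prod_append]; rfl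
lemma pair_ind {g : B} {M N : Submodule ℂ B} (h : ∀ y ∈ M, y ∈ N ∧ g * y ∈ N) {u} (hu : u ∈ Submodule.span ℂ {1, g} * M) : u ∈ N := by
  have h1 : Submodule.span ℂ {1, g} * M ≤ N := by
    rw [Submodule.mul_le]
    intro m hm y hy
    obtain ⟨r, t, rfl⟩ := Submodule.mem_span_pair.1 hm
    rw [add_mul, smul_mul_assoc, smul_mul_assoc, one_mul]
    exact add_mem (Submodule.smul_mem _ _ (h y hy).1) (Submodule.smul_mem _ _ (h y hy).2)
  exact h1 hu
lemma pair_mem {g : B} {M : Submodule ℂ B} {y} (hy : y ∈ M) : y ∈ Submodule.span ℂ {1, g} * M ∧ g * y ∈ Submodule.span ℂ {1, g} * M := by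
  refine ⟨?_, Submodule.mul_mem_mul (Submodule.subset_span (by simp)) hy⟩
  have := Submodule.mul_mem_mul (Submodule.subset_span (by simp) : (1 : B) ∈ Submodule.span ℂ {1, g}) hy
  rwa [one_mul] at this
lemma K_ind {l L} {N : Submodule ℂ B}
    (h : ∀ y ∈ D.KK L, y ∈ N ∧ D.c l * y ∈ N ∧ D.x l * y ∈ N ∧ D.c l * (D.x l * y) ∈ N) {u} (hu : u ∈ D.KK (l :: L)) : u ∈ N := by
  rw [KK_cons] at hu
  have hN : ∀ y ∈ Submodule.span ℂ {1, D.x l} * D.KK L, y ∈ N ⊓ N.comap (LinearMap.mulLeft ℂ (D.c l)) := fun y hy =>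
    pair_ind (N := N ⊓ N.comap (LinearMap.mulLeft ℂ (D.c l))) (fun z hz => ⟨⟨(h z hz).1, (h z hz).2.1⟩, ⟨(h z hz).2.2.1, (h z hz).2.2.2⟩⟩) hy
  exact pair_ind (fun y hy => ⟨(hN y hy).1, (hN y hy).2⟩) hu
lemma K_mem {l L y} (hy : y ∈ D.KK L) : y ∈ D.KK (l :: L) ∧ D.c l * y ∈ D.KK (l :: L) ∧ D.x l * y ∈ D.KK (l :: L)
    ∧ D.c l * (D.x l * y) ∈ D.KK (l :: L) := by
  rw [KK_cons]
  exact ⟨(pair_mem (pair_mem hy).1).1, (pair_mem (pair_mem hy).1).2, (pair_mem (pair_mem hy).2).1, (pair_mem (pair_mem hy).2).2⟩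
lemma S_ind {L} {M N : Submodule ℂ B} (h : ∀ w : Equiv.Perm ι, (∀ i, i ∉ L → w i = i) → ∀ y ∈ M, D.σ w * y ∈ N) {u} (hu : u ∈ D.SS L * M) : u ∈ N := by
  have h1 : D.SS L * M ≤ N := by
    rw [Submodule.mul_le]
    intro m hm y hy
    induction hm using Submodule.span_induction with
    | mem m hm => obtain ⟨w, hw, rfl⟩ := hm; exact h w hw y hy
    | zero => rw [zero_mul]; exact zero_mem _
    | add u v _ _ hu hv => rw [add_mul]; exact add_mem hu hv
    | smul r u _ hu => rw [smul_mul_assoc]; exact Submodule.smul_mem _ _ hu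
  exact h1 hu
lemma S_mem {L} {M : Submodule ℂ B} {w : Equiv.Perm ι} (hw : ∀ i, i ∉ L → w i = i) {y} (hy : y ∈ M) : D.σ w * y ∈ D.SS L * M :=
  Submodule.mul_mem_mul (Submodule.subset_span ⟨w, hw, rfl⟩) hy
lemma S_one {L} {M : Submodule ℂ B} {y} (hy : y ∈ M) : y ∈ D.SS L * M := by
  have := S_mem (D := D) (L := L) (w := 1) (fun _ _ => rfl) hy
  rwa [map_one, one_mul] at this
lemma S_S {L} {M : Submodule ℂ B} {w : Equiv.Perm ι} (hw : ∀ i, i ∉ L → w i = i) {y} (hy : y ∈ D.SS L * M) : D.σ w * y ∈ D.SS L * M := by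
  refine S_ind (N := (D.SS L * M).comap (LinearMap.mulLeft ℂ (D.σ w))) (fun v hv y hy => show D.σ w * (D.σ v * y) ∈ D.SS L * M from ?_) hy
  rw [← mul_assoc, ← map_mul]
  exact S_mem (fun i hi => by rw [Equiv.Perm.mul_apply, hv i hi, hw i hi]) hy
lemma pai (w : Equiv.Perm ι) (i) : w (w⁻¹ i) = i := w.apply_symm_apply i
lemma fix_inv {L : List ι} {w : Equiv.Perm ι} (hw : ∀ i, i ∉ L → w i = i) {i} (hi : i ∈ L) : w⁻¹ i ∈ L := by
  by_contra h
  have := hw _ h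
  rw [pai] at this
  rw [← this] at h; exact h hi
lemma T_close (L : List ι) (hL : L.Nodup) : ∀ i ∈ L, ∀ u ∈ D.SS L * D.KK L, D.c i * u ∈ D.SS L * D.KK L ∧ D.x i * u ∈ D.SS L * D.KK L := by
  induction L with
  | nil => intro i hi; simp at hi
  | cons l L ih =>
    have hl : l ∉ L := (List.nodup_cons.1 hL).1
    replace ih := ih (List.nodup_cons.1 hL).2
    set T := D.SS (l :: L) * D.KK (l :: L) with hT
    have cl : ∀ y, D.c l * (D.c l * y) = -y := fun y => by rw [← mul_assoc, D.c_sq, neg_one_mul]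
    have xl : ∀ y, D.x l * (D.x l * y) = a • y := fun y => by rw [← mul_assoc, D.x_sq, Algebra.smul_def]
    have xc : ∀ y, D.x l * (D.c l * y) = -(D.c l * (D.x l * y)) := fun y => by rw [← mul_assoc, D.x_c, neg_mul, mul_assoc]
    have F1 : ∀ y ∈ D.SS L * D.KK L, y ∈ T ∧ D.c l * y ∈ T ∧ D.x l * y ∈ T ∧ D.c l * (D.x l * y) ∈ T := by
      intro y hy
      refine S_ind (N := T ⊓ T.comap (LinearMap.mulLeft ℂ (D.c l)) ⊓ (T.comap (LinearMap.mulLeft ℂ (D.x l)) ⊓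
        (T.comap (LinearMap.mulLeft ℂ (D.c l))).comap (LinearMap.mulLeft ℂ (D.x l)))) (fun w hw z hz => ?_) hy |> fun h => ⟨h.1.1, h.1.2, h.2.1, h.2.2⟩
      have hwl := hw l hl
      have hw' : ∀ i, i ∉ l :: L → w i = i := fun i hi => hw i (fun h => hi (List.mem_cons_of_mem _ h))
      have e1 : ∀ z, D.c l * (D.σ w * z) = D.σ w * (D.c l * z) := fun z => by rw [← mul_assoc, ← mul_assoc, D.σ_c, hwl]
      have e2 : ∀ z, D.x l * (D.σ w * z) = D.σ w * (D.x l * z) := fun z => by rw [← mul_assoc, ← mul_assoc, D.σ_x, hwl]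
      obtain ⟨k1, k2, k3, k4⟩ := K_mem (D := D) (l := l) hz
      refine ⟨⟨S_mem hw' k1, ?_⟩, ⟨?_, ?_⟩⟩
      · show D.c l * (D.σ w * z) ∈ T; rw [e1]; exact S_mem hw' k2
      · show D.x l * (D.σ w * z) ∈ T; rw [e2]; exact S_mem hw' k3
      · show D.c l * (D.x l * (D.σ w * z)) ∈ T; rw [e2, e1]; exact S_mem hw' k4
    have KS : ∀ y ∈ D.KK L, y ∈ D.SS L * D.KK L := fun y hy => S_one hy
    -- Clifford generators
    have hc : ∀ i ∈ l :: L, ∀ u ∈ T, D.c i * u ∈ T := by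
      intro i hi u hu
      refine S_ind (N := T.comap (LinearMap.mulLeft ℂ (D.c i))) (fun w hw y hy => ?_) hu
      show D.c i * (D.σ w * y) ∈ T
      have hj := fix_inv hw hi
      have : D.c i * (D.σ w * y) = D.σ w * (D.c (w⁻¹ i) * y) := by
        rw [← mul_assoc, ← mul_assoc, D.σ_c, pai]
      rw [this]
      refine S_S hw ?_
      generalize w⁻¹ i = j at hj
      refine K_ind (N := T.comap (LinearMap.mulLeft ℂ (D.c j))) (fun z hz => ?_) hy
      simp only [Submodule.mem_comap, LinearMap.mulLeft_apply]
      by_cases hjl : j = l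
      · subst hjl
        obtain ⟨k1, k2, k3, k4⟩ := F1 z (KS z hz)
        rw [cl, cl]
        exact ⟨k2, neg_mem k1, k4, neg_mem k3⟩
      · have hjL : j ∈ L := (List.mem_cons.1 hj).resolve_left hjl
        obtain ⟨k1, k2, k3, k4⟩ := F1 _ (ih j hjL z (KS z hz)).1
        have e1 : ∀ z, D.c j * (D.c l * z) = -(D.c l * (D.c j * z)) := fun z => by rw [← mul_assoc, D.c_anti _ _ hjl, neg_mul, mul_assoc]
        have e2 : ∀ z, D.c j * (D.x l * z) = D.x l * (D.c j * z) := fun z => by rw [← mul_assoc, ← D.x_c' _ _ (Ne.symm hjl), mul_assoc]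
        rw [e1, e1, e2]
        exact ⟨k1, neg_mem k2, k3, neg_mem k4⟩
    refine fun i hi u hu => ⟨hc i hi u hu, ?_⟩
    refine S_ind (N := T.comap (LinearMap.mulLeft ℂ (D.x i))) (fun w hw y hy => ?_) hu
    show D.x i * (D.σ w * y) ∈ T
    have hj := fix_inv hw hi
    have : D.x i * (D.σ w * y) = D.σ w * (D.x (w⁻¹ i) * y) := by
      rw [← mul_assoc, ← mul_assoc, D.σ_x, pai]
    rw [this]
    refine S_S hw ?_
    generalize w⁻¹ i = j at hj
    refine K_ind (N := T.comap (LinearMap.mulLeft ℂ (D.x j))) (fun z hz => ?_) hy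
    simp only [Submodule.mem_comap, LinearMap.mulLeft_apply]
    by_cases hjl : j = l
    · subst hjl
      obtain ⟨k1, k2, k3, k4⟩ := F1 z (KS z hz)
      rw [xc, xc, xl, mul_smul_comm]
      exact ⟨k3, neg_mem k4, Submodule.smul_mem _ _ k1, neg_mem (Submodule.smul_mem _ _ k2)⟩
    · have hjL : j ∈ L := (List.mem_cons.1 hj).resolve_left hjl
      obtain ⟨k1, k2, k3, k4⟩ := F1 _ (ih j hjL z (KS z hz)).2
      obtain ⟨m1, m2, m3, m4⟩ := F1 _ (ih j hjL z (KS z hz)).1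
      obtain ⟨n1, n2, n3, n4⟩ := F1 _ (ih j hjL _ (ih j hjL z (KS z hz)).2).1
      obtain ⟨z1, z2, z3, z4⟩ := F1 z (KS z hz)
      have e1 : ∀ z, D.x j * (D.c l * z) = D.c l * (D.x j * z) := fun z => by rw [← mul_assoc, D.x_c' _ _ hjl, mul_assoc]
      have hs : ∀ i, i ∉ l :: L → Equiv.swap j l i = i := fun i hi => by
        rw [List.mem_cons, not_or] at hi
        exact Equiv.swap_apply_of_ne_of_ne (fun h => hi.2 (h ▸ hjL)) hi.1
      have e2 : D.x j * (D.x l * z) = D.x l * (D.x j * z)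
          + D.σ (Equiv.swap j l) * ((D.x l * z - D.x j * z) + (D.c l * (D.x l * (D.c j * z)) + D.c l * (D.c j * (D.x j * z)))) := by
        have h1 := D.σ_x (Equiv.swap j l) l
        have h2 := D.σ_x (Equiv.swap j l) j
        have h3 := D.σ_c (Equiv.swap j l) l
        have h4 := D.σ_c (Equiv.swap j l) j
        rw [Equiv.swap_apply_right] at h1 h3
        rw [Equiv.swap_apply_left] at h2 h4
        have h5 : D.x l * (D.c j * z) = D.c j * (D.x l * z) := by rw [← mul_assoc, D.x_c' _ _ (Ne.symm hjl), mul_assoc]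
        have h7 : (D.x l * z - D.x j * z) + (D.c l * (D.c j * (D.x l * z)) + D.c l * (D.c j * (D.x j * z)))
            = ((D.x l - D.x j) + D.c l * D.c j * (D.x l + D.x j)) * z := by simp only [add_mul, sub_mul, mul_add, mul_assoc]
        rw [h5, h7, ← mul_assoc, D.x_x _ _ hjl, ← mul_assoc (D.σ _), ← mul_assoc, ← add_mul]
        congr 2
        have h6 : D.σ (Equiv.swap j l) * (D.c l * D.c j * (D.x l + D.x j)) = D.c j * D.c l * (D.x j + D.x l) * D.σ (Equiv.swap j l) := by
          rw [← mul_assoc, ← mul_assoc, h3, mul_assoc (D.c j), h4, ← mul_assoc, mul_assoc (D.c j * D.c l), mul_add, h1, h2, ← add_mul, ← mul_assoc]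
        rw [mul_add (D.σ _), mul_sub, h6, h1, h2, add_mul _ _ (D.σ _), sub_mul]
      have e3 : D.x j * (D.x l * z) ∈ T := by
        rw [e2]; exact add_mem k3 (S_S hs (add_mem (sub_mem z3 k1) (add_mem m4 n2)))
      rw [e1, e1]
      exact ⟨k1, k2, e3, hc l (by simp) _ e3⟩
variable (D) in
def sgens : Set B := {u | (∃ w, u = D.σ w) ∨ (∃ i, u = D.c i ∨ u = D.x i)}
lemma one_KK (L) : (1 : B) ∈ D.KK L := by
  induction L with
  | nil => exact Submodule.one_le.1 le_rfl
  | cons l L ih => exact (K_mem ih).1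
lemma T_all {L : List ι} (hL : L.Nodup) (h : ∀ i, i ∈ L) {u} (hu : u ∈ Algebra.adjoin ℂ D.sgens) : u ∈ D.SS L * D.KK L := by
  have := adjoin_left_ind (Algebra.lmul ℂ B) D.sgens (D.SS L * D.KK L) (fun g hg m hm => ?_) u hu 1 (S_one (one_KK L))
  · simpa using this
  · show g * m ∈ _
    obtain ⟨w, rfl⟩ | ⟨i, rfl | rfl⟩ := hg
    · exact S_S (fun i hi => absurd (h i) hi) hm
    · exact (T_close L hL i (h i) m hm).1
    · exact (T_close L hL i (h i) m hm).2
end SD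

/-- a submodule spanned by at most `n` elements -/
def Few {B : Type} [Ring B] [Algebra ℂ B] (N : Submodule ℂ B) (n : ℕ) : Prop := ∃ s : Finset B, s.card ≤ n ∧ N = Submodule.span ℂ (s : Set B)
open Pointwise in
lemma Few.mul {B : Type} [Ring B] [Algebra ℂ B] {M N : Submodule ℂ B} {m n} (hM : Few M m) (hN : Few N n) : Few (M * N) (m * n) := by
  classical
  obtain ⟨s, hs, rfl⟩ := hM
  obtain ⟨t, ht, rfl⟩ := hN
  exact ⟨s * t, Finset.card_mul_le.trans (Nat.mul_le_mul hs ht), by rw [Submodule.span_mul_span, Finset.coe_mul]⟩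
lemma Few.pair {B : Type} [Ring B] [Algebra ℂ B] (u v : B) : Few (Submodule.span ℂ {u, v}) 2 := by
  classical
  exact ⟨{u, v}, Finset.card_le_two, by simp⟩
lemma SD.few {ι : Type} [DecidableEq ι] {a : ℂ} {B : Type} [Ring B] [Algebra ℂ B] (D : SD ι a B) (L : List ι) : Few (D.KK L) (4 ^ L.length) := by
  induction L with
  | nil => exact ⟨{1}, by simp, by simp [SD.KK, Submodule.one_eq_span]⟩
  | cons l L ih =>
    have := (Few.pair 1 (D.c l)).mul ((Few.pair 1 (D.x l)).mul ih)
    rw [SD.KK_cons, List.length_cons, pow_succ]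
    convert this using 1; ring
lemma Few.finrank {B : Type} [Ring B] [Algebra ℂ B] {N : Submodule ℂ B} {n} (h : Few N n) : Module.Finite ℂ N ∧ Module.finrank ℂ N ≤ n := by
  obtain ⟨s, hs, rfl⟩ := h
  exact ⟨Module.Finite.span_of_finite ℂ s.finite_toSet, (finrank_span_finset_le_card s).trans hs⟩
end

section
set_option linter.unusedSectionVars false
set_option linter.unusedSimpArgs false
set_option linter.unusedVariables false
namespace Tr
open SDM
variable {ι : Type} [DecidableEq ι] {a : ℂ} (ω : ℂ) (o : ι)
local notation "𝐬" => DFunLike.coe (SD.σ (Serg.can _ _))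
local notation "𝐜" => SD.c (Serg.can _ _)
local notation "𝐱" => SD.x (Serg.can _ _)
section IM
variable {k : ℕ} {b ω : ℂ} {A : Type} [Ring A] [Algebra ℂ A] {D : WD k a b ω A} {φ : A →ₐ[ℂ] EP k a}
variable (φ) in
/-- the orbit map of the vacuum vector -/
def Ψ : A →ₗ[ℂ] PK k a where
  toFun u := φ u 1
  map_add' u v := by rw [map_add]; rfl
  map_smul' r u := by rw [map_smul]; rfl
lemma comm_adj {s : Set A} {T : EP k a} (h : ∀ g ∈ s, ∀ u, φ g (T u) = T (φ g u)) {y} (hy : y ∈ Algebra.adjoin ℂ s) : ∀ u, φ y (T u) = T (φ y u) := by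
  induction hy using Algebra.adjoin_induction with
  | mem g hg => exact h g hg
  | algebraMap r => intro u; rw [AlgHom.commutes, Module.algebraMap_end_apply, Module.algebraMap_end_apply, map_smul]
  | add y z _ _ hy hz => intro u; rw [map_add, LinearMap.add_apply, LinearMap.add_apply, hy, hz, map_add]
  | mul y z _ _ hy hz => intro u; rw [map_mul, Module.End.mul_apply, Module.End.mul_apply, hz, hy]
lemma I_φ {u} (hu : u ∈ LinearMap.range (Ψ φ)) (g : A) : φ g u ∈ LinearMap.range (Ψ φ) := by
  obtain ⟨v, rfl⟩ := hu
  exact ⟨g * v, show φ (g * v) 1 = _ by rw [map_mul]; rfl⟩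
/-- elements acting on the right through the commutant -/
lemma I_right (W : WRep D φ) (hg : Algebra.adjoin ℂ D.gens = ⊤) {y : PK k a} (g : A) (hy : ∀ u, φ g u = y * u)
    (h1 : ∀ w, y * 𝐬 (ir w) = 𝐬 (ir w) * y) (h2 : ∀ i, ε y * 𝐜 (Sum.inr i) = 𝐜 (Sum.inr i) * y) (h3 : ∀ i, y ∈ Sp (Sum.inr i))
    {u} (hu : u ∈ LinearMap.range (Ψ φ)) : u * y ∈ LinearMap.range (Ψ φ) := by
  obtain ⟨v, rfl⟩ := hu
  have hc : ∀ u, φ v (LinearMap.mulRight ℂ y u) = LinearMap.mulRight ℂ y (φ v u) := by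
    refine comm_adj (s := D.gens) (fun g hg u => ?_) (by rw [hg]; trivial)
    show φ g (u * y) = φ g u * y
    obtain ⟨w, rfl⟩ | ⟨w, rfl⟩ | ⟨i, rfl | rfl | rfl | rfl⟩ | ⟨i, j, rfl⟩ := hg
    · rw [W.hσ, W.hσ, mul_assoc]
    · rw [W.hσb, W.hσb, mul_assoc, h1, mul_assoc]
    · rw [W.hc, W.hc, mul_assoc]
    · rw [W.hcb, W.hcb, map_mul, mul_assoc, h2, mul_assoc]
    · rw [W.hx, W.hx, mul_assoc]
    · rw [W.hxb, W.hxb, Xb_right _ _ _ (h3 i)]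
    · rw [W.hE, W.hE, En_right _ _ _ _ (h3 j)]
  refine ⟨v * g, ?_⟩
  show φ (v * g) 1 = φ v 1 * y
  have := hc 1
  rw [LinearMap.mulRight_apply, LinearMap.mulRight_apply, one_mul] at this
  rw [← this, map_mul, Module.End.mul_apply, hy, mul_one]
lemma I_cl (W : WRep D φ) (hg : Algebra.adjoin ℂ D.gens = ⊤) (i : Fin k) {u} (hu : u ∈ LinearMap.range (Ψ φ)) : u * 𝐜 (Sum.inl i) ∈ LinearMap.range (Ψ φ) := by
  refine I_right W hg (D.c i) (W.hc i) (fun w => ?_) (fun j => ?_) (fun j => Sp_c (by simp)) hu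
  · rw [(Serg.can _ _).σ_c, ir_l]
  · rw [ε_c, (Serg.can _ _).c_anti _ _ (by simp : (Sum.inr j : IK k) ≠ Sum.inl i), neg_mul]
lemma I_xl (W : WRep D φ) (hg : Algebra.adjoin ℂ D.gens = ⊤) (i : Fin k) {u} (hu : u ∈ LinearMap.range (Ψ φ)) : u * 𝐱 (Sum.inl i) ∈ LinearMap.range (Ψ φ) := by
  refine I_right W hg (D.x i) (W.hx i) (fun w => ?_) (fun j => ?_) (fun j => Sp_x (by simp)) hu
  · rw [(Serg.can _ _).σ_x, ir_l]
  · rw [ε_x, (Serg.can _ _).x_c' _ _ (by simp : (Sum.inl i : IK k) ≠ Sum.inr j)]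
lemma one_I : (1 : PK k a) ∈ LinearMap.range (Ψ φ) := by
  refine ⟨1, ?_⟩
  show φ 1 1 = 1
  rw [map_one φ]; rfl
lemma I_ε (W : WRep D φ) (hg : Algebra.adjoin ℂ D.gens = ⊤) {u} (hu : u ∈ LinearMap.range (Ψ φ)) : ε u ∈ LinearMap.range (Ψ φ) := by
  obtain ⟨v, rfl⟩ := hu
  have h1 : (1 : PK k a) ∈ LinearMap.range (Ψ φ) := one_I
  have := adjoin_left_ind φ D.gens (LinearMap.range (Ψ φ) ⊓ (LinearMap.range (Ψ φ)).comap (ε (ι := IK k) (a := a)).toLinearMap) (fun g hg m hm => ⟨I_φ hm.1 g, ?_⟩) v (by rw [hg]; trivial) 1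
    ⟨h1, show ε (1 : PK k a) ∈ _ by rw [map_one]; exact h1⟩
  · exact this.2
  · show ε (φ g m) ∈ LinearMap.range (Ψ φ)
    have hm2 : ε m ∈ LinearMap.range (Ψ φ) := hm.2
    have h2 := I_φ hm2 g
    obtain ⟨w, rfl⟩ | ⟨w, rfl⟩ | ⟨i, rfl | rfl | rfl | rfl⟩ | ⟨i, j, rfl⟩ := hg
    · rw [W.hσ] at h2 ⊢; rwa [map_mul, ε_s]
    · rw [W.hσb] at h2 ⊢; rwa [map_mul, ε_s]
    · rw [W.hc] at h2 ⊢; rw [map_mul, ε_c, neg_mul]; exact neg_mem h2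
    · rw [W.hcb] at h2 ⊢; rw [map_mul, ε_c, mul_neg]; exact neg_mem h2
    · rw [W.hx] at h2 ⊢; rwa [map_mul, ε_x]
    · rw [W.hxb] at h2 ⊢; rwa [← Xb_ε]
    · rw [W.hE] at h2 ⊢; rwa [← En_ε]
lemma I_c (W : WRep D φ) (hg : Algebra.adjoin ℂ D.gens = ⊤) (i : IK k) {u} (hu : u ∈ LinearMap.range (Ψ φ)) : u * 𝐜 i ∈ LinearMap.range (Ψ φ) := by
  rcases i with i | i
  · exact I_cl W hg i hu
  · have := I_φ (I_ε W hg hu) (D.cb i)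
    rwa [W.hcb, ε_ε] at this
lemma I_s (W : WRep D φ) (hg : Algebra.adjoin ℂ D.gens = ⊤) (n : ℕ) : ∀ w : Equiv.Perm (IK k),
    (Finset.univ.filter fun i : Fin k => (w (Sum.inl i)).isRight).card = n → (𝐬 w : PK k a) ∈ LinearMap.range (Ψ φ) := by
  have h1 : (1 : PK k a) ∈ LinearMap.range (Ψ φ) := one_I
  induction n using Nat.strong_induction_on with
  | _ n ih =>
  intro w hw
  by_cases h : ∃ i, (w (Sum.inl i)).isRight
  · obtain ⟨i, hi⟩ := h
    obtain ⟨j, hj⟩ := Sum.isRight_iff.1 hi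
    have h2 : ∃ j' l, w (Sum.inr j') = Sum.inl l := by
      by_contra hc
      have h3 : ∀ j', ∃ q, w (Sum.inr j') = Sum.inr q := fun j' => by
        rcases h : w (Sum.inr j') with l | q
        · exact absurd ⟨j', l, h⟩ hc
        · exact ⟨q, rfl⟩
      choose f hf using h3
      have hfi : Function.Injective f := fun p q hpq => by
        have : w (Sum.inr p) = w (Sum.inr q) := by rw [hf, hf, hpq]
        exact Sum.inr_injective (w.injective this)
      obtain ⟨q, hq⟩ := (Finite.injective_iff_surjective.1 hfi) j
      have : w (Sum.inr q) = w (Sum.inl i) := by rw [hf, hq, hj]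
      exact absurd (w.injective this) (by simp)
    obtain ⟨j', l, hl⟩ := h2
    set v := Equiv.swap (Sum.inl l) (Sum.inr j) * w with hv
    have v1 : v (Sum.inl i) = Sum.inl l := by rw [hv, Equiv.Perm.mul_apply, hj, Equiv.swap_apply_right]
    have v2 : v (Sum.inr j') = Sum.inr j := by rw [hv, Equiv.Perm.mul_apply, hl, Equiv.swap_apply_left]
    have h3 : (Finset.univ.filter fun i : Fin k => (v (Sum.inl i)).isRight).card < n := by
      rw [← hw]
      refine Finset.card_lt_card ⟨fun i' hi' => ?_, fun hc => ?_⟩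
      · rw [Finset.mem_filter] at hi' ⊢
        refine ⟨hi'.1, ?_⟩
        have h4 := hi'.2
        by_cases he : i' = i
        · rw [he]; exact hi
        · rwa [hv, Equiv.Perm.mul_apply, Equiv.swap_apply_of_ne_of_ne] at h4
          · rw [← hl]; exact fun hc => absurd (w.injective hc) (by simp)
          · rw [← hj]; exact fun hc => he (Sum.inl_injective (w.injective hc))
      · have := hc (Finset.mem_filter.2 ⟨Finset.mem_univ i, hi⟩)
        rw [Finset.mem_filter, v1] at this
        exact absurd this.2 (by simp)
    have h4 := I_φ (ih _ h3 v rfl) (D.E l j')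
    have h5 : φ (D.E l j') (𝐬 v) = 𝐬 w := by
      rw [W.hE]
      have h6 := En_rs ω (Sum.inr j') v (Sum.inl l) (1 : PK k a)
      rw [one_mul] at h6
      rw [h6, v2, En_o_Sp ω (by simp) (one_mem _), one_mul, σσ, hv, ← mul_assoc, Equiv.swap_mul_self, one_mul]
    rwa [h5] at h4
  · have h2 : w ∈ (Equiv.Perm.sumCongrHom (Fin k) (Fin k)).range := by
      refine Equiv.Perm.mem_sumCongrHom_range_of_perm_mapsTo_inl ?_
      rintro _ ⟨i, rfl⟩
      rcases h3 : w (Sum.inl i) with l | q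
      · exact ⟨l, rfl⟩
      · exact absurd ⟨i, by rw [h3]; rfl⟩ h
    obtain ⟨⟨u, v⟩, rfl⟩ := h2
    have h3 : Equiv.Perm.sumCongrHom (Fin k) (Fin k) (u, v) = il u * ir v := by
      rw [il, ir, ← map_mul, Prod.mk_mul_mk, one_mul, mul_one]
    have := I_φ (I_φ h1 (D.σb v⁻¹)) (D.σ u)
    rw [W.hσb, W.hσ, one_mul, inv_inv, σσ] at this
    rwa [h3]
lemma K_Sp {L : List (IK k)} {o : IK k} (h : o ∉ L) : (Serg.can (IK k) a).KK L ≤ Subalgebra.toSubmodule (Sp o) := by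
  induction L with
  | nil => exact Submodule.one_le.2 (Sp o).one_mem
  | cons l L ih =>
    rw [List.mem_cons, not_or] at h
    intro u hu
    have hc := Sp_c (a := a) (Ne.symm h.1)
    have hx := Sp_x (a := a) (Ne.symm h.1)
    exact SD.K_ind (fun y hy => ⟨ih h.2 hy, (Sp o).mul_mem hc (ih h.2 hy), (Sp o).mul_mem hx (ih h.2 hy), (Sp o).mul_mem hc ((Sp o).mul_mem hx (ih h.2 hy))⟩) hu
/-- products of a permutation and Clifford generators -/
def CS (k : ℕ) (a : ℂ) : Set (PK k a) := {u | ∃ w, ∃ L : List (IK k), u = 𝐬 w * (L.map 𝐜).prod}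
lemma CS_c {u : PK k a} (hu : u ∈ CS k a) (i) : u * 𝐜 i ∈ CS k a := by
  obtain ⟨w, L, rfl⟩ := hu
  exact ⟨w, L ++ [i], by simp [mul_assoc]⟩
lemma CS_I (W : WRep D φ) (hg : Algebra.adjoin ℂ D.gens = ⊤) {u : PK k a} (hu : u ∈ CS k a) : u ∈ LinearMap.range (Ψ φ) := by
  obtain ⟨w, L, rfl⟩ := hu
  induction L using List.reverseRecOn with
  | nil => simpa using I_s W hg _ w rfl
  | append_singleton L i ih => simpa [mul_assoc] using I_c W hg i ih
lemma CS_Xb {u : PK k a} (hu : u ∈ CS k a) (o) (y : PK k a) : u * Xb ω o y = Xb ω o (u * y) := by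
  obtain ⟨w, L, rfl⟩ := hu
  rw [mul_assoc, mul_assoc, ← s_Xb]
  congr 1
  induction L with
  | nil => simp
  | cons l L ih => rw [List.map_cons, List.prod_cons, mul_assoc, ih, c_Xb, mul_assoc]
lemma CS_K (W : WRep D φ) (hg : Algebra.adjoin ℂ D.gens = ⊤) (L : List (Fin k)) (hL : L.Nodup) : ∀ u ∈ CS k a,
    ∀ y ∈ (Serg.can (IK k) a).KK (L.map Sum.inr), u * y ∈ LinearMap.range (Ψ φ) := by
  induction L with
  | nil =>
    intro u hu y hy
    obtain ⟨r, rfl⟩ := Submodule.mem_one.1 hy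
    rw [← Algebra.commutes, ← Algebra.smul_def]
    exact Submodule.smul_mem _ _ (CS_I W hg hu)
  | cons l L ih =>
    obtain ⟨hl, hL⟩ := List.nodup_cons.1 hL
    intro u hu y hy
    have hx : ∀ u ∈ CS k a, ∀ y ∈ (Serg.can (IK k) a).KK (L.map Sum.inr), u * (𝐱 (Sum.inr l) * y) ∈ LinearMap.range (Ψ φ) := by
      intro u hu y hy
      have h1 : y ∈ Sp (Sum.inr l) := K_Sp (by simpa using hl) hy
      have h2 := I_φ (ih hL u hu y hy) (D.xb l)
      rw [W.hxb, ← CS_Xb hu, Xb_y ω _ h1, mul_neg] at h2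
      simpa using neg_mem h2
    refine SD.K_ind (N := (LinearMap.range (Ψ φ)).comap (LinearMap.mulLeft ℂ u)) (fun y hy => ⟨ih hL u hu y hy, ?_, hx u hu y hy, ?_⟩) hy
    · show u * (𝐜 _ * y) ∈ LinearMap.range (Ψ φ)
      rw [← mul_assoc]; exact ih hL _ (CS_c hu _) y hy
    · show u * (𝐜 _ * (𝐱 _ * y)) ∈ LinearMap.range (Ψ φ)
      rw [← mul_assoc]; exact hx _ (CS_c hu _) y hy
lemma I_K (W : WRep D φ) (hg : Algebra.adjoin ℂ D.gens = ⊤) (L : List (Fin k)) : ∀ y ∈ (Serg.can (IK k) a).KK (L.map Sum.inl),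
    ∀ u ∈ LinearMap.range (Ψ φ), u * y ∈ LinearMap.range (Ψ φ) := by
  induction L with
  | nil =>
    intro y hy u hu
    obtain ⟨r, rfl⟩ := Submodule.mem_one.1 hy
    rw [← Algebra.commutes, ← Algebra.smul_def]
    exact Submodule.smul_mem _ _ hu
  | cons l L ih =>
    intro y hy u hu
    have hc := fun u hu => I_cl W hg l (u := u) hu
    have hx := fun u hu => I_xl W hg l (u := u) hu
    refine SD.K_ind (N := (LinearMap.range (Ψ φ)).comap (LinearMap.mulLeft ℂ u)) (fun y hy => ?_) hy
    simp only [Submodule.mem_comap, LinearMap.mulLeft_apply, ← mul_assoc]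
    exact ⟨ih y hy u hu, ih y hy _ (hc u hu), ih y hy _ (hx u hu), ih y hy _ (hx _ (hc u hu))⟩
theorem Ψ_surj (W : WRep D φ) (hg : Algebra.adjoin ℂ D.gens = ⊤) : Function.Surjective (Ψ φ) := by
  intro u
  set L := (Finset.univ : Finset (Fin k)).toList with hL
  have hn : L.Nodup := Finset.nodup_toList _
  have h1 : ((L.map Sum.inr ++ L.map Sum.inl : List (IK k))).Nodup := by
    refine List.Nodup.append (hn.map Sum.inr_injective) (hn.map Sum.inl_injective) ?_
    intro x h1 h2
    obtain ⟨p, -, rfl⟩ := List.mem_map.1 h1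
    obtain ⟨q, -, h⟩ := List.mem_map.1 h2
    exact absurd h (by simp)
  have h2 : ∀ i : IK k, i ∈ (L.map Sum.inr ++ L.map Sum.inl : List (IK k)) := by
    rintro (i | i) <;> simp [hL]
  have h3 : u ∈ Algebra.adjoin ℂ (Serg.can (IK k) a).sgens :=
    Serg.top_of_gens _ (fun w => Algebra.subset_adjoin (Or.inl ⟨w, rfl⟩)) (fun i => Algebra.subset_adjoin (Or.inr ⟨i, Or.inl rfl⟩))
      (fun i => Algebra.subset_adjoin (Or.inr ⟨i, Or.inr rfl⟩)) u
  have h4 := SD.T_all h1 h2 h3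
  rw [SD.KK_append] at h4
  show u ∈ LinearMap.range (Ψ φ)
  refine SD.S_ind (fun w _ y hy => ?_) h4
  refine Submodule.mul_induction_on (C := fun y => 𝐬 w * y ∈ LinearMap.range (Ψ φ)) hy (fun m hm n hn' => ?_) (fun y z hy hz => ?_)
  · rw [← mul_assoc]
    exact I_K W hg L n hn' _ (CS_K W hg L hn _ ⟨w, [], by simp⟩ m hm)
  · rw [mul_add]; exact add_mem hy hz
/-- faithfulness of multiplication by `E n n` on the vacuum -/
lemma Ψ_E (W : WRep D φ) {n : Fin k} {y} (hy : y ∈ D.LA n) (h : y * D.E n n = 0) : Ψ φ y = 0 := by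
  set t : Equiv.Perm (IK k) := Equiv.swap (Sum.inl n) (Sum.inr n) with ht
  have hc : ∀ u, φ y (LinearMap.mulRight ℂ (𝐬 t) u) = LinearMap.mulRight ℂ (𝐬 t) (φ y u) := by
    refine comm_adj (s := D.lgen n) (fun g hg u => ?_) hy
    show φ g (u * 𝐬 t) = φ g u * 𝐬 t
    have tr : ∀ i, i ≠ n → t (Sum.inr i) = Sum.inr i := fun i hi => Equiv.swap_apply_of_ne_of_ne (by simp) (by simpa using hi)
    obtain ⟨w, hw, rfl⟩ | ⟨w, hw, rfl⟩ | ⟨i, hi, rfl | rfl | rfl | rfl⟩ | ⟨i, j, hi, hj, rfl⟩ := hg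
    · rw [W.hσ, W.hσ, mul_assoc]
    · have h1 : t * ir w⁻¹ = ir w⁻¹ * t := by
        have hw' : w⁻¹ n = n := by rw [Equiv.Perm.inv_eq_iff_eq, hw]
        rw [ht, Equiv.swap_mul_eq_mul_swap, ← ir_inv, inv_inv, ir_l, ir_r, hw]
      rw [W.hσb, W.hσb, mul_assoc, σσ, h1, ← σσ, mul_assoc]
    · rw [W.hc, W.hc, mul_assoc]
    · rw [W.hcb, W.hcb, map_mul, ε_s, mul_assoc, mul_assoc, (Serg.can _ _).σ_c, tr i hi]
    · rw [W.hx, W.hx, mul_assoc]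
    · rw [W.hxb, W.hxb, Xb_rs, tr i hi]
    · rw [W.hE, W.hE, En_rs, tr j hj]
  have h1 : φ (D.E n n) 1 = 𝐬 t := by rw [W.hE, En_o_Sp ω (by simp) (one_mem _), one_mul]
  have h2 : φ (y * D.E n n) 1 = φ y 1 * 𝐬 t := by
    rw [map_mul, Module.End.mul_apply, h1]
    have := hc 1
    rwa [LinearMap.mulRight_apply, LinearMap.mulRight_apply, one_mul] at this
  rw [h, map_zero, LinearMap.zero_apply] at h2
  show φ y 1 = 0
  have h3 : (𝐬 t * 𝐬 t : PK k a) = 1 := by rw [σσ, ht, Equiv.swap_mul_self, map_one]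
  have h4 : φ y 1 * (𝐬 t * 𝐬 t) = 0 := by rw [← mul_assoc, ← h2, zero_mul]
  rwa [h3, mul_one] at h4
end IM
end Tr
end

section
set_option linter.unusedSectionVars false
set_option linter.unusedSimpArgs false
set_option linter.unusedVariables false
namespace WD
variable {k : ℕ} {a b ω : ℂ} {A : Type} [Ring A] [Algebra ℂ A] (D : WD k a b ω A)
lemma ipa {ι : Type} (w : Equiv.Perm ι) (i) : w⁻¹ (w i) = i := w.symm_apply_apply i
/-- partial matchings -/
def Mt (L : List (Fin k × Fin k)) : Prop := L.Pairwise fun p q => p.1 ≠ q.1 ∧ p.2 ≠ q.2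
lemma Mt.perm {L L' : List (Fin k × Fin k)} (h : Mt L) (hp : L.Perm L') : Mt L' :=
  hp.pairwise h (fun h => ⟨h.1.symm, h.2.symm⟩)
lemma Mt.nodup {L : List (Fin k × Fin k)} (h : Mt L) : L.Nodup := h.imp fun h hc => h.1 (by rw [hc])
lemma Mt.split {L : List (Fin k × Fin k)} (h : Mt L) {p} (hp : p ∈ L) : ∃ L', L.Perm (p :: L') ∧ Mt (p :: L') :=
  ⟨L.erase p, List.perm_cons_erase hp, h.perm (List.perm_cons_erase hp)⟩
lemma Mt.fst {L : List (Fin k × Fin k)} (h : Mt L) {i j j'} (h1 : (i, j) ∈ L) (h2 : (i, j') ∈ L) : j = j' := by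
  by_contra hc
  obtain ⟨L', hp, hm⟩ := h.split h1
  have := hp.mem_iff.1 h2
  rw [List.mem_cons] at this
  rcases this with h3 | h3
  · exact hc (Prod.mk.inj h3).2.symm
  · exact ((List.pairwise_cons.1 hm).1 _ h3).1 rfl
lemma Mt.snd {L : List (Fin k × Fin k)} (h : Mt L) {i i' j} (h1 : (i, j) ∈ L) (h2 : (i', j) ∈ L) : i = i' := by
  by_contra hc
  obtain ⟨L', hp, hm⟩ := h.split h1
  have := hp.mem_iff.1 h2
  rw [List.mem_cons] at this
  rcases this with h3 | h3
  · exact hc (Prod.mk.inj h3).1.symm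
  · exact ((List.pairwise_cons.1 hm).1 _ h3).2 rfl
/-- product of arcs -/
def eL (L : List (Fin k × Fin k)) : A := (L.map fun p => D.E p.1 p.2).prod
variable {D}
lemma eL_cons (p L) : D.eL (p :: L) = D.E p.1 p.2 * D.eL L := by rw [eL, List.map_cons, List.prod_cons]; rfl
lemma eL_perm {L L'} (h : Mt L) (hp : L.Perm L') : D.eL L = D.eL L' := by
  refine (hp.map _).prod_eq' ?_
  rw [List.pairwise_map]
  exact h.imp fun h => D.EE_comm _ _ _ _ h.1 h.2
lemma eL_sw {L i j l m} (h : Mt L) (h1 : (i, j) ∈ L) (h2 : (l, m) ∈ L) (hil : i ≠ l) (hjm : j ≠ m) :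
    D.eL L * D.σ (Equiv.swap i l) * D.σb (Equiv.swap j m) = D.eL L := by
  obtain ⟨L1, p1, m1⟩ := h.split h1
  have h3 : (l, m) ∈ L1 := by
    have := p1.mem_iff.1 h2
    rw [List.mem_cons] at this
    exact this.resolve_left fun hc => hil (Prod.mk.inj hc).1.symm
  obtain ⟨L2, p2, m2⟩ := Mt.split (List.pairwise_cons.1 m1).2 h3
  have hp : L.Perm (L2 ++ [(i, j), (l, m)]) := (p1.trans (p2.cons _)).trans (List.perm_append_comm (l₁ := [(i, j), (l, m)]))
  have e : D.eL (L2 ++ [(i, j), (l, m)]) = D.eL L2 * (D.E i j * D.E l m) := by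
    rw [eL, List.map_append, List.prod_append]; simp [eL]
  have := D.EE_σ i j l m hil hjm
  rw [eL_perm h hp, e, mul_assoc, mul_assoc, ← mul_assoc (D.E i j * D.E l m), this]
lemma eL_fix {L} (h : Mt L) (n : ℕ) : ∀ π ρ : Equiv.Perm (Fin k), π.support.card = n → (∀ i, (∀ j, (i, j) ∉ L) → π i = i) →
    (∀ j, (∀ i, (i, j) ∉ L) → ρ j = j) → (∀ i j, (i, j) ∈ L → (π i, ρ j) ∈ L) → D.eL L * D.σ π * D.σb ρ = D.eL L := by
  induction n using Nat.strong_induction_on with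
  | _ n ih =>
  intro π ρ hn h1 h2 h3
  by_cases hπ : π = 1
  · have : ρ = 1 := by
      refine Equiv.ext fun j => ?_
      by_cases hj : ∃ i, (i, j) ∈ L
      · obtain ⟨i, hi⟩ := hj
        have := h3 i j hi
        rw [hπ] at this
        exact h.fst this hi
      · exact h2 j (by simpa using hj)
    rw [this, hπ, map_one, map_one, mul_one, mul_one]
  · obtain ⟨i, hi⟩ : ∃ i, π i ≠ i := by
      by_contra hc; simp only [not_exists, not_not] at hc; exact hπ (Equiv.ext hc)
    obtain ⟨j, hj⟩ : ∃ j, (i, j) ∈ L := by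
      by_contra hc; exact hi (h1 i (by simpa using hc))
    have hj' := h3 i j hj
    have hρ : ρ j ≠ j := fun hc => by rw [hc] at hj'; exact hi (h.snd hj' hj)
    have hs := eL_sw (D := D) h hj hj' hi.symm hρ.symm
    have hm : ∀ l m, (l, m) ∈ L → (Equiv.swap i (π i) l, Equiv.swap j (ρ j) m) ∈ L := by
      intro l m hl
      by_cases e1 : l = i
      · subst e1; rw [h.fst hl hj, Equiv.swap_apply_left, Equiv.swap_apply_left]; exact hj'
      by_cases e2 : l = π i
      · subst e2; rw [h.fst hl hj', Equiv.swap_apply_right, Equiv.swap_apply_right]; exact hj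
      rw [Equiv.swap_apply_of_ne_of_ne e1 e2, Equiv.swap_apply_of_ne_of_ne]
      · exact hl
      · rintro rfl; exact e1 (h.snd hl hj)
      · rintro rfl; exact e2 (h.snd hl hj')
    have := ih _ (hn ▸ Equiv.Perm.card_support_swap_mul hi) (Equiv.swap i (π i) * π) (Equiv.swap j (ρ j) * ρ) rfl
      (fun l hl => by
        rw [Equiv.Perm.mul_apply, h1 l hl, Equiv.swap_apply_of_ne_of_ne]
        · rintro rfl; exact hl _ hj
        · rintro rfl; exact hl _ hj')
      (fun l hl => by
        rw [Equiv.Perm.mul_apply, h2 l hl, Equiv.swap_apply_of_ne_of_ne]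
        · rintro rfl; exact hl _ hj
        · rintro rfl; exact hl _ hj')
      (fun l m hl => hm _ _ (h3 l m hl))
    rw [map_mul, map_mul, mul_assoc, mul_assoc (D.σ _), ← mul_assoc (D.σ π), D.σσb π, ← mul_assoc, ← mul_assoc, ← mul_assoc, hs, mul_assoc] at this
    rw [mul_assoc]; exact this
/-- the permutation attached to a diagram -/
structure Rw (L : List (Fin k × Fin k)) (u v : Equiv.Perm (Fin k)) (w : Equiv.Perm (Fin k ⊕ Fin k)) : Prop where
  a : ∀ i j, (i, j) ∈ L ↔ w (Sum.inr j) = Sum.inl i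
  r : ∀ j q, w (Sum.inr j) = Sum.inr q → v q = j
  l : ∀ l m, w (Sum.inl l) = Sum.inl m → u l = m
  x : ∀ l q, w (Sum.inl l) = Sum.inr q → (u l, v q) ∈ L
lemma Rw_ex {L} (h : Mt L) (u v : Equiv.Perm (Fin k)) : ∃ w, Rw L u v w := by
  induction L with
  | nil =>
    refine ⟨Tr.il u * Tr.ir v⁻¹, fun i j => by simp, fun j q h => ?_, fun l m h => by simpa using h, fun l q h => by simp at h⟩
    rw [Equiv.Perm.mul_apply, Tr.ir_r, Tr.il_r] at h
    rw [← Sum.inr_injective h, SD.pai]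
  | cons p L ih =>
    obtain ⟨i, j⟩ := p
    obtain ⟨hp, hL⟩ := List.pairwise_cons.1 h
    obtain ⟨w, hw⟩ := ih hL
    have hi : ∀ j', w (Sum.inr j') ≠ Sum.inl i := fun j' hc => (hp _ ((hw.a _ _).2 hc)).1 rfl
    obtain ⟨q, hq⟩ : ∃ q, w (Sum.inr j) = Sum.inr q := by
      rcases h3 : w (Sum.inr j) with i' | q
      · exact absurd rfl (hp _ ((hw.a _ _).2 h3)).2
      · exact ⟨q, rfl⟩
    have hv := hw.r _ _ hq
    set s : Equiv.Perm (Fin k ⊕ Fin k) := Equiv.swap (Sum.inl i) (Sum.inr q) with hs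
    have sj : s (w (Sum.inr j)) = Sum.inl i := by rw [hq, hs, Equiv.swap_apply_right]
    have sr : ∀ j', j' ≠ j → s (w (Sum.inr j')) = w (Sum.inr j') := fun j' hj => by
      refine Equiv.swap_apply_of_ne_of_ne (hi j') ?_
      rw [← hq]; exact fun hc => hj (Sum.inr_injective (w.injective hc))
    have sl : ∀ l, w (Sum.inl l) ≠ Sum.inl i → s (w (Sum.inl l)) = w (Sum.inl l) := fun l hl => by
      refine Equiv.swap_apply_of_ne_of_ne hl ?_
      rw [← hq]; exact fun hc => absurd (w.injective hc) (by simp)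
    have si : ∀ l, w (Sum.inl l) = Sum.inl i → s (w (Sum.inl l)) = Sum.inr q := fun l hl => by
      rw [hl, hs, Equiv.swap_apply_left]
    refine ⟨s * w, fun i' j' => ?_, fun j' q' h1 => ?_, fun l m h1 => ?_, fun l q' h1 => ?_⟩
    · rw [Equiv.Perm.mul_apply, List.mem_cons]
      by_cases hj : j' = j
      · subst hj
        rw [sj]
        refine ⟨fun h1 => ?_, fun h1 => Or.inl (by rw [Sum.inl_injective h1])⟩
        rcases h1 with h1 | h1
        · rw [(Prod.mk.inj h1).1]
        · exact absurd rfl (hp _ h1).2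
      · rw [sr j' hj, hw.a]
        refine ⟨fun h1 => ?_, Or.inr⟩
        rcases h1 with h1 | h1
        · exact absurd (Prod.mk.inj h1).2 hj
        · exact h1
    · rw [Equiv.Perm.mul_apply] at h1
      by_cases hj : j' = j
      · subst hj; rw [sj] at h1; exact absurd h1 (by simp)
      · rw [sr j' hj] at h1; exact hw.r _ _ h1
    · rw [Equiv.Perm.mul_apply] at h1
      by_cases hl : w (Sum.inl l) = Sum.inl i
      · rw [si l hl] at h1; exact absurd h1 (by simp)
      · rw [sl l hl] at h1; exact hw.l _ _ h1
    · rw [Equiv.Perm.mul_apply] at h1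
      by_cases hl : w (Sum.inl l) = Sum.inl i
      · rw [si l hl] at h1
        rw [← Sum.inr_injective h1, hv, hw.l _ _ hl]; exact List.mem_cons_self
      · rw [sl l hl] at h1; exact List.mem_cons_of_mem _ (hw.x _ _ h1)
lemma Rw_uniq {L L' u u' v v' w} (h : Mt L) (h' : Mt L') (r : Rw L u v w) (r' : Rw L' u' v' w) :
    D.eL L * D.σ u * D.σb v = D.eL L' * D.σ u' * D.σb v' := by
  have hp : L'.Perm L := (List.perm_ext_iff_of_nodup h'.nodup h.nodup).2 fun p => by
    obtain ⟨i, j⟩ := p; rw [r.a, r'.a]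
  have h1 := eL_fix (D := D) h _ (u' * u⁻¹) (v' * v⁻¹) rfl (fun i hi => ?_) (fun j hj => ?_) (fun i j hij => ?_)
  · rw [eL_perm h' hp]
    conv_rhs => rw [show u' = u' * u⁻¹ * u by group, show v' = v' * v⁻¹ * v by group, map_mul, map_mul _ (v' * v⁻¹)]
    rw [mul_assoc (D.eL L) (_ * _), mul_assoc (D.σ _) (D.σ u), ← mul_assoc (D.σ u), D.σσb u, mul_assoc (D.σb _), ← mul_assoc, ← mul_assoc, h1, mul_assoc]
  · rw [Equiv.Perm.mul_apply]
    rcases h2 : w (Sum.inl (u⁻¹ i)) with m | q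
    · have e1 := r.l _ _ h2
      rw [SD.pai] at e1
      rw [r'.l _ _ h2, e1]
    · have e1 := r.x _ _ h2
      rw [SD.pai] at e1
      exact absurd e1 (hi _)
  · rw [Equiv.Perm.mul_apply]
    rcases h2 : w (Sum.inr j) with m | q
    · exact absurd ((r.a _ _).2 h2) (hj _)
    · rw [← r.r _ _ h2, ipa, r'.r _ _ h2, ← r.r _ _ h2]
  · rw [Equiv.Perm.mul_apply, Equiv.Perm.mul_apply]
    rcases h2 : w (Sum.inl (u⁻¹ i)) with m | q
    · have e1 := r.l _ _ h2
      rw [SD.pai] at e1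
      rw [← e1, ← (r.a _ _).1 hij] at h2
      exact absurd (w.injective h2) (by simp)
    · have e1 := r.x _ _ h2
      rw [SD.pai] at e1
      have e2 := r'.x _ _ h2
      rw [h.fst hij e1, ipa]
      exact hp.mem_iff.1 e2
variable (D) in
/-- span of the diagrams -/
def TT : Submodule ℂ A := Submodule.span ℂ {T | ∃ L u v, Mt L ∧ T = D.eL L * D.σ u * D.σb v}
lemma TT_few : Few D.TT (2 * k).factorial := by
  classical
  let f : Equiv.Perm (Fin k ⊕ Fin k) → A := fun w => if h : ∃ T, ∃ L u v, Mt L ∧ Rw L u v w ∧ T = D.eL L * D.σ u * D.σb v then h.choose else 0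
  refine ⟨Finset.univ.image f, Finset.card_image_le.trans ?_, le_antisymm (Submodule.span_le.2 ?_) (Submodule.span_le.2 ?_)⟩
  · rw [Finset.card_univ, Fintype.card_perm, Fintype.card_sum, Fintype.card_fin, two_mul]
  · rintro T ⟨L, u, v, hL, rfl⟩
    obtain ⟨w, hw⟩ := Rw_ex hL u v
    refine Submodule.subset_span ?_
    rw [Finset.coe_image]
    refine ⟨w, by simp, ?_⟩
    have h : ∃ T, ∃ L u v, Mt L ∧ Rw L u v w ∧ T = D.eL L * D.σ u * D.σb v := ⟨_, L, u, v, hL, hw, rfl⟩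
    have e : f w = h.choose := dif_pos h
    obtain ⟨L', u', v', hL', hw', e'⟩ := h.choose_spec
    rw [e, e', Rw_uniq hL' hL hw' hw]
  · intro T hT
    rw [Finset.coe_image] at hT
    obtain ⟨w, -, rfl⟩ := hT
    by_cases h : ∃ T, ∃ L u v, Mt L ∧ Rw L u v w ∧ T = D.eL L * D.σ u * D.σb v
    · have e : f w = h.choose := dif_pos h
      obtain ⟨L', u', v', hL', hw', e'⟩ := h.choose_spec
      rw [e, e']
      exact Submodule.subset_span ⟨_, _, _, hL', rfl⟩
    · have e : f w = 0 := dif_neg h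
      rw [e]; exact zero_mem _
lemma TT_ind {N : Submodule ℂ A} (h : ∀ L u v, Mt L → D.eL L * D.σ u * D.σb v ∈ N) {T} (hT : T ∈ D.TT) : T ∈ N :=
  Submodule.span_le.2 (by rintro T ⟨L, u, v, hL, rfl⟩; exact h L u v hL) hT
lemma TT_mem {L} (h : Mt L) (u v) : D.eL L * D.σ u * D.σb v ∈ D.TT := Submodule.subset_span ⟨L, u, v, h, rfl⟩
lemma TT_one : (1 : A) ∈ D.TT := by
  have := TT_mem (D := D) (L := []) List.Pairwise.nil 1 1
  simpa [eL] using this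
lemma σ_eL (w : Equiv.Perm (Fin k)) (L) : D.σ w * D.eL L = D.eL (L.map (Prod.map w id)) * D.σ w := by
  induction L with
  | nil => simp [eL]
  | cons p L ih => rw [List.map_cons, eL_cons, eL_cons, ← mul_assoc, D.σ_E, mul_assoc, ih, mul_assoc]; rfl
lemma σb_eL (w : Equiv.Perm (Fin k)) (L) : D.σb w * D.eL L = D.eL (L.map (Prod.map id w)) * D.σb w := by
  induction L with
  | nil => simp [eL]
  | cons p L ih => rw [List.map_cons, eL_cons, eL_cons, ← mul_assoc, D.σb_E, mul_assoc, ih, mul_assoc]; rfl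
lemma TT_σ (w) {T} (hT : T ∈ D.TT) : D.σ w * T ∈ D.TT := by
  refine TT_ind (N := D.TT.comap (LinearMap.mulLeft ℂ (D.σ w))) (fun L u v hL => ?_) hT
  show D.σ w * (D.eL L * D.σ u * D.σb v) ∈ D.TT
  rw [← mul_assoc, ← mul_assoc, σ_eL, mul_assoc (D.eL _), ← map_mul]
  refine TT_mem (List.pairwise_map.2 (List.Pairwise.imp ?_ hL)) _ _
  exact fun h => ⟨fun hc => h.1 (w.injective hc), h.2⟩
lemma TT_σb (w) {T} (hT : T ∈ D.TT) : D.σb w * T ∈ D.TT := by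
  refine TT_ind (N := D.TT.comap (LinearMap.mulLeft ℂ (D.σb w))) (fun L u v hL => ?_) hT
  show D.σb w * (D.eL L * D.σ u * D.σb v) ∈ D.TT
  rw [← mul_assoc, ← mul_assoc, σb_eL, mul_assoc (D.eL _), ← D.σσb, ← mul_assoc, mul_assoc, ← map_mul]
  refine TT_mem (List.pairwise_map.2 (List.Pairwise.imp ?_ hL)) _ _
  exact fun h => ⟨h.1, fun hc => h.2 (w.injective hc)⟩
lemma TT_σr (w) {T} (hT : T ∈ D.TT) : T * D.σ w ∈ D.TT := by
  refine TT_ind (N := D.TT.comap (LinearMap.mulRight ℂ (D.σ w))) (fun L u v hL => ?_) hT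
  show D.eL L * D.σ u * D.σb v * D.σ w ∈ D.TT
  rw [mul_assoc, ← D.σσb, ← mul_assoc, mul_assoc (D.eL L), ← map_mul]
  exact TT_mem hL _ _
lemma EE_l' {i i'} (j) (h : i ≠ i') : D.E i j * D.E i' j = D.σ (Equiv.swap i i') * D.E i' j := by
  rw [D.EE_l _ _ _ h, D.σ_E, Equiv.swap_apply_right]
lemma EE_r' {j j'} (i) (h : j ≠ j') : D.E i j * D.E i j' = D.σb (Equiv.swap j j') * D.E i j' := by
  rw [D.EE_r _ _ _ h, D.σb_E, Equiv.swap_apply_right]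
lemma TT_E (i j) {T} (hT : T ∈ D.TT) : D.E i j * T ∈ D.TT := by
  refine TT_ind (N := D.TT.comap (LinearMap.mulLeft ℂ (D.E i j))) (fun L u v hL => ?_) hT
  show D.E i j * (D.eL L * D.σ u * D.σb v) ∈ D.TT
  have hT := TT_mem (D := D) hL u v
  by_cases h : ∃ p ∈ L, p.1 = i ∨ p.2 = j
  · obtain ⟨⟨i', j'⟩, hp, h⟩ := h
    obtain ⟨L', pp, -⟩ := hL.split hp
    have e := eL_perm (D := D) hL pp
    rw [eL_cons] at e
    by_cases h1 : i' = i
    · subst h1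
      by_cases h2 : j' = j
      · subst h2
        rw [e, ← mul_assoc, ← mul_assoc, ← mul_assoc, D.E_E]; simp
      · have : D.E i' j * D.eL L = D.σb (Equiv.swap j j') * D.eL L := by rw [e, ← mul_assoc, EE_r' _ (Ne.symm h2), mul_assoc]
        rw [← mul_assoc, ← mul_assoc, this, mul_assoc, mul_assoc, ← mul_assoc (D.eL L)]; exact TT_σb _ hT
    · have h2 : j' = j := h.resolve_left h1
      subst h2
      have : D.E i j' * D.eL L = D.σ (Equiv.swap i i') * D.eL L := by rw [e, ← mul_assoc, EE_l' _ (Ne.symm h1), mul_assoc]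
      rw [← mul_assoc, ← mul_assoc, this, mul_assoc, mul_assoc, ← mul_assoc (D.eL L)]; exact TT_σ _ hT
  · have hm : Mt ((i, j) :: L) := List.pairwise_cons.2 ⟨fun p hp => ⟨fun hc => h ⟨p, hp, Or.inl hc.symm⟩, fun hc => h ⟨p, hp, Or.inr hc.symm⟩⟩, hL⟩
    have := TT_mem (D := D) hm u v
    rwa [eL_cons, mul_assoc, mul_assoc, ← mul_assoc (D.eL L)] at this
/-- the alternative for a diagram and a letter -/
lemma TT_dich {L} (hL : Mt L) (u v : Equiv.Perm (Fin k)) (i : Fin k) :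
    (∃ l, D.x i * (D.eL L * D.σ u * D.σb v) = D.eL L * D.σ u * D.σb v * D.x l ∧ D.c i * (D.eL L * D.σ u * D.σb v) = D.eL L * D.σ u * D.σb v * D.c l)
    ∨ ∃ j, ∃ T ∈ D.TT, D.eL L * D.σ u * D.σb v = D.E i j * T := by
  by_cases h : ∃ j, (i, j) ∈ L
  · obtain ⟨j, hj⟩ := h
    obtain ⟨L', pp, hm⟩ := hL.split hj
    refine Or.inr ⟨j, _, TT_mem (List.pairwise_cons.1 hm).2 u v, ?_⟩
    rw [eL_perm hL pp, eL_cons]; simp only [mul_assoc]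
  · refine Or.inl ⟨u⁻¹ i, ?_⟩
    have hx : ∀ L : List (Fin k × Fin k), (¬ ∃ j, (i, j) ∈ L) → D.x i * D.eL L = D.eL L * D.x i ∧ D.c i * D.eL L = D.eL L * D.c i := by
      intro L h
      induction L with
      | nil => simp [eL]
      | cons p L ih =>
        obtain ⟨i', j'⟩ := p
        have h1 := ih (fun ⟨j, hj⟩ => h ⟨j, List.mem_cons_of_mem _ hj⟩)
        have h2 : i ≠ i' := by rintro rfl; exact h ⟨j', List.mem_cons_self⟩
        rw [eL_cons]
        constructor
        · rw [← mul_assoc, D.E_x' _ _ _ h2, mul_assoc, h1.1, mul_assoc]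
        · rw [← mul_assoc, D.E_c' _ _ _ h2, mul_assoc, h1.2, mul_assoc]
    have h1 := hx L h
    constructor
    · rw [mul_assoc _ (D.σb v), D.σb_x, ← mul_assoc _ (D.x _), mul_assoc (D.eL L) (D.σ u) (D.x _), D.σ_x, SD.pai, ← mul_assoc, ← mul_assoc, h1.1]
      simp only [mul_assoc]
    · rw [mul_assoc _ (D.σb v), D.σb_c, ← mul_assoc _ (D.c _), mul_assoc (D.eL L) (D.σ u) (D.c _), D.σ_c, SD.pai, ← mul_assoc, ← mul_assoc, h1.2]
      simp only [mul_assoc]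
end WD
end

section
set_option linter.unusedSectionVars false
set_option linter.unusedSimpArgs false
set_option linter.unusedVariables false
namespace WD
variable {k : ℕ} {a b ω : ℂ} {A : Type} [Ring A] [Algebra ℂ A] (D : WD k a b ω A)
/-- unbarred Sergeev part -/
def sd : SD (Fin k) a A where
  σ := D.σ
  c := D.c
  x := D.x
  c_sq := D.c_sq
  c_anti := D.c_anti
  σ_c := D.σ_c
  σ_x := D.σ_x
  x_sq := D.x_sq
  x_c := D.x_c
  x_c' := D.x_c'
  x_x := D.x_x
/-- the span of `TT * P` -/
def B0 : Submodule ℂ A := D.TT * Subalgebra.toSubmodule (Algebra.adjoin ℂ D.sd.sgens)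
def B1 : Submodule ℂ A := Subalgebra.toSubmodule (Algebra.adjoin ℂ (Set.range D.cb)) * D.B0
/-- the filtration -/
def FF : ℕ → Submodule ℂ A
  | 0 => D.B1
  | n + 1 => FF n ⊔ Submodule.span ℂ (Set.range D.xb) * FF n
variable {D}
lemma P_c (l) : D.c l ∈ Algebra.adjoin ℂ D.sd.sgens := Algebra.subset_adjoin (Or.inr ⟨l, Or.inl rfl⟩)
lemma P_x (l) : D.x l ∈ Algebra.adjoin ℂ D.sd.sgens := Algebra.subset_adjoin (Or.inr ⟨l, Or.inr rfl⟩)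
lemma B0_mem {T y} (hT : T ∈ D.TT) (hy : y ∈ Algebra.adjoin ℂ D.sd.sgens) : T * y ∈ D.B0 := Submodule.mul_mem_mul hT hy
lemma B0_ind {N : Submodule ℂ A} (h : ∀ L u v, Mt L → ∀ y ∈ Algebra.adjoin ℂ D.sd.sgens, D.eL L * D.σ u * D.σb v * y ∈ N) {u} (hu : u ∈ D.B0) : u ∈ N := by
  have h1 : D.B0 ≤ N := by
    rw [B0, Submodule.mul_le]
    intro T hT y hy
    exact TT_ind (N := N.comap (LinearMap.mulRight ℂ y)) (fun L u v hL => h L u v hL y hy) hT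
  exact h1 hu
lemma B0_l {g : A} (h : ∀ T ∈ D.TT, g * T ∈ D.TT) {u} (hu : u ∈ D.B0) : g * u ∈ D.B0 := by
  refine B0_ind (N := D.B0.comap (LinearMap.mulLeft ℂ g)) (fun L u v hL y hy => ?_) hu
  show g * (_ * y) ∈ D.B0
  rw [← mul_assoc]
  exact B0_mem (h _ (TT_mem hL u v)) hy
lemma B0_B1 {u} (hu : u ∈ D.B0) : u ∈ D.B1 := by
  have h1 : (1 : A) ∈ Subalgebra.toSubmodule (Algebra.adjoin ℂ (Set.range D.cb)) := (Algebra.adjoin ℂ (Set.range D.cb)).one_mem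
  have := Submodule.mul_mem_mul h1 hu
  rwa [one_mul] at this
lemma B1_ind {N : Submodule ℂ A} (h0 : ∀ u ∈ D.B0, u ∈ N) (h : ∀ j, ∀ u ∈ N, D.cb j * u ∈ N) {u} (hu : u ∈ D.B1) : u ∈ N := by
  have h1 : D.B1 ≤ N := by
    rw [B1, Submodule.mul_le]
    intro m hm y hy
    refine adjoin_left_ind (Algebra.lmul ℂ A) (Set.range D.cb) N ?_ m hm y (h0 y hy)
    rintro _ ⟨j, rfl⟩ u hu
    exact h j u hu
  exact h1 hu
lemma B1_cb (j) {u} (hu : u ∈ D.B1) : D.cb j * u ∈ D.B1 := by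
  have h1 : D.B1 ≤ D.B1.comap (LinearMap.mulLeft ℂ (D.cb j)) := by
    conv_lhs => rw [B1]
    rw [Submodule.mul_le]
    intro m hm y hy
    show D.cb j * (m * y) ∈ D.B1
    rw [← mul_assoc]
    exact Submodule.mul_mem_mul ((Algebra.adjoin ℂ (Set.range D.cb)).mul_mem (Algebra.subset_adjoin ⟨j, rfl⟩) hm) hy
  exact h1 hu
lemma B1_σ (w) {u} (hu : u ∈ D.B1) : D.σ w * u ∈ D.B1 := by
  refine B1_ind (N := D.B1.comap (LinearMap.mulLeft ℂ (D.σ w))) (fun u hu => B0_B1 (B0_l (fun T hT => TT_σ w hT) hu)) (fun j u hu => ?_) hu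
  show D.σ w * (D.cb j * u) ∈ D.B1
  rw [← mul_assoc, D.σ_cb, mul_assoc]; exact B1_cb _ hu
lemma B1_σb (w) {u} (hu : u ∈ D.B1) : D.σb w * u ∈ D.B1 := by
  refine B1_ind (N := D.B1.comap (LinearMap.mulLeft ℂ (D.σb w))) (fun u hu => B0_B1 (B0_l (fun T hT => TT_σb w hT) hu)) (fun j u hu => ?_) hu
  show D.σb w * (D.cb j * u) ∈ D.B1
  rw [← mul_assoc, D.σb_cb, mul_assoc]; exact B1_cb _ hu
lemma B1_c (i) {u} (hu : u ∈ D.B1) : D.c i * u ∈ D.B1 := by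
  refine B1_ind (N := D.B1.comap (LinearMap.mulLeft ℂ (D.c i))) (fun u hu => ?_) (fun j u hu => ?_) hu
  · refine B0_ind (N := D.B1.comap (LinearMap.mulLeft ℂ (D.c i))) (fun L u v hL y hy => ?_) hu
    show D.c i * (_ * y) ∈ D.B1
    rw [← mul_assoc]
    rcases TT_dich (D := D) hL u v i with ⟨l, -, h⟩ | ⟨j, T, hT, h⟩
    · rw [h, mul_assoc]; exact B0_B1 (B0_mem (TT_mem hL u v) (mul_mem (P_c l) hy))
    · rw [h, ← mul_assoc, D.c_E, mul_assoc, mul_assoc, ← mul_assoc (D.E i j)]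
      exact B1_cb _ (B0_B1 (B0_mem (TT_E i j hT) hy))
  · show D.c i * (D.cb j * u) ∈ D.B1
    rw [← mul_assoc, D.c_cb, neg_mul, mul_assoc]; exact neg_mem (B1_cb _ hu)
lemma B1_E (i j) {u} (hu : u ∈ D.B1) : D.E i j * u ∈ D.B1 := by
  refine (B1_ind (N := D.B1.comap (LinearMap.mulLeft ℂ (D.E i j)) ⊓ D.B1.comap (LinearMap.mulLeft ℂ (D.E i j * D.c i)))
    (fun u hu => ⟨B0_B1 (B0_l (fun T hT => TT_E i j hT) hu), ?_⟩) (fun l u hu => ?_) hu).1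
  · refine B0_ind (N := D.B1.comap (LinearMap.mulLeft ℂ (D.E i j * D.c i))) (fun L u v hL y hy => ?_) hu
    show D.E i j * D.c i * (_ * y) ∈ D.B1
    rw [← mul_assoc, mul_assoc (D.E i j)]
    rcases TT_dich (D := D) hL u v i with ⟨l, -, h⟩ | ⟨j', T, hT, h⟩
    · rw [h, mul_assoc, mul_assoc]; exact B0_B1 (B0_l (fun T hT => TT_E i j hT) (B0_mem (TT_mem hL u v) (mul_mem (P_c l) hy)))
    · rw [h]
      by_cases hj : j' = j
      · subst hj
        rw [← mul_assoc, ← mul_assoc, D.E_cE, zero_mul, zero_mul]; exact zero_mem _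
      · have : D.E i j * (D.c i * (D.E i j' * T)) * y = D.cb j' * (D.E i j * (D.E i j' * T) * y) := by
          rw [← mul_assoc (D.c i), D.c_E, mul_assoc (D.cb j'), ← mul_assoc (D.E i j), ← D.E_cb' _ _ _ hj]; simp only [mul_assoc]
        rw [this]
        exact B1_cb _ (B0_B1 (B0_mem (TT_E i j (TT_E i j' hT)) hy))
  · have h1 : D.E i j * u ∈ D.B1 := hu.1
    have h2 : D.E i j * D.c i * u ∈ D.B1 := hu.2
    by_cases hl : l = j
    · subst hl
      refine ⟨show D.E i l * (D.cb l * u) ∈ D.B1 from ?_, show D.E i l * D.c i * (D.cb l * u) ∈ D.B1 from ?_⟩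
      · rwa [← mul_assoc, ← D.E_c]
      · rw [D.E_c, ← mul_assoc, mul_assoc (D.E i l), D.cb_sq, mul_one]; exact h1
    · refine ⟨show D.E i j * (D.cb l * u) ∈ D.B1 from ?_, show D.E i j * D.c i * (D.cb l * u) ∈ D.B1 from ?_⟩
      · rw [← mul_assoc, ← D.E_cb' _ _ _ hl, mul_assoc]; exact B1_cb _ h1
      · rw [← mul_assoc, mul_assoc (D.E i j), D.c_cb, mul_neg, neg_mul, ← mul_assoc, ← D.E_cb' _ _ _ hl, mul_assoc (D.cb l), mul_assoc (D.cb l)]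
        exact neg_mem (B1_cb _ h2)
lemma F_le (d) : D.FF d ≤ D.FF (d + 1) := le_sup_left
lemma F_xb {d} (l) {u} (hu : u ∈ D.FF d) : D.xb l * u ∈ D.FF (d + 1) :=
  (le_sup_right : _ ≤ D.FF (d + 1)) (Submodule.mul_mem_mul (Submodule.subset_span ⟨l, rfl⟩) hu)
lemma F_ind {d} {N : Submodule ℂ A} (h0 : ∀ u ∈ D.FF d, u ∈ N) (h : ∀ l, ∀ u ∈ D.FF d, D.xb l * u ∈ N) {u} (hu : u ∈ D.FF (d + 1)) : u ∈ N := by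
  have h1 : D.FF (d + 1) ≤ N := by
    refine sup_le h0 (Submodule.mul_le.2 fun m hm y hy => ?_)
    refine (Submodule.span_le (p := N.comap (LinearMap.mulRight ℂ y))).2 ?_ hm
    rintro _ ⟨l, rfl⟩
    exact h l y hy
  exact h1 hu
lemma F_pres {d} : ∀ u ∈ D.FF d, (∀ w, D.σ w * u ∈ D.FF d) ∧ (∀ w, D.σb w * u ∈ D.FF d) ∧ (∀ i, D.c i * u ∈ D.FF d) ∧ ∀ i, D.cb i * u ∈ D.FF d := by
  induction d with
  | zero => exact fun u hu => ⟨fun w => B1_σ w hu, fun w => B1_σb w hu, fun i => B1_c i hu, fun i => B1_cb i hu⟩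
  | succ d ih =>
    have key : ∀ g : A, (∀ u ∈ D.FF d, g * u ∈ D.FF d) → (∀ l, ∃ l', ∃ g', (∀ u ∈ D.FF d, g' * u ∈ D.FF d) ∧ g * D.xb l = D.xb l' * g') →
        ∀ u ∈ D.FF (d + 1), g * u ∈ D.FF (d + 1) := by
      intro g hg h u hu
      refine F_ind (N := (D.FF (d + 1)).comap (LinearMap.mulLeft ℂ g)) (fun u hu => F_le _ (hg u hu)) (fun l u hu => ?_) hu
      obtain ⟨l', g', h1, h2⟩ := h l
      show g * (D.xb l * u) ∈ D.FF (d + 1)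
      rw [← mul_assoc, h2, mul_assoc]; exact F_xb _ (h1 u hu)
    refine fun u hu => ⟨fun w => ?_, fun w => ?_, fun i => ?_, fun i => ?_⟩
    · exact key _ (fun u hu => (ih u hu).1 w) (fun l => ⟨l, _, fun u hu => (ih u hu).1 w, D.σ_xb w l⟩) u hu
    · exact key _ (fun u hu => (ih u hu).2.1 w) (fun l => ⟨w l, _, fun u hu => (ih u hu).2.1 w, D.σb_xb w l⟩) u hu
    · exact key _ (fun u hu => (ih u hu).2.2.1 i) (fun l => ⟨l, _, fun u hu => (ih u hu).2.2.1 i, (D.xb_c l i).symm⟩) u hu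
    · refine key _ (fun u hu => (ih u hu).2.2.2 i) (fun l => ?_) u hu
      by_cases hl : l = i
      · subst hl
        exact ⟨l, -D.cb l, fun u hu => by rw [neg_mul]; exact neg_mem ((ih u hu).2.2.2 l), by rw [mul_neg, D.xb_cb, neg_neg]⟩
      · exact ⟨l, _, fun u hu => (ih u hu).2.2.2 i, (D.xb_cb' _ _ hl).symm⟩
lemma B1_x (i) {u} (hu : u ∈ D.B1) : D.x i * u ∈ D.FF 1 := by
  refine B1_ind (N := (D.FF 1).comap (LinearMap.mulLeft ℂ (D.x i))) (fun u hu => ?_) (fun j u hu => ?_) hu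
  · refine B0_ind (N := (D.FF 1).comap (LinearMap.mulLeft ℂ (D.x i))) (fun L u v hL y hy => ?_) hu
    show D.x i * (_ * y) ∈ D.FF 1
    rw [← mul_assoc]
    rcases TT_dich (D := D) hL u v i with ⟨l, h, -⟩ | ⟨j, T, hT, h⟩
    · rw [h, mul_assoc]; exact F_le 0 (B0_B1 (B0_mem (TT_mem hL u v) (mul_mem (P_x l) hy)))
    · rw [h, ← mul_assoc, D.x_E, neg_mul, neg_mul, mul_assoc, mul_assoc, ← mul_assoc (D.E i j)]
      exact neg_mem (F_xb (d := 0) _ (B0_B1 (B0_mem (TT_E i j hT) hy)))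
  · show D.x i * (D.cb j * u) ∈ D.FF 1
    rw [← mul_assoc, D.x_cb, mul_assoc]; exact (F_pres _ hu).2.2.2 _
lemma B1_Ex (i j) {u} (hu : u ∈ D.B1) : D.E i j * D.x i * u ∈ D.FF 1 := by
  refine (B1_ind (N := (D.FF 1).comap (LinearMap.mulLeft ℂ (D.E i j * D.x i)) ⊓ (D.FF 1).comap (LinearMap.mulLeft ℂ (D.E i j * (D.x i * D.c i))))
    (fun u hu => ?_) (fun l u hu => ?_) hu).1
  · refine B0_ind (N := (D.FF 1).comap (LinearMap.mulLeft ℂ (D.E i j * D.x i)) ⊓ (D.FF 1).comap (LinearMap.mulLeft ℂ (D.E i j * (D.x i * D.c i)))) (fun L u v hL y hy => ?_) hu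
    refine ⟨show D.E i j * D.x i * (_ * y) ∈ D.FF 1 from ?_, show D.E i j * (D.x i * D.c i) * (_ * y) ∈ D.FF 1 from ?_⟩
    all_goals rcases TT_dich (D := D) hL u v i with ⟨l, hx, hc⟩ | ⟨j', T, hT, h⟩
    · rw [← mul_assoc, mul_assoc (D.E i j), hx, mul_assoc, mul_assoc]
      exact F_le 0 (B1_E _ _ (B0_B1 (B0_mem (TT_mem hL u v) (mul_mem (P_x l) hy))))
    · rw [h]
      by_cases hj : j' = j
      · subst hj
        rw [← mul_assoc, ← mul_assoc, D.E_xE, smul_mul_assoc, smul_mul_assoc]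
        exact Submodule.smul_mem _ _ (F_le 0 (B0_B1 (B0_mem (TT_E _ _ hT) hy)))
      · have : D.E i j * D.x i * (D.E i j' * T * y) = -(D.xb j' * (D.E i j * (D.E i j' * T) * y)) := by
          rw [mul_assoc (D.E i j), ← mul_assoc (D.x i), ← mul_assoc (D.x i), D.x_E, neg_mul, neg_mul, mul_neg, ← mul_assoc, ← mul_assoc, ← mul_assoc, ← D.E_xb' _ _ _ hj]; simp only [mul_assoc]
        rw [this]
        exact neg_mem (F_xb (d := 0) _ (B0_B1 (B0_mem (TT_E i j (TT_E i j' hT)) hy)))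
    · rw [← mul_assoc, mul_assoc (D.E i j), mul_assoc (D.x i), hc, ← mul_assoc (D.x i), hx, mul_assoc, mul_assoc, mul_assoc]
      exact F_le 0 (B1_E _ _ (B0_B1 (B0_mem (TT_mem hL u v) (mul_mem (P_x l) (mul_mem (P_c l) hy)))))
    · rw [h]
      by_cases hj : j' = j
      · subst hj
        rw [← mul_assoc, ← mul_assoc, D.E_xcE, zero_mul, zero_mul]; exact zero_mem _
      · have : D.E i j * (D.x i * D.c i) * (D.E i j' * T * y) = -(D.cb j' * (D.xb j' * (D.E i j * (D.E i j' * T) * y))) := by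
          have e1 : D.x i * D.c i * D.E i j' = -(D.cb j' * (D.xb j' * D.E i j')) := by
            rw [mul_assoc, D.c_E, ← mul_assoc, D.x_cb, mul_assoc, D.x_E, mul_neg]
          rw [mul_assoc (D.E i j), ← mul_assoc (_ * _), ← mul_assoc (_ * _), e1, neg_mul, neg_mul, mul_neg, ← mul_assoc, ← mul_assoc, ← mul_assoc, ← D.E_cb' _ _ _ hj,
            ← mul_assoc, mul_assoc (D.cb j'), ← D.E_xb' _ _ _ hj]; simp only [mul_assoc]
        rw [this]
        exact neg_mem ((F_pres _ (F_xb (d := 0) _ (B0_B1 (B0_mem (TT_E i j (TT_E i j' hT)) hy)))).2.2.2 _)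
  · have h1 : D.E i j * D.x i * u ∈ D.FF 1 := hu.1
    have h2 : D.E i j * (D.x i * D.c i) * u ∈ D.FF 1 := hu.2
    have cc : D.x i * D.c i * D.cb l = -(D.cb l * (D.x i * D.c i)) := by
      rw [mul_assoc, D.c_cb, mul_neg, ← mul_assoc, D.x_cb, mul_assoc]
    refine ⟨show D.E i j * D.x i * (D.cb l * u) ∈ D.FF 1 from ?_, show D.E i j * (D.x i * D.c i) * (D.cb l * u) ∈ D.FF 1 from ?_⟩
    all_goals by_cases hl : l = j
    · subst hl
      rw [← mul_assoc, mul_assoc (D.E i l), D.x_cb, ← mul_assoc, ← D.E_c, mul_assoc (D.E i l), ← neg_neg (D.c i * _), ← D.x_c, mul_neg, neg_mul]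
      exact neg_mem h2
    · rw [← mul_assoc, mul_assoc (D.E i j), D.x_cb, ← mul_assoc, ← D.E_cb' _ _ _ hl, mul_assoc (D.cb l), mul_assoc (D.cb l)]
      exact (F_pres _ h1).2.2.2 _
    · subst hl
      have : D.E i l * (D.x i * D.c i) * (D.cb l * u) = -(D.E i l * D.x i * u) := by
        rw [← mul_assoc, mul_assoc (D.E i l), cc, mul_neg, ← mul_assoc, ← D.E_c, D.x_c, mul_neg, mul_assoc (D.E i l), ← mul_assoc (D.c i), D.c_sq]; simp
      rw [this]; exact neg_mem h1
    · rw [← mul_assoc, mul_assoc (D.E i j), cc, mul_neg, neg_mul, ← mul_assoc, ← D.E_cb' _ _ _ hl, mul_assoc (D.cb l), mul_assoc (D.cb l)]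
      exact neg_mem ((F_pres _ h2).2.2.2 _)
lemma F_all (d) : (∀ i j, ∀ u ∈ D.FF d, D.E i j * u ∈ D.FF d) ∧ (∀ i, ∀ u ∈ D.FF d, D.x i * u ∈ D.FF (d + 1)) ∧
    ∀ i j, ∀ u ∈ D.FF d, D.E i j * D.x i * u ∈ D.FF (d + 1) := by
  induction d with
  | zero => exact ⟨fun i j u hu => B1_E i j hu, fun i u hu => B1_x i hu, fun i j u hu => B1_Ex i j hu⟩
  | succ d ih =>
    obtain ⟨hE, hX, hS⟩ := ih
    have hE' : ∀ i j, ∀ u ∈ D.FF (d + 1), D.E i j * u ∈ D.FF (d + 1) := fun i j u hu => by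
      refine F_ind (N := (D.FF (d + 1)).comap (LinearMap.mulLeft ℂ (D.E i j))) (fun u hu => F_le _ (hE i j u hu)) (fun l u hu => ?_) hu
      show D.E i j * (D.xb l * u) ∈ D.FF (d + 1)
      rw [← mul_assoc]
      by_cases hl : l = j
      · subst hl
        rw [← neg_neg (D.E i l * D.xb l), ← D.E_x, neg_mul]; exact neg_mem (hS _ _ u hu)
      · rw [← D.E_xb' _ _ _ hl, mul_assoc]; exact F_xb _ (hE _ _ u hu)
    have hH : ∀ e, (∀ i j, ∀ u ∈ D.FF e, D.E i j * u ∈ D.FF e) → ∀ i l, ∀ u ∈ D.FF e, (D.E i l - D.c i * D.E i l * D.c i) * u ∈ D.FF e := fun e he i l u hu => by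
      rw [sub_mul, mul_assoc, mul_assoc]
      exact sub_mem (he _ _ u hu) ((F_pres _ (he _ _ _ ((F_pres u hu).2.2.1 i))).2.2.1 i)
    refine ⟨hE', fun i u hu => ?_, fun i j u hu => ?_⟩
    · refine F_ind (N := (D.FF (d + 1 + 1)).comap (LinearMap.mulLeft ℂ (D.x i))) (fun u hu => F_le _ (hX i u hu)) (fun l u hu => ?_) hu
      show D.x i * (D.xb l * u) ∈ D.FF (d + 1 + 1)
      rw [← mul_assoc, D.x_xb, sub_mul, add_mul, mul_assoc, mul_assoc, mul_assoc (D.x i)]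
      exact sub_mem (add_mem (F_xb _ (hX i u hu)) (F_le _ (hH _ hE' _ _ _ (hX i u hu)))) (F_le _ (hX _ _ (hH _ hE _ _ u hu)))
    · refine F_ind (N := (D.FF (d + 1 + 1)).comap (LinearMap.mulLeft ℂ (D.E i j * D.x i))) (fun u hu => F_le _ (hS i j u hu)) (fun l u hu => ?_) hu
      show D.E i j * D.x i * (D.xb l * u) ∈ D.FF (d + 1 + 1)
      by_cases hl : l = j
      · subst hl
        rw [D.E_x, neg_mul, ← mul_assoc, mul_assoc (D.E i l), D.xb_sq, ← Algebra.commutes, mul_assoc, ← Algebra.smul_def]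
        exact neg_mem (Submodule.smul_mem _ _ (F_le _ (F_le _ (hE _ _ u hu))))
      · rw [mul_assoc, ← mul_assoc (D.x i), D.x_xb, sub_mul, add_mul, mul_sub, mul_add, mul_assoc, mul_assoc, mul_assoc (D.x i), ← mul_assoc (D.E i j), ← D.E_xb' _ _ _ hl, mul_assoc (D.xb l), ← mul_assoc (D.E i j) (D.x i), ← mul_assoc (D.E i j) (D.x i)]
        exact sub_mem (add_mem (F_xb _ (hS _ _ u hu)) (F_le _ (hE' _ _ _ (hH _ hE' _ _ _ (hX i u hu))))) (F_le _ (hS _ _ _ (hH _ hE _ _ u hu)))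
lemma F_mono {d e} (h : d ≤ e) : D.FF d ≤ D.FF e := monotone_nat_of_le_succ F_le h
lemma F_top (hg : Algebra.adjoin ℂ D.gens = ⊤) (u : A) : ∃ d, u ∈ D.FF d := by
  let S : Submodule ℂ A :=
    { carrier := {u | ∃ d, u ∈ D.FF d}
      zero_mem' := ⟨0, zero_mem _⟩
      add_mem' := fun {u v} ⟨d, hd⟩ ⟨e, he⟩ => ⟨max d e, add_mem (F_mono (le_max_left _ _) hd) (F_mono (le_max_right _ _) he)⟩
      smul_mem' := fun r u ⟨d, hd⟩ => ⟨d, Submodule.smul_mem _ _ hd⟩ }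
  have h1 : (1 : A) ∈ S := ⟨0, B0_B1 (by simpa using B0_mem (D := D) TT_one (one_mem _))⟩
  have := D.gens_ind hg S ?_ u 1 h1
  · rwa [mul_one] at this
  · rintro g (⟨w, rfl⟩ | ⟨w, rfl⟩ | ⟨i, rfl | rfl | rfl | rfl⟩ | ⟨i, j, rfl⟩) u ⟨d, hu⟩
    · exact ⟨d, (F_pres u hu).1 w⟩
    · exact ⟨d, (F_pres u hu).2.1 w⟩
    · exact ⟨d, (F_pres u hu).2.2.1 i⟩
    · exact ⟨d, (F_pres u hu).2.2.2 i⟩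
    · exact ⟨d + 1, (F_all d).2.1 i u hu⟩
    · exact ⟨d + 1, F_xb i hu⟩
    · exact ⟨d, (F_all d).1 i j u hu⟩
end WD
end

section
set_option linter.unusedSectionVars false
set_option linter.unusedSimpArgs false
set_option linter.unusedVariables false
namespace WD
variable {k : ℕ} {a b ω : ℂ} {A : Type} [Ring A] [Algebra ℂ A] (D : WD k a b ω A)
open MulOpposite in
/-- barred Sergeev part, in the opposite algebra -/
def sdo : SD (Fin k) b Aᵐᵒᵖ where
  σ := { toFun := fun w => op (D.σb w⁻¹)
         map_one' := by rw [inv_one, map_one, op_one]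
         map_mul' := fun w v => by rw [mul_inv_rev, map_mul, op_mul] }
  c i := op (Complex.I • D.cb i)
  x i := op (D.xb i)
  c_sq i := by
    rw [← op_mul, smul_mul_smul_comm, D.cb_sq, Complex.I_mul_I, neg_one_smul, op_neg, op_one]
  c_anti i j h := by
    rw [← op_mul, ← op_mul, ← op_neg, smul_mul_smul_comm, smul_mul_smul_comm, D.cb_anti _ _ h.symm, smul_neg]
  σ_c w i := by
    show op (D.σb w⁻¹) * _ = _ * op (D.σb w⁻¹)
    rw [← op_mul, ← op_mul, smul_mul_assoc, mul_smul_comm, D.σb_cb, ipa]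
  σ_x w i := by
    show op (D.σb w⁻¹) * _ = _ * op (D.σb w⁻¹)
    rw [← op_mul, ← op_mul, D.σb_xb, ipa]
  x_sq i := by rw [← op_mul, D.xb_sq]; rfl
  x_c i := by
    rw [← op_mul, ← op_mul, ← op_neg, smul_mul_assoc, mul_smul_comm, D.xb_cb, smul_neg, neg_neg]
  x_c' i j h := by
    rw [← op_mul, ← op_mul, smul_mul_assoc, mul_smul_comm, D.xb_cb' _ _ h]
  x_x i j h := by
    show _ = _ + _ * op (D.σb (Equiv.swap i j)⁻¹)
    rw [Equiv.swap_inv, ← op_mul, ← op_mul, ← op_sub, ← op_add, ← op_mul, ← op_mul, ← op_add, ← op_mul, ← op_add,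
      D.xb_xb _ _ h.symm, smul_mul_smul_comm, Complex.I_mul_I, neg_one_smul]
    congr 2
    have e : (D.xb j + D.xb i) * (D.cb i * D.cb j) = D.cb j * D.cb i * (D.xb j + D.xb i) := by
      rw [add_mul, mul_add, ← mul_assoc, D.xb_cb' _ _ h.symm, mul_assoc, D.xb_cb, ← mul_assoc (D.xb i), D.xb_cb, neg_mul, mul_assoc (D.cb i),
        D.xb_cb' _ _ h, mul_neg, ← mul_assoc, ← mul_assoc, D.cb_anti _ _ h.symm, neg_mul, neg_mul]
    have m1 : ∀ l, D.σb (Equiv.swap i j) * D.xb l = D.xb (Equiv.swap i j l) * D.σb (Equiv.swap i j) := fun l => D.σb_xb _ _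
    have m2 : D.σb (Equiv.swap i j) * (D.cb j * D.cb i) = D.cb i * D.cb j * D.σb (Equiv.swap i j) := by
      rw [← mul_assoc, D.σb_cb, mul_assoc, D.σb_cb, Equiv.swap_apply_left, Equiv.swap_apply_right, mul_assoc]
    have m3 : D.σb (Equiv.swap i j) * ((D.xb i + D.xb j) * (D.cb j * D.cb i)) = D.cb j * D.cb i * (D.xb j + D.xb i) * D.σb (Equiv.swap i j) := by
      rw [← e, ← mul_assoc, mul_add, m1, m1, Equiv.swap_apply_left, Equiv.swap_apply_right, ← add_mul, mul_assoc, m2, ← mul_assoc]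
    rw [mul_neg, mul_add (D.σb _), mul_neg, m3, mul_sub (D.σb _), m1, m1, Equiv.swap_apply_left, Equiv.swap_apply_right, Equiv.swap_comm j i,
      sub_mul, sub_mul, ← sub_eq_add_neg]
lemma sm_mono {M M' N N' : Submodule ℂ A} (h : M ≤ M') (h' : N ≤ N') : M * N ≤ M' * N' :=
  Submodule.mul_le.2 fun _ hm _ hn => Submodule.mul_mem_mul (h hm) (h' hn)
/-- `unop` as a linear map -/
def un : Aᵐᵒᵖ →ₗ[ℂ] A := ((MulOpposite.opLinearEquiv ℂ : A ≃ₗ[ℂ] Aᵐᵒᵖ).symm : Aᵐᵒᵖ →ₗ[ℂ] A)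
def QM : Submodule ℂ A := (Subalgebra.toSubmodule (Algebra.adjoin ℂ D.sdo.sgens)).map un
variable {D}
lemma QM_l {g : A} (hg : MulOpposite.op g ∈ Algebra.adjoin ℂ D.sdo.sgens) {u} (hu : u ∈ D.QM * D.B0) : g * u ∈ D.QM * D.B0 := by
  have h1 : D.QM * D.B0 ≤ (D.QM * D.B0).comap (LinearMap.mulLeft ℂ g) := by
    rw [Submodule.mul_le]
    intro m hm y hy
    show g * (m * y) ∈ D.QM * D.B0
    rw [← mul_assoc]
    refine Submodule.mul_mem_mul ?_ hy
    obtain ⟨q, hq, rfl⟩ := hm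
    exact ⟨q * MulOpposite.op g, (Algebra.adjoin ℂ D.sdo.sgens).mul_mem hq hg, rfl⟩
  exact h1 hu
lemma Q_cb (j) : MulOpposite.op (D.cb j) ∈ Algebra.adjoin ℂ D.sdo.sgens := by
  have h : MulOpposite.op (Complex.I • D.cb j) ∈ Algebra.adjoin ℂ D.sdo.sgens := Algebra.subset_adjoin (Or.inr ⟨j, Or.inl rfl⟩)
  have := (Algebra.adjoin ℂ D.sdo.sgens).smul_mem h (-Complex.I)
  rwa [← MulOpposite.op_smul, smul_smul, neg_mul, Complex.I_mul_I, neg_neg, one_smul] at this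
lemma Q_xb (j) : MulOpposite.op (D.xb j) ∈ Algebra.adjoin ℂ D.sdo.sgens := Algebra.subset_adjoin (Or.inr ⟨j, Or.inr rfl⟩)
lemma F_Q (d) : ∀ u ∈ D.FF d, u ∈ D.QM * D.B0 := by
  induction d with
  | zero =>
    intro u hu
    refine B1_ind (fun u hu => ?_) (fun j u hu => QM_l (Q_cb j) hu) hu
    have h1 : (1 : A) ∈ D.QM := ⟨1, (Algebra.adjoin ℂ D.sdo.sgens).one_mem, rfl⟩
    have := Submodule.mul_mem_mul h1 hu
    rwa [one_mul] at this
  | succ d ih => exact fun u hu => F_ind ih (fun l u hu => QM_l (Q_xb l) (ih u hu)) hu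
lemma few_map {M : Submodule ℂ Aᵐᵒᵖ} {n} (h : Few M n) : Few (M.map un) n := by
  classical
  obtain ⟨s, hs, rfl⟩ := h
  exact ⟨s.image un, Finset.card_image_le.trans hs, by rw [Submodule.map_span, Finset.coe_image]⟩
lemma few_top (hg : Algebra.adjoin ℂ D.gens = ⊤) : Few (⊤ : Submodule ℂ A) (4 ^ k * ((2 * k).factorial * 4 ^ k)) := by
  set L := List.finRange k with hL
  have hn : L.Nodup := List.nodup_finRange k
  have hm : ∀ i, i ∈ L := List.mem_finRange
  have h1 := (few_map (D.sdo.few L)).mul ((TT_few (D := D)).mul (D.sd.few L))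
  rw [hL, List.length_finRange, ← hL] at h1
  suffices h : (⊤ : Submodule ℂ A) = (D.sdo.KK L).map un * (D.TT * D.sd.KK L) by rw [h]; exact h1
  refine (eq_top_iff.2 ?_).symm
  have e1 : D.B0 ≤ D.TT * D.sd.KK L := by
    have : Subalgebra.toSubmodule (Algebra.adjoin ℂ D.sd.sgens) ≤ D.sd.SS L * D.sd.KK L := fun u hu => SD.T_all hn hm hu
    refine (sm_mono le_rfl this).trans ?_
    rw [← mul_assoc]
    refine sm_mono (Submodule.mul_le.2 fun T hT s hs => ?_) le_rfl
    refine (Submodule.span_le (p := D.TT.comap (LinearMap.mulLeft ℂ T))).2 ?_ hs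
    rintro _ ⟨w, -, rfl⟩
    exact TT_σr w hT
  have e2 : D.QM ≤ (D.sdo.KK L).map un * (D.sdo.SS L).map un := by
    have : Subalgebra.toSubmodule (Algebra.adjoin ℂ D.sdo.sgens) ≤ D.sdo.SS L * D.sdo.KK L := fun u hu => SD.T_all hn hm hu
    refine (Submodule.map_mono this).trans (le_of_eq ?_)
    exact Submodule.map_unop_mul _ _
  intro u _
  obtain ⟨d, hd⟩ := F_top hg u
  have h2 := sm_mono e2 e1 (F_Q d u hd)
  rw [mul_assoc, ← mul_assoc (Submodule.map un (D.sdo.SS L))] at h2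
  refine sm_mono le_rfl (sm_mono (Submodule.mul_le.2 fun s hs T hT => ?_) le_rfl) h2
  obtain ⟨s, hs, rfl⟩ := hs
  refine (Submodule.span_le (p := (D.TT.comap (LinearMap.mulRight ℂ T)).comap un)).2 ?_ hs
  rintro _ ⟨w, -, rfl⟩
  exact TT_σb w⁻¹ hT
theorem faithful (hg : Algebra.adjoin ℂ D.gens = ⊤) {φ} (W : Tr.WRep D φ) {n : Fin k} {y : A} (hy : y ∈ D.LA n) (h : y * D.E n n = 0) : y = 0 := by
  have h1 := (few_top hg).finrank
  have f1 : Module.Finite ℂ (⊤ : Submodule ℂ A) := h1.1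
  have f2 : Module.Finite ℂ A := Module.Finite.equiv Submodule.topEquiv
  have hs := Tr.Ψ_surj W hg
  have f3 : Module.Finite ℂ (Tr.PK k a) := Module.Finite.of_surjective _ hs
  have h2 := Tr.serg_dim (⊤ : Submodule ℂ (Tr.PK k a)) rfl
  have h3 := h1.2
  rw [finrank_top] at h2 h3
  rw [Fintype.card_sum, Fintype.card_fin] at h2
  have h4 : Module.finrank ℂ A ≤ Module.finrank ℂ (Tr.PK k a) := by
    refine h3.trans (le_trans (le_of_eq ?_) h2)
    rw [← two_mul, two_mul, pow_add]; ring
  have h5 := LinearMap.finrank_le_finrank_of_surjective hs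
  have hi := (LinearMap.injective_iff_surjective_of_finrank_eq_finrank (le_antisymm h4 h5)).2 hs
  exact hi (by rw [map_zero]; exact Tr.Ψ_E W hy h)
end WD
end

section
set_option linter.unusedSectionVars false
set_option linter.unusedSimpArgs false
set_option linter.unusedVariables false
namespace WD
variable {k : ℕ} {a b ω : ℂ} {A : Type} [Ring A] [Algebra ℂ A] {D : WD k a b ω A}
/-- existence and uniqueness of the element `ξ` for an arbitrary middle factor -/
lemma xi_unique (hg : Algebra.adjoin ℂ D.gens = ⊤) {φ} (W : Tr.WRep D φ) (n : Fin k) (g : A) :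
    ∃! ξ : A, ξ ∈ D.LA n ∧ D.E n n * g * D.E n n = ξ * D.E n n := by
  obtain ⟨y, hy, h⟩ := D.part1_le hg g
  refine ⟨y, ⟨hy, by rw [h, D.LA_E hy]⟩, fun z hz => ?_⟩
  refine sub_eq_zero.1 (faithful hg W (n := n) (sub_mem hz.1 hy) ?_)
  rw [sub_mul, ← hz.2, h, D.LA_E hy, sub_self]
end WD
lemma l2_sq {A : Type} [Ring A] [Algebra ℂ A] {x : A} {a : ℂ} (h : Polynomial.aeval x (X ^ 2 - C a) = 0) : x * x = algebraMap ℂ A a := by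
  rw [map_sub, map_pow, aeval_X, aeval_C, sub_eq_zero] at h
  rw [← pow_two, h]
end

/-- Proposition 5.5: in `BC_{2,k,k}` over `ℂ` one has
`e_k BC_{2,k,k} e_k = e_k BC_{2,k-1,k-1}`; moreover for each `a` there are unique elements
`ξ_{a,k}, ξ̄_{a,k} ∈ BC_{2,k-1,k-1}` with `e_k z_k^a e_k = ξ_{a,k} e_k` and
`e_k z̄_k^a e_k = ξ̄_{a,k} e_k`, and `ξ_{2n,k} = ξ̄_{2n,k} = 0` (`n ≥ 1`), `ξ_{1,k} = ω_1`. -/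
theorem statement13 (A : Type) [Ring A] [Algebra ℂ A]
    (k m : ℕ) (hk : 2 ≤ k) (hm : 2 * (k + k) ≤ m)
    (p : ℂ)
    (hp : (∀ z : ℤ, p ≠ (z : ℂ)) ∨ (∃ z : ℤ, p = (z : ℂ) ∧ ((2 * (m : ℤ) < z) ∨ z < 0)))
    (d : AWBC ℂ A k k (omSeq m p 1))
    (hu : d.IsCycUniversal (omSeq m p)
      (Polynomial.X ^ 2 - Polynomial.C (p * (p + 1)))
      (Polynomial.X ^ 2 - Polynomial.C ((p - 2 * (m : ℂ) + 1) * (p - 2 * (m : ℂ))))) :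
    (Set.range (fun a : A => d.toWBC.E k k * a * d.toWBC.E k k)
      = (fun b : A => d.toWBC.E k k * b) ''
          (↑(Algebra.adjoin ℂ (d.lowerGensA (k - 1))) : Set A)) ∧
    (∀ a : ℕ,
      (∃! ξ : A, ξ ∈ Algebra.adjoin ℂ (d.lowerGensA (k - 1)) ∧
        d.toWBC.E k k * d.z k ^ a * d.toWBC.E k k = ξ * d.toWBC.E k k) ∧
      (∃! ξb : A, ξb ∈ Algebra.adjoin ℂ (d.lowerGensA (k - 1)) ∧
        d.toWBC.E k k * d.zb k ^ a * d.toWBC.E k k = ξb * d.toWBC.E k k)) ∧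
    (∀ n : ℕ, 1 ≤ n →
      d.toWBC.E k k * d.z k ^ (2 * n) * d.toWBC.E k k = 0 ∧
      d.toWBC.E k k * d.zb k ^ (2 * n) * d.toWBC.E k k = 0) ∧
    d.toWBC.E k k * d.z k * d.toWBC.E k k = algebraMap ℂ A (omSeq m p 1) * d.toWBC.E k k := by
  obtain ⟨hs, hc, -⟩ := id hu
  have hx := l2_sq hc.1
  have hxb := l2_sq hc.2
  obtain ⟨φ, W⟩ := Tr.wrep_exists hk (omSeq m p) rfl (fun _ => rfl) (by
    show _ = p * (p + 1) + -2 * (m : ℂ) * (2 * p - 2 * (m : ℂ) + 1)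
    ring) d hu hx hxb
  have hg := d.gens_top hk hx hxb hu
  rw [d.z_eq hk hx hxb, d.zb_eq hk hx hxb, d.Ek_eq hk hx hxb, d.LA_eq hk hx hxb]
  refine ⟨Set.Subset.antisymm ?_ ?_, fun a => ⟨WD.xi_unique hg W _ _, WD.xi_unique hg W _ _⟩,
    fun n _ => ⟨WD.Z_even _ _ n, WD.Zb_even _ _ n⟩, ?_⟩
  · rintro _ ⟨g, rfl⟩
    obtain ⟨y, hy, h⟩ := WD.part1_le _ hg g
    exact ⟨y, hy, h.symm⟩
  · rintro _ ⟨y, hy, rfl⟩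
    exact ⟨_, (WD.part1_ge _ (AWBC.znn hk).symm hy).symm⟩
  · rw [WD.Z_one, Algebra.smul_def]
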